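/- Let p > 2 and B_1 ⊂ ℝ². There exist constants δ_0 > 0 and C > 0, depending only on p, such that: if f ∈ L^∞(B_1) with ‖f‖_{L^∞(B_1)} ≤ δ_0, and u ∈ C¹(B_1) is a weak solution of -Δ_p u = f in B_1 with ‖u‖_{L^∞(B_1)} ≤ 1, then for all sufficiently small r > 0 (say 0 < r ≤ r_0 with r_0 depending only on p), sup_{x ∈ B_r} | u(x) − [ u(0) + ∇u(0)·x ] | ≤ C r^{p'}. -/

import Mathlib

open MeasureTheory Metric Real
open scoped RealInnerProductSpace ENNReal

noncomputable section

/-- The open ball of radius `r` centered at the origin of `ℝ^d`. -/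
abbrev B (d : ℕ) (r : ℝ) : Set (EuclideanSpace ℝ (Fin d)) := ball 0 r

/-- `u` is a weak solution of `-Δ_p u = f` in the ball `B_r ⊂ ℝ^d`. -/
def IsPLaplaceWeakSolution {d : ℕ} (p r : ℝ)
    (u f : EuclideanSpace ℝ (Fin d) → ℝ) : Prop :=
  ∀ φ : EuclideanSpace ℝ (Fin d) → ℝ, ContDiff ℝ (⊤ : ℕ∞) φ → HasCompactSupport φ →
    tsupport φ ⊆ B d r →
    ∫ x in B d r, ‖gradient u x‖ ^ (p - 2) * ⟪gradient u x, gradient φ x⟫ =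
      ∫ x in B d r, f x * φ x

namespace CP
open Complex (I)
open scoped ComplexConjugate

/-- Fourier coefficients on `[-π, π]`. -/
def fc (f : ℝ → ℂ) (n : ℤ) : ℂ :=
  (1 / (2 * π) : ℝ) • ∫ θ in (-π)..π, Complex.exp (-(n * θ * I)) * f θ

theorem fc_eq (f : ℝ → ℂ) (n : ℤ) (h : (-π : ℝ) < π) : fc f n = fourierCoeffOn h f n := by
  rw [fourierCoeffOn_eq_integral, fc]
  congr 1
  · congr 1; ring
  · apply intervalIntegral.integral_congr
    intro θ _
    simp only [fourier_coe_apply, smul_eq_mul]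
    congr 2
    have : (π : ℂ) ≠ 0 := by exact_mod_cast Real.pi_ne_zero
    push_cast
    field_simp
    ring

theorem fc_hasSum (f : ℝ → ℂ) (hf : Continuous f) :
    HasSum (fun n => ‖fc f n‖ ^ 2) ((1 / (2 * π)) * ∫ θ in (-π)..π, ‖f θ‖ ^ 2) := by
  have h : (-π : ℝ) < π := by linarith [Real.pi_pos]
  have hm : MemLp f 2 (volume.restrict (Set.Ioc (-π) π)) := by
    obtain ⟨C, hC⟩ := isCompact_Icc.exists_bound_of_continuousOn (hf.continuousOn (s := Set.Icc (-π) π))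
    refine MemLp.of_bound hf.aestronglyMeasurable C ?_
    filter_upwards [ae_restrict_mem measurableSet_Ioc] with x hx
    exact hC x (Set.Ioc_subset_Icc_self hx)
  have := hasSum_sq_fourierCoeffOn h hm
  simp only [fc_eq f _ h]
  convert this using 1
  rw [smul_eq_mul]; congr 1; rw [one_div]; congr 1; ring

theorem fc_add (f g : ℝ → ℂ) (hf : Continuous f) (hg : Continuous g) (n : ℤ) :
    fc (fun θ => f θ + g θ) n = fc f n + fc g n := by
  unfold fc
  rw [← smul_add, ← intervalIntegral.integral_add]
  · congr 1; apply intervalIntegral.integral_congr; intro θ _; simp only; ring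
  · apply Continuous.intervalIntegrable; fun_prop
  · apply Continuous.intervalIntegrable; fun_prop

theorem fc_const_mul (f : ℝ → ℂ) (c : ℂ) (n : ℤ) :
    fc (fun θ => c * f θ) n = c * fc f n := by
  unfold fc
  rw [mul_smul_comm, ← intervalIntegral.integral_const_mul]
  congr 1; apply intervalIntegral.integral_congr; intro θ _; simp only; ring

theorem fc_conj (f : ℝ → ℂ) (n : ℤ) :
    fc (fun θ => conj (f θ)) n = conj (fc f (-n)) := by
  unfold fc
  rw [Complex.real_smul, Complex.real_smul, map_mul, Complex.conj_ofReal]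
  congr 1
  rw [intervalIntegral.integral_of_le (by linarith [Real.pi_pos]), intervalIntegral.integral_of_le (by linarith [Real.pi_pos]),
    ← integral_conj]
  congr 1; funext θ
  rw [map_mul, ← Complex.exp_conj]
  congr 2
  simp 

theorem fc_shift (f : ℝ → ℂ) (n : ℤ) :
    fc (fun θ => Complex.exp (-(θ * I)) * f θ) n = fc f (n + 1) := by
  unfold fc
  congr 1; apply intervalIntegral.integral_congr; intro θ _
  simp only
  rw [← mul_assoc, ← Complex.exp_add]
  congr 2; push_cast; ring

theorem fc_deriv (G G' : ℝ → ℂ) (hG : ∀ θ, HasDerivAt G (G' θ) θ) (hG' : Continuous G')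
    (hper : G π = G (-π)) (n : ℤ) : fc G' n = I * n * fc G n := by
  have key : ∫ θ in (-π)..π, (Complex.exp (-(n * θ * I)) * G' θ
      - (n * I) * (Complex.exp (-(n * θ * I)) * G θ)) = 0 := by
    have hd : ∀ θ : ℝ, HasDerivAt (fun θ : ℝ => Complex.exp (-(n * θ * I)) * G θ)
        (Complex.exp (-(n * θ * I)) * G' θ - (n * I) * (Complex.exp (-(n * θ * I)) * G θ)) θ := by
      intro θ
      have h1 : HasDerivAt (fun θ : ℝ => -((n:ℂ) * (θ:ℂ) * I)) (-(n * 1 * I)) θ :=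
        (((Complex.ofRealCLM.hasDerivAt (x := θ)).const_mul (n:ℂ)).mul_const I).neg
      have := h1.cexp.mul (hG θ)
      refine this.congr_deriv ?_
      ring
    have hGc : Continuous G := continuous_iff_continuousAt.2 fun θ => (hG θ).continuousAt
    rw [intervalIntegral.integral_eq_sub_of_hasDerivAt (fun θ _ => hd θ)]
    · rw [hper, sub_eq_zero]
      congr 1
      rw [Complex.exp_eq_exp_iff_exists_int]
      refine ⟨-n, ?_⟩
      push_cast; ring
    · apply Continuous.intervalIntegrable; fun_prop
  have hGc : Continuous G := continuous_iff_continuousAt.2 fun θ => (hG θ).continuousAt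
  rw [intervalIntegral.integral_sub, intervalIntegral.integral_const_mul, sub_eq_zero] at key
  · unfold fc
    rw [key, mul_smul_comm]; congr 1; ring
  · apply Continuous.intervalIntegrable; fun_prop
  · apply Continuous.intervalIntegrable; fun_prop

/-- The algebraic inequality on each pair of Fourier modes. -/
theorem mode_ineq {s D l : ℝ} (hl : 0 ≤ l) (hls : l ≤ s) (hD : 0 ≤ D) (hDs : D ≤ s)
    (hc : D ^ 2 ≤ (s - l) * (s + l / 3)) (m : ℕ) (a b : ℂ) (ha : (m:ℝ) = 0 → a = b)
    (hb : (m : ℝ) = 1 → b = 0) :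
    0 ≤ (s + l / (m + 1)) * ‖a‖ ^ 2 + (s + l / (1 - m)) * ‖b‖ ^ 2 + 2 * D * (a * b).re := by
  have hre : -(‖a‖ * ‖b‖) ≤ (a * b).re := by
    have := Complex.abs_re_le_norm (a * b)
    rw [norm_mul] at this
    linarith [neg_abs_le (a * b).re]
  rcases Nat.lt_or_ge m 2 with h | h
  · interval_cases m
    · have := ha (by simp)
      subst this
      simp only [Nat.cast_zero, zero_add, sub_zero, div_one]
      have : 2 * D * -(‖a‖ * ‖a‖) ≤ 2 * D * (a * a).re := by gcongr
      nlinarith [norm_nonneg a, sq_nonneg ‖a‖, mul_nonneg (sub_nonneg.2 hDs) (sq_nonneg ‖a‖), mul_nonneg hl (sq_nonneg ‖a‖)]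
    · have := hb (by simp)
      subst this
      simp
      have : 0 ≤ s + l / (1+1) := by linarith
      positivity
  · have hm : (2:ℝ) ≤ m := by exact_mod_cast h
    have e1 : l / (1 - (m:ℝ)) = - (l / (m - 1)) := by
      rw [← div_neg]; congr 1; ring
    rw [e1]
    have h1 : l / (m - 1) ≤ l := div_le_self hl (by linarith)
    have h2 : 0 ≤ l / ((m:ℝ)+1) := by positivity
    have key : D ^ 2 ≤ (s + l / (m + 1)) * (s + -(l / (m - 1))) := by
      refine hc.trans ?_
      have : (s + l / (m + 1)) * (s + -(l / (m - 1))) - (s - l) * (s + l / 3)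
        = (s * l * (2/3 - 2/((m+1)*(m-1)))) + l^2 * (1/3 - 1/((m+1)*(m-1))) := by
        have : (m:ℝ) - 1 ≠ 0 := by linarith
        field_simp
        ring
      have h3 : 1/(((m:ℝ)+1)*(m-1)) ≤ 1/3 := by
        apply one_div_le_one_div_of_le (by norm_num); nlinarith
      have h4 : 2/(((m:ℝ)+1)*(m-1)) ≤ 2/3 := by
        have : 2/(((m:ℝ)+1)*(m-1)) = 2 * (1/(((m:ℝ)+1)*(m-1))) := by ring
        linarith
      have : 0 ≤ (s * l * (2/3 - 2/(((m:ℝ)+1)*(m-1)))) + l^2 * (1/3 - 1/(((m:ℝ)+1)*(m-1))) := by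
        have : 0 ≤ s := by linarith
        apply add_nonneg
        · apply mul_nonneg (by positivity); linarith
        · apply mul_nonneg (by positivity); linarith
      linarith
    set A := s + l / ((m:ℝ) + 1)
    set Bb := s + -(l / ((m:ℝ) - 1))
    have hA : 0 ≤ A := by simp only [A]; linarith
    have hB : 0 ≤ Bb := by simp only [Bb]; linarith
    have h5 : D ≤ √A * √Bb := by
      rw [← Real.sqrt_mul hA]; exact Real.le_sqrt_of_sq_le key
    have h6 : 2 * D * (‖a‖ * ‖b‖) ≤ 2 * (√A * √Bb) * (‖a‖ * ‖b‖) := by gcongr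
    have h7 : 2 * D * -(‖a‖ * ‖b‖) ≤ 2 * D * (a * b).re := by gcongr
    nlinarith [sq_nonneg (√A * ‖a‖ - √Bb * ‖b‖), Real.sq_sqrt hA, Real.sq_sqrt hB]

theorem circle_ineq (G G' : ℝ → ℂ) (hG : ∀ θ, HasDerivAt G (G' θ) θ) (hG' : Continuous G')
    (hper : G π = G (-π)) {s D l : ℝ} (hl : 0 ≤ l) (hls : l ≤ s) (hD : 0 ≤ D) (hDs : D ≤ s)
    (hc : D ^ 2 ≤ (s - l) * (s + l / 3)) :
    0 ≤ ∫ θ in (-π)..π, (s * ‖G' θ‖ ^ 2 + D * ((Complex.exp (-(θ * I)) * G' θ) ^ 2).re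
      + l * (conj (G θ) * G' θ).im) := by
  have hGc : Continuous G := continuous_iff_continuousAt.2 fun θ => (hG θ).continuousAt
  set W : ℝ → ℂ := fun θ => Complex.exp (-(θ * I)) * G' θ with hW
  have hWc : Continuous W := by fun_prop
  have hWn : ∀ θ, ‖W θ‖ = ‖G' θ‖ := by
    intro θ
    simp only [hW, norm_mul]
    rw [show -((θ:ℂ) * I) = ((-θ : ℝ) : ℂ) * I by push_cast; ring, Complex.norm_exp_ofReal_mul_I, one_mul]
  have hWm : ∀ m, fc W m = I * (m + 1) * fc G (m + 1) := by
    intro m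
    rw [hW, fc_shift, fc_deriv G G' hG hG' hper]; push_cast; ring
  have S1 := fc_hasSum W hWc
  have S2 := fc_hasSum (fun θ => W θ + conj (W θ)) (by fun_prop)
  have S3 := (Equiv.addRight (1:ℤ)).hasSum_iff.2 (fc_hasSum G hGc)
  have S4 := (Equiv.addRight (1:ℤ)).hasSum_iff.2 (fc_hasSum (fun θ => G' θ + I * G θ) (by fun_prop))
  -- total
  have S := ((S1.mul_left (s - D - l/2)).add (S2.mul_left (D/2))).add
    (((S4.mul_left (l/2)).sub (S3.mul_left (l/2))))
  set X : ℝ := _ with hX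
  have hS : HasSum _ X := S
  have hintg : (1 / (2 * π)) * (∫ θ in (-π)..π, (s * ‖G' θ‖ ^ 2 + D * (W θ ^ 2).re
      + l * (conj (G θ) * G' θ).im)) = X := by
    rw [hX]
    simp only [← intervalIntegral.integral_const_mul]
    rw [← intervalIntegral.integral_add, ← intervalIntegral.integral_sub, ← intervalIntegral.integral_add]
    · apply intervalIntegral.integral_congr
      intro θ _
      simp only
      rw [hWn θ]
      have e1 : ‖W θ + conj (W θ)‖ ^ 2 = 2 * ‖G' θ‖ ^ 2 + 2 * (W θ ^ 2).re := by
        rw [← hWn θ]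
        simp only [Complex.sq_norm, Complex.normSq_apply]
        simp [pow_two]; ring
      have e2 : ‖G' θ + I * G θ‖ ^ 2 = ‖G' θ‖ ^ 2 + ‖G θ‖ ^ 2 + 2 * (conj (G θ) * G' θ).im := by
        simp only [Complex.sq_norm, Complex.normSq_apply]
        simp; ring
      rw [e1, e2]; ring
    all_goals (apply Continuous.intervalIntegrable; fun_prop)
  have hX0 : 0 ≤ X := by
    have hS' := (Equiv.neg ℤ).hasSum_iff.2 hS
    have h2 := hS.add hS'
    have : 0 ≤ X + X := by
      refine h2.nonneg ?_
      intro m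
      simp only [Function.comp_apply, Equiv.coe_addRight, Equiv.neg_apply]
      have cW : ∀ m : ℤ, fc (fun θ => W θ + conj (W θ)) m = fc W m + conj (fc W (-m)) := by
        intro m
        rw [fc_add _ _ hWc (by fun_prop), fc_conj]
      have cG : ∀ m : ℤ, l/2 * ‖fc (fun θ => G' θ + I * G θ) (m+1)‖^2 - l/2 * ‖fc G (m+1)‖^2
          = (l/2) * ‖fc W m‖^2 + (l / ((m:ℝ) + 1)) * ‖fc W m‖^2 := by
        intro m
        rw [fc_add _ _ hG' (by fun_prop), fc_const_mul, fc_deriv G G' hG hG' hper, hWm]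
        have : I * ((m+1 : ℤ):ℂ) * fc G (m+1) + I * fc G (m+1) = I * ((m + 2 : ℝ) : ℂ) * fc G (m+1) := by
          push_cast; ring
        rw [this, show ((m:ℂ)+1) = ((m + 1 : ℝ) : ℂ) by push_cast; rfl]
        simp only [norm_mul, Complex.norm_I, Complex.norm_real, one_mul, mul_pow, Real.norm_eq_abs, sq_abs]
        rcases eq_or_ne ((m:ℝ)+1) 0 with h | h
        · rw [h]; rw [show (m:ℝ) + 2 = 1 by linarith]; ring
        · field_simp; ring
      rw [cG, cG, cW, cW]
      have e3 : ∀ a b : ℂ, ‖a + conj b‖ ^ 2 = ‖a‖^2 + ‖b‖^2 + 2 * (a * b).re := by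
        intro a b
        simp only [Complex.sq_norm, Complex.normSq_apply]
        simp; ring
      rw [e3, e3, neg_neg]
      have hb1 : fc W (-1) = 0 := by rw [hWm]; simp
      have main : ∀ m : ℕ, 0 ≤ (s + l / (m + 1)) * ‖fc W m‖ ^ 2 + (s + l / (1 - m)) * ‖fc W (-m)‖ ^ 2 + 2 * D * (fc W m * fc W (-m)).re := by
        intro m
        apply mode_ineq hl hls hD hDs hc
        · intro h
          have : m = 0 := by exact_mod_cast h
          subst this; simp
        · intro h
          have : m = 1 := by exact_mod_cast h
          subst this; simpa using hb1
      rcases Int.eq_nat_or_neg m with ⟨n, rfl | rfl⟩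
      · have := main n
        have e : (((-(n:ℤ) : ℤ):ℝ) + 1) = 1 - n := by push_cast; ring
        rw [e]
        rw [mul_comm (fc W (-n)) (fc W n)]
        push_cast
        linarith
      · have := main n
        have e : (((-(n:ℤ) : ℤ):ℝ) + 1) = 1 - n := by push_cast; ring
        rw [e]
        rw [neg_neg, mul_comm (fc W (-n)) (fc W n)]
        push_cast
        linarith
    linarith
  have hpi := Real.pi_pos
  rw [← hintg] at hX0
  have : 0 < 1 / (2 * π) := by positivity
  exact nonneg_of_mul_nonneg_right hX0 this

theorem polar_ineq (F : ℂ → ℂ) (hF : ContDiff ℝ 1 F) (Y : ℝ → ℝ) (hY : ∀ t, 0 ≤ t → 0 ≤ Y t)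
    {s D l : ℝ} (hl : 0 ≤ l) (hls : l ≤ s) (hD : 0 ≤ D) (hDs : D ≤ s)
    (hc : D^2 ≤ (s-l)*(s+l/3)) :
    0 ≤ ∫ x : ℂ, Y (‖x‖^2) * (s * ‖fderiv ℝ F x (I*x)‖^2
      + D * ((conj x * fderiv ℝ F x (I*x))^2).re / ‖x‖^2
      + l * (conj (F x) * fderiv ℝ F x (I*x)).im) := by
  set f : ℂ → ℝ := fun x => Y (‖x‖^2) * (s * ‖fderiv ℝ F x (I*x)‖^2
      + D * ((conj x * fderiv ℝ F x (I*x))^2).re / ‖x‖^2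
      + l * (conj (F x) * fderiv ℝ F x (I*x)).im) with hf
  show 0 ≤ ∫ x : ℂ, f x
  rw [← Complex.integral_comp_polarCoord_symm]
  by_cases hi : IntegrableOn (fun p : ℝ × ℝ => p.1 • f (Complex.polarCoord.symm p)) (polarCoord.target)
  swap
  · rw [integral_undef hi]
  rw [polarCoord_target] at hi ⊢
  rw [Measure.volume_eq_prod] at hi ⊢
  rw [setIntegral_prod _ hi]
  apply setIntegral_nonneg measurableSet_Ioi
  intro r hr
  have hr : 0 < r := hr
  have hpi := Real.pi_pos
  rw [← integral_Ioc_eq_integral_Ioo, ← intervalIntegral.integral_of_le (by linarith)]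
  have hderiv : ∀ θ : ℝ, HasDerivAt (fun θ : ℝ => F (r * Complex.exp (θ * I)))
      (fderiv ℝ F (r * Complex.exp (θ * I)) (I * (r * Complex.exp (θ * I)))) θ := by
    intro θ
    have h1 : HasDerivAt (fun θ : ℝ => (r * Complex.exp (θ * I) : ℂ)) (I * (r * Complex.exp (θ * I))) θ := by
      have h2 : HasDerivAt (fun z : ℂ => (r * Complex.exp (z * I) : ℂ)) (I * (r * Complex.exp (θ * I))) (θ : ℂ) := by
        have := (((hasDerivAt_id (θ:ℂ)).mul_const I).cexp).const_mul (r:ℂ)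
        refine this.congr_deriv ?_
        simp; ring
      exact h2.comp_ofReal
    exact ((hF.differentiable (by norm_num) _).hasFDerivAt).comp_hasDerivAt θ h1
  have key := circle_ineq _ _ hderiv ?_ ?_ hl hls hD hDs hc
  · have : (fun θ : ℝ => r • f (Complex.polarCoord.symm (r, θ))) = fun θ : ℝ => (r * Y (r^2)) * (s*‖fderiv ℝ F (r * Complex.exp (θ * I)) (I * (r * Complex.exp (θ * I)))‖^2 + D*((Complex.exp (-(θ*I)) * fderiv ℝ F (r * Complex.exp (θ * I)) (I * (r * Complex.exp (θ * I))))^2).re + l*(conj (F (r * Complex.exp (θ * I))) * fderiv ℝ F (r * Complex.exp (θ * I)) (I * (r * Complex.exp (θ * I)))).im) := by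
      funext θ
      have e1 : Complex.polarCoord.symm (r, θ) = r * Complex.exp (θ * I) := by
        rw [Complex.polarCoord_symm_apply, Complex.exp_mul_I]; simp
      have e2 : ‖(r * Complex.exp (θ * I) : ℂ)‖ = r := by
        rw [norm_mul, Complex.norm_exp_ofReal_mul_I, Complex.norm_real, Real.norm_of_nonneg hr.le, mul_one]
      have e3 : conj (r * Complex.exp (θ * I) : ℂ) = r * Complex.exp (-(θ*I)) := by
        rw [map_mul, Complex.conj_ofReal, ← Complex.exp_conj, map_mul, Complex.conj_ofReal, Complex.conj_I, mul_neg]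
      rw [e1, hf]
      simp only [e2]
      rw [e3]
      generalize fderiv ℝ F (r * Complex.exp (θ * I)) (I * (r * Complex.exp (θ * I))) = A
      have e4 : (((r * Complex.exp (-(θ*I)) * A)^2 : ℂ)).re = r^2 * ((Complex.exp (-(θ*I)) * A)^2).re := by
        rw [show (((r * Complex.exp (-(θ*I)) * A)^2 : ℂ)) = ((r^2 : ℝ) : ℂ) * (Complex.exp (-(θ*I)) * A)^2 by push_cast; ring]
        rw [Complex.re_ofReal_mul]
      rw [e4]
      rw [smul_eq_mul]
      field_simp
    rw [this, intervalIntegral.integral_const_mul]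
    exact mul_nonneg (mul_nonneg hr.le (hY _ (sq_nonneg _))) key
  · have : Continuous (fderiv ℝ F) := hF.continuous_fderiv (by norm_num)
    fun_prop
  · simp only [Complex.ofReal_neg]
    have : Complex.exp (π * I) = Complex.exp (-π * I) := by
      rw [neg_mul, Complex.exp_neg, Complex.exp_pi_mul_I]; norm_num
    rw [this]

/-- jacobian -/
def jac (L : ℂ →L[ℝ] ℂ) : ℝ := (conj (L 1) * L I).im

def hs (L : ℂ →L[ℝ] ℂ) : ℝ := ‖L 1‖^2 + ‖L I‖^2

theorem clm_apply (L : ℂ →L[ℝ] ℂ) (z : ℂ) : L z = z.re • L 1 + z.im • L I := by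
  rw [← map_smul, ← map_smul, ← map_add]
  congr 1
  apply Complex.ext <;> simp

theorem clm_real (L : ℂ →L[ℝ] ℝ) (z : ℂ) : L z = z.re * L 1 + z.im * L I := by
  rw [← smul_eq_mul, ← smul_eq_mul, ← map_smul, ← map_smul, ← map_add]
  congr 1
  apply Complex.ext <;> simp

theorem integrable_cs {E : Type*} [NormedAddCommGroup E] {f : ℂ → E} (hf : Continuous f) (h : HasCompactSupport f) : Integrable f :=
  hf.integrable_of_hasCompactSupport h

theorem ibp_jac (F : ℂ → ℂ) (hF : ContDiff ℝ 2 F) (ζ : ℂ → ℝ) (hζ : ContDiff ℝ 1 ζ)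
    (hs : HasCompactSupport ζ) :
    ∫ x, ζ x * jac (fderiv ℝ F x) = -∫ x, (1/2) * (conj (F x) * (fderiv ℝ ζ x 1 * fderiv ℝ F x I - fderiv ℝ ζ x I * fderiv ℝ F x 1)).im := by
  have hF1 : ContDiff ℝ 1 (fderiv ℝ F) := hF.fderiv_right (by norm_num)
  have hFd : Differentiable ℝ F := hF.differentiable (by norm_num)
  have hF1d : Differentiable ℝ (fderiv ℝ F) := hF1.differentiable (by norm_num)
  have hζd : Differentiable ℝ ζ := hζ.differentiable (by norm_num)
  have hcζ' : Continuous (fderiv ℝ ζ) := hζ.continuous_fderiv (by norm_num)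
  have hsζ' : HasCompactSupport (fderiv ℝ ζ) := hs.fderiv ℝ
  -- general fact: P v w = Im (conj F * DF w), derivative in direction v
  let P : ℂ → ℂ → ℝ := fun w x => (conj (F x) * fderiv ℝ F x w).im
  have hP : ∀ w, ContDiff ℝ 1 (P w) := by
    intro w
    have h1 : ContDiff ℝ 1 (fun x => conj (F x)) := Complex.conjCLE.contDiff.comp (hF.of_le (by norm_num))
    have h2 : ContDiff ℝ 1 (fun x => fderiv ℝ F x w) := hF1.clm_apply contDiff_const
    exact Complex.imCLM.contDiff.comp (h1.mul h2)
  have hPd : ∀ w v x, fderiv ℝ (P w) x v = (conj (fderiv ℝ F x v) * fderiv ℝ F x w + conj (F x) * (fderiv ℝ (fderiv ℝ F) x v w)).im := by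
    intro w v x
    have h1 : HasFDerivAt (fun x => conj (F x)) ((Complex.conjCLE : ℂ →L[ℝ] ℂ).comp (fderiv ℝ F x)) x :=
      (Complex.conjCLE : ℂ →L[ℝ] ℂ).hasFDerivAt.comp x (hFd x).hasFDerivAt
    have h2 : HasFDerivAt (fun x => fderiv ℝ F x w) ((ContinuousLinearMap.apply ℝ ℂ w).comp (fderiv ℝ (fderiv ℝ F) x)) x :=
      (ContinuousLinearMap.apply ℝ ℂ w).hasFDerivAt.comp x (hF1d x).hasFDerivAt
    have h3 := (Complex.imCLM.hasFDerivAt.comp x (h1.mul h2)).fderiv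
    have e : P w = (⇑Complex.imCLM ∘ ((fun x => conj (F x)) * fun x => fderiv ℝ F x w)) := by funext; rfl
    rw [e, h3]
    simp
    ring
  have hpart : ∀ w v, ∫ x, ζ x * fderiv ℝ (P w) x v = - ∫ x, fderiv ℝ ζ x v * P w x := by
    intro w v
    have c1 : Continuous (fderiv ℝ (P w)) := (hP w).continuous_fderiv (by norm_num)
    have c2 : Continuous (P w) := (hP w).continuous
    have c3 := hζ.continuous
    apply integral_mul_fderiv_eq_neg_fderiv_mul_of_integrable
    · apply integrable_cs (by fun_prop)
      apply HasCompactSupport.mul_right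
      exact hsζ'.comp_left (g := fun L : ℂ →L[ℝ] ℝ => L v) (by simp)
    · exact integrable_cs (by fun_prop) hs.mul_right
    · exact integrable_cs (by fun_prop) hs.mul_right
    · exact fun x _ => hζd x
    · exact fun x _ => (hP w).differentiable (by norm_num) x
  have hsym : ∀ x, fderiv ℝ (fderiv ℝ F) x 1 I = fderiv ℝ (fderiv ℝ F) x I 1 := by
    intro x
    exact (hF.contDiffAt.isSymmSndFDerivAt (by simp)) 1 I
  have e1 : ∀ x, ζ x * jac (fderiv ℝ F x) = (1/2) * (ζ x * fderiv ℝ (P I) x 1) - (1/2) * (ζ x * fderiv ℝ (P 1) x I) := by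
    intro x
    rw [hPd, hPd, hsym, jac]
    simp
    ring
  have e2 : ∀ x, (1/2) * (conj (F x) * (fderiv ℝ ζ x 1 * fderiv ℝ F x I - fderiv ℝ ζ x I * fderiv ℝ F x 1)).im = (1/2) * (fderiv ℝ ζ x 1 * P I x) - (1/2) * (fderiv ℝ ζ x I * P 1 x) := by
    intro x
    simp [P]
    ring
  have i1 : ∀ w v, Integrable (fun x => ζ x * fderiv ℝ (P w) x v) := by
    intro w v
    have c1 : Continuous (fderiv ℝ (P w)) := (hP w).continuous_fderiv (by norm_num)
    have c3 := hζ.continuous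
    exact integrable_cs (by fun_prop) hs.mul_right
  have i2 : ∀ w v, Integrable (fun x => fderiv ℝ ζ x v * P w x) := by
    intro w v
    have c2 : Continuous (P w) := (hP w).continuous
    apply integrable_cs (by fun_prop)
    apply HasCompactSupport.mul_right
    exact hsζ'.comp_left (g := fun L : ℂ →L[ℝ] ℝ => L v) (by simp)
  simp only [e1, e2]
  rw [integral_sub ((i1 _ _).const_mul _) ((i1 _ _).const_mul _), integral_sub ((i2 _ _).const_mul _) ((i2 _ _).const_mul _)]
  simp only [integral_const_mul]
  rw [hpart, hpart]
  ring


/-- the tangential quadratic form -/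
def qf (s D : ℝ) (x v : ℂ) : ℝ := s * ‖v‖^2 + D * ((conj x * v)^2).re / ‖x‖^2

def pf (s D l : ℝ) (Z : ℝ → ℝ) (c x : ℂ) (L : ℂ →L[ℝ] ℂ) : ℝ :=
  l * (Z (‖x-c‖^2) * jac L) + (-deriv Z (‖x-c‖^2)) * qf s D (x-c) (L (I*(x-c)))

theorem qf_abs_le (x v : ℂ) : |((conj x * v)^2).re / ‖x‖^2| ≤ ‖v‖^2 := by
  by_cases hx : x = 0
  · simp [hx]
  have h : 0 < ‖x‖ := norm_pos_iff.2 hx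
  rw [abs_div, abs_of_nonneg (sq_nonneg ‖x‖), div_le_iff₀ (by positivity)]
  refine (Complex.abs_re_le_norm _).trans ?_
  rw [norm_pow, norm_mul, Complex.norm_conj]
  nlinarith

theorem cs_of_zero {Y : ℝ → ℝ} {R : ℝ} (hZ : ∀ t, R^2 ≤ t → Y t = 0) :
    HasCompactSupport (fun x : ℂ => Y (‖x‖^2)) := by
  apply HasCompactSupport.of_support_subset_isCompact (isCompact_closedBall (0:ℂ) |R|)
  intro x hx
  rw [mem_closedBall_zero_iff]
  by_contra h
  push Not at h
  apply hx
  apply hZ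
  rw [← sq_abs R]
  gcongr

theorem plane_smooth0 (F : ℂ → ℂ) (hF : ContDiff ℝ 2 F) (Z : ℝ → ℝ) (hZ : ContDiff ℝ 1 Z)
    {R : ℝ} (hZ0 : ∀ t, R^2 ≤ t → Z t = 0) (hZ' : ∀ t, 0 ≤ t → deriv Z t ≤ 0)
    {s D l : ℝ} (hl : 0 ≤ l) (hls : l ≤ s) (hD : 0 ≤ D) (hDs : D ≤ s)
    (hc : D^2 ≤ (s-l)*(s+l/3)) :
    0 ≤ ∫ x : ℂ, pf s D l Z 0 x (fderiv ℝ F x) := by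
  have hp := polar_ineq F (hF.of_le (by norm_num)) (fun t => -deriv Z t) (fun t ht => by linarith [hZ' t ht]) hl hls hD hDs hc
  have hZc : Continuous (deriv Z) := hZ.continuous_deriv (by norm_num)
  have hFc : Continuous (fderiv ℝ F) := hF.continuous_fderiv (by norm_num)
  have hFc0 : Continuous F := hF.continuous
  have hd0 : ∀ t, R^2 ≤ t → deriv Z t = 0 := by
    intro t ht
    have h1 : ∀ t, R^2 < t → deriv Z t = 0 := by
      intro t ht
      have : Z =ᶠ[nhds t] fun _ => 0 := by
        filter_upwards [lt_mem_nhds ht] with y hy using hZ0 y hy.le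
      rw [this.deriv_eq]; simp
    have h2 : IsClosed {t | deriv Z t = 0} := isClosed_eq hZc continuous_const
    have h3 : closure (Set.Ioi (R^2)) ⊆ {t | deriv Z t = 0} := h2.closure_subset_iff.2 (fun t ht => h1 t ht)
    rw [closure_Ioi] at h3
    exact h3 ht
  have cs0 : HasCompactSupport (fun x : ℂ => Z (‖x‖^2)) := cs_of_zero hZ0
  have cs1 : HasCompactSupport (fun x : ℂ => -deriv Z (‖x‖^2)) := cs_of_zero (R := R) (Y := fun t => -deriv Z t) (fun t ht => by simp [hd0 t ht])
  have hζ : ContDiff ℝ 1 (fun x : ℂ => Z (‖x‖^2)) := hZ.comp (contDiff_norm_sq ℝ)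
  have hib := ibp_jac F hF _ hζ cs0
  have hdζ : ∀ x v : ℂ, fderiv ℝ (fun x : ℂ => Z (‖x‖^2)) x v = deriv Z (‖x‖^2) * (2 * (x.re * v.re + x.im * v.im)) := by
    intro x v
    have h1 : HasFDerivAt (fun x : ℂ => ‖x‖^2) (2 • (innerSL ℝ x)) x := (hasStrictFDerivAt_norm_sq x).hasFDerivAt
    have h2 := ((hZ.differentiable (by norm_num) (‖x‖^2)).hasDerivAt).comp_hasFDerivAt x h1
    have h2' : fderiv ℝ (fun x : ℂ => Z (‖x‖^2)) x = _ := h2.fderiv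
    rw [h2']
    simp [Complex.inner]
    ring_nf
    tauto
  have e0 : ∀ x : ℂ, -((1/2) * (conj (F x) * (fderiv ℝ (fun x : ℂ => Z (‖x‖^2)) x 1 * fderiv ℝ F x I - fderiv ℝ (fun x : ℂ => Z (‖x‖^2)) x I * fderiv ℝ F x 1)).im) = (-deriv Z (‖x‖^2)) * ((conj (F x) * fderiv ℝ F x (I*x)).im) := by
    intro x
    rw [hdζ, hdζ, clm_apply (fderiv ℝ F x) (I*x)]
    simp
    ring
  have icont : ∀ g : ℂ → ℝ, Continuous g → Integrable (fun x : ℂ => (-deriv Z (‖x‖^2)) * g x) := by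
    intro g hg
    apply integrable_cs (by fun_prop) cs1.mul_right
  have i1 : Integrable (fun x : ℂ => l * (Z (‖x‖^2) * jac (fderiv ℝ F x))) := by
    apply Integrable.const_mul
    have := hZ.continuous
    apply integrable_cs _ cs0.mul_right
    unfold jac
    have : Continuous (fun x : ℂ => conj (fderiv ℝ F x 1)) := Complex.continuous_conj.comp (by fun_prop)
    fun_prop
  have cc : Continuous (fun x : ℂ => conj (F x)) := Complex.continuous_conj.comp (by fun_prop)
  have i2 : Integrable (fun x : ℂ => (-deriv Z (‖x‖^2)) * ((conj (F x) * fderiv ℝ F x (I*x)).im)) := by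
    apply icont
    fun_prop
  have i3 : Integrable (fun x : ℂ => (-deriv Z (‖x‖^2)) * (s * ‖fderiv ℝ F x (I*x)‖^2)) := by
    apply icont; fun_prop
  have i4 : Integrable (fun x : ℂ => (-deriv Z (‖x‖^2)) * (D * ((conj x * fderiv ℝ F x (I*x))^2).re / ‖x‖^2)) := by
    have := icont (fun x => D * ‖fderiv ℝ F x (I*x)‖^2) (by fun_prop)
    refine this.mono ?_ ?_
    · apply Measurable.aestronglyMeasurable
      have m1 : Continuous (fun x : ℂ => D * ((conj x * fderiv ℝ F x (I*x))^2).re) := by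
        have : Continuous (fun x : ℂ => conj x) := Complex.continuous_conj
        fun_prop
      have m2 : Continuous (fun x : ℂ => (-deriv Z (‖x‖^2))) := by fun_prop
      have m3 : Continuous (fun x : ℂ => ‖x‖^2) := by fun_prop
      exact m2.measurable.mul (m1.measurable.div m3.measurable)
    · refine Filter.Eventually.of_forall (fun x => ?_)
      rw [norm_mul, norm_mul]
      gcongr
      rw [mul_div_assoc, norm_mul, norm_mul]
      gcongr
      rw [Real.norm_eq_abs, Real.norm_eq_abs, abs_of_nonneg (sq_nonneg ‖fderiv ℝ F x (I*x)‖)]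
      exact qf_abs_le _ _
  have e1 : ∀ x, pf s D l Z 0 x (fderiv ℝ F x) = l * (Z (‖x‖^2) * jac (fderiv ℝ F x)) + ((-deriv Z (‖x‖^2)) * (s * ‖fderiv ℝ F x (I*x)‖^2) + (-deriv Z (‖x‖^2)) * (D * ((conj x * fderiv ℝ F x (I*x))^2).re / ‖x‖^2)) := by
    intro x
    simp only [pf, qf, sub_zero]; ring
  have i34 : Integrable (fun x : ℂ => (-deriv Z (‖x‖^2)) * (s * ‖fderiv ℝ F x (I*x)‖^2) + (-deriv Z (‖x‖^2)) * (D * ((conj x * fderiv ℝ F x (I*x))^2).re / ‖x‖^2)) := i3.add i4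
  simp only [e1]
  rw [integral_add i1 i34, integral_const_mul, hib, ← integral_neg]
  simp only [e0]
  rw [← integral_const_mul, ← integral_add (i2.const_mul l) i34]
  convert hp using 2
  funext x
  ring

theorem plane_smooth (F : ℂ → ℂ) (hF : ContDiff ℝ 2 F) (Z : ℝ → ℝ) (hZ : ContDiff ℝ 1 Z)
    {R : ℝ} (hZ0 : ∀ t, R^2 ≤ t → Z t = 0) (hZ' : ∀ t, 0 ≤ t → deriv Z t ≤ 0)
    {s D l : ℝ} (hl : 0 ≤ l) (hls : l ≤ s) (hD : 0 ≤ D) (hDs : D ≤ s)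
    (hc : D^2 ≤ (s-l)*(s+l/3)) (c : ℂ) :
    0 ≤ ∫ x : ℂ, pf s D l Z c x (fderiv ℝ F x) := by
  have h := plane_smooth0 (fun x => F (x + c)) (hF.comp (contDiff_id.add contDiff_const)) Z hZ hZ0 hZ' hl hls hD hDs hc
  have e : ∫ x : ℂ, pf s D l Z c x (fderiv ℝ F x) = ∫ x : ℂ, pf s D l Z c (x+c) (fderiv ℝ F (x+c)) :=
    (integral_add_right_eq_self (μ := (volume : Measure ℂ)) (fun x : ℂ => pf s D l Z c x (fderiv ℝ F x)) c).symm
  rw [e]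
  convert h using 2
  funext x
  simp [pf, fderiv_comp_add_right]


/-- Local `W^{1,2}` functions, with continuous representative, described by smooth approximation. -/
def H1loc (U : Set ℂ) (F : ℂ → ℂ) (D : ℂ → ℂ →L[ℝ] ℂ) : Prop :=
  ∀ K ⊆ U, IsCompact K → MemLp D 2 (volume.restrict K) ∧ ∀ ε > 0, ∃ G : ℂ → ℂ,
    ContDiff ℝ (⊤ : ℕ∞) G ∧ (∀ x ∈ K, ‖G x - F x‖ ≤ ε) ∧
    ∫ x in K, ‖fderiv ℝ G x - D x‖^2 ≤ ε

theorem cutoff {K V : Set ℂ} (hK : IsCompact K) (hV : IsOpen V) (hKV : K ⊆ V) :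
    ∃ ξ : ℂ → ℝ, ContDiff ℝ (⊤ : ℕ∞) ξ ∧ HasCompactSupport ξ ∧ tsupport ξ ⊆ V ∧
      (∀ x, 0 ≤ ξ x ∧ ξ x ≤ 1) ∧ ∀ x ∈ K, ∀ᶠ y in nhds x, ξ y = 1 := by
  obtain ⟨L, hL, hKL, hLV⟩ := exists_compact_between hK hV hKV
  obtain ⟨f, h1, h2, h3⟩ := exists_contMDiffMap_one_nhds_of_subset_interior (n := (⊤ : ℕ∞)) (modelWithCornersSelf ℝ ℂ) hK.isClosed hKL
  have hts : tsupport f ⊆ L := by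
    apply closure_minimal _ hL.isClosed
    intro x hx
    by_contra h
    exact hx (h2 x h)
  refine ⟨f, f.contMDiff.contDiff, HasCompactSupport.of_support_subset_isCompact hL (subset_closure.trans hts), hts.trans hLV, fun x => (h3 x), ?_⟩
  intro x hx
  exact h1.filter_mono (nhds_le_nhdsSet hx)

theorem finK {K : Set ℂ} (hK : IsCompact K) : IsFiniteMeasure ((volume : Measure ℂ).restrict K) :=
  ⟨by rw [Measure.restrict_apply_univ]; exact hK.measure_lt_top⟩

theorem memLp_cont {E : Type*} [NormedAddCommGroup E] {f : ℂ → E} {K : Set ℂ} (hK : IsCompact K)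
    (hf : ContinuousOn f K) (p : ℝ≥0∞) [SecondCountableTopologyEither ℂ E] : MemLp f p (volume.restrict K) := by
  obtain ⟨C, hC⟩ := hK.exists_bound_of_continuousOn hf
  haveI : IsFiniteMeasure (volume.restrict K) := finK hK
  apply MemLp.of_bound (hf.aestronglyMeasurable hK.measurableSet) C
  filter_upwards [ae_restrict_mem hK.measurableSet] with x hx using hC x hx

theorem MemLp2.int {E : Type*} [NormedAddCommGroup E] {f : ℂ → E} {μ : Measure ℂ} (h : MemLp f 2 μ) : Integrable (fun x => ‖f x‖^2) μ :=
  (memLp_two_iff_integrable_sq_norm h.1).1 h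

theorem fd_memLp {G : ℂ → ℂ} (hG : ContDiff ℝ (⊤ : ℕ∞) G) {K : Set ℂ} (hK : IsCompact K) :
    MemLp (fderiv ℝ G) 2 (volume.restrict K) :=
  memLp_cont hK (hG.continuous_fderiv (by simp)).continuousOn 2

/-- passing to the limit in quadratic expressions -/
theorem lim_form {K : Set ℂ} (hK : IsCompact K) {F : ℂ → ℂ} {D : ℂ → ℂ →L[ℝ] ℂ}
    (hD : MemLp D 2 (volume.restrict K)) (Φ : ℂ → ℂ → (ℂ →L[ℝ] ℂ) → ℝ) {C : ℝ} (hC0 : 0 ≤ C)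
    (hC : ∀ x ∈ K, ∀ w' L L', ‖w' - F x‖ ≤ 1 → |Φ x w' L' - Φ x (F x) L| ≤
      C * (‖L' - L‖^2 + ‖L' - L‖ * (1 + ‖L‖) + ‖w' - F x‖ * (1 + ‖L‖)^2))
    (hI : IntegrableOn (fun x => Φ x (F x) (D x)) K)
    (hI' : ∀ G : ℂ → ℂ, ContDiff ℝ (⊤ : ℕ∞) G → IntegrableOn (fun x => Φ x (G x) (fderiv ℝ G x)) K)
    {ε : ℝ} (hε : 0 < ε) :
    ∃ η > 0, ∀ G : ℂ → ℂ, ContDiff ℝ (⊤ : ℕ∞) G → (∀ x ∈ K, ‖G x - F x‖ ≤ η) →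
      ∫ x in K, ‖fderiv ℝ G x - D x‖^2 ≤ η →
      |(∫ x in K, Φ x (G x) (fderiv ℝ G x)) - ∫ x in K, Φ x (F x) (D x)| ≤ ε := by
  haveI : IsFiniteMeasure (volume.restrict K) := finK hK
  have hA1 : MemLp (fun x => 1 + ‖D x‖) 2 (volume.restrict K) := by
    have h1 : MemLp (fun _ : ℂ => (1:ℝ)) 2 (volume.restrict K) := memLp_const 1
    exact h1.add hD.norm
  have hA : Integrable (fun x => (1 + ‖D x‖)^2) (volume.restrict K) := by
    have := MemLp2.int hA1
    refine this.congr (Filter.Eventually.of_forall fun x => ?_)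
    simp
  set A := ∫ x in K, (1 + ‖D x‖)^2 with hAd
  have hA0 : 0 ≤ A := integral_nonneg (fun x => by positivity)
  set t := min 1 (ε / ((C+1) * (2 + 2 * A))) with ht
  have ht0 : 0 < t := by positivity
  have ht1 : t ≤ 1 := min_le_left _ _
  have ht2 : t * ((C+1) * (2 + 2 * A)) ≤ ε := by
    rw [← le_div_iff₀ (by positivity)]; exact min_le_right _ _
  refine ⟨t^2, by positivity, fun G hG h1 h2 => ?_⟩
  have hE : MemLp (fun x => fderiv ℝ G x - D x) 2 (volume.restrict K) := (fd_memLp hG hK).sub hD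
  have hEi := MemLp2.int hE
  rw [← integral_sub (hI' G hG) hI, ← Real.norm_eq_abs]
  have b : ∀ᵐ x ∂(volume.restrict K), ‖Φ x (G x) (fderiv ℝ G x) - Φ x (F x) (D x)‖ ≤
      (C * (1 + 1/t)) * ‖fderiv ℝ G x - D x‖^2 + (C * (t + t^2)) * (1 + ‖D x‖)^2 := by
    filter_upwards [ae_restrict_mem hK.measurableSet] with x hx
    have := hC x hx (G x) (D x) (fderiv ℝ G x) ((h1 x hx).trans (by nlinarith))
    rw [Real.norm_eq_abs]
    refine this.trans ?_
    set E := ‖fderiv ℝ G x - D x‖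
    set B := 1 + ‖D x‖ with hB
    have k1 : E * B ≤ 1/t * E^2 + t * B^2 := by
      have : 0 ≤ (1/t) * (E - t * B)^2 + E * B := by positivity
      have e : (1/t) * (E - t * B)^2 = 1/t * E^2 + t * B^2 - 2 * (E * B) := by field_simp; ring
      nlinarith [this]
    have k2 : ‖G x - F x‖ * B^2 ≤ t^2 * B^2 := by
      have := h1 x hx
      gcongr
    calc _ ≤ C * (E^2 + (1/t * E^2 + t * B^2) + t^2 * B^2) := by gcongr
      _ = _ := by ring
  refine (norm_integral_le_of_norm_le ((hEi.const_mul _).add (hA.const_mul _)) b).trans ?_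
  have : ∫ x in K, ((C * (1 + 1/t)) * ‖fderiv ℝ G x - D x‖^2 + (C * (t + t^2)) * (1 + ‖D x‖)^2) =
     (C * (1 + 1/t)) * (∫ x in K, ‖fderiv ℝ G x - D x‖^2) + (C * (t + t^2)) * A := by
    rw [integral_add (hEi.const_mul _) (hA.const_mul _), integral_const_mul, integral_const_mul]
  refine this.trans_le ?_
  calc _ ≤ (C * (1 + 1/t)) * t^2 + (C * (t + t^2)) * A := by gcongr
    _ = C * (t + t^2) * (1 + A) := by field_simp; ring
    _ ≤ C * (t + t) * (1 + A) := by
        have : t^2 ≤ t := by nlinarith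
        gcongr
    _ = t * (C * (2 + 2 * A)) := by ring
    _ ≤ t * ((C+1) * (2 + 2 * A)) := by gcongr; linarith
    _ ≤ ε := ht2

/-- approximation along composition -/
theorem comp_est {K : Set ℂ} (hK : IsCompact K) {F : ℂ → ℂ} (hF : ContinuousOn F K) {D : ℂ → ℂ →L[ℝ] ℂ}
    (hD : MemLp D 2 (volume.restrict K)) {T : ℂ → ℂ} (hT : ContDiff ℝ (⊤ : ℕ∞) T) {ε : ℝ} (hε : 0 < ε) :
    ∃ η > 0, ∀ G : ℂ → ℂ, ContDiff ℝ (⊤ : ℕ∞) G → (∀ x ∈ K, ‖G x - F x‖ ≤ η) →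
      ∫ x in K, ‖fderiv ℝ G x - D x‖^2 ≤ η → (∀ x ∈ K, ‖T (G x) - T (F x)‖ ≤ ε) ∧
      ∫ x in K, ‖(fderiv ℝ T (G x)).comp (fderiv ℝ G x) - (fderiv ℝ T (F x)).comp (D x)‖^2 ≤ ε := by
  obtain ⟨M, hM⟩ := hK.exists_bound_of_continuousOn hF
  have hcb := isCompact_closedBall (0:ℂ) (M+1)
  have hTc : Continuous T := hT.continuous
  have hT'c : Continuous (fderiv ℝ T) := hT.continuous_fderiv (by simp)
  obtain ⟨M', hM'⟩ := hcb.exists_bound_of_continuousOn hT'c.continuousOn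
  have u1 := Metric.uniformContinuousOn_iff.1 (hcb.uniformContinuousOn_of_continuous hTc.continuousOn)
  have u2 := Metric.uniformContinuousOn_iff.1 (hcb.uniformContinuousOn_of_continuous hT'c.continuousOn)
  have hDi := MemLp2.int hD
  set A := ∫ x in K, ‖D x‖^2
  have hA0 : 0 ≤ A := integral_nonneg (fun x => by positivity)
  set ω := ε / (4 * (A + 1)) with hω
  have hω0 : 0 < ω := by positivity
  obtain ⟨d1, hd1, u1⟩ := u1 ε hε
  obtain ⟨d2, hd2, u2⟩ := u2 (√ω) (by positivity)
  set η := min (min 1 (min (d1/2) (d2/2))) (ε / (4 * (M'^2 + 1))) with hη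
  have hη0 : 0 < η := by positivity
  have hη1 : η ≤ 1 := (min_le_left _ _).trans (min_le_left _ _)
  have hη2 : η ≤ d1/2 := (min_le_left _ _).trans ((min_le_right _ _).trans (min_le_left _ _))
  have hη3 : η ≤ d2/2 := (min_le_left _ _).trans ((min_le_right _ _).trans (min_le_right _ _))
  have hη4 : η * (4 * (M'^2 + 1)) ≤ ε := by
    rw [← le_div_iff₀ (by positivity)]; exact min_le_right _ _
  refine ⟨η, hη0, fun G hG h1 h2 => ?_⟩
  have mem1 : ∀ x ∈ K, F x ∈ closedBall (0:ℂ) (M+1) := fun x hx => by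
    rw [mem_closedBall_zero_iff]; linarith [hM x hx]
  have mem2 : ∀ x ∈ K, G x ∈ closedBall (0:ℂ) (M+1) := fun x hx => by
    rw [mem_closedBall_zero_iff]
    have := norm_le_norm_add_norm_sub' (G x) (F x)
    linarith [hM x hx, h1 x hx]
  have hE : MemLp (fun x => fderiv ℝ G x - D x) 2 (volume.restrict K) := (fd_memLp hG hK).sub hD
  have hEi := MemLp2.int hE
  constructor
  · intro x hx
    rw [← dist_eq_norm]
    apply (u1 _ (mem2 x hx) _ (mem1 x hx) _).le
    rw [dist_eq_norm]; linarith [h1 x hx]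
  · have b : ∀ᵐ x ∂(volume.restrict K), ‖(fderiv ℝ T (G x)).comp (fderiv ℝ G x) - (fderiv ℝ T (F x)).comp (D x)‖^2 ≤ (2 * M'^2) * ‖fderiv ℝ G x - D x‖^2 + (2 * ω) * ‖D x‖^2 := by
      filter_upwards [ae_restrict_mem hK.measurableSet] with x hx
      have e : (fderiv ℝ T (G x)).comp (fderiv ℝ G x) - (fderiv ℝ T (F x)).comp (D x) =
        (fderiv ℝ T (G x)).comp (fderiv ℝ G x - D x) + (fderiv ℝ T (G x) - fderiv ℝ T (F x)).comp (D x) := by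
        ext v; simp
      have n1 := ContinuousLinearMap.opNorm_comp_le (fderiv ℝ T (G x)) (fderiv ℝ G x - D x)
      have n2 := ContinuousLinearMap.opNorm_comp_le (fderiv ℝ T (G x) - fderiv ℝ T (F x)) (D x)
      have n3 := hM' _ (mem2 x hx)
      have n4 : ‖fderiv ℝ T (G x) - fderiv ℝ T (F x)‖ ≤ √ω := by
        rw [← dist_eq_norm]
        apply (u2 _ (mem2 x hx) _ (mem1 x hx) _).le
        rw [dist_eq_norm]; linarith [h1 x hx]
      have n5 : ‖(fderiv ℝ T (G x)).comp (fderiv ℝ G x - D x)‖ ≤ M' * ‖fderiv ℝ G x - D x‖ := n1.trans (by gcongr)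
      have n6 : ‖(fderiv ℝ T (G x) - fderiv ℝ T (F x)).comp (D x)‖ ≤ √ω * ‖D x‖ := n2.trans (by gcongr)
      have n7 : ‖(fderiv ℝ T (G x)).comp (fderiv ℝ G x) - (fderiv ℝ T (F x)).comp (D x)‖ ≤ M' * ‖fderiv ℝ G x - D x‖ + √ω * ‖D x‖ := by
        rw [e]; exact (norm_add_le _ _).trans (add_le_add n5 n6)
      calc _ ≤ (M' * ‖fderiv ℝ G x - D x‖ + √ω * ‖D x‖)^2 := by gcongr
        _ ≤ 2 * (M' * ‖fderiv ℝ G x - D x‖)^2 + 2 * (√ω * ‖D x‖)^2 := by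
          nlinarith [sq_nonneg (M' * ‖fderiv ℝ G x - D x‖ - √ω * ‖D x‖)]
        _ = _ := by rw [mul_pow √ω, Real.sq_sqrt hω0.le]; ring
    refine (integral_mono_of_nonneg (Filter.Eventually.of_forall fun x => by positivity) ((hEi.const_mul _).add (hDi.const_mul _)) b).trans ?_
    have : ∫ x in K, ((2 * M'^2) * ‖fderiv ℝ G x - D x‖^2 + (2 * ω) * ‖D x‖^2) =
      (2 * M'^2) * (∫ x in K, ‖fderiv ℝ G x - D x‖^2) + (2 * ω) * A := by
      rw [integral_add (hEi.const_mul _) (hDi.const_mul _), integral_const_mul, integral_const_mul]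
    refine this.trans_le ?_
    have q1 : (2 * M'^2) * (∫ x in K, ‖fderiv ℝ G x - D x‖^2) ≤ (2 * M'^2) * η := by gcongr
    have q2 : ω * (4 * (A+1)) = ε := by rw [hω]; field_simp
    nlinarith


theorem comp_memLp {K : Set ℂ} (hK : IsCompact K) {F : ℂ → ℂ} (hF : ContinuousOn F K) {D : ℂ → ℂ →L[ℝ] ℂ}
    (hD : MemLp D 2 (volume.restrict K)) {T : ℂ → ℂ} (hT : ContDiff ℝ (⊤ : ℕ∞) T) :
    MemLp (fun x => (fderiv ℝ T (F x)).comp (D x)) 2 (volume.restrict K) := by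
  have hT'c : Continuous (fderiv ℝ T) := hT.continuous_fderiv (by simp)
  have hc : ContinuousOn (fun x => fderiv ℝ T (F x)) K := hT'c.comp_continuousOn hF
  obtain ⟨M, hM⟩ := hK.exists_bound_of_continuousOn hc
  have hm : AEStronglyMeasurable (fun x => (fderiv ℝ T (F x)).comp (D x)) (volume.restrict K) := by
    have c2 : Continuous (fun p : (ℂ →L[ℝ] ℂ) × (ℂ →L[ℝ] ℂ) => p.1.comp p.2) := by fun_prop
    exact c2.comp_aestronglyMeasurable ((hc.aestronglyMeasurable hK.measurableSet).prodMk hD.1)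
  apply hD.of_le_mul hm (c := M)
  filter_upwards [ae_restrict_mem hK.measurableSet] with x hx
  refine (ContinuousLinearMap.opNorm_comp_le _ _).trans ?_
  gcongr
  exact hM x hx

theorem H1loc.comp {U : Set ℂ} {F : ℂ → ℂ} {D : ℂ → ℂ →L[ℝ] ℂ} (h : H1loc U F D) (hF : ContinuousOn F U)
    {G : ℂ → ℂ} {N : ℂ → ℂ →L[ℝ] ℂ}
    (hG : ∀ K ⊆ U, IsCompact K → ∃ T : ℂ → ℂ, ContDiff ℝ (⊤ : ℕ∞) T ∧ (∀ x ∈ K, G x = T (F x)) ∧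
      ∀ x ∈ K, N x = (fderiv ℝ T (F x)).comp (D x)) : H1loc U G N := by
  intro K hKU hK
  obtain ⟨T, hT, h1, h2⟩ := hG K hKU hK
  obtain ⟨hD, hap⟩ := h K hKU hK
  have hFK := hF.mono hKU
  constructor
  · refine (comp_memLp hK hFK hD hT).ae_eq ?_
    filter_upwards [ae_restrict_mem hK.measurableSet] with x hx using (h2 x hx).symm
  · intro ε hε
    obtain ⟨η, hη, hest⟩ := comp_est hK hFK hD hT hε
    obtain ⟨G₀, g1, g2, g3⟩ := hap η hη
    obtain ⟨k1, k2⟩ := hest G₀ g1 g2 g3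
    refine ⟨fun x => T (G₀ x), hT.comp g1, fun x hx => by rw [h1 x hx]; exact k1 x hx, ?_⟩
    refine le_trans (le_of_eq ?_) k2
    apply setIntegral_congr_fun hK.measurableSet
    intro x hx
    have : fderiv ℝ (fun x => T (G₀ x)) x = (fderiv ℝ T (G₀ x)).comp (fderiv ℝ G₀ x) :=
      fderiv_comp (g := T) x (hT.differentiable (by simp) _) (g1.differentiable (by simp) _)
    simp only [h2 x hx, this]

theorem H1loc.comp_ext {U : Set ℂ} {F : ℂ → ℂ} {D : ℂ → ℂ →L[ℝ] ℂ} (hU : IsOpen U) (hF : ContinuousOn F U)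
    (h : H1loc {x | x ∈ U ∧ F x ≠ 0} F D)
    {T : ℂ → ℂ} (hT : ContDiff ℝ (⊤ : ℕ∞) T) {τ : ℝ} (hτ : 0 < τ) (hT0 : ∀ w, ‖w‖ < τ → T w = 0) :
    H1loc U (fun x => T (F x)) (fun x => (fderiv ℝ T (F x)).comp (D x)) := by
  intro K hKU hK
  have hT0' : ∀ w, ‖w‖ < τ → fderiv ℝ T w = 0 := by
    intro w hw
    have : T =ᶠ[nhds w] fun _ => 0 := by
      filter_upwards [(isOpen_lt continuous_norm continuous_const).mem_nhds hw] with y hy using hT0 y hy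
    rw [this.fderiv_eq]; simp
  set Ω : Set ℂ := {x | x ∈ U ∧ F x ≠ 0} with hΩ
  have hΩo : IsOpen Ω := hF.isOpen_inter_preimage hU isOpen_compl_singleton
  have hFK := hF.mono hKU
  set K₁ : Set ℂ := K ∩ {x | 0.9 * τ ≤ ‖F x‖} with hK₁
  have hK₁c : IsCompact K₁ := by
    have : IsClosed K₁ := by
      have := (hFK.norm).preimage_isClosed_of_isClosed hK.isClosed (isClosed_Ici (a := 0.9 * τ))
      exact this
    exact hK.of_isClosed_subset this Set.inter_subset_left
  have hK₁Ω : K₁ ⊆ Ω := by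
    rintro x ⟨hx, hx2⟩
    refine ⟨hKU hx, ?_⟩
    intro h0
    simp only [Set.mem_setOf_eq, h0, norm_zero] at hx2
    linarith
  have hKd : ∀ x ∈ K, x ∉ K₁ → ‖F x‖ < 0.9 * τ := by
    intro x hx hx1
    by_contra hcon
    exact hx1 ⟨hx, not_lt.1 hcon⟩
  obtain ⟨K', hK'c, hK₁K', hK'Ω⟩ := exists_compact_between hK₁c hΩo hK₁Ω
  obtain ⟨ξ, x1, x2, x3, x4, x5⟩ := cutoff hK₁c isOpen_interior hK₁K'
  obtain ⟨hD, hap⟩ := h K' hK'Ω hK'c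
  have hK₁K'' : K₁ ⊆ K' := hK₁K'.trans interior_subset
  have hD₁ : MemLp D 2 (volume.restrict K₁) := hD.mono_measure (Measure.restrict_mono hK₁K'' le_rfl)
  have hFK₁ : ContinuousOn F K₁ := hFK.mono Set.inter_subset_left
  have hzero : ∀ x ∈ K, x ∉ K₁ → (fderiv ℝ T (F x)).comp (D x) = 0 := by
    intro x hx hx1
    rw [hT0' _ (by linarith [hKd x hx hx1])]; simp
  constructor
  · have e : MemLp (K₁.indicator (fun x => (fderiv ℝ T (F x)).comp (D x))) 2 (volume.restrict K) := by
      rw [memLp_indicator_iff_restrict hK₁c.measurableSet, Measure.restrict_restrict hK₁c.measurableSet,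
        Set.inter_eq_left.2 (Set.inter_subset_left : K₁ ⊆ K)]
      exact comp_memLp hK₁c hFK₁ hD₁ hT
    refine e.ae_eq ?_
    filter_upwards [ae_restrict_mem hK.measurableSet] with x hx
    by_cases hx1 : x ∈ K₁
    · rw [Set.indicator_of_mem hx1]
    · rw [Set.indicator_of_notMem hx1, hzero x hx hx1]
  · intro ε hε
    obtain ⟨η, hη, hest⟩ := comp_est hK₁c hFK₁ hD₁ hT hε
    obtain ⟨G₀, g1, g2, g3⟩ := hap (min η (0.1 * τ)) (by positivity)
    have hEi : IntegrableOn (fun x => ‖fderiv ℝ G₀ x - D x‖^2) K' := MemLp2.int ((fd_memLp g1 hK'c).sub hD)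
    obtain ⟨k1, k2⟩ := hest G₀ g1 (fun x hx => (g2 x (hK₁K'' hx)).trans (min_le_left _ _))
      ((setIntegral_mono_set hEi (Filter.Eventually.of_forall fun x => by positivity) hK₁K''.eventuallyLE).trans (g3.trans (min_le_left _ _)))
    have small : ∀ x ∈ K, x ∉ K₁ → x ∈ K' → ‖G₀ x‖ < τ := by
      intro x hx hx1 hx'
      have a1 := hKd x hx hx1
      have a2 := (g2 x hx').trans (min_le_right _ _)
      have := norm_le_norm_add_norm_sub' (G₀ x) (F x)
      linarith
    refine ⟨fun x => ξ x • T (G₀ x), x1.smul (hT.comp g1), ?_, ?_⟩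
    · intro x hx
      beta_reduce
      by_cases hx1 : x ∈ K₁
      · rw [(x5 x hx1).self_of_nhds, one_smul]
        exact k1 x hx1
      · rw [hT0 (F x) (by linarith [hKd x hx hx1])]
        by_cases hx' : x ∈ K'
        · rw [hT0 _ (small x hx hx1 hx')]; simp [hε.le]
        · have : ξ x = 0 := image_eq_zero_of_notMem_tsupport (fun hh => hx' (interior_subset (x3 hh)))
          simp [this, hε.le]
    · have hTG : ∀ x, fderiv ℝ (fun x => T (G₀ x)) x = (fderiv ℝ T (G₀ x)).comp (fderiv ℝ G₀ x) := fun x =>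
        fderiv_comp (g := T) x (hT.differentiable (by simp) _) (g1.differentiable (by simp) _)
      have e1 : ∀ x ∈ K₁, fderiv ℝ (fun x => ξ x • T (G₀ x)) x = (fderiv ℝ T (G₀ x)).comp (fderiv ℝ G₀ x) := by
        intro x hx
        rw [← hTG]
        apply Filter.EventuallyEq.fderiv_eq
        filter_upwards [x5 x hx] with y hy
        rw [hy, one_smul]
      have e2 : ∀ x ∈ K, x ∉ K₁ → fderiv ℝ (fun x => ξ x • T (G₀ x)) x = 0 := by
        intro x hx hx1
        by_cases hx' : x ∈ K'
        · have : (fun x => ξ x • T (G₀ x)) =ᶠ[nhds x] fun _ => 0 := by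
            have hs := small x hx hx1 hx'
            filter_upwards [(isOpen_lt g1.continuous.norm continuous_const).mem_nhds hs] with y hy
            rw [hT0 _ hy, smul_zero]
          rw [this.fderiv_eq]; simp
        · have hn : x ∉ tsupport ξ := (fun hh => hx' (interior_subset (x3 hh)))
          have : (fun x => ξ x • T (G₀ x)) =ᶠ[nhds x] fun _ => 0 := by
            filter_upwards [(isClosed_tsupport ξ).isOpen_compl.mem_nhds hn] with y hy
            rw [image_eq_zero_of_notMem_tsupport hy, zero_smul]
          rw [this.fderiv_eq]; simp
      refine le_trans (le_of_eq ?_) k2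
      rw [← integral_indicator hK.measurableSet, ← integral_indicator hK₁c.measurableSet]
      congr 1
      funext x
      by_cases hx : x ∈ K
      · rw [Set.indicator_of_mem hx]
        by_cases hx1 : x ∈ K₁
        · rw [Set.indicator_of_mem hx1, e1 x hx1]
        · rw [Set.indicator_of_notMem hx1, e2 x hx hx1]; beta_reduce; rw [hzero x hx hx1]; simp
      · rw [Set.indicator_of_notMem hx, Set.indicator_of_notMem (fun hh => hx hh.1)]

theorem H1loc.closure {U : Set ℂ} {F : ℂ → ℂ} {D : ℂ → ℂ →L[ℝ] ℂ}
    (hD : ∀ K ⊆ U, IsCompact K → MemLp D 2 (volume.restrict K))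
    (h : ∀ K ⊆ U, IsCompact K → ∀ ε > 0, ∃ F' D', H1loc U F' D' ∧ (∀ x ∈ K, ‖F' x - F x‖ ≤ ε) ∧
      ∫ x in K, ‖D' x - D x‖^2 ≤ ε) : H1loc U F D := by
  intro K hKU hK
  refine ⟨hD K hKU hK, fun ε hε => ?_⟩
  obtain ⟨F', D', h1, h2, h3⟩ := h K hKU hK (ε/4) (by positivity)
  obtain ⟨m1, a1⟩ := h1 K hKU hK
  obtain ⟨G, g1, g2, g3⟩ := a1 (ε/4) (by positivity)
  refine ⟨G, g1, fun x hx => ?_, ?_⟩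
  · have := norm_sub_le_norm_sub_add_norm_sub (G x) (F' x) (F x)
    linarith [g2 x hx, h2 x hx]
  · have i1 := MemLp2.int ((fd_memLp g1 hK).sub m1)
    have i2 := MemLp2.int (m1.sub (hD K hKU hK))
    have b : ∀ x, ‖fderiv ℝ G x - D x‖^2 ≤ 2 * ‖fderiv ℝ G x - D' x‖^2 + 2 * ‖D' x - D x‖^2 := by
      intro x
      have := norm_sub_le_norm_sub_add_norm_sub (fderiv ℝ G x) (D' x) (D x)
      have h0 := norm_nonneg (fderiv ℝ G x - D x)
      nlinarith [sq_nonneg (‖fderiv ℝ G x - D' x‖ - ‖D' x - D x‖)]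
    have i1' : IntegrableOn (fun x => ‖fderiv ℝ G x - D' x‖^2) K := i1
    have i2' : IntegrableOn (fun x => ‖D' x - D x‖^2) K := i2
    have := integral_mono_of_nonneg (Filter.Eventually.of_forall fun x => by positivity) ((i1'.const_mul 2).add (i2'.const_mul 2)) (Filter.Eventually.of_forall b)
    refine this.trans ?_
    refine (integral_add (i1'.const_mul 2) (i2'.const_mul 2)).trans_le ?_
    rw [integral_const_mul, integral_const_mul]
    linarith


theorem cd2 {G : ℂ → ℂ} (h : ContDiff ℝ (⊤ : ℕ∞) G) : ContDiff ℝ 2 G := by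
  exact_mod_cast contDiff_infty.1 h 2

theorem n1 (L : ℂ →L[ℝ] ℂ) : ‖L 1‖ ≤ ‖L‖ := by simpa using L.le_opNorm 1
theorem nI (L : ℂ →L[ℝ] ℂ) : ‖L I‖ ≤ ‖L‖ := by simpa using L.le_opNorm I

theorem jac_lip (L L' : ℂ →L[ℝ] ℂ) : |jac L' - jac L| ≤ 2 * (‖L' - L‖^2 + ‖L' - L‖ * ‖L‖) := by
  have e : jac L' - jac L = (conj (L 1) * (L' - L) I + conj ((L' - L) 1) * L I + conj ((L' - L) 1) * (L' - L) I).im := by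
    simp [jac]; ring
  rw [e]
  refine (Complex.abs_im_le_norm _).trans ((norm_add₃_le).trans ?_)
  simp only [norm_mul, Complex.norm_conj]
  have a1 := n1 L; have a2 := nI L; have a3 := n1 (L' - L); have a4 := nI (L' - L)
  calc _ ≤ ‖L‖ * ‖L' - L‖ + ‖L' - L‖ * ‖L‖ + ‖L' - L‖ * ‖L' - L‖ := by gcongr
    _ ≤ _ := by nlinarith [sq_nonneg ‖L' - L‖]

theorem qf_lip {s D : ℝ} (hs : 0 ≤ s) (hD : 0 ≤ D) (x v v' : ℂ) :
    |qf s D x v' - qf s D x v| ≤ (s + D) * (2 * (‖v' - v‖^2 + ‖v' - v‖ * ‖v‖)) := by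
  have h1 : |‖v'‖^2 - ‖v‖^2| ≤ 2 * (‖v' - v‖^2 + ‖v' - v‖ * ‖v‖) := by
    rw [show ‖v'‖^2 - ‖v‖^2 = (‖v'‖ - ‖v‖) * (‖v'‖ + ‖v‖) by ring, abs_mul]
    have a := abs_norm_sub_norm_le v' v
    have b : |‖v'‖ + ‖v‖| ≤ ‖v' - v‖ + 2 * ‖v‖ := by
      rw [abs_of_nonneg (by positivity)]
      have := norm_le_norm_add_norm_sub' v' v
      linarith
    calc _ ≤ ‖v' - v‖ * (‖v' - v‖ + 2 * ‖v‖) := by gcongr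
      _ ≤ _ := by nlinarith [sq_nonneg ‖v' - v‖]
  have h2 : |((conj x * v')^2).re / ‖x‖^2 - ((conj x * v)^2).re / ‖x‖^2| ≤ 2 * (‖v' - v‖^2 + ‖v' - v‖ * ‖v‖) := by
    by_cases hx : x = 0
    · simp [hx]; positivity
    have hx : 0 < ‖x‖ := norm_pos_iff.2 hx
    rw [← sub_div, abs_div, abs_of_nonneg (sq_nonneg ‖x‖), div_le_iff₀ (by positivity), ← Complex.sub_re]
    refine (Complex.abs_re_le_norm _).trans ?_
    rw [show (conj x * v')^2 - (conj x * v)^2 = (conj x)^2 * ((v' - v) * (v' + v)) by ring, norm_mul, norm_mul, norm_pow, Complex.norm_conj]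
    have : ‖v' + v‖ ≤ ‖v' - v‖ + 2 * ‖v‖ := by
      have e : v' + v = (v' - v) + (v + v) := by ring
      rw [e]
      refine (norm_add_le _ _).trans ?_
      have := norm_add_le v v
      linarith
    calc _ ≤ ‖x‖^2 * (‖v' - v‖ * (‖v' - v‖ + 2 * ‖v‖)) := by gcongr
      _ ≤ ‖x‖^2 * (2 * (‖v' - v‖^2 + ‖v' - v‖ * ‖v‖)) := by
        refine mul_le_mul_of_nonneg_left ?_ (by positivity)
        nlinarith [sq_nonneg ‖v' - v‖]
      _ = _ := by ring
  have e : qf s D x v' - qf s D x v = s * (‖v'‖^2 - ‖v‖^2) + D * (((conj x * v')^2).re / ‖x‖^2 - ((conj x * v)^2).re / ‖x‖^2) := by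
    simp only [qf]; ring
  rw [e]
  refine (abs_add_le _ _).trans ?_
  rw [abs_mul, abs_mul, abs_of_nonneg hs, abs_of_nonneg hD, add_mul]
  gcongr

theorem pf_lip {s D l R : ℝ} {Z : ℝ → ℝ} (hs : 0 ≤ s) (hD : 0 ≤ D) (hZ : ContDiff ℝ 1 Z) (c : ℂ) :
    ∃ C, 0 ≤ C ∧ ∀ x ∈ closedBall c R, ∀ L L' : ℂ →L[ℝ] ℂ, |pf s D l Z c x L' - pf s D l Z c x L| ≤
      C * (‖L' - L‖^2 + ‖L' - L‖ * (1 + ‖L‖)) := by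
  have hZc := hZ.continuous
  have hZd : Continuous (deriv Z) := hZ.continuous_deriv (by norm_num)
  have hcb := isCompact_closedBall c R
  obtain ⟨M1, hM1⟩ := hcb.exists_bound_of_continuousOn (f := fun x => Z (‖x-c‖^2)) (by fun_prop)
  obtain ⟨M2, hM2⟩ := hcb.exists_bound_of_continuousOn (f := fun x => deriv Z (‖x-c‖^2)) (by fun_prop)
  refine ⟨|l| * (|M1| * 2) + |M2| * ((s + D) * (2 * (1 + |R|)^2)), by positivity, fun x hx L L' => ?_⟩
  have e : pf s D l Z c x L' - pf s D l Z c x L = l * (Z (‖x-c‖^2) * (jac L' - jac L)) + (-deriv Z (‖x-c‖^2)) * (qf s D (x-c) (L' (I*(x-c))) - qf s D (x-c) (L (I*(x-c)))) := by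
    simp only [pf]; ring
  rw [e]
  refine (abs_add_le _ _).trans ?_
  rw [abs_mul, abs_mul, abs_mul, abs_neg, add_mul]
  have j := jac_lip L L'
  have q := qf_lip hs hD (x-c) (L (I*(x-c))) (L' (I*(x-c)))
  have z1 : |Z (‖x-c‖^2)| ≤ |M1| := (hM1 x hx).trans (le_abs_self _)
  have z2 : |deriv Z (‖x-c‖^2)| ≤ |M2| := (hM2 x hx).trans (le_abs_self _)
  have hxc : ‖I * (x - c)‖ ≤ |R| := by
    rw [norm_mul, Complex.norm_I, one_mul, ← dist_eq_norm]; exact (mem_closedBall.1 hx).trans (le_abs_self _)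
  have v1 : ‖L' (I*(x-c)) - L (I*(x-c))‖ ≤ ‖L' - L‖ * |R| := by
    have := (L' - L).le_opNorm (I*(x-c))
    rw [ContinuousLinearMap.sub_apply] at this
    exact this.trans (by gcongr)
  have v2 : ‖L (I*(x-c))‖ ≤ ‖L‖ * |R| := (L.le_opNorm _).trans (by gcongr)
  have nE := norm_nonneg (L' - L)
  have nL := norm_nonneg L
  have nR := abs_nonneg R
  refine add_le_add ?_ ?_
  · calc _ ≤ |l| * (|M1| * (2 * (‖L' - L‖^2 + ‖L' - L‖ * ‖L‖))) := by gcongr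
      _ = |l| * (|M1| * 2) * (‖L' - L‖^2 + ‖L' - L‖ * ‖L‖) := by ring
      _ ≤ _ := by
        refine mul_le_mul_of_nonneg_left ?_ (by positivity)
        nlinarith
  · calc _ ≤ |M2| * ((s + D) * (2 * ((‖L' - L‖ * |R|)^2 + (‖L' - L‖ * |R|) * (‖L‖ * |R|)))) := by
          refine mul_le_mul z2 (q.trans ?_) (abs_nonneg _) (abs_nonneg _)
          gcongr
      _ = |M2| * ((s + D) * (2 * |R|^2)) * (‖L' - L‖^2 + ‖L' - L‖ * ‖L‖) := by ring
      _ ≤ |M2| * ((s + D) * (2 * (1 + |R|)^2)) * (‖L' - L‖^2 + ‖L' - L‖ * ‖L‖) := by gcongr; linarith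
      _ ≤ _ := by
        refine mul_le_mul_of_nonneg_left ?_ (by positivity)
        nlinarith

theorem continuous_jac : Continuous jac := by
  unfold jac
  have : Continuous (fun L : ℂ →L[ℝ] ℂ => conj (L 1)) := Complex.continuous_conj.comp (by fun_prop)
  fun_prop

theorem aesm_app {μ : Measure ℂ} {N : ℂ → ℂ →L[ℝ] ℂ} {v : ℂ → ℂ} (hN : AEStronglyMeasurable N μ)
    (hv : AEStronglyMeasurable v μ) : AEStronglyMeasurable (fun x => N x (v x)) μ := by
  have c2 : Continuous (fun p : (ℂ →L[ℝ] ℂ) × ℂ => p.1 p.2) := by fun_prop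
  exact c2.comp_aestronglyMeasurable (hN.prodMk hv)

theorem pf_int {s D l R : ℝ} {Z : ℝ → ℝ} (hs : 0 ≤ s) (hD : 0 ≤ D) (hZ : ContDiff ℝ 1 Z) (c : ℂ)
    {N : ℂ → ℂ →L[ℝ] ℂ} (hN : MemLp N 2 (volume.restrict (closedBall c R))) :
    IntegrableOn (fun x => pf s D l Z c x (N x)) (closedBall c R) := by
  obtain ⟨C, hC0, hC⟩ := pf_lip (s := s) (D := D) (l := l) (R := R) hs hD hZ c
  have hcb := isCompact_closedBall c R
  haveI := finK hcb
  have hA1 : MemLp (fun x => 1 + ‖N x‖) 2 (volume.restrict (closedBall c R)) := by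
    have h1 : MemLp (fun _ : ℂ => (1:ℝ)) 2 (volume.restrict (closedBall c R)) := memLp_const 1
    exact h1.add hN.norm
  have hA : Integrable (fun x => (1 + ‖N x‖)^2) (volume.restrict (closedBall c R)) := by
    have := MemLp2.int hA1
    refine this.congr (Filter.Eventually.of_forall fun x => ?_)
    simp
  refine (hA.const_mul C).mono' ?_ ?_
  · have hZc := hZ.continuous
    have hZd : Continuous (deriv Z) := hZ.continuous_deriv (by norm_num)
    have m1 : AEStronglyMeasurable (fun x => Z (‖x-c‖^2)) (volume.restrict (closedBall c R)) := (by fun_prop : Continuous (fun x => Z (‖x-c‖^2))).aestronglyMeasurable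
    have m2 : AEStronglyMeasurable (fun x => -deriv Z (‖x-c‖^2)) (volume.restrict (closedBall c R)) := (by fun_prop : Continuous (fun x => -deriv Z (‖x-c‖^2))).aestronglyMeasurable
    have m3 : AEStronglyMeasurable (fun x => jac (N x)) (volume.restrict (closedBall c R)) := continuous_jac.comp_aestronglyMeasurable hN.1
    have mid : AEStronglyMeasurable (fun x : ℂ => I*(x-c)) (volume.restrict (closedBall c R)) :=
      (by fun_prop : Continuous (fun x : ℂ => I*(x-c))).aestronglyMeasurable
    have m4 : AEStronglyMeasurable (fun x => N x (I*(x-c))) (volume.restrict (closedBall c R)) := aesm_app hN.1 mid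
    have mcj : AEStronglyMeasurable (fun x : ℂ => conj (x-c)) (volume.restrict (closedBall c R)) :=
      (Complex.continuous_conj.comp (by fun_prop : Continuous (fun x : ℂ => x-c))).aestronglyMeasurable
    have m5' : AEStronglyMeasurable (fun x => (conj (x-c) * N x (I*(x-c)))^2) (volume.restrict (closedBall c R)) := (mcj.mul m4).pow 2
    have m5 : AEStronglyMeasurable (fun x => ((conj (x-c) * N x (I*(x-c)))^2).re) (volume.restrict (closedBall c R)) := 
      Complex.continuous_re.comp_aestronglyMeasurable m5'
    have m6' : Measurable (fun x : ℂ => ‖x-c‖^2) := (by fun_prop : Continuous (fun x : ℂ => ‖x-c‖^2)).measurable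
    have m6 : AEStronglyMeasurable (fun x : ℂ => (‖x-c‖^2)⁻¹) (volume.restrict (closedBall c R)) := 
      (m6'.inv).aestronglyMeasurable
    have m7 : AEStronglyMeasurable (fun x => qf s D (x-c) (N x (I*(x-c)))) (volume.restrict (closedBall c R)) := by
      simp only [qf, div_eq_mul_inv]
      exact ((m4.norm.pow 2).const_mul s).add ((m5.const_mul D).mul m6)
    exact ((m1.mul m3).const_mul l).add (m2.mul m7)
  · filter_upwards [ae_restrict_mem hcb.measurableSet] with x hx
    have := hC x hx 0 (N x)
    have e : pf s D l Z c x 0 = 0 := by simp [pf, qf, jac]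
    rw [e, sub_zero, sub_zero, norm_zero] at this
    rw [Real.norm_eq_abs]
    refine this.trans ?_
    gcongr
    nlinarith [norm_nonneg (N x)]

theorem plane_H1 {U : Set ℂ} {F : ℂ → ℂ} {N : ℂ → ℂ →L[ℝ] ℂ} (h : H1loc U F N) (Z : ℝ → ℝ) (hZ : ContDiff ℝ 1 Z)
    {R : ℝ} (hR : 0 ≤ R) (hZ0 : ∀ t, R^2 ≤ t → Z t = 0) (hZ' : ∀ t, 0 ≤ t → deriv Z t ≤ 0)
    {s D l : ℝ} (hl : 0 ≤ l) (hls : l ≤ s) (hD : 0 ≤ D) (hDs : D ≤ s)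
    (hc : D^2 ≤ (s-l)*(s+l/3)) {c : ℂ} (hU : closedBall c R ⊆ U) :
    0 ≤ ∫ x in closedBall c R, pf s D l Z c x (N x) := by
  have hcb := isCompact_closedBall c R
  obtain ⟨hN, hap⟩ := h _ hU hcb
  obtain ⟨C, hC0, hC⟩ := pf_lip (s := s) (D := D) (l := l) (R := R) (hl.trans hls) hD hZ c
  apply le_of_forall_pos_le_add
  intro ε hε
  obtain ⟨η, hη, hlim⟩ := lim_form hcb (F := F) hN (fun x _ L => pf s D l Z c x L) hC0
    (fun x hx w' L L' _ => (hC x hx L L').trans (by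
      refine mul_le_mul_of_nonneg_left ?_ hC0
      have : 0 ≤ ‖w' - F x‖ * (1 + ‖L‖)^2 := by positivity
      linarith))
    (pf_int (hl.trans hls) hD hZ c hN) (fun G hG => pf_int (hl.trans hls) hD hZ c (fd_memLp hG hcb)) hε
  obtain ⟨G, g1, g2, g3⟩ := hap η hη
  have h1 := hlim G g1 g2 g3
  have h2 := plane_smooth G (cd2 g1) Z hZ hZ0 hZ' hl hls hD hDs hc c
  rw [← setIntegral_eq_integral_of_forall_compl_eq_zero (s := closedBall c R)] at h2
  · linarith [(abs_le.1 h1).2]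
  · intro x hx
    rw [mem_closedBall, not_le, dist_eq_norm] at hx
    have hx2 : R^2 < ‖x-c‖^2 := by gcongr
    have e1 := hZ0 _ hx2.le
    have e2 : deriv Z (‖x-c‖^2) = 0 := by
      have : Z =ᶠ[nhds (‖x-c‖^2)] fun _ => 0 := by
        filter_upwards [lt_mem_nhds hx2] with y hy using hZ0 y hy.le
      rw [this.deriv_eq]; simp
    simp [pf, e1, e2]

/-- boundary form in the jacobian integration by parts -/
def bf (ζ : ℂ → ℝ) (x w : ℂ) (L : ℂ →L[ℝ] ℂ) : ℝ :=
  (1/2) * (conj w * (fderiv ℝ ζ x 1 * L I - fderiv ℝ ζ x I * L 1)).im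

theorem ibp_H1 {U : Set ℂ} {F : ℂ → ℂ} {N : ℂ → ℂ →L[ℝ] ℂ} (h : H1loc U F N) (hF : ContinuousOn F U)
    {ζ : ℂ → ℝ} (hζ : ContDiff ℝ 1 ζ) {K : Set ℂ} (hK : IsCompact K) (hKU : K ⊆ U) (hζK : tsupport ζ ⊆ K) :
    ∫ x in K, ζ x * jac (N x) = -∫ x in K, bf ζ x (F x) (N x) := by
  have hcs : HasCompactSupport ζ := hK.of_isClosed_subset (isClosed_tsupport _) hζK
  have hζ' : Continuous (fderiv ℝ ζ) := hζ.continuous_fderiv (by norm_num)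
  obtain ⟨hN, hap⟩ := h _ hKU hK
  haveI := finK hK
  have hFK := hF.mono hKU
  obtain ⟨A, hA⟩ := hK.exists_bound_of_continuousOn hFK
  obtain ⟨M, hM⟩ := hK.exists_bound_of_continuousOn hζ.continuous.continuousOn
  obtain ⟨M', hM'⟩ := hK.exists_bound_of_continuousOn hζ'.continuousOn
  have iN2 : ∀ N : ℂ → ℂ →L[ℝ] ℂ, MemLp N 2 (volume.restrict K) → Integrable (fun x => (1 + ‖N x‖)^2) (volume.restrict K) := by
    intro N hN
    have h1 : MemLp (fun _ : ℂ => (1:ℝ)) 2 (volume.restrict K) := memLp_const 1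
    have h2 : MemLp (fun x => 1 + ‖N x‖) 2 (volume.restrict K) := h1.add hN.norm
    refine (MemLp2.int h2).congr (Filter.Eventually.of_forall fun x => ?_)
    simp
  have int1 : ∀ N : ℂ → ℂ →L[ℝ] ℂ, MemLp N 2 (volume.restrict K) → IntegrableOn (fun x => ζ x * jac (N x)) K := by
    intro N hN
    refine ((iN2 N hN).const_mul (|M| * 2)).mono' (hζ.continuous.aestronglyMeasurable.mul (continuous_jac.comp_aestronglyMeasurable hN.1)) ?_
    filter_upwards [ae_restrict_mem hK.measurableSet] with x hx
    rw [norm_mul, mul_assoc]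
    gcongr
    · exact (hM x hx).trans (le_abs_self _)
    · have := jac_lip 0 (N x)
      have e : jac 0 = 0 := by simp [jac]
      rw [e, sub_zero, sub_zero, norm_zero, mul_zero, add_zero] at this
      rw [Real.norm_eq_abs]
      refine this.trans ?_
      gcongr; linarith
  have bb : ∀ x w (L : ℂ →L[ℝ] ℂ), |bf ζ x w L| ≤ ‖fderiv ℝ ζ x‖ * (‖w‖ * ‖L‖) := by
    intro x w L
    rw [bf, abs_mul]
    have := Complex.abs_im_le_norm (conj w * (fderiv ℝ ζ x 1 * L I - fderiv ℝ ζ x I * L 1))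
    rw [norm_mul, Complex.norm_conj] at this
    have k1 : ‖(fderiv ℝ ζ x 1 * L I - fderiv ℝ ζ x I * L 1 : ℂ)‖ ≤ ‖fderiv ℝ ζ x‖ * ‖L‖ + ‖fderiv ℝ ζ x‖ * ‖L‖ := by
      refine (norm_sub_le _ _).trans ?_
      rw [norm_mul, norm_mul, Complex.norm_real, Complex.norm_real]
      have a1 : ‖fderiv ℝ ζ x 1‖ ≤ ‖fderiv ℝ ζ x‖ := by simpa using (fderiv ℝ ζ x).le_opNorm 1
      have a2 : ‖fderiv ℝ ζ x I‖ ≤ ‖fderiv ℝ ζ x‖ := by simpa using (fderiv ℝ ζ x).le_opNorm I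
      gcongr
      · exact nI L
      · exact n1 L
    have k2 : ‖w‖ * ‖(fderiv ℝ ζ x 1 * L I - fderiv ℝ ζ x I * L 1 : ℂ)‖ ≤ ‖w‖ * (‖fderiv ℝ ζ x‖ * ‖L‖ + ‖fderiv ℝ ζ x‖ * ‖L‖) := by gcongr
    have : |(1/2 : ℝ)| = 1/2 := by norm_num
    rw [this]
    linarith
  have int2 : ∀ (G : ℂ → ℂ) (N : ℂ → ℂ →L[ℝ] ℂ), ContinuousOn G K → MemLp N 2 (volume.restrict K) → IntegrableOn (fun x => bf ζ x (G x) (N x)) K := by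
    intro G N hG hN
    obtain ⟨A, hA⟩ := hK.exists_bound_of_continuousOn hG
    refine ((iN2 N hN).const_mul (|M'| * |A|)).mono' ?_ ?_
    · have c1 : Continuous (fun p : ((ℂ →L[ℝ] ℝ) × ℂ) × (ℂ →L[ℝ] ℂ) => (1/2) * (conj p.1.2 * (p.1.1 1 * p.2 I - p.1.1 I * p.2 1)).im) := by
        have : Continuous (fun p : ((ℂ →L[ℝ] ℝ) × ℂ) × (ℂ →L[ℝ] ℂ) => conj p.1.2) := Complex.continuous_conj.comp (by fun_prop)
        fun_prop
      exact c1.comp_aestronglyMeasurable ((hζ'.aestronglyMeasurable.prodMk (hG.aestronglyMeasurable hK.measurableSet)).prodMk hN.1)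
    · filter_upwards [ae_restrict_mem hK.measurableSet] with x hx
      rw [Real.norm_eq_abs, mul_assoc]
      refine (bb x _ _).trans ?_
      gcongr
      · exact (hM' x hx).trans (le_abs_self _)
      · exact (hA x hx).trans (le_abs_self _)
      · nlinarith [norm_nonneg (N x)]
  -- combined form
  have key : ∀ ε > 0, |(∫ x in K, (ζ x * jac (N x) + bf ζ x (F x) (N x)))| ≤ ε := by
    intro ε hε
    have hC0 : 0 ≤ |M| * 2 + |M'| * (|A| + 2) := by positivity
    obtain ⟨η, hη, hlim⟩ := lim_form hK (F := F) hN (fun x w L => ζ x * jac L + bf ζ x w L) hC0 (by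
      intro x hx w' L L' hw
      have e : ζ x * jac L' + bf ζ x w' L' - (ζ x * jac L + bf ζ x (F x) L) = ζ x * (jac L' - jac L) + (bf ζ x w' (L' - L) + bf ζ x (w' - F x) L + (bf ζ x (F x) (L' - L) - bf ζ x (F x) (L' - L)) + (bf ζ x (F x) L - bf ζ x (F x) L)) := by
        simp [bf]; ring
      rw [sub_self, sub_self, add_zero, add_zero] at e
      rw [e]
      refine (abs_add_le _ _).trans ?_
      have z1 : |ζ x| ≤ |M| := (hM x hx).trans (le_abs_self _)
      have z2 : ‖fderiv ℝ ζ x‖ ≤ |M'| := (hM' x hx).trans (le_abs_self _)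
      have z3 : ‖F x‖ ≤ |A| := (hA x hx).trans (le_abs_self _)
      have z4 : ‖w'‖ ≤ |A| + 1 := by
        have := norm_le_norm_add_norm_sub' w' (F x)
        linarith
      have b1 := bb x w' (L' - L)
      have b2 := bb x (w' - F x) L
      have b3 := jac_lip L L'
      set E := ‖L' - L‖
      set W := ‖w' - F x‖
      have hE : 0 ≤ E := norm_nonneg _
      have hW : 0 ≤ W := norm_nonneg _
      have hL := norm_nonneg L
      have c1 : |ζ x * (jac L' - jac L)| ≤ |M| * 2 * (E^2 + E * (1 + ‖L‖) + W * (1 + ‖L‖)^2) := by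
        rw [abs_mul, mul_assoc]
        refine mul_le_mul z1 (b3.trans ?_) (abs_nonneg _) (abs_nonneg _)
        refine mul_le_mul_of_nonneg_left ?_ (by norm_num)
        have : 0 ≤ W * (1 + ‖L‖)^2 := by positivity
        nlinarith
      have c2 : |bf ζ x w' (L' - L) + bf ζ x (w' - F x) L| ≤ |M'| * (|A| + 2) * (E^2 + E * (1 + ‖L‖) + W * (1 + ‖L‖)^2) := by
        refine (abs_add_le _ _).trans ?_
        have d1 : |bf ζ x w' (L' - L)| ≤ |M'| * ((|A| + 1) * E) := b1.trans (by gcongr)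
        have d2 : |bf ζ x (w' - F x) L| ≤ |M'| * (W * ‖L‖) := b2.trans (by gcongr)
        refine (add_le_add d1 d2).trans ?_
        rw [← mul_add, mul_assoc]
        refine mul_le_mul_of_nonneg_left ?_ (abs_nonneg _)
        have t1 : 0 ≤ |A| := abs_nonneg _
        have t2 : E ≤ (E^2 + E * (1 + ‖L‖) + W * (1 + ‖L‖)^2) := by
          have : 0 ≤ W * (1 + ‖L‖)^2 := by positivity
          linarith [mul_nonneg hE hL, sq_nonneg E, mul_one_add E ‖L‖]
        have t3 : W * ‖L‖ ≤ (E^2 + E * (1 + ‖L‖) + W * (1 + ‖L‖)^2) := by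
          have : 0 ≤ E * (1 + ‖L‖) := by positivity
          have : W * ‖L‖ ≤ W * (1 + ‖L‖)^2 := mul_le_mul_of_nonneg_left (by nlinarith) hW
          linarith [sq_nonneg E]
        calc (|A| + 1) * E + W * ‖L‖ ≤ (|A| + 1) * (E^2 + E * (1 + ‖L‖) + W * (1 + ‖L‖)^2) + (E^2 + E * (1 + ‖L‖) + W * (1 + ‖L‖)^2) :=
            add_le_add (mul_le_mul_of_nonneg_left t2 (by positivity)) t3
          _ = _ := by ring
      rw [add_mul]
      exact add_le_add c1 c2)
      ((int1 N hN).add (int2 F N hFK hN))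
      (fun G hG => (int1 _ (fd_memLp hG hK)).add (int2 G _ hG.continuous.continuousOn (fd_memLp hG hK))) hε
    obtain ⟨G, g1, g2, g3⟩ := hap η hη
    have h1 := hlim G g1 g2 g3
    have h2 := ibp_jac G (cd2 g1) ζ hζ hcs
    have h3 : ∫ x in K, (ζ x * jac (fderiv ℝ G x) + bf ζ x (G x) (fderiv ℝ G x)) = 0 := by
      rw [integral_add (int1 _ (fd_memLp g1 hK)) (int2 G _ g1.continuous.continuousOn (fd_memLp g1 hK))]
      have hz : ∀ x ∉ K, ζ x = 0 := fun x hx => image_eq_zero_of_notMem_tsupport (fun hh => hx (hζK hh))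
      have hz' : ∀ x ∉ K, fderiv ℝ ζ x = 0 := fun x hx => image_eq_zero_of_notMem_tsupport (fun hh => hx (hζK (tsupport_fderiv_subset ℝ hh)))
      rw [setIntegral_eq_integral_of_forall_compl_eq_zero, setIntegral_eq_integral_of_forall_compl_eq_zero, h2]
      · simp only [bf]; ring
      · intro x hx; simp [bf, hz' x hx]
      · intro x hx; simp [hz x hx]
    beta_reduce at h1
    rw [h3, zero_sub, abs_neg] at h1
    exact h1
  have key2 : (∫ x in K, (ζ x * jac (N x) + bf ζ x (F x) (N x))) = 0 := by
    apply abs_eq_zero.1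
    apply le_antisymm _ (abs_nonneg _)
    apply le_of_forall_pos_le_add
    intro ε hε
    linarith [key ε hε]
  rw [integral_add (int1 N hN) (int2 F N hFK hN)] at key2
  linarith


def qg (k e : ℝ) (L : ℂ →L[ℝ] ℂ) : Prop :=
  |(L 1).im - (L I).re| ≤ e ∧ hs L ≤ (k + 1/k) * (-jac L) + e^2

theorem jac_eq (L : ℂ →L[ℝ] ℂ) : jac L = (L 1).re * (L I).im - (L 1).im * (L I).re := by
  simp [jac, Complex.mul_im]; ring

theorem hs_eq (L : ℂ →L[ℝ] ℂ) : hs L = (L 1).re^2 + (L 1).im^2 + (L I).re^2 + (L I).im^2 := by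
  simp [hs, ← Complex.normSq_eq_norm_sq, Complex.normSq_apply]; ring

theorem norm_le_hs (L : ℂ →L[ℝ] ℂ) : ‖L‖^2 ≤ 2 * hs L := by
  have h : ‖L‖ ≤ ‖L 1‖ + ‖L I‖ := by
    refine L.opNorm_le_bound (by positivity) fun z => ?_
    rw [clm_apply]
    refine (norm_add_le _ _).trans ?_
    rw [norm_smul, norm_smul, add_mul, Real.norm_eq_abs, Real.norm_eq_abs, mul_comm, mul_comm |z.im|]
    gcongr
    · exact Complex.abs_re_le_norm z
    · exact Complex.abs_im_le_norm z
  have h0 := norm_nonneg L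
  unfold hs
  nlinarith [sq_nonneg (‖L 1‖ - ‖L I‖)]

theorem hs_le_norm (L : ℂ →L[ℝ] ℂ) : hs L ≤ 2 * ‖L‖^2 := by
  have h1 := n1 L
  have h2 := nI L
  unfold hs
  nlinarith [norm_nonneg (L 1), norm_nonneg (L I)]

def c1 (k : ℝ) : ℝ := (2/(k+1) + 1/k)/2
def sk (k : ℝ) : ℝ := (c1 k + 1/k)/2
def dk (k : ℝ) : ℝ := (c1 k - 1/k)/2

theorem frame_alg {k : ℝ} (hk : 1 < k) : ∃ C : ℝ, 0 ≤ C ∧ ∀ e X Y B D : ℝ, |Y - B| ≤ e →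
    X^2+Y^2+B^2+D^2 ≤ (k+1/k)*(B*Y - X*D) + e^2 → c1 k * B^2 + D^2/k ≤ (B*Y - X*D) + C*e^2 := by
  have hk0 : 0 < k := by linarith
  have hg : 0 < 2/(k+1) - c1 k := by
    unfold c1
    have : (2/(k+1) - (2/(k+1) + 1/k)/2) = (k-1)/(2*k*(k+1)) := by field_simp; ring
    rw [this]; have : 0 < k-1 := by linarith
    positivity
  have hk2 : 0 < k^2 - 1 := by nlinarith
  refine ⟨k/(k^2-1) + (2/(k+1))^2/(4*(2/(k+1) - c1 k)), by positivity, ?_⟩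
  intro e X Y B D hw h
  obtain ⟨w, rfl⟩ : ∃ w, Y = B + w := ⟨Y - B, by ring⟩
  rw [add_sub_cancel_left] at hw
  have hw2 : w^2 ≤ e^2 := by rw [← sq_abs w]; gcongr
  set g := 2/(k+1) - c1 k with hgd
  have e1 : 2/(k+1) = c1 k + g := by ring
  -- d*q bound
  have h1 : (k - 1/k) * (D * (X + D/k)) ≤ (k+1/k-2)*(B^2+B*w) + e^2 := by
    have : (k - 1/k) * (D * (X + D/k)) = (X^2+(k+1/k)*(X*D)+D^2) - (X+D/k)^2 := by
      field_simp; ring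
    rw [this]
    nlinarith [sq_nonneg (X+D/k), sq_nonneg w]
  have h2 : D * (X + D/k) ≤ (1 - 2/(k+1)) * (B^2+B*w) + k/(k^2-1) * e^2 := by
    have hpos : 0 < k - 1/k := by
      have : k - 1/k = (k^2-1)/k := by field_simp
      rw [this]; positivity
    refine le_of_mul_le_mul_left (h1.trans (le_of_eq ?_)) hpos
    have : (k+1) ≠ 0 := by linarith
    have : k^2-1 ≠ 0 := hk2.ne'
    field_simp; ring
  have h3 : -(2/(k+1)) * (B * w) ≤ g * B^2 + (2/(k+1))^2/(4*g) * e^2 := by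
    have : g * B^2 + (2/(k+1))^2/(4*g) * w^2 + (2/(k+1)) * (B*w) = (2*g*B + (2/(k+1))*w)^2/(4*g) := by
      field_simp; ring
    have t : 0 ≤ (2*g*B + (2/(k+1))*w)^2/(4*g) := by positivity
    have t2 : (2/(k+1))^2/(4*g) * w^2 ≤ (2/(k+1))^2/(4*g) * e^2 := by gcongr
    linarith
  have h4 : D * (X + D/k) = X*D + D^2/k := by ring
  rw [h4] at h2
  rw [e1] at h2 h3 ⊢
  linarith

theorem qg_frame {k : ℝ} (hk : 1 < k) : ∃ C : ℝ, 0 ≤ C ∧ ∀ e L, qg k e L → ∀ x : ℂ,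
    qf (sk k) (dk k) x (L (I*x)) ≤ ‖x‖^2 * (-jac L + C * e^2) := by
  obtain ⟨C, hC0, hC⟩ := frame_alg hk
  refine ⟨C, hC0, ?_⟩
  intro e L hL x
  by_cases hx : x = 0
  · subst hx; simp [qf]
  have hR : 0 < ‖x‖^2 := by positivity
  have hRe : ‖x‖^2 = x.re^2 + x.im^2 := by
    rw [← Complex.normSq_eq_norm_sq, Complex.normSq_apply]; ring
  obtain ⟨hw, hh⟩ := hL
  have he : 0 ≤ e := (abs_nonneg _).trans hw
  rw [clm_apply]
  rw [jac_eq] at hh ⊢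
  rw [hs_eq] at hh
  simp only [qf]
  rw [← Complex.normSq_eq_norm_sq (_ + _), Complex.normSq_apply]
  simp only [Complex.mul_re, Complex.mul_im, Complex.I_re, Complex.I_im, Complex.add_re, Complex.add_im, Complex.real_smul, Complex.ofReal_re, Complex.ofReal_im, pow_two ((starRingEnd ℂ) x * _), Complex.conj_re, Complex.conj_im]
  set a := (L 1).re
  set b := (L 1).im
  set c := (L I).re
  set d := (L I).im
  set p := x.re
  set q := x.im
  set R := ‖x‖^2 with hRdef
  have hk0 : 0 < k := by linarith
  have key := hC (R*e) (p*(p*a+q*c)+q*(p*b+q*d)) (p*(p*b+q*d)-q*(p*a+q*c)) (p*(-q*a+p*c)+q*(-q*b+p*d)) (p*(-q*b+p*d)-q*(-q*a+p*c))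
    (by
      have : p*(p*b+q*d)-q*(p*a+q*c) - (p*(-q*a+p*c)+q*(-q*b+p*d)) = R * (b - c) := by rw [hRe]; ring
      rw [this, abs_mul, abs_of_pos hR]; gcongr)
    (by
      have := mul_le_mul_of_nonneg_left hh (sq_nonneg R)
      rw [hRe] at this ⊢
      refine le_trans (le_of_eq ?_) (this.trans (le_of_eq ?_)) <;> ring)
  have hs1 : sk k = (c1 k + 1/k)/2 := rfl
  have hd1 : dk k = (c1 k - 1/k)/2 := rfl
  rw [hs1, hd1]
  refine le_of_mul_le_mul_left ?_ hR
  refine le_trans (le_of_eq ?_) (key.trans (le_of_eq ?_))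
  · rw [mul_add, mul_div_cancel₀ _ hR.ne', hRe]
    field_simp; ring
  · rw [hRe]; ring

/-- the exponent -/
theorem exp_exists {k : ℝ} (hk : 1 < k) : ∃ l, 1/k < l ∧ l < 1 ∧ l ≤ sk k ∧ 0 ≤ dk k ∧ dk k ≤ sk k ∧
    (dk k)^2 ≤ (sk k - l) * (sk k + l/3) := by
  have hk0 : 0 < k := by linarith
  have hd : 0 < dk k := by
    unfold dk c1
    have : ((2/(k+1) + 1/k)/2 - 1/k)/2 = (k-1)/(4*k*(k+1)) := by field_simp; ring
    rw [this]; have : 0 < k-1 := by linarith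
    positivity
  have hk1 : (0:ℝ) < 1/k := by positivity
  have hs1 : sk k = 1/k + dk k := by unfold sk dk; ring
  have hlt : sk k < 1 := by
    unfold sk c1
    have h1 : 1/k < 1 := by rw [div_lt_one hk0]; exact hk
    have h2 : 2/(k+1) < 1 := by rw [div_lt_one (by linarith)]; linarith
    linarith
  set q := 1/k
  set d := dk k
  -- l = q + t with t small
  have : ∃ t, 0 < t ∧ t < d ∧ d^2 ≤ (d - t) * (q + d + (q+t)/3) := by
    refine ⟨d * q / (q + d + 1 + 3 * q), by positivity, ?_, ?_⟩
    · rw [div_lt_iff₀ (by positivity)]; nlinarith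
    · set t := d * q / (q + d + 1 + 3 * q) with ht
      have h1 : t * (q + d + 1 + 3 * q) = d * q := by rw [ht]; field_simp
      have h0 : 0 < t := by positivity
      have h2 : t < d := by nlinarith
      nlinarith [mul_pos h0 (sub_pos.2 h2)]
  obtain ⟨t, t0, td, ht⟩ := this
  refine ⟨q + t, by linarith, by linarith, by linarith, hd.le, by linarith, ?_⟩
  rw [hs1]
  convert ht using 2
  ring


theorem jac_comp (A L : ℂ →L[ℝ] ℂ) : jac (A.comp L) = jac A * jac L := by
  rw [jac_eq, jac_eq, jac_eq]
  simp only [ContinuousLinearMap.comp_apply]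
  rw [clm_apply A (L 1), clm_apply A (L I)]
  simp only [Complex.add_re, Complex.add_im, Complex.real_smul, Complex.mul_re, Complex.mul_im, Complex.ofReal_re, Complex.ofReal_im]
  ring

def chi (t : ℝ) : ℝ := Real.smoothTransition (t - 1)

theorem chi_cd : ContDiff ℝ (⊤ : ℕ∞) chi :=
  Real.smoothTransition.contDiff.comp (contDiff_id.sub contDiff_const)

theorem chi_props : (∀ t, 0 ≤ chi t ∧ chi t ≤ 1) ∧ (∀ t ≤ 1, chi t = 0) ∧ (∀ t, 2 ≤ t → chi t = 1) ∧
    (∀ t, 0 ≤ deriv chi t) ∧ ∃ M, 0 ≤ M ∧ ∀ t, |t * deriv chi t| ≤ M := by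
  have h0 : ∀ t ≤ 1, chi t = 0 := fun t ht => Real.smoothTransition.zero_of_nonpos (by linarith)
  have h1 : ∀ t, 2 ≤ t → chi t = 1 := fun t ht => Real.smoothTransition.one_of_one_le (by linarith)
  refine ⟨fun t => ⟨Real.smoothTransition.nonneg _, Real.smoothTransition.le_one _⟩, h0, h1, ?_, ?_⟩
  · intro t
    apply Monotone.deriv_nonneg
    intro a b hab
    exact Real.smoothTransition.monotone (by linarith)
  · have hc : Continuous (fun t => t * deriv chi t) := continuous_id.mul (chi_cd.continuous_deriv (by simp))
    obtain ⟨M, hM⟩ := (isCompact_Icc (a := (0:ℝ)) (b := 3)).exists_bound_of_continuousOn hc.continuousOn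
    refine ⟨|M|, abs_nonneg _, fun t => ?_⟩
    by_cases ht : t ∈ Set.Icc (0:ℝ) 3
    · exact (hM t ht).trans (le_abs_self _)
    · have : deriv chi t = 0 := by
        rw [Set.mem_Icc, not_and_or, not_le, not_le] at ht
        rcases ht with ht | ht
        · have : chi =ᶠ[nhds t] fun _ => 0 := by
            filter_upwards [gt_mem_nhds (show t < 1 by linarith)] with y hy using h0 y hy.le
          rw [this.deriv_eq]; simp
        · have : chi =ᶠ[nhds t] fun _ => 1 := by
            filter_upwards [lt_mem_nhds (show 2 < t by linarith)] with y hy using h1 y hy.le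
          rw [this.deriv_eq]; simp
      rw [this]; simp

/-- truncation away from zero -/
theorem trunc : ∃ M : ℝ, 1 ≤ M ∧ ∀ τ > 0, ∃ T : ℂ → ℂ, ContDiff ℝ (⊤ : ℕ∞) T ∧ (∀ z, ‖z‖ < τ → T z = 0) ∧
    (∀ z, 0 ≤ jac (fderiv ℝ T z) ∧ jac (fderiv ℝ T z) ≤ M) ∧
    (∀ z, 2 * τ < ‖z‖ → T z = z ∧ fderiv ℝ T z = ContinuousLinearMap.id ℝ ℂ) ∧
    (∀ z v, ‖T z‖ * ‖fderiv ℝ T z v‖ ≤ ‖z‖ * (jac (fderiv ℝ T z) * ‖v‖)) ∧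
    (∀ z, ‖T z - z‖ ≤ 2 * τ) ∧ (∀ z, ‖fderiv ℝ T z‖ ≤ M) := by
  obtain ⟨c01, cz, co, cd, M, hM0, hM⟩ := chi_props
  refine ⟨1 + 2 * M, by linarith, ?_⟩
  intro τ hτ
  have hτ2 : 0 < τ^2 := by positivity
  set T : ℂ → ℂ := fun z => chi (‖z‖^2/τ^2) • z with hT
  have hTc : ContDiff ℝ (⊤ : ℕ∞) T := (chi_cd.comp ((contDiff_norm_sq ℝ).div_const _)).smul contDiff_id
  -- derivative
  have hd : ∀ z v, fderiv ℝ T z v = chi (‖z‖^2/τ^2) • v + (deriv chi (‖z‖^2/τ^2) * (2/τ^2) * (conj z * v).re) • z := by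
    intro z v
    have h1 : HasFDerivAt (fun z : ℂ => ‖z‖^2/τ^2) ((τ^2)⁻¹ • (2 • innerSL ℝ z)) z := by
      have := (hasStrictFDerivAt_norm_sq z).hasFDerivAt.const_mul ((τ^2)⁻¹)
      refine this.congr_of_eventuallyEq (Filter.Eventually.of_forall fun y => ?_)
      beta_reduce; rw [div_eq_inv_mul]
    have h2 : HasFDerivAt (fun z : ℂ => chi (‖z‖^2/τ^2)) (deriv chi (‖z‖^2/τ^2) • ((τ^2)⁻¹ • (2 • innerSL ℝ z))) z :=
      ((chi_cd.differentiable (by simp)).differentiableAt.hasDerivAt).comp_hasFDerivAt z h1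
    have h3 := (h2.smul (hasFDerivAt_id z)).fderiv
    have h4 : fderiv ℝ T z = _ := h3
    rw [h4]
    simp only [ContinuousLinearMap.add_apply, ContinuousLinearMap.smul_apply, ContinuousLinearMap.smulRight_apply, innerSL_apply_apply, ContinuousLinearMap.id_apply, id, Complex.inner]
    congr 2
    simp only [nsmul_eq_mul, smul_eq_mul, Nat.cast_ofNat]
    rw [mul_comm v]
    rw [div_eq_mul_inv]; ring
  have hj : ∀ z, jac (fderiv ℝ T z) = chi (‖z‖^2/τ^2) * (chi (‖z‖^2/τ^2) + 2 * (‖z‖^2/τ^2 * deriv chi (‖z‖^2/τ^2))) := by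
    intro z
    rw [jac_eq, hd, hd]
    have hRe : ‖z‖^2 = z.re^2 + z.im^2 := by
      rw [← Complex.normSq_eq_norm_sq, Complex.normSq_apply]; ring
    set a := chi (‖z‖^2/τ^2)
    set b := deriv chi (‖z‖^2/τ^2)
    have hq : 2 * (‖z‖^2/τ^2 * b) = (2/τ^2) * ((z.re^2+z.im^2) * b) := by rw [hRe]; ring
    rw [hq]
    generalize 2/τ^2 = q
    simp only [Complex.mul_re, Complex.mul_im, Complex.I_re, Complex.I_im, Complex.add_re, Complex.add_im, Complex.real_smul, Complex.ofReal_re, Complex.ofReal_im, Complex.conj_re, Complex.conj_im, Complex.one_re, Complex.one_im]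
    ring
  have hpos : ∀ z : ℂ, 0 ≤ ‖z‖^2/τ^2 * deriv chi (‖z‖^2/τ^2) := fun z => mul_nonneg (by positivity) (cd _)
  have hle : ∀ z : ℂ, ‖z‖^2/τ^2 * deriv chi (‖z‖^2/τ^2) ≤ M := fun z => (le_abs_self _).trans (hM _)
  have hdn : ∀ z v, ‖fderiv ℝ T z v‖ ≤ (chi (‖z‖^2/τ^2) + 2 * (‖z‖^2/τ^2 * deriv chi (‖z‖^2/τ^2))) * ‖v‖ := by
    intro z v
    rw [hd]
    refine (norm_add_le _ _).trans ?_
    rw [norm_smul, norm_smul, Real.norm_eq_abs, Real.norm_eq_abs, abs_of_nonneg (c01 _).1, add_mul]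
    refine add_le_add le_rfl ?_
    rw [abs_mul, abs_mul, abs_of_nonneg (cd _), abs_of_pos (by positivity : (0:ℝ) < 2/τ^2)]
    have : |(conj z * v).re| ≤ ‖z‖ * ‖v‖ := by
      refine (Complex.abs_re_le_norm _).trans ?_
      rw [norm_mul, Complex.norm_conj]
    calc _ ≤ deriv chi (‖z‖^2/τ^2) * (2/τ^2) * (‖z‖ * ‖v‖) * ‖z‖ := by
          have := cd (‖z‖^2/τ^2)
          gcongr
      _ = _ := by ring
  refine ⟨T, hTc, ?_, ?_, ?_, ?_, ?_, ?_⟩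
  · intro z hz
    have : ‖z‖^2/τ^2 ≤ 1 := by
      rw [div_le_one hτ2]; gcongr
    simp [hT, cz _ this]
  · intro z
    rw [hj]
    have h1 := hpos z
    have h2 := hle z
    obtain ⟨h3, h4⟩ := c01 (‖z‖^2/τ^2)
    constructor
    · positivity
    · nlinarith
  · intro z hz
    have hb : ∀ y : ℂ, 2 * τ < ‖y‖ → T y = y := by
      intro y hy
      have : 2 ≤ ‖y‖^2/τ^2 := by
        rw [le_div_iff₀ hτ2]; nlinarith
      simp [hT, co _ this]
    refine ⟨hb z hz, ?_⟩
    have : T =ᶠ[nhds z] id := by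
      filter_upwards [(isOpen_lt continuous_const continuous_norm).mem_nhds hz] with y hy using hb y hy
    rw [this.fderiv_eq, fderiv_id]
  · intro z v
    rw [hj]
    have h1 : ‖T z‖ = chi (‖z‖^2/τ^2) * ‖z‖ := by
      rw [hT]; beta_reduce; rw [norm_smul, Real.norm_eq_abs, abs_of_nonneg (c01 _).1]
    rw [h1]
    have h0 := (c01 (‖z‖^2/τ^2)).1
    calc _ ≤ chi (‖z‖^2/τ^2) * ‖z‖ * ((chi (‖z‖^2/τ^2) + 2 * (‖z‖^2/τ^2 * deriv chi (‖z‖^2/τ^2))) * ‖v‖) :=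
          mul_le_mul_of_nonneg_left (hdn z v) (by positivity)
      _ = _ := by ring
  · intro z
    by_cases hz : 2 * τ < ‖z‖
    · have : 2 ≤ ‖z‖^2/τ^2 := by
        rw [le_div_iff₀ hτ2]; nlinarith
      simp [hT, co _ this, hτ.le]
    · have : T z - z = (chi (‖z‖^2/τ^2) - 1) • z := by rw [sub_smul, one_smul]
      rw [this, norm_smul, Real.norm_eq_abs]
      obtain ⟨h3, h4⟩ := c01 (‖z‖^2/τ^2)
      have : |chi (‖z‖^2/τ^2) - 1| ≤ 1 := by rw [abs_le]; constructor <;> linarith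
      push Not at hz
      calc _ ≤ 1 * ‖z‖ := by gcongr
        _ ≤ _ := by linarith
  · intro z
    refine ContinuousLinearMap.opNorm_le_bound _ (by linarith) fun v => (hdn z v).trans ?_
    have h2 := hle z
    obtain ⟨h3, h4⟩ := c01 (‖z‖^2/τ^2)
    gcongr


structure QG (k e : ℝ) (U : Set ℂ) (F : ℂ → ℂ) (D : ℂ → ℂ →L[ℝ] ℂ) : Prop where
  op : IsOpen U
  cont : ContinuousOn F U
  bd : ∀ x ∈ U, ‖F x‖ ≤ 1
  h1 : H1loc {x | x ∈ U ∧ F x ≠ 0} F D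
  ae : ∀ᵐ x, x ∈ U → F x ≠ 0 → qg k e (D x)

theorem jac_int {K : Set ℂ} {N : ℂ → ℂ →L[ℝ] ℂ} (hN : MemLp N 2 (volume.restrict K)) :
    IntegrableOn (fun x => jac (N x)) K := by
  have h := MemLp2.int hN
  refine h.mono' (continuous_jac.comp_aestronglyMeasurable hN.1) (Filter.Eventually.of_forall fun x => ?_)
  rw [Real.norm_eq_abs, jac]
  refine (Complex.abs_im_le_norm _).trans ?_
  rw [norm_mul, Complex.norm_conj, sq]
  gcongr
  · exact n1 _
  · exact nI _

theorem continuous_hs : Continuous hs := by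
  unfold hs; fun_prop

theorem hs_int {K : Set ℂ} {N : ℂ → ℂ →L[ℝ] ℂ} (hN : MemLp N 2 (volume.restrict K)) :
    IntegrableOn (fun x => hs (N x)) K := by
  have h := (MemLp2.int hN).const_mul 2
  refine h.mono' (continuous_hs.comp_aestronglyMeasurable hN.1) (Filter.Eventually.of_forall fun x => ?_)
  rw [Real.norm_eq_abs, abs_of_nonneg (by unfold hs; positivity)]
  exact hs_le_norm _

theorem hs_nonneg (L : ℂ →L[ℝ] ℂ) : 0 ≤ hs L := by unfold hs; positivity

theorem bf_le (ζ : ℂ → ℝ) (x w : ℂ) (L : ℂ →L[ℝ] ℂ) :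
    |bf ζ x w L| ≤ (1/2) * (‖fderiv ℝ ζ x‖ * (‖w‖ * ‖L I‖ + ‖w‖ * ‖L 1‖)) := by
  unfold bf
  rw [abs_mul, abs_of_pos (by norm_num : (0:ℝ) < 1/2)]
  refine mul_le_mul_of_nonneg_left ?_ (by norm_num)
  refine (Complex.abs_im_le_norm _).trans ?_
  rw [norm_mul, Complex.norm_conj]
  have k1 : ‖(fderiv ℝ ζ x 1 * L I - fderiv ℝ ζ x I * L 1 : ℂ)‖ ≤ ‖fderiv ℝ ζ x‖ * ‖L I‖ + ‖fderiv ℝ ζ x‖ * ‖L 1‖ := by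
    refine (norm_sub_le _ _).trans ?_
    rw [norm_mul, norm_mul, Complex.norm_real, Complex.norm_real]
    gcongr
    · simpa using (fderiv ℝ ζ x).le_opNorm 1
    · simpa using (fderiv ℝ ζ x).le_opNorm I
  calc _ ≤ ‖w‖ * (‖fderiv ℝ ζ x‖ * ‖L I‖ + ‖fderiv ℝ ζ x‖ * ‖L 1‖) := by gcongr
    _ = _ := by ring

theorem memLp_ind {E : Type*} [NormedAddCommGroup E] {S : Set ℂ} (hS : MeasurableSet S) {μ : Measure ℂ} {D : ℂ → E}
    (h : MemLp D 2 (μ.restrict S)) : MemLp (S.indicator D) 2 μ :=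
  (memLp_indicator_iff_restrict hS).2 h

theorem lev_compact {U K : Set ℂ} {F : ℂ → ℂ} (hF : ContinuousOn F U) (hK : IsCompact K) (hKU : K ⊆ U) (τ : ℝ) :
    IsCompact (K ∩ {x | τ ≤ ‖F x‖}) := by
  have : IsClosed (K ∩ (fun x => ‖F x‖) ⁻¹' (Set.Ici τ)) :=
    (hF.mono hKU).norm.preimage_isClosed_of_isClosed hK.isClosed isClosed_Ici
  exact hK.of_isClosed_subset this Set.inter_subset_left

theorem cacc {k : ℝ} (hk : 1 < k) {U : Set ℂ} (hU : IsOpen U)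
    {K : Set ℂ} (hK : IsCompact K) (hKU : K ⊆ U) :
    ∃ C, 0 ≤ C ∧ ∀ (e : ℝ) (F : ℂ → ℂ) (D : ℂ → ℂ →L[ℝ] ℂ), QG k e U F D →
      ∀ τ > 0, ∫ x in K ∩ {x | 3 * τ ≤ ‖F x‖}, hs (D x) ≤ C * (1 + e^2) := by
  obtain ⟨M, hM1, hT⟩ := trunc
  obtain ⟨η, e1, e2, e3, e4, e5⟩ := cutoff hK hU hKU
  set K' := tsupport η with hK'
  have hK'c : IsCompact K' := e2
  haveI := finK hK'c
  have hKK' : K ⊆ K' := fun x hx => subset_tsupport _ (by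
    rw [Function.mem_support, (e5 x hx).self_of_nhds]; norm_num)
  have hηc : Continuous (fderiv ℝ η) := e1.continuous_fderiv (by simp)
  obtain ⟨P, hP⟩ := hK'c.exists_bound_of_continuousOn hηc.continuousOn
  set κ := k + 1/k with hκ
  have hκ0 : 0 < κ := by have : 0 < k := by linarith
                         positivity
  set ζ : ℂ → ℝ := fun x => η x ^ 2 with hζ
  have hζc : ContDiff ℝ 1 ζ := (e1.pow 2).of_le (by exact_mod_cast le_top)
  have hζs : tsupport ζ ⊆ K' := by
    apply closure_mono
    intro x hx hx0
    apply hx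
    simp [hζ, hx0]
  have hζd : ∀ x ∈ K', ‖fderiv ℝ ζ x‖ ≤ 2 * η x * |P| := by
    intro x hx
    have : fderiv ℝ ζ x = (2 * η x) • fderiv ℝ η x := by
      have := ((e1.differentiable (by simp) x).hasFDerivAt.pow 2).fderiv
      rw [hζ, this]; simp
    rw [this, norm_smul, Real.norm_eq_abs, abs_of_nonneg (by linarith [(e4 x).1])]
    have := (hP x hx).trans (le_abs_self P)
    have := (e4 x).1
    gcongr
  set V := (volume.restrict K').real Set.univ
  have hV : 0 ≤ V := measureReal_nonneg
  refine ⟨2 * ((κ^2 * P^2 + 1) * M * V), by positivity, fun e F D h τ hτ => ?_⟩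
  obtain ⟨T, t1, t2, t3, t4, t5, t6, t7⟩ := hT τ hτ
  have hN := h.h1.comp_ext h.op h.cont t1 hτ t2
  set N : ℂ → ℂ →L[ℝ] ℂ := fun x => (fderiv ℝ T (F x)).comp (D x) with hNd
  set w : ℂ → ℝ := fun x => jac (fderiv ℝ T (F x)) with hw
  have hGc : ContinuousOn (fun x => T (F x)) U := t1.continuous.comp_continuousOn h.cont
  have ibp := ibp_H1 hN hGc hζc hK'c e3 hζs
  have hwN : ∀ x, jac (N x) = w x * jac (D x) := fun x => jac_comp _ _
  have hfd0 : ∀ z : ℂ, ‖z‖ < τ → fderiv ℝ T z = 0 := by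
    intro z hz
    have : T =ᶠ[nhds z] fun _ => 0 := by
      filter_upwards [(isOpen_lt continuous_norm continuous_const).mem_nhds hz] with y hy using t2 y hy
    rw [this.fderiv_eq]; simp
  have hw0 : ∀ x, ‖F x‖ < τ → w x = 0 := by
    intro x hx
    simp [hw, hfd0 _ hx, jac]
  set S := K' ∩ {x | τ ≤ ‖F x‖} with hS
  have hSc : IsCompact S := lev_compact h.cont hK'c e3 τ
  have hSΩ : S ⊆ {x | x ∈ U ∧ F x ≠ 0} := by
    rintro x ⟨hx, hx'⟩
    refine ⟨e3 hx, fun h0 => ?_⟩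
    have : τ ≤ ‖F x‖ := hx'
    rw [h0, norm_zero] at this
    linarith
  have hDS := (h.h1 S hSΩ hSc).1
  have hD1 : MemLp (S.indicator D) 2 (volume.restrict K') := by
    apply memLp_ind hSc.measurableSet
    rw [Measure.restrict_restrict hSc.measurableSet,
      Set.inter_eq_left.2 (show S ⊆ K' from Set.inter_subset_left)]
    exact hDS
  have hwc : ContinuousOn w K' := by
    have c : Continuous (fun z => jac (fderiv ℝ T z)) := continuous_jac.comp (t1.continuous_fderiv (by simp))
    exact c.comp_continuousOn (h.cont.mono e3)
  set A : ℂ → ℝ := fun x => η x ^ 2 * w x * hs (D x) with hA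
  have hA0 : ∀ x, 0 ≤ A x := fun x => mul_nonneg (mul_nonneg (sq_nonneg _) (t3 _).1) (hs_nonneg _)
  have hAi : IntegrableOn A K' := by
    have i1 : IntegrableOn (fun x => (η x ^ 2 * w x) * hs (S.indicator D x)) K' := by
      have i0 := hs_int hD1
      refine (i0.const_mul M).mono' ?_ ?_
      · have c1 : ContinuousOn (fun x => η x ^ 2 * w x) K' := ((e1.continuous.pow 2).continuousOn).mul hwc
        exact (c1.aestronglyMeasurable hK'c.measurableSet).mul i0.1
      · refine Filter.Eventually.of_forall fun x => ?_
        rw [Real.norm_eq_abs, abs_of_nonneg (mul_nonneg (mul_nonneg (sq_nonneg _) (t3 _).1) (hs_nonneg _))]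
        refine mul_le_mul_of_nonneg_right ?_ (hs_nonneg _)
        have a1 : η x ^ 2 ≤ 1 := pow_le_one₀ (e4 x).1 (e4 x).2
        have a2 := (t3 (F x)).1
        have a3 := (t3 (F x)).2
        calc η x ^ 2 * w x ≤ 1 * w x := by gcongr
          _ ≤ M := by rw [one_mul]; exact a3
    refine (integrableOn_congr_fun ?_ hK'c.measurableSet).1 i1
    intro x hx
    beta_reduce
    by_cases hxS : x ∈ S
    · rw [Set.indicator_of_mem hxS]
    · have : ‖F x‖ < τ := by
        by_contra hh; push Not at hh; exact hxS ⟨hx, hh⟩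
      rw [hA]; beta_reduce; rw [hw0 x this]; simp
  have hNi : IntegrableOn (fun x => ζ x * jac (N x)) K' := by
    have i0 := jac_int (hN K' e3 hK'c).1
    refine i0.norm.mono' ((hζc.continuous.aestronglyMeasurable).mul i0.1) (Filter.Eventually.of_forall fun x => ?_)
    rw [norm_mul]
    have a1 : ‖ζ x‖ ≤ 1 := by
      rw [Real.norm_eq_abs, abs_of_nonneg (sq_nonneg _)]; exact pow_le_one₀ (e4 x).1 (e4 x).2
    calc _ ≤ 1 * ‖jac (N x)‖ := by gcongr
      _ = _ := one_mul _
  -- step 1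
  have s1 : ∫ x in K', A x ≤ κ * (-∫ x in K', ζ x * jac (N x)) + e^2 * M * V := by
    have : ∫ x in K', A x ≤ ∫ x in K', ((-κ) * (ζ x * jac (N x)) + e^2 * M) := by
      refine setIntegral_mono_ae_restrict hAi ((hNi.const_mul (-κ)).add (integrable_const _)) ?_
      rw [Filter.EventuallyLE, ae_restrict_iff' hK'c.measurableSet]
      filter_upwards [h.ae] with x hx hxK
      rw [hwN]
      have a1 : η x ^ 2 ≤ 1 := pow_le_one₀ (e4 x).1 (e4 x).2
      have a0 : 0 ≤ η x ^ 2 := sq_nonneg _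
      have a2 : 0 ≤ w x := (t3 (F x)).1
      have a3 : w x ≤ M := (t3 (F x)).2
      by_cases h0 : F x = 0
      · have : w x = 0 := hw0 x (by rw [h0, norm_zero]; exact hτ)
        simp only [hA, this]
        simp; positivity
      · have := (hx (e3 hxK) h0).2
        have b1 := mul_le_mul_of_nonneg_left this (mul_nonneg a0 a2)
        have b2 : η x ^ 2 * w x * e^2 ≤ 1 * M * e^2 := by gcongr
        simp only [hA, hζ]
        calc _ ≤ _ := b1
          _ ≤ _ := by rw [← hκ]; linarith
    rw [integral_add (hNi.const_mul (-κ)) (integrable_const _), integral_const_mul, integral_const] at this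
    rw [smul_eq_mul] at this
    linarith
  have s2 : κ * |∫ x in K', bf ζ x (T (F x)) (N x)| ≤ (1/2) * (∫ x in K', A x) + κ^2 * P^2 * M * V := by
    have : |∫ x in K', bf ζ x (T (F x)) (N x)| ≤ ∫ x in K', κ⁻¹ * ((1/2) * A x + κ^2 * P^2 * M) := by
      rw [← Real.norm_eq_abs]
      refine norm_integral_le_of_norm_le (((hAi.const_mul (1/2)).add (integrable_const _)).const_mul _) ?_
      filter_upwards [ae_restrict_mem hK'c.measurableSet] with x hx
      rw [Real.norm_eq_abs]
      refine (bf_le _ _ _ _).trans ?_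
      have q1 : ‖T (F x)‖ * ‖N x I‖ ≤ w x * ‖D x I‖ := by
        refine (t5 (F x) (D x I)).trans ?_
        have := h.bd x (e3 hx)
        have a2 : 0 ≤ w x * ‖D x I‖ := mul_nonneg (t3 (F x)).1 (norm_nonneg _)
        calc _ ≤ 1 * (w x * ‖D x I‖) := mul_le_mul_of_nonneg_right this a2
          _ = _ := one_mul _
      have q2 : ‖T (F x)‖ * ‖N x 1‖ ≤ w x * ‖D x 1‖ := by
        refine (t5 (F x) (D x 1)).trans ?_
        have := h.bd x (e3 hx)
        have a2 : 0 ≤ w x * ‖D x 1‖ := mul_nonneg (t3 (F x)).1 (norm_nonneg _)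
        calc _ ≤ 1 * (w x * ‖D x 1‖) := mul_le_mul_of_nonneg_right this a2
          _ = _ := one_mul _
      have a2 : 0 ≤ w x := (t3 (F x)).1
      have a3 : w x ≤ M := (t3 (F x)).2
      have a4 := (e4 x).1
      have q3 : (1/2) * (‖fderiv ℝ ζ x‖ * (‖T (F x)‖ * ‖N x I‖ + ‖T (F x)‖ * ‖N x 1‖)) ≤ (1/2) * ((2 * η x * |P|) * (w x * ‖D x I‖ + w x * ‖D x 1‖)) := by
        refine mul_le_mul_of_nonneg_left ?_ (by norm_num)
        exact mul_le_mul (hζd x hx) (add_le_add q1 q2) (by positivity) (by positivity)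
      refine q3.trans ?_
      rw [le_inv_mul_iff₀ hκ0]
      have r1 : κ * |P| * (η x * ‖D x I‖) ≤ (1/2) * (η x^2 * ‖D x I‖^2) + (1/2) * (κ^2 * P^2) := by
        have := sq_nonneg (κ * |P| - η x * ‖D x I‖)
        have hp : |P|^2 = P^2 := sq_abs _
        nlinarith
      have r2 : κ * |P| * (η x * ‖D x 1‖) ≤ (1/2) * (η x^2 * ‖D x 1‖^2) + (1/2) * (κ^2 * P^2) := by
        have := sq_nonneg (κ * |P| - η x * ‖D x 1‖)
        have hp : |P|^2 = P^2 := sq_abs _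
        nlinarith
      have r3 := mul_le_mul_of_nonneg_left (add_le_add r1 r2) a2
      have r4 : w x * (κ^2*P^2) ≤ M * (κ^2*P^2) := by gcongr
      simp only [hA, hs]
      nlinarith
    have h2 := mul_le_mul_of_nonneg_left this hκ0.le
    rw [integral_const_mul, integral_add (hAi.const_mul (1/2)) (integrable_const _), integral_const_mul, integral_const, smul_eq_mul, ← mul_assoc κ, mul_inv_cancel₀ hκ0.ne', one_mul] at h2
    linarith
  have s3 : ∫ x in K', A x ≤ 2 * ((κ^2 * P^2 + e^2) * M * V) := by
    rw [ibp, neg_neg] at s1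
    have := mul_le_mul_of_nonneg_left (le_abs_self (∫ x in K', bf ζ x (T (F x)) (N x))) hκ0.le
    linarith
  have s4 : 2 * ((κ^2 * P^2 + e^2) * M * V) ≤ 2 * ((κ^2 * P^2 + 1) * M * V) * (1 + e^2) := by
    have q1 : κ^2 * P^2 + e^2 ≤ (κ^2 * P^2 + 1) * (1 + e^2) := by
      have : 0 ≤ κ^2 * P^2 * e^2 := by positivity
      nlinarith
    have q2 : 0 ≤ M * V := by positivity
    nlinarith [mul_le_mul_of_nonneg_right q1 q2]
  refine le_trans ?_ (s3.trans s4)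
  have hsub : K ∩ {x | 3 * τ ≤ ‖F x‖} ⊆ K' := Set.inter_subset_left.trans hKK'
  have hme : MeasurableSet (K ∩ {x | 3 * τ ≤ ‖F x‖}) := (lev_compact h.cont hK hKU (3*τ)).measurableSet
  calc _ = ∫ x in K ∩ {x | 3 * τ ≤ ‖F x‖}, A x := by
        refine setIntegral_congr_fun hme ?_
        rintro x ⟨hx, hx'⟩
        have hx'' : 3 * τ ≤ ‖F x‖ := hx'
        have : w x = 1 := by
          simp only [hw]
          rw [(t4 (F x) (by linarith)).2]; simp [jac]
        simp only [hA]
        rw [this, (e5 x hx).self_of_nhds]; simp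
    _ ≤ _ := setIntegral_mono_set hAi (Filter.Eventually.of_forall hA0) hsub.eventuallyLE

theorem QG.ext {k e : ℝ} (hk : 1 < k) (he : 0 ≤ e) {U : Set ℂ} {F : ℂ → ℂ} {D : ℂ → ℂ →L[ℝ] ℂ} (h : QG k e U F D) :
    ∃ D0, H1loc U F D0 ∧ ∀ᵐ x, x ∈ U → qg k e (D0 x) := by
  set Ω : Set ℂ := {x | x ∈ U ∧ F x ≠ 0} with hΩ
  have hΩo : IsOpen Ω := by
    have : Ω = U ∩ F ⁻¹' {0}ᶜ := by ext x; simp [hΩ]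
    rw [this]
    exact h.cont.isOpen_inter_preimage h.op isOpen_compl_singleton
  have hΩm := hΩo.measurableSet
  have hMem : ∀ K ⊆ U, IsCompact K → MemLp (Ω.indicator D) 2 (volume.restrict K) := by
    intro K hKU hK
    obtain ⟨C, -, hC⟩ := cacc hk h.op hK hKU
    apply memLp_ind hΩm
    set μ := (volume.restrict K).restrict Ω with hμ
    set φ : ℕ → Set ℂ := fun n => K ∩ {x | 3 * (1/((n:ℝ)+1)) ≤ ‖F x‖} with hφ
    have hφc : ∀ n, IsCompact (φ n) := fun n => lev_compact h.cont hK hKU _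
    have hφΩ : ∀ n, φ n ⊆ Ω := by
      rintro n x ⟨hx, hx'⟩
      refine ⟨hKU hx, fun h0 => ?_⟩
      have : 3 * (1/((n:ℝ)+1)) ≤ ‖F x‖ := hx'
      rw [h0, norm_zero] at this
      have : 0 < 3 * (1/((n:ℝ)+1)) := by positivity
      linarith
    have hr : ∀ n, μ.restrict (φ n) = volume.restrict (φ n) := by
      intro n
      rw [hμ, Measure.restrict_restrict hΩm, Measure.restrict_restrict (hφc n).measurableSet]
      congr 1
      ext x
      constructor
      · exact fun hx => hx.1
      · exact fun hx => ⟨hx, hφΩ n hx, hx.1⟩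
    have hcov : AECover μ Filter.atTop φ := by
      refine ⟨?_, fun n => (hφc n).measurableSet⟩
      rw [hμ, Measure.restrict_restrict hΩm]
      filter_upwards [ae_restrict_mem (hΩm.inter hK.measurableSet)] with x hx
      have hpos : 0 < ‖F x‖ / 3 := by have := norm_pos_iff.2 hx.1.2; positivity
      have := (tendsto_one_div_add_atTop_nhds_zero_nat (𝕜 := ℝ)).eventually (gt_mem_nhds hpos)
      filter_upwards [this] with n hn
      refine ⟨hx.2, ?_⟩
      show 3 * (1/((n:ℝ)+1)) ≤ ‖F x‖
      linarith
    have hmeas : AEStronglyMeasurable D μ := hcov.aestronglyMeasurable (fun n => by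
      rw [hr]; exact (h.h1 _ (hφΩ n) (hφc n)).1.1)
    rw [memLp_two_iff_integrable_sq_norm hmeas]
    have hsI : Integrable (fun x => hs (D x)) μ := by
      refine hcov.integrable_of_integral_norm_bounded (C * (1 + e^2)) (fun n => ?_) (Filter.Eventually.of_forall fun n => ?_)
      · rw [IntegrableOn, hr]; exact hs_int (h.h1 _ (hφΩ n) (hφc n)).1
      · rw [hr]
        refine le_trans (le_of_eq ?_) (hC e F D h (1/((n:ℝ)+1)) (by positivity))
        refine integral_congr_ae (Filter.Eventually.of_forall fun x => ?_)
        beta_reduce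
        rw [Real.norm_eq_abs, abs_of_nonneg (hs_nonneg _)]
    refine (hsI.const_mul 2).mono' (hmeas.norm.pow 2) (Filter.Eventually.of_forall fun x => ?_)
    rw [Real.norm_eq_abs, abs_of_nonneg (sq_nonneg _)]
    exact norm_le_hs _
  refine ⟨Ω.indicator D, ?_, ?_⟩
  · refine H1loc.closure hMem ?_
    intro K hKU hK ε hε
    haveI := finK hK
    obtain ⟨M, hM1, hT⟩ := trunc
    have hT' : ∀ n : ℕ, _ := fun n => hT (1/((n:ℝ)+1)) (by positivity)
    choose T t1 t2 t3 t4 t5 t6 t7 using hT'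
    have hlim : Filter.Tendsto (fun n => ∫ x in K, ‖(fderiv ℝ (T n) (F x)).comp (D x) - Ω.indicator D x‖^2) Filter.atTop (nhds (∫ x in K, (0:ℝ))) := by
      have hI := (MemLp2.int (hMem K hKU hK)).const_mul ((M+1)^2)
      have hz : ∀ n (z : ℂ), z = 0 → fderiv ℝ (T n) z = 0 := by
        intro n z hz
        have : T n =ᶠ[nhds z] fun _ => 0 := by
          filter_upwards [(isOpen_lt continuous_norm continuous_const).mem_nhds (show ‖z‖ < 1/((n:ℝ)+1) by rw [hz, norm_zero]; positivity)] with y hy using t2 n y hy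
        rw [this.fderiv_eq]; simp
      have hcomp : ∀ n, ∀ x ∈ K, (fderiv ℝ (T n) (F x)).comp (D x) = (fderiv ℝ (T n) (F x)).comp (Ω.indicator D x) := by
        intro n x hx
        by_cases hxΩ : x ∈ Ω
        · rw [Set.indicator_of_mem hxΩ]
        · have : F x = 0 := by
            by_contra h0; exact hxΩ ⟨hKU hx, h0⟩
          rw [hz n _ this]; simp
      refine tendsto_integral_of_dominated_convergence _ (fun n => ?_) hI (fun n => ?_) ?_
      · have := (h.h1.comp_ext h.op h.cont (t1 n) (τ := 1/((n:ℝ)+1)) (by positivity) (t2 n) K hKU hK).1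
        exact ((this.1.sub (hMem K hKU hK).1).norm.pow 2)
      · filter_upwards [ae_restrict_mem hK.measurableSet] with x hx
        rw [Real.norm_eq_abs, abs_of_nonneg (sq_nonneg _), hcomp n x hx, ← mul_pow]
        gcongr
        refine (norm_sub_le _ _).trans ?_
        rw [add_mul, one_mul]
        refine add_le_add ((ContinuousLinearMap.opNorm_comp_le _ _).trans ?_) le_rfl
        exact mul_le_mul_of_nonneg_right (t7 n _) (norm_nonneg _)
      · filter_upwards [ae_restrict_mem hK.measurableSet] with x hx
        apply tendsto_const_nhds.congr'
        by_cases hxΩ : x ∈ Ω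
        · have hpos : 0 < ‖F x‖ / 2 := by have := norm_pos_iff.2 hxΩ.2; positivity
          have := (tendsto_one_div_add_atTop_nhds_zero_nat (𝕜 := ℝ)).eventually (gt_mem_nhds hpos)
          filter_upwards [this] with n hn
          rw [hcomp n x hx, (t4 n (F x) (by linarith)).2]
          simp
        · refine Filter.Eventually.of_forall fun n => ?_
          beta_reduce
          rw [hcomp n x hx, Set.indicator_of_notMem hxΩ]; simp
    rw [integral_zero] at hlim
    have l1 := hlim.eventually (gt_mem_nhds hε)
    have l2 := (tendsto_one_div_add_atTop_nhds_zero_nat (𝕜 := ℝ)).eventually (gt_mem_nhds (show 0 < ε/2 by positivity))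
    obtain ⟨n, hn1, hn2⟩ := (l1.and l2).exists
    refine ⟨_, _, h.h1.comp_ext h.op h.cont (t1 n) (τ := 1/((n:ℝ)+1)) (by positivity) (t2 n), fun x hx => ?_, hn1.le⟩
    refine (t6 n (F x)).trans ?_
    linarith
  · filter_upwards [h.ae] with x hx hxU
    by_cases hxΩ : x ∈ Ω
    · rw [Set.indicator_of_mem hxΩ]; exact hx hxU hxΩ.2
    · rw [Set.indicator_of_notMem hxΩ]
      constructor
      · simpa using he
      · simp [hs, jac]; positivity


structure QH (k e : ℝ) (U : Set ℂ) (F : ℂ → ℂ) (D : ℂ → ℂ →L[ℝ] ℂ) : Prop where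
  cont : ContinuousOn F U
  bd : ∀ x ∈ U, ‖F x‖ ≤ 1
  h1 : H1loc U F D
  ae : ∀ᵐ x, x ∈ U → qg k e (D x)

theorem energy {k : ℝ} (hk : 1 < k) {U : Set ℂ} (hU : IsOpen U)
    {K : Set ℂ} (hK : IsCompact K) (hKU : K ⊆ U) :
    ∃ C, 0 ≤ C ∧ ∀ (e : ℝ) (F : ℂ → ℂ) (D : ℂ → ℂ →L[ℝ] ℂ), QH k e U F D →
      ∫ x in K, hs (D x) ≤ C * (1 + e^2) := by
  obtain ⟨C, hC0, hC⟩ := cacc hk hU hK hKU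
  refine ⟨9 * C, by positivity, ?_⟩
  intro e F D h
  have hn : ∀ x ∈ U, 1/3 ≤ ‖(1/3:ℝ) • (F x + 2)‖ := by
    intro x hx
    rw [norm_smul]
    have h1 := h.bd x hx
    have h2 : ‖(2:ℂ)‖ ≤ ‖F x + 2‖ + ‖F x‖ := by
      have := norm_sub_le (F x + 2) (F x); rwa [add_sub_cancel_left] at this
    rw [Complex.norm_ofNat] at h2
    rw [Real.norm_eq_abs, abs_of_pos (by norm_num : (0:ℝ) < 1/3)]
    linarith
  have hq : QG k (e/3) U (fun x => (1/3:ℝ) • (F x + 2)) (fun x => (1/3:ℝ) • D x) := by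
    refine ⟨hU, by have := h.cont; fun_prop, ?_, ?_, ?_⟩
    · intro x hx
      rw [norm_smul, Real.norm_eq_abs, abs_of_pos (by norm_num : (0:ℝ) < 1/3)]
      have := norm_add_le (F x) 2
      rw [Complex.norm_ofNat] at this
      linarith [h.bd x hx]
    · have : H1loc U (fun x => (1/3:ℝ) • (F x + 2)) (fun x => (1/3:ℝ) • D x) := by
        refine h.h1.comp h.cont ?_
        intro K _ _
        refine ⟨fun z => (1/3:ℝ) • (z + 2), (contDiff_id.add contDiff_const).const_smul _, fun x _ => rfl, fun x _ => ?_⟩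
        have : HasFDerivAt (fun z : ℂ => (1/3:ℝ) • (z + 2)) ((1/3:ℝ) • ContinuousLinearMap.id ℝ ℂ) (F x) :=
          ((hasFDerivAt_id (F x)).add_const 2).const_smul (1/3:ℝ)
        rw [this.fderiv]
        ext <;> simp
      exact fun K hKs hKc => this K (fun x hx => (hKs hx).1) hKc
    · filter_upwards [h.ae] with x hx hxU _
      obtain ⟨a1, a2⟩ := hx hxU
      constructor
      · simp only [ContinuousLinearMap.smul_apply, Complex.smul_im, Complex.smul_re, ← smul_sub]
        rw [smul_eq_mul, abs_mul, abs_of_pos (by norm_num : (0:ℝ) < 1/3)]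
        linarith
      · rw [hs_eq, jac_eq] at *
        simp only [ContinuousLinearMap.smul_apply, Complex.smul_im, Complex.smul_re, smul_eq_mul]
        nlinarith
  have := hC _ _ _ hq (1/9) (by norm_num)
  have hKe : K ∩ {x | 3 * (1/9) ≤ ‖(1/3:ℝ) • (F x + 2)‖} = K := by
    apply Set.inter_eq_left.2
    intro x hx
    have := hn x (hKU hx)
    show 3 * (1/9) ≤ ‖(1/3:ℝ) • (F x + 2)‖
    linarith
  rw [hKe] at this
  have e1 : ∀ x, hs ((1/3:ℝ) • D x) = (1/9) * hs (D x) := by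
    intro x
    rw [hs_eq, hs_eq]
    simp only [ContinuousLinearMap.smul_apply, Complex.smul_im, Complex.smul_re, smul_eq_mul]
    ring
  simp only [e1] at this
  rw [integral_const_mul] at this
  have : C * (1 + (e/3)^2) ≤ C * (1 + e^2) := mul_le_mul_of_nonneg_left (by nlinarith [sq_nonneg e]) hC0
  linarith

def zf (l ρ t : ℝ) : ℝ := (t^2 + ρ^4)^(-l/2) * (1 - chi (32 * t))
def zd (l ρ t : ℝ) : ℝ := -(l * t * (t^2+ρ^4)^(-l/2-1) * (1 - chi (32*t))) - (t^2+ρ^4)^(-l/2) * (32 * deriv chi (32*t))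
def zp (l ρ t : ℝ) : ℝ := l * ρ^4 * (t^2+ρ^4)^(-l/2-1) * (1 - chi (32*t))
def zq (l ρ t : ℝ) : ℝ := - ((t^2+ρ^4)^(-l/2) * (32 * t * deriv chi (32*t)))

theorem zf_cd (l : ℝ) {ρ : ℝ} (hρ : 0 < ρ) : ContDiff ℝ 1 (zf l ρ) := by
  have h1 : ContDiff ℝ 1 (fun t : ℝ => (t^2 + ρ^4)^(-l/2)) := by
    apply ContDiff.rpow_const_of_ne
    · fun_prop
    · intro t; positivity
  have h2 : ContDiff ℝ 1 (fun t : ℝ => 1 - chi (32 * t)) := by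
    have := chi_cd.of_le (show (1 : WithTop ℕ∞) ≤ ((⊤:ℕ∞) : WithTop ℕ∞) by exact_mod_cast le_top)
    exact contDiff_const.sub (this.comp (contDiff_const.mul contDiff_id))
  exact h1.mul h2

theorem zf_deriv (l : ℝ) {ρ : ℝ} (hρ : 0 < ρ) (t : ℝ) : deriv (zf l ρ) t = zd l ρ t := by
  have hp : 0 < t^2+ρ^4 := by positivity
  have h0 : HasDerivAt (fun t : ℝ => t^2+ρ^4) (2*t) t := by
    simpa using (hasDerivAt_pow 2 t).add_const (ρ^4)
  have h1 : HasDerivAt (fun t : ℝ => (t^2 + ρ^4)^(-l/2)) _ t := h0.rpow_const (p := -l/2) (Or.inl hp.ne')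
  have h2 : HasDerivAt (fun t : ℝ => 1 - chi (32 * t)) (-(deriv chi (32*t) * 32)) t := by
    have a := (chi_cd.differentiable (by simp) (32*t)).hasDerivAt
    have b : HasDerivAt (fun t : ℝ => 32 * t) 32 t := by simpa using (hasDerivAt_id t).const_mul 32
    have := a.comp t b
    exact this.const_sub 1
  have h3 : deriv (zf l ρ) t = _ := (h1.mul h2).deriv
  rw [h3]
  unfold zd
  ring

theorem chi_deriv_zero {t : ℝ} (ht : t ≤ 1) : deriv chi t = 0 := by
  obtain ⟨c01, cz, co, cd, -⟩ := chi_props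
  apply IsLocalMin.deriv_eq_zero
  apply Filter.Eventually.of_forall
  intro y
  rw [cz t ht]; exact (c01 y).1

theorem z_props {l : ℝ} (hl0 : 0 < l) (hl1 : l < 1) : ∃ M, 0 ≤ M ∧ ∀ ρ > 0,
    (∀ t, 0 ≤ t → zd l ρ t ≤ 0) ∧ (∀ t, 1/16 ≤ t → zf l ρ t = 0) ∧ (∀ t, 0 ≤ zf l ρ t) ∧
    (∀ t, l * zf l ρ t + t * zd l ρ t = zp l ρ t + zq l ρ t) ∧ (∀ t, 0 ≤ zp l ρ t) ∧
    (∀ t, 0 ≤ t → |zq l ρ t| ≤ M) ∧ (ρ ≤ 1/8 → ∀ t, 0 ≤ t → t ≤ ρ^2 → l/4 * ρ^(-2*l) ≤ zp l ρ t) := by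
  obtain ⟨c01, cz, co, cd, M, hM0, hM⟩ := chi_props
  refine ⟨32 * M, by positivity, ?_⟩
  intro ρ hρ
  have hA : ∀ t : ℝ, 0 < t^2+ρ^4 := fun t => by positivity
  have hc1 : ∀ t, 0 ≤ 1 - chi (32*t) := fun t => by linarith [(c01 (32*t)).2]
  refine ⟨?_, ?_, ?_, ?_, ?_, ?_, ?_⟩
  · intro t ht
    unfold zd
    have a1 := hc1 t
    have a2 := cd (32*t)
    have a3 := (rpow_pos_of_pos (hA t) (-l/2)).le
    have a4 := (rpow_pos_of_pos (hA t) (-l/2-1)).le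
    have b1 : 0 ≤ l * t * (t^2+ρ^4)^(-l/2-1) * (1 - chi (32*t)) := by positivity
    have b2 : 0 ≤ (t^2+ρ^4)^(-l/2) * (32 * deriv chi (32*t)) := by positivity
    linarith
  · intro t ht
    unfold zf; rw [co _ (by linarith)]; simp
  · intro t
    exact mul_nonneg (rpow_pos_of_pos (hA t) _).le (hc1 t)
  · intro t
    have : (t^2+ρ^4)^(-l/2) = (t^2+ρ^4)^(-l/2-1) * (t^2+ρ^4) := by
      rw [rpow_sub_one (hA t).ne']; field_simp
    unfold zf zd zp zq
    rw [this]; ring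
  · intro t
    have a4 := (rpow_pos_of_pos (hA t) (-l/2-1)).le
    have a1 := hc1 t
    unfold zp; positivity
  · intro t ht
    unfold zq
    rw [abs_neg, abs_mul, abs_of_pos (rpow_pos_of_pos (hA t) _)]
    by_cases h : 32 * t ≤ 1
    · rw [chi_deriv_zero h]; simp; positivity
    · push Not at h
      have b1 : (t^2+ρ^4)^(-l/2) ≤ 32 := by
        have c1 : (1/1024 : ℝ) ≤ t^2+ρ^4 := by
          have : 0 < ρ^4 := by positivity
          nlinarith
        calc (t^2+ρ^4)^(-l/2) ≤ (1/1024:ℝ)^(-l/2) := rpow_le_rpow_of_nonpos (by norm_num) c1 (by linarith)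
          _ = (1024:ℝ)^(l/2) := by rw [one_div, inv_rpow (by norm_num), ← rpow_neg (by norm_num)]; congr 1; ring
          _ ≤ (1024:ℝ)^(1/2:ℝ) := rpow_le_rpow_of_exponent_le (by norm_num) (by linarith)
          _ = 32 := by rw [← sqrt_eq_rpow, show (1024:ℝ) = 32^2 by norm_num, sqrt_sq (by norm_num)]
      have b2 := hM (32*t)
      gcongr
  · intro hρ8 t ht htρ
    unfold zp
    rw [cz (32*t) (by nlinarith), sub_zero, mul_one]
    have c1 : t^2+ρ^4 ≤ 2*ρ^4 := by nlinarith
    have c2 : (2*ρ^4)^(-l/2-1) ≤ (t^2+ρ^4)^(-l/2-1) := rpow_le_rpow_of_nonpos (hA t) c1 (by linarith)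
    have c3 : (2*ρ^4)^(-l/2-1) = 2^(-l/2-1) * (ρ^(-2*l) * (ρ^4)⁻¹) := by
      rw [mul_rpow (by norm_num) (by positivity)]
      congr 1
      rw [rpow_sub_one (by positivity), div_eq_mul_inv]
      congr 1
      rw [← rpow_natCast, ← rpow_mul hρ.le]; congr 1; push_cast; ring
    have c4 : (1/4:ℝ) ≤ 2^(-l/2-1) := by
      calc (1/4:ℝ) = 2^(-2:ℝ) := by rw [rpow_neg (by norm_num)]; norm_num
        _ ≤ _ := rpow_le_rpow_of_exponent_le (by norm_num) (by linarith)
    have c5 : 0 < ρ^(-2*l) := rpow_pos_of_pos hρ _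
    calc l/4 * ρ^(-2*l) = l * ρ^4 * ((1/4) * (ρ^(-2*l) * (ρ^4)⁻¹)) := by field_simp
      _ ≤ l * ρ^4 * (2^(-l/2-1) * (ρ^(-2*l) * (ρ^4)⁻¹)) := by gcongr
      _ ≤ _ := by rw [← c3]; gcongr

/-- divergence theorem for radial functions -/
theorem radial_div (Z : ℝ → ℝ) (hZ : ContDiff ℝ 1 Z) {R : ℝ} (hR : 0 ≤ R) (hZ0 : ∀ t, R^2 ≤ t → Z t = 0) (c : ℂ) :
    ∫ x in closedBall c R, Z (‖x-c‖^2) = -∫ x in closedBall c R, ‖x-c‖^2 * deriv Z (‖x-c‖^2) := by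
  have hout : ∀ x ∉ closedBall c R, R^2 ≤ ‖x-c‖^2 := by
    intro x hx
    rw [mem_closedBall, not_le, dist_eq_norm] at hx
    gcongr
  set ζ : ℂ → ℝ := fun x => Z (‖x-c‖^2) with hζ
  have hζc : ContDiff ℝ 1 ζ := hZ.comp ((contDiff_norm_sq ℝ).comp (contDiff_id.sub contDiff_const))
  have hz : ∀ x ∉ closedBall c R, ζ x = 0 := fun x hx => hZ0 _ (hout x hx)
  have hcs : HasCompactSupport ζ := HasCompactSupport.intro (isCompact_closedBall c R) hz
  have hts : tsupport ζ ⊆ closedBall c R := by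
    apply closure_minimal _ isClosed_closedBall
    intro x hx
    by_contra h
    exact hx (hz x h)
  have hdζ : ∀ x v : ℂ, fderiv ℝ ζ x v = deriv Z (‖x-c‖^2) * (2 * ((x-c).re * v.re + (x-c).im * v.im)) := by
    intro x v
    have h0 : HasFDerivAt (fun x : ℂ => x - c) (ContinuousLinearMap.id ℝ ℂ) x := (hasFDerivAt_id x).sub_const c
    have h1 : HasFDerivAt (fun x : ℂ => ‖x‖^2) (2 • (innerSL ℝ (x-c))) (x-c) := (hasStrictFDerivAt_norm_sq (x-c)).hasFDerivAt
    have h2 := ((hZ.differentiable (by norm_num) (‖x-c‖^2)).hasDerivAt).comp_hasFDerivAt x (h1.comp x h0)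
    have h2' : fderiv ℝ ζ x = _ := h2.fderiv
    rw [h2']
    simp [Complex.inner]
    ring_nf
    tauto
  have h := ibp_jac (fun x => x - c) (contDiff_id.sub contDiff_const) ζ hζc hcs
  have hfd : ∀ x : ℂ, fderiv ℝ (fun x : ℂ => x - c) x = ContinuousLinearMap.id ℝ ℂ := fun x =>
    ((hasFDerivAt_id x).sub_const c).fderiv
  have hfd0 : ∀ x ∉ closedBall c R, fderiv ℝ ζ x = 0 := fun x hx =>
    image_eq_zero_of_notMem_tsupport (fun hh => hx (hts (tsupport_fderiv_subset ℝ hh)))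
  have e2 : ∀ x : ℂ, (1/2) * (conj (x-c) * (fderiv ℝ ζ x 1 * (I:ℂ) - fderiv ℝ ζ x I * (1:ℂ))).im = ‖x-c‖^2 * deriv Z (‖x-c‖^2) := by
    intro x
    rw [hdζ, hdζ]
    have hRe : ‖x-c‖^2 = (x-c).re^2 + (x-c).im^2 := by
      rw [← Complex.normSq_eq_norm_sq, Complex.normSq_apply]; ring
    generalize deriv Z (‖x-c‖^2) = b
    rw [hRe]
    generalize x - c = y
    simp only [Complex.mul_re, Complex.mul_im, Complex.I_re, Complex.I_im, Complex.sub_re, Complex.sub_im, Complex.ofReal_re, Complex.ofReal_im, Complex.conj_re, Complex.conj_im, Complex.one_re, Complex.one_im]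
    ring
  rw [setIntegral_eq_integral_of_forall_compl_eq_zero hz, setIntegral_eq_integral_of_forall_compl_eq_zero]
  · simp only [hfd, ContinuousLinearMap.id_apply, e2] at h
    rw [← h]
    simp [jac]
  · intro x hx
    rw [← e2, hfd0 x hx]; simp


theorem cont_mul_int {K : Set ℂ} (hK : IsCompact K) {g f : ℂ → ℝ} (hg : Continuous g) (hf : IntegrableOn f K) :
    IntegrableOn (fun x => g x * f x) K := hf.continuousOn_mul hg.continuousOn hK

theorem abs_jac_le (L : ℂ →L[ℝ] ℂ) : |jac L| ≤ hs L := by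
  rw [jac]
  refine (Complex.abs_im_le_norm _).trans ?_
  rw [norm_mul, Complex.norm_conj]
  unfold hs
  nlinarith [sq_nonneg (‖L 1‖ - ‖L I‖), sq_nonneg (‖L 1‖), sq_nonneg (‖L I‖)]

theorem qg_j {k e : ℝ} (hk : 1 < k) {L : ℂ →L[ℝ] ℂ} (h : qg k e L) : 0 ≤ -jac L + e^2 ∧ hs L ≤ (k + 1/k) * (-jac L + e^2) := by
  have h2 := h.2
  have h0 := hs_nonneg L
  have hκ : 1 ≤ k + 1/k := by
    have : 0 < 1/k := by have : 0 < k := by linarith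
                         positivity
    linarith
  have he : 0 ≤ e^2 := sq_nonneg e
  have h3 : hs L ≤ (k + 1/k) * (-jac L + e^2) := by nlinarith
  refine ⟨?_, h3⟩
  by_contra hh
  push Not at hh
  nlinarith

theorem decay {k : ℝ} (hk : 1 < k) {l : ℝ} (hlk : 1/k < l) (hl1 : l < 1) (hls : l ≤ sk k) (hd : 0 ≤ dk k)
    (hds : dk k ≤ sk k) (hc : (dk k)^2 ≤ (sk k - l) * (sk k + l/3)) :
    ∃ C, 0 ≤ C ∧ ∀ (e : ℝ) (F : ℂ → ℂ) (D : ℂ → ℂ →L[ℝ] ℂ), QH k e (ball 0 1) F D →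
      ∀ c ∈ closedBall (0:ℂ) (1/2), ∀ ρ, 0 < ρ → ρ ≤ 1/8 →
        ∫ x in closedBall c ρ, hs (D x) ≤ C * (1 + e^2) * ρ^(2*l) := by
  have hk0 : 0 < k := by linarith
  have hl0 : 0 < l := lt_trans (by positivity) hlk
  have h34 : closedBall (0:ℂ) (3/4) ⊆ ball 0 1 := closedBall_subset_ball (by norm_num)
  obtain ⟨Ce, hCe0, hCe⟩ := energy hk (isOpen_ball (x := (0:ℂ)) (ε := 1)) (isCompact_closedBall (0:ℂ) (3/4)) h34
  obtain ⟨C1, hC10, hC1⟩ := qg_frame hk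
  obtain ⟨M, hM0, hM⟩ := z_props hl0 hl1
  set V := volume.real (closedBall (0:ℂ) 1) with hV
  have hV0 : 0 ≤ V := measureReal_nonneg
  have h1l : 0 < 1 - l := by linarith
  set κ := k + 1/k with hκ
  have hκ0 : 0 < κ := by positivity
  refine ⟨κ * (4/l) * (C1 * (M * V / (1-l)) + M * Ce + M * V), by positivity, ?_⟩
  intro e F D h c hcm ρ hρ hρ8
  obtain ⟨z1, z2, z3, z4, z5, z6, z7⟩ := hM ρ hρ
  set Bc := closedBall c (1/4) with hBc
  have hBcc : IsCompact Bc := isCompact_closedBall c (1/4)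
  haveI := finK hBcc
  have hB34 : Bc ⊆ closedBall 0 (3/4) := by
    apply closedBall_subset_closedBall'
    rw [mem_closedBall] at hcm; linarith
  have hBU : Bc ⊆ ball 0 1 := hB34.trans h34
  have hZc := zf_cd l hρ
  have hZdc : Continuous (zd l ρ) := by
    have : deriv (zf l ρ) = zd l ρ := funext (zf_deriv l hρ)
    rw [← this]; exact hZc.continuous_deriv (by norm_num)
  have hR : ∀ t, (1/4:ℝ)^2 ≤ t → zf l ρ t = 0 := fun t ht => z2 t (by linarith)
  have hpl := plane_H1 h.h1 (zf l ρ) hZc (R := 1/4) (by norm_num) hR (fun t ht => by rw [zf_deriv l hρ]; exact z1 t ht) hl0.le hls hd hds hc hBU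
  have hrd := radial_div (zf l ρ) hZc (R := 1/4) (by norm_num) hR c
  have hDm := (h.h1 Bc hBU hBcc).1
  have ij : IntegrableOn (fun x => -jac (D x)) Bc := (jac_int hDm).neg
  have ih : IntegrableOn (fun x => hs (D x)) Bc := hs_int hDm
  set t : ℂ → ℝ := fun x => ‖x-c‖^2 with ht
  have htc : Continuous t := by rw [ht]; fun_prop
  have ht0 : ∀ x, 0 ≤ t x := fun x => sq_nonneg _
  have cf : Continuous (fun x => zf l ρ (t x)) := hZc.continuous.comp htc
  have cd : Continuous (fun x => t x * zd l ρ (t x)) := htc.mul (hZdc.comp htc)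
  have cA : Continuous (fun x : ℂ => (t x)^2 + ρ^4) := by fun_prop
  have cq : Continuous (fun x => zq l ρ (t x)) := by
    unfold zq
    refine ((cA.rpow_const (fun x => Or.inl (by positivity))).mul ((continuous_const.mul htc).mul ?_)).neg
    exact (chi_cd.continuous_deriv (by simp)).comp (continuous_const.mul htc)
  have cp : Continuous (fun x => zp l ρ (t x)) := by
    have : (fun x => zp l ρ (t x)) = fun x => l * zf l ρ (t x) + t x * zd l ρ (t x) - zq l ρ (t x) := by
      funext x; rw [z4]; ring
    rw [this]
    exact ((continuous_const.mul cf).add cd).sub cq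
  have iof : ∀ g : ℂ → ℝ, Continuous g → IntegrableOn g Bc := fun g hg => hg.continuousOn.integrableOn_compact hBcc
  have hVB : (volume.restrict Bc).real Set.univ ≤ V := by
    rw [measureReal_restrict_apply_univ]
    exact measureReal_mono (hB34.trans (closedBall_subset_closedBall (by norm_num))) (isCompact_closedBall _ _).measure_lt_top.ne
  -- integral of |zq| 
  have hQ : ∀ g : ℂ → ℝ, IntegrableOn g Bc → |∫ x in Bc, zq l ρ (t x) * g x| ≤ M * ∫ x in Bc, |g x| := by
    intro g hg
    rw [← Real.norm_eq_abs, ← integral_const_mul]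
    refine norm_integral_le_of_norm_le (hg.abs.const_mul M) (Filter.Eventually.of_forall fun x => ?_)
    rw [Real.norm_eq_abs, abs_mul]
    exact mul_le_mul_of_nonneg_right (z6 _ (ht0 x)) (abs_nonneg _)
  have hQ1 : |∫ x in Bc, zq l ρ (t x)| ≤ M * V := by
    have := hQ (fun _ => 1) (integrable_const _)
    simp only [mul_one, abs_one, integral_const, smul_eq_mul] at this
    exact this.trans (by gcongr)
  set Iz := ∫ x in Bc, zf l ρ (t x) with hIz
  have hIz0 : 0 ≤ Iz := integral_nonneg fun x => z3 _
  have hdI : ∫ x in Bc, t x * zd l ρ (t x) = - Iz := by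
    rw [hIz]
    have e1 : ∫ x in Bc, zf l ρ (t x) = -∫ x in Bc, t x * deriv (zf l ρ) (t x) := hrd
    rw [e1, neg_neg]
    simp only [zf_deriv l hρ]
  have hsum : (l - 1) * Iz = (∫ x in Bc, zp l ρ (t x)) + ∫ x in Bc, zq l ρ (t x) := by
    rw [← integral_add (iof _ cp) (iof _ cq)]
    have : (fun x => zp l ρ (t x) + zq l ρ (t x)) = fun x => l * zf l ρ (t x) + t x * zd l ρ (t x) := by
      funext x; rw [z4]
    rw [this, integral_add ((iof _ cf).const_mul l) (iof _ cd), integral_const_mul, hdI]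
    ring
  have hP0 : 0 ≤ ∫ x in Bc, zp l ρ (t x) := integral_nonneg fun x => z5 _
  have hq1 := (abs_le.1 hQ1).1
  have hIzle : Iz ≤ M * V / (1 - l) := by
    rw [le_div_iff₀ h1l]; nlinarith
  have hPle : ∫ x in Bc, zp l ρ (t x) ≤ M * V := by nlinarith
  -- main inequality
  have iPj := cont_mul_int hBcc cp ij
  have iQj := cont_mul_int hBcc cq ij
  have main : (∫ x in Bc, zp l ρ (t x) * (-jac (D x))) + (∫ x in Bc, zq l ρ (t x) * (-jac (D x))) ≤ C1 * e^2 * Iz := by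
    have hpf := pf_int (l := l) (hl0.le.trans hls) hd hZc c hDm
    have hle : ∫ x in Bc, pf (sk k) (dk k) l (zf l ρ) c x (D x) ≤
        ∫ x in Bc, (-(zp l ρ (t x) * (-jac (D x)) + zq l ρ (t x) * (-jac (D x))) + (-(C1 * e^2)) * (t x * zd l ρ (t x))) := by
      refine setIntegral_mono_ae_restrict hpf ((iPj.add iQj).neg.add ((iof _ cd).const_mul _)) ?_
      rw [Filter.EventuallyLE, ae_restrict_iff' hBcc.measurableSet]
      filter_upwards [h.ae] with x hx hxB
      have f := hC1 e (D x) (hx (hBU hxB)) (x-c)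
      have f2 := mul_le_mul_of_nonneg_left f (neg_nonneg.2 (z1 (t x) (ht0 x)))
      have f3 := z4 (t x)
      unfold pf
      rw [zf_deriv l hρ]
      have f4 : (zp l ρ (t x) + zq l ρ (t x)) * (-jac (D x)) = (l * zf l ρ (t x) + t x * zd l ρ (t x)) * (-jac (D x)) := by rw [f3]
      simp only [ht] at f2 f4 ⊢
      nlinarith
    have i1 : ∫ x in Bc, (-(zp l ρ (t x) * (-jac (D x)) + zq l ρ (t x) * (-jac (D x))) + (-(C1 * e^2)) * (t x * zd l ρ (t x)))
        = -((∫ x in Bc, zp l ρ (t x) * (-jac (D x))) + (∫ x in Bc, zq l ρ (t x) * (-jac (D x)))) + C1 * e^2 * Iz := by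
      have iN : IntegrableOn (fun x => -(zp l ρ (t x) * (-jac (D x)) + zq l ρ (t x) * (-jac (D x)))) Bc := (iPj.add iQj).neg
      have iM : IntegrableOn (fun x => (-(C1 * e^2)) * (t x * zd l ρ (t x))) Bc := (iof _ cd).const_mul _
      rw [integral_add iN iM, integral_const_mul, hdI]
      rw [show (∫ x in Bc, -(zp l ρ (t x) * (-jac (D x)) + zq l ρ (t x) * (-jac (D x)))) = -∫ x in Bc, (zp l ρ (t x) * (-jac (D x)) + zq l ρ (t x) * (-jac (D x))) from integral_neg _]
      rw [integral_add iPj iQj]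
      ring
    rw [i1] at hle
    linarith
  have hE : ∫ x in Bc, |(-jac (D x))| ≤ Ce * (1 + e^2) := by
    calc _ ≤ ∫ x in Bc, hs (D x) := by
          refine integral_mono ij.abs ih fun x => ?_
          beta_reduce
          rw [abs_neg]; exact abs_jac_le _
      _ ≤ ∫ x in closedBall (0:ℂ) (3/4), hs (D x) :=
          setIntegral_mono_set (hs_int (h.h1 _ h34 (isCompact_closedBall _ _)).1) (Filter.Eventually.of_forall fun x => hs_nonneg _) hB34.eventuallyLE
      _ ≤ _ := hCe e F D h
  have hQj := (abs_le.1 (hQ _ ij)).1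
  have hfin : ∫ x in Bc, zp l ρ (t x) * (-jac (D x) + e^2) ≤ (C1 * (M * V / (1-l)) + M * Ce + M * V) * (1 + e^2) := by
    have : ∫ x in Bc, zp l ρ (t x) * (-jac (D x) + e^2) = (∫ x in Bc, zp l ρ (t x) * (-jac (D x))) + e^2 * ∫ x in Bc, zp l ρ (t x) := by
      rw [← integral_const_mul, ← integral_add iPj ((iof _ cp).const_mul _)]
      congr 1; funext x; ring
    rw [this]
    have he2 := sq_nonneg e
    have g1 : C1 * e^2 * Iz ≤ C1 * (1 + e^2) * (M * V / (1-l)) := by gcongr; linarith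
    have g2 : e^2 * ∫ x in Bc, zp l ρ (t x) ≤ (1 + e^2) * (M * V) := by gcongr; linarith
    have g3 := mul_le_mul_of_nonneg_left hE hM0
    linarith
  have hsub : closedBall c ρ ⊆ Bc := closedBall_subset_closedBall (by linarith)
  have hρp : 0 < ρ^(2*l) := rpow_pos_of_pos hρ _
  have hPj : IntegrableOn (fun x => zp l ρ (t x) * (-jac (D x) + e^2)) Bc := cont_mul_int hBcc cp (ij.add (integrable_const _))
  have fin2 : ∫ x in closedBall c ρ, hs (D x) ≤ ∫ x in closedBall c ρ, κ * (4/l) * ρ^(2*l) * (zp l ρ (t x) * (-jac (D x) + e^2)) := by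
    refine setIntegral_mono_ae_restrict (ih.mono_set hsub) ((hPj.mono_set hsub).const_mul _) ?_
    rw [Filter.EventuallyLE, ae_restrict_iff' isClosed_closedBall.measurableSet]
    filter_upwards [h.ae] with x hx hxB
    obtain ⟨j1, j2⟩ := qg_j hk (hx (hBU (hsub hxB)))
    have htx : t x ≤ ρ^2 := by
      rw [mem_closedBall, dist_eq_norm] at hxB
      simp only [ht]; gcongr
    have p1 := z7 hρ8 (t x) (ht0 x) htx
    have p2 : 1 ≤ (4/l) * ρ^(2*l) * zp l ρ (t x) := by
      have : (4/l) * ρ^(2*l) * (l/4 * ρ^(-2*l)) = 1 := by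
        have : ρ^(2*l) * ρ^(-2*l) = 1 := by rw [← rpow_add hρ]; simp
        calc _ = (4/l * (l/4)) * (ρ^(2*l) * ρ^(-2*l)) := by ring
          _ = 1 := by rw [this, mul_one]; field_simp
      rw [← this]
      exact mul_le_mul_of_nonneg_left p1 (by positivity)
    calc hs (D x) ≤ κ * (-jac (D x) + e^2) := j2
      _ = κ * (1 * (-jac (D x) + e^2)) := by ring
      _ ≤ κ * ((4/l) * ρ^(2*l) * zp l ρ (t x) * (-jac (D x) + e^2)) := by gcongr
      _ = _ := by ring
  rw [integral_const_mul] at fin2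
  have fin3 : ∫ x in closedBall c ρ, zp l ρ (t x) * (-jac (D x) + e^2) ≤ ∫ x in Bc, zp l ρ (t x) * (-jac (D x) + e^2) := by
    refine setIntegral_mono_set hPj ?_ hsub.eventuallyLE
    rw [Filter.EventuallyLE, ae_restrict_iff' hBcc.measurableSet]
    filter_upwards [h.ae] with x hx hxB
    exact mul_nonneg (z5 _) (qg_j hk (hx (hBU hxB))).1
  calc _ ≤ _ := fin2
    _ ≤ κ * (4/l) * ρ^(2*l) * ((C1 * (M * V / (1-l)) + M * Ce + M * V) * (1 + e^2)) :=
        mul_le_mul_of_nonneg_left (fin3.trans hfin) (by positivity)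
    _ = _ := by ring


theorem int_affine {E : Type*} [NormedAddCommGroup E] [NormedSpace ℝ E] (f : ℂ → E) (a : ℂ) {s : ℝ} (hs : 0 < s) :
    ∫ z, f (a + s • z) = (s^2)⁻¹ • ∫ z, f z := by
  have h1 := Measure.integral_comp_smul (volume : Measure ℂ) (fun z => f (a + z)) s
  rw [h1, Complex.finrank_real_complex, abs_of_pos (by positivity)]
  congr 1
  exact integral_add_left_eq_self (μ := (volume : Measure ℂ)) f a

theorem ball_subst {E : Type*} [NormedAddCommGroup E] [NormedSpace ℝ E] (f : ℂ → E) (a : ℂ) {s : ℝ} (hs : 0 < s) :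
    ∫ z in closedBall (0:ℂ) 1, f (a + s • z) = (s^2)⁻¹ • ∫ z in closedBall a s, f z := by
  rw [← integral_indicator isClosed_closedBall.measurableSet, ← integral_indicator isClosed_closedBall.measurableSet,
    ← int_affine _ a hs]
  congr 1; funext z
  have : (a + s • z ∈ closedBall a s) ↔ z ∈ closedBall (0:ℂ) 1 := by
    rw [mem_closedBall, mem_closedBall, dist_eq_norm, dist_eq_norm, add_sub_cancel_left, norm_smul, Real.norm_eq_abs, abs_of_pos hs, sub_zero]
    constructor
    · intro h; by_contra hh; push Not at hh; nlinarith
    · intro h; nlinarith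
  by_cases hz : z ∈ closedBall (0:ℂ) 1
  · rw [Set.indicator_of_mem hz, Set.indicator_of_mem (this.2 hz)]
  · rw [Set.indicator_of_notMem hz, Set.indicator_of_notMem (fun h => hz (this.1 h))]

theorem morrey_smooth {G : ℂ → ℂ} (hG : ContDiff ℝ (⊤ : ℕ∞) G) {c a a' : ℂ} {ρ s s' θ : ℝ} (hρ : 0 < ρ) (hθ : 0 < θ)
    (h1 : ‖a - c‖ + s ≤ ρ) (h2 : ‖a' - c‖ + s' ≤ ρ) (h3 : ρ/4 ≤ s) (h4 : ρ/4 ≤ s') :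
    ‖(∫ z in closedBall (0:ℂ) 1, G (a' + s' • z)) - ∫ z in closedBall (0:ℂ) 1, G (a + s • z)‖ ≤
      3 * ρ * (16 / (θ * ρ^2) * (∫ x in closedBall c ρ, ‖fderiv ℝ G x‖^2) + θ * volume.real (closedBall (0:ℂ) 1)) := by
  set V := volume.real (closedBall (0:ℂ) 1) with hV
  have hKc : IsCompact (closedBall (0:ℂ) 1) := isCompact_closedBall _ _
  haveI := finK hKc
  set P : ℝ → ℂ → ℂ := fun t z => (a + t • (a' - a)) + (s + t * (s' - s)) • z with hP
  set Q : ℂ → ℂ := fun z => (a' - a) + (s' - s) • z with hQ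
  have hPc : Continuous (fun q : ℝ × ℂ => P q.1 q.2) := by simp only [hP]; fun_prop
  have hDc : Continuous (fderiv ℝ G) := hG.continuous_fderiv (by simp)
  have hGc := hG.continuous
  have hG1 : Differentiable ℝ G := hG.differentiable (by simp)
  have hQc : Continuous Q := by simp only [hQ]; fun_prop
  have hPt : ∀ t, Continuous (P t) := fun t => by simp only [hP]; fun_prop
  have hF'c : Continuous (fun q : ℝ × ℂ => fderiv ℝ G (P q.1 q.2) (Q q.2)) :=
    (hDc.comp hPc).clm_apply (hQc.comp continuous_snd)
  have hder : ∀ t₀ : ℝ, HasDerivAt (fun t => ∫ z in closedBall (0:ℂ) 1, G (P t z))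
      (∫ z in closedBall (0:ℂ) 1, fderiv ℝ G (P t₀ z) (Q z)) t₀ := by
    intro t₀
    obtain ⟨M, hM⟩ := ((isCompact_closedBall t₀ 1).prod hKc).exists_bound_of_continuousOn hF'c.continuousOn
    refine (hasDerivAt_integral_of_dominated_loc_of_deriv_le (bound := fun _ => M) (closedBall_mem_nhds t₀ one_pos)
      (Filter.Eventually.of_forall fun t => ?_) ?_ (F' := fun t z => fderiv ℝ G (P t z) (Q z)) ?_ ?_ (integrable_const _) ?_).2
    · exact (hGc.comp (hPt t)).aestronglyMeasurable
    · exact (hGc.comp (hPt t₀)).continuousOn.integrableOn_compact hKc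
    · exact ((hDc.comp (hPt t₀)).clm_apply hQc).aestronglyMeasurable
    · filter_upwards [ae_restrict_mem hKc.measurableSet] with z hz t ht
      exact hM (t, z) ⟨ht, hz⟩
    · refine Filter.Eventually.of_forall fun z t _ => ?_
      have hp : HasDerivAt (fun t => P t z) (Q z) t := by
        simp only [hP, hQ]
        have e1 : HasDerivAt (fun t : ℝ => a + t • (a' - a)) (a' - a) t := by
          simpa using ((hasDerivAt_id t).smul_const (a' - a)).const_add a
        have e2 : HasDerivAt (fun t : ℝ => (s + t * (s' - s)) • z) ((s' - s) • z) t := by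
          have : HasDerivAt (fun t : ℝ => s + t * (s' - s)) (s' - s) t := by
            simpa using ((hasDerivAt_id t).mul_const (s' - s)).const_add s
          exact this.smul_const z
        exact e1.add e2
      exact (hG1 (P t z)).hasFDerivAt.comp_hasDerivAt t hp
  have hna : ‖a - c‖ ≤ ρ := by linarith
  have hna' : ‖a' - c‖ ≤ ρ := by linarith
  have ha := norm_nonneg (a - c)
  have ha' := norm_nonneg (a' - c)
  have hQb : ∀ z ∈ closedBall (0:ℂ) 1, ‖Q z‖ ≤ 3 * ρ := by
    intro z hz
    have hz1 : ‖z‖ ≤ 1 := by simpa using hz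
    have : ‖a' - a‖ ≤ 2 * ρ := by
      calc ‖a' - a‖ = ‖(a' - c) - (a - c)‖ := by congr 1; ring
        _ ≤ ‖a' - c‖ + ‖a - c‖ := norm_sub_le _ _
        _ ≤ _ := by linarith
    have h5 : |s' - s| ≤ ρ := by rw [abs_le]; constructor <;> linarith
    calc ‖Q z‖ ≤ ‖a' - a‖ + ‖(s' - s) • z‖ := norm_add_le _ _
      _ ≤ 2 * ρ + ρ * 1 := by
          rw [norm_smul, Real.norm_eq_abs]
          exact add_le_add this (mul_le_mul h5 hz1 (norm_nonneg _) hρ.le)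
      _ = _ := by ring
  have hE0 : 0 ≤ ∫ x in closedBall c ρ, ‖fderiv ℝ G x‖^2 := integral_nonneg fun x => by positivity
  have key := norm_image_sub_le_of_norm_deriv_le_segment_01' (f := fun t => ∫ z in closedBall (0:ℂ) 1, G (P t z))
    (f' := fun t => ∫ z in closedBall (0:ℂ) 1, fderiv ℝ G (P t z) (Q z))
    (C := 3 * ρ * (16 / (θ * ρ^2) * (∫ x in closedBall c ρ, ‖fderiv ℝ G x‖^2) + θ * V))
    (fun t _ => (hder t).hasDerivWithinAt) ?_
  · simpa [hP] using key
  · rintro t ⟨ht0, ht1⟩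
    set at' := a + t • (a' - a) with hat
    set st := s + t * (s' - s) with hst
    have hst1 : ρ/4 ≤ st := by simp only [hst]; nlinarith
    have hst0 : 0 < st := by linarith
    have hsub : closedBall at' st ⊆ closedBall c ρ := by
      apply closedBall_subset_closedBall'
      rw [dist_eq_norm]
      have : ‖at' - c‖ ≤ (1-t) * ‖a - c‖ + t * ‖a' - c‖ := by
        calc ‖at' - c‖ = ‖(1-t) • (a - c) + t • (a' - c)‖ := by
              congr 1; simp only [hat, Complex.real_smul]; push_cast; ring
          _ ≤ _ := by
              refine (norm_add_le _ _).trans ?_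
              rw [norm_smul, norm_smul, Real.norm_eq_abs, Real.norm_eq_abs, abs_of_nonneg ht0, abs_of_nonneg (by linarith)]
      simp only [hst]; nlinarith
    have hintg : IntegrableOn (fun z => 3 * ρ * (θ⁻¹ * ‖fderiv ℝ G (P t z)‖^2 + θ)) (closedBall (0:ℂ) 1) := by
      refine ContinuousOn.integrableOn_compact (isCompact_closedBall _ _) (Continuous.continuousOn ?_)
      have := hDc.comp (hPt t)
      simp only [Function.comp_def] at this
      fun_prop
    have hintg2 : IntegrableOn (fun z => ‖fderiv ℝ G (P t z)‖^2) (closedBall (0:ℂ) 1) := by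
      refine ContinuousOn.integrableOn_compact (isCompact_closedBall _ _) (Continuous.continuousOn ?_)
      have := hDc.comp (hPt t)
      simp only [Function.comp_def] at this
      fun_prop
    refine (norm_integral_le_of_norm_le hintg ?_).trans ?_
    · filter_upwards [ae_restrict_mem hKc.measurableSet] with z hz
      refine (ContinuousLinearMap.le_opNorm _ _).trans ?_
      set n := ‖fderiv ℝ G (P t z)‖
      have hn : 0 ≤ n := norm_nonneg _
      have : n ≤ θ⁻¹ * n^2 + θ := by
        have : θ⁻¹ * n^2 + θ - n = θ⁻¹ * ((n - θ/2)^2 + 3/4 * θ^2) := by field_simp; ring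
        have : 0 ≤ θ⁻¹ * ((n - θ/2)^2 + 3/4 * θ^2) := by positivity
        linarith
      calc n * ‖Q z‖ ≤ n * (3 * ρ) := mul_le_mul_of_nonneg_left (hQb z hz) hn
        _ ≤ (θ⁻¹ * n^2 + θ) * (3 * ρ) := mul_le_mul_of_nonneg_right this (by positivity)
        _ = _ := by ring
    · rw [integral_const_mul, integral_add (hintg2.const_mul _) (integrable_const _), integral_const_mul]
      have hb := ball_subst (fun x => ‖fderiv ℝ G x‖^2) at' hst0
      have hb' : ∫ z in closedBall (0:ℂ) 1, ‖fderiv ℝ G (P t z)‖^2 = (st^2)⁻¹ * ∫ x in closedBall at' st, ‖fderiv ℝ G x‖^2 := hb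
      rw [hb']
      have hm : ∫ x in closedBall at' st, ‖fderiv ℝ G x‖^2 ≤ ∫ x in closedBall c ρ, ‖fderiv ℝ G x‖^2 := by
        refine setIntegral_mono_set ?_ (Filter.Eventually.of_forall fun x => by positivity) hsub.eventuallyLE
        refine ContinuousOn.integrableOn_compact (isCompact_closedBall _ _) (Continuous.continuousOn ?_)
        fun_prop
      have hi : (st^2)⁻¹ ≤ 16/ρ^2 := by
        rw [inv_le_comm₀ (by positivity) (by positivity)]
        have : (16/ρ^2)⁻¹ = (ρ/4)^2 := by field_simp; norm_num
        rw [this]; gcongr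
      have hm2 : (st^2)⁻¹ * ∫ x in closedBall at' st, ‖fderiv ℝ G x‖^2 ≤ 16/ρ^2 * ∫ x in closedBall c ρ, ‖fderiv ℝ G x‖^2 :=
        mul_le_mul hi hm (integral_nonneg fun x => by positivity) (by positivity)
      apply mul_le_mul_of_nonneg_left _ (by positivity)
      have e1 : ∫ z in closedBall (0:ℂ) 1, θ = θ * V := by
        rw [integral_const, measureReal_restrict_apply_univ, smul_eq_mul, mul_comm]
      rw [e1]
      have := mul_le_mul_of_nonneg_left hm2 (inv_nonneg.2 hθ.le)
      have e2 : θ⁻¹ * (16/ρ^2 * ∫ x in closedBall c ρ, ‖fderiv ℝ G x‖^2) = 16 / (θ * ρ^2) * (∫ x in closedBall c ρ, ‖fderiv ℝ G x‖^2) := by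
        field_simp
      linarith

theorem affine_mem {c a z : ℂ} {ρ s : ℝ} (hs : 0 ≤ s) (h1 : ‖a - c‖ + s ≤ ρ) (hz : z ∈ closedBall (0:ℂ) 1) :
    a + s • z ∈ closedBall c ρ := by
  have hz1 : ‖z‖ ≤ 1 := by simpa using hz
  rw [mem_closedBall, dist_eq_norm]
  calc ‖a + s • z - c‖ = ‖(a - c) + s • z‖ := by congr 1; ring
    _ ≤ ‖a - c‖ + s * ‖z‖ := by
        refine (norm_add_le _ _).trans ?_
        rw [norm_smul, Real.norm_eq_abs, abs_of_nonneg hs]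
    _ ≤ _ := by nlinarith

theorem mean_cont {F : ℂ → ℂ} {c a : ℂ} {ρ s : ℝ} (hF : ContinuousOn F (closedBall c ρ)) (hs : 0 ≤ s) (h1 : ‖a - c‖ + s ≤ ρ) :
    ContinuousOn (fun z : ℂ => F (a + s • z)) (closedBall 0 1) :=
  hF.comp (by fun_prop) (fun _ hz => affine_mem hs h1 hz)

theorem morrey_H {U : Set ℂ} {F : ℂ → ℂ} {D : ℂ → ℂ →L[ℝ] ℂ} (h : H1loc U F D) (hF : ContinuousOn F U)
    {c a a' : ℂ} {ρ s s' θ : ℝ} (hρ : 0 < ρ) (hθ : 0 < θ) (hU : closedBall c ρ ⊆ U)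
    (h1 : ‖a - c‖ + s ≤ ρ) (h2 : ‖a' - c‖ + s' ≤ ρ) (h3 : ρ/4 ≤ s) (h4 : ρ/4 ≤ s') :
    ‖(∫ z in closedBall (0:ℂ) 1, F (a' + s' • z)) - ∫ z in closedBall (0:ℂ) 1, F (a + s • z)‖ ≤
      3 * ρ * (16 / (θ * ρ^2) * (2 * ∫ x in closedBall c ρ, ‖D x‖^2) + θ * volume.real (closedBall (0:ℂ) 1)) := by
  have hKc : IsCompact (closedBall (0:ℂ) 1) := isCompact_closedBall _ _
  have hKρ : IsCompact (closedBall c ρ) := isCompact_closedBall _ _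
  set V := volume.real (closedBall (0:ℂ) 1) with hV
  obtain ⟨hD, hap⟩ := h _ hU hKρ
  set E := ∫ x in closedBall c ρ, ‖D x‖^2 with hE
  have hclose : ∀ (G : ℂ → ℂ) (ε : ℝ), ContDiff ℝ (⊤ : ℕ∞) G → (∀ x ∈ closedBall c ρ, ‖G x - F x‖ ≤ ε) → ∀ (b : ℂ) (r : ℝ), 0 ≤ r → ‖b - c‖ + r ≤ ρ →
      ‖(∫ z in closedBall (0:ℂ) 1, F (b + r • z)) - ∫ z in closedBall (0:ℂ) 1, G (b + r • z)‖ ≤ ε * V := by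
    intro G ε hG hGF b r hr hb
    have i1 : IntegrableOn (fun z : ℂ => F (b + r • z)) (closedBall 0 1) :=
      (mean_cont (hF.mono hU) hr hb).integrableOn_compact hKc
    have i2 : IntegrableOn (fun z : ℂ => G (b + r • z)) (closedBall 0 1) :=
      (mean_cont hG.continuous.continuousOn hr hb).integrableOn_compact hKc
    rw [← integral_sub i1 i2]
    refine (norm_setIntegral_le_of_norm_le_const hKc.measure_lt_top ?_)
    intro z hz
    rw [norm_sub_rev]
    exact hGF _ (affine_mem hr hb hz)
  refine le_of_forall_pos_le_add fun ε hε => ?_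
  have hV0 : 0 ≤ V := measureReal_nonneg
  set κ := 2 * V + 3 * ρ * (16 / (θ * ρ^2) * 2) with hκ
  have hκ0 : 0 < κ := by positivity
  obtain ⟨G, hG, hGF, hGD⟩ := hap (ε/κ) (by positivity)
  have m := morrey_smooth hG hρ hθ h1 h2 h3 h4
  have c1 := hclose G _ hG hGF a s (by linarith) h1
  have c2 := hclose G _ hG hGF a' s' (by linarith) h2
  have hfd := fd_memLp hG hKρ
  have hEG : ∫ x in closedBall c ρ, ‖fderiv ℝ G x‖^2 ≤ 2 * E + 2 * (ε/κ) := by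
    have hsubm : MemLp (fun x => fderiv ℝ G x - D x) 2 (volume.restrict (closedBall c ρ)) := hfd.sub hD
    calc ∫ x in closedBall c ρ, ‖fderiv ℝ G x‖^2 ≤ ∫ x in closedBall c ρ, (2 * ‖D x‖^2 + 2 * ‖fderiv ℝ G x - D x‖^2) := by
          refine integral_mono (MemLp2.int hfd) (((MemLp2.int hD).const_mul 2).add ((MemLp2.int hsubm).const_mul 2)) fun x => ?_
          beta_reduce
          have : ‖fderiv ℝ G x‖ ≤ ‖D x‖ + ‖fderiv ℝ G x - D x‖ := by
            calc _ = ‖D x + (fderiv ℝ G x - D x)‖ := by congr 1; abel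
              _ ≤ _ := norm_add_le _ _
          have h0 := norm_nonneg (fderiv ℝ G x)
          nlinarith [sq_nonneg (‖D x‖ - ‖fderiv ℝ G x - D x‖)]
      _ = 2 * E + 2 * ∫ x in closedBall c ρ, ‖fderiv ℝ G x - D x‖^2 := by
          rw [integral_add ((MemLp2.int hD).const_mul 2) ((MemLp2.int hsubm).const_mul 2), integral_const_mul, integral_const_mul]
      _ ≤ _ := by linarith
  have m2 : 3 * ρ * (16 / (θ * ρ^2) * (∫ x in closedBall c ρ, ‖fderiv ℝ G x‖^2) + θ * V) ≤
      3 * ρ * (16 / (θ * ρ^2) * (2 * E + 2 * (ε/κ)) + θ * V) := by gcongr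
  have e0 : (2 * V + 3 * ρ * (16 / (θ * ρ^2) * 2)) * (ε/κ) = ε := by
    rw [← hκ]; field_simp
  have tri : ∀ A B C D : ℂ, ‖A - B‖ ≤ ‖A - C‖ + ‖C - D‖ + ‖B - D‖ := fun A B C D => by
    calc ‖A - B‖ = ‖(A - C) + (C - D) - (B - D)‖ := by congr 1; ring
      _ ≤ _ := (norm_sub_le _ _).trans (by gcongr; exact norm_add_le _ _)
  refine (tri _ _ _ _).trans ((add_le_add (add_le_add c2 (m.trans m2)) c1).trans (le_of_eq ?_))
  linear_combination e0

theorem hs_norm_int {K : Set ℂ} {D : ℂ → ℂ →L[ℝ] ℂ} (hD : MemLp D 2 (volume.restrict K)) :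
    ∫ x in K, ‖D x‖^2 ≤ 2 * ∫ x in K, hs (D x) := by
  rw [← integral_const_mul]
  exact integral_mono (MemLp2.int hD) ((hs_int hD).const_mul 2) fun x => norm_le_hs _

/-- Hölder continuity from decay of the energy -/
theorem holder {l : ℝ} (hl : 0 < l) : ∃ C, 0 ≤ C ∧ ∀ (N : ℝ) (F : ℂ → ℂ) (D : ℂ → ℂ →L[ℝ] ℂ), 0 < N →
    H1loc (ball 0 1) F D → ContinuousOn F (ball 0 1) →
    (∀ c ∈ closedBall (0:ℂ) (1/2), ∀ ρ, 0 < ρ → ρ ≤ 1/8 → ∫ x in closedBall c ρ, hs (D x) ≤ N^2 * ρ^(2*l)) →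
    ∀ x ∈ closedBall (0:ℂ) (1/32), ∀ y ∈ closedBall (0:ℂ) (1/32), ‖F x - F y‖ ≤ C * N * ‖x - y‖^l := by
  set V := volume.real (closedBall (0:ℂ) 1) with hV
  have hV0 : 0 < V := by
    rw [hV]
    exact ENNReal.toReal_pos (measure_closedBall_pos _ _ one_pos).ne' (isCompact_closedBall _ _).measure_lt_top.ne
  set C1 := 3 * (64 + V) with hC1
  set q := (1/2:ℝ)^l with hq
  have hq0 : 0 < q := by positivity
  have hq1 : q < 1 := rpow_lt_one (by norm_num) (by norm_num) hl
  have hq2 : 0 < 1 - q := by linarith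
  refine ⟨V⁻¹ * (2 * (C1/(1-q)) + C1 * 2^l), by positivity, ?_⟩
  intro N F D hN h1 hF hdec
  have step : ∀ c ∈ closedBall (0:ℂ) (1/2), ∀ ρ, 0 < ρ → ρ ≤ 1/8 → ∀ a a' s s', ‖a - c‖ + s ≤ ρ → ‖a' - c‖ + s' ≤ ρ → ρ/4 ≤ s → ρ/4 ≤ s' →
      ‖(∫ z in closedBall (0:ℂ) 1, F (a' + s' • z)) - ∫ z in closedBall (0:ℂ) 1, F (a + s • z)‖ ≤ C1 * N * ρ^l := by
    intro c hc ρ hρ hρ8 a a' s s' g1 g2 g3 g4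
    have hU : closedBall c ρ ⊆ ball (0:ℂ) 1 := by
      apply closedBall_subset_ball'
      rw [mem_closedBall] at hc; linarith
    have hpl : 0 < ρ^l := rpow_pos_of_pos hρ _
    have m := morrey_H h1 hF hρ (θ := N * ρ^l / ρ) (by positivity) hU g1 g2 g3 g4
    refine m.trans ?_
    have hE := hs_norm_int (h1 _ hU (isCompact_closedBall _ _)).1
    have hd := hdec c hc ρ hρ hρ8
    have e2 : ρ^(2*l) = (ρ^l)^2 := by rw [mul_comm, rpow_mul hρ.le]; norm_cast
    have hE2 : 2 * ∫ x in closedBall c ρ, ‖D x‖^2 ≤ 4 * (N^2 * (ρ^l)^2) := by rw [← e2]; linarith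
    calc _ ≤ 3 * ρ * (16 / (N * ρ^l / ρ * ρ^2) * (4 * (N^2 * (ρ^l)^2)) + N * ρ^l / ρ * V) := by gcongr
      _ = C1 * N * ρ^l := by rw [hC1]; field_simp; ring
  have near : ∀ x ∈ closedBall (0:ℂ) (1/32), ∀ r, 0 < r → r ≤ 1/16 →
      ‖(∫ z in closedBall (0:ℂ) 1, F (x + r • z)) - V • F x‖ ≤ C1/(1-q) * N * r^l := by
    intro x hx r hr hr16
    have hxm : x ∈ closedBall (0:ℂ) (1/2) := closedBall_subset_closedBall (by norm_num) hx
    have hrn : ∀ n : ℕ, 0 < r * (1/2)^n ∧ r * (1/2)^n ≤ r := fun n =>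
      ⟨by positivity, mul_le_of_le_one_right hr.le (pow_le_one₀ (by norm_num) (by norm_num))⟩
    have hlim : Filter.Tendsto (fun n : ℕ => ∫ z in closedBall (0:ℂ) 1, F (x + (r * (1/2)^n) • z)) Filter.atTop (nhds (V • F x)) := by
      have hc : ContinuousAt F x := hF.continuousAt (isOpen_ball.mem_nhds (closedBall_subset_ball (by norm_num) hx))
      have hKc : IsCompact (closedBall (0:ℂ) 1) := isCompact_closedBall _ _
      haveI := finK hKc
      have e1 : V • F x = ∫ z in closedBall (0:ℂ) 1, F x := by
        rw [integral_const, measureReal_restrict_apply_univ]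
      rw [e1]
      have hsubU : closedBall x r ⊆ ball 0 1 := by
        apply closedBall_subset_ball'
        rw [mem_closedBall] at hx; linarith
      obtain ⟨M, hM⟩ := (isCompact_closedBall x r).exists_bound_of_continuousOn (hF.mono hsubU)
      refine tendsto_integral_of_dominated_convergence (fun _ => M) ?_ (integrable_const _) ?_ ?_
      · intro n
        exact (mean_cont (c := x) (ρ := r) (hF.mono hsubU) (hrn n).1.le (by simpa using (hrn n).2)).aestronglyMeasurable hKc.measurableSet
      · intro n
        filter_upwards [ae_restrict_mem hKc.measurableSet] with z hz
        exact hM _ (affine_mem (hrn n).1.le (by simpa using (hrn n).2) hz)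
      · refine Filter.Eventually.of_forall fun z => ?_
        refine hc.tendsto.comp ?_
        have : Filter.Tendsto (fun n : ℕ => r * (1/2:ℝ)^n) Filter.atTop (nhds 0) := by
          simpa using (tendsto_pow_atTop_nhds_zero_of_lt_one (by norm_num : (0:ℝ) ≤ 1/2) (by norm_num)).const_mul r
        simpa using (this.smul_const z).const_add x
    have hg := dist_le_of_le_geometric_of_tendsto₀ q (C1 * N * r^l) hq1 (f := fun n : ℕ => ∫ z in closedBall (0:ℂ) 1, F (x + (r * (1/2)^n) • z)) ?_ hlim
    · rw [dist_eq_norm] at hg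
      simp only [pow_zero, mul_one] at hg
      refine hg.trans (le_of_eq ?_)
      ring
    · intro n
      have := step x hxm (r * (1/2)^n) (hrn n).1 ((hrn n).2.trans (by linarith)) x x (r * (1/2)^(n+1)) (r * (1/2)^n)
        (by simp; gcongr <;> norm_num) (by simp)
        (by rw [pow_succ]; linarith [(hrn n).1]) (by linarith [(hrn n).1])
      rw [dist_eq_norm]
      refine this.trans (le_of_eq ?_)
      rw [mul_rpow hr.le (by positivity), hq, ← rpow_natCast, ← rpow_natCast, ← rpow_mul (by norm_num), ← rpow_mul (by norm_num), mul_comm (n:ℝ) l]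
      ring
  intro x hx y hy
  rcases eq_or_ne x y with rfl | hxy
  · simp [hl.ne']
  set r := ‖x - y‖ with hr
  have hr0 : 0 < r := norm_pos_iff.2 (sub_ne_zero.2 hxy)
  have hr16 : r ≤ 1/16 := by
    have e1 : ‖x‖ ≤ 1/32 := by simpa using hx
    have e2 : ‖y‖ ≤ 1/32 := by simpa using hy
    have := norm_sub_le x y
    rw [hr]; linarith
  have n1 := near x hx r hr0 hr16
  have n2 := near y hy r hr0 hr16
  have hxm : x ∈ closedBall (0:ℂ) (1/2) := closedBall_subset_closedBall (by norm_num) hx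
  have n3 := step x hxm (2*r) (by linarith) (by linarith) y x r r (by rw [norm_sub_rev y x]; linarith) (by simp; linarith) (by linarith) (by linarith)
  have tri : ∀ A B C D : ℂ, ‖A - B‖ ≤ ‖C - A‖ + ‖C - D‖ + ‖D - B‖ := fun A B C D => by
    calc ‖A - B‖ = ‖-(C - A) + (C - D) + (D - B)‖ := by congr 1; ring
      _ ≤ _ := by
        refine (norm_add_le _ _).trans ?_
        gcongr
        refine (norm_add_le _ _).trans ?_
        rw [norm_neg]
  have tot := (tri (V • F x) (V • F y) _ _).trans (add_le_add (add_le_add n1 n3) n2)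
  rw [← smul_sub, norm_smul, Real.norm_eq_abs, abs_of_pos hV0, mul_rpow (by norm_num) hr0.le] at tot
  calc ‖F x - F y‖ = V⁻¹ * (V * ‖F x - F y‖) := by field_simp
    _ ≤ V⁻¹ * _ := mul_le_mul_of_nonneg_left tot (by positivity)
    _ = _ := by ring

/-- Proposition C -/
theorem propC {k : ℝ} (hk : 1 < k) : ∃ l C, 1/k < l ∧ l < 1 ∧ 0 ≤ C ∧ ∀ (e : ℝ) (F : ℂ → ℂ) (D : ℂ → ℂ →L[ℝ] ℂ), 0 ≤ e →
    QG k e (ball 0 1) F D →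
    ∀ x ∈ closedBall (0:ℂ) (1/32), ∀ y ∈ closedBall (0:ℂ) (1/32), ‖F x - F y‖ ≤ C * (1 + e) * ‖x - y‖^l := by
  obtain ⟨l, hlk, hl1, hls, hd, hds, hc⟩ := exp_exists hk
  have hk0 : 0 < k := by linarith
  have hl0 : 0 < l := lt_trans (by positivity) hlk
  obtain ⟨C1, hC1, hdec⟩ := decay hk hlk hl1 hls hd hds hc
  obtain ⟨C2, hC2, hh⟩ := holder hl0
  refine ⟨l, C2 * (C1 + 1), hlk, hl1, by positivity, ?_⟩
  intro e F D he hQ x hx y hy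
  obtain ⟨D0, hD0, hae⟩ := QG.ext hk he hQ
  have hQH : QH k e (ball 0 1) F D0 := ⟨hQ.cont, hQ.bd, hD0, hae⟩
  have := hh ((C1 + 1) * (1 + e)) F D0 (by positivity) hD0 hQ.cont ?_ x hx y hy
  · refine this.trans (le_of_eq (by ring))
  · intro c hc ρ hρ hρ8
    refine (hdec e F D0 hQH c hc ρ hρ hρ8).trans ?_
    apply mul_le_mul_of_nonneg_right _ (by positivity)
    calc C1 * (1 + e^2) ≤ (C1+1)^2 * (1+e)^2 := by
          apply mul_le_mul <;> nlinarith
      _ = _ := by ring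


/-- the nonlinearity `|g|^{p-2} g`, `k = p - 1` -/
def Vf (k : ℝ) (g : ℂ) : ℂ := (‖g‖^(k-1)) • g

theorem Vf_zero (k : ℝ) : Vf k 0 = 0 := by simp [Vf]

theorem Vf_norm {k : ℝ} (hk : 1 < k) (g : ℂ) : ‖Vf k g‖ = ‖g‖^k := by
  rw [Vf, norm_smul, Real.norm_eq_abs, abs_of_nonneg (by positivity)]
  rcases eq_or_ne g 0 with rfl | hg
  · rw [norm_zero, mul_zero, zero_rpow (by linarith)]
  · have : 0 < ‖g‖ := norm_pos_iff.2 hg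
    rw [rpow_sub_one this.ne']; field_simp

theorem Vf_cont {k : ℝ} (hk : 1 < k) : Continuous (Vf k) := by
  unfold Vf
  exact (continuous_norm.rpow_const fun _ => Or.inr (by linarith)).smul continuous_id

theorem Vf_smul {k : ℝ} {m : ℝ} (hm : 0 < m) (hk : 1 < k) (g : ℂ) : Vf k (m • g) = m^k • Vf k g := by
  unfold Vf
  rw [norm_smul, Real.norm_eq_abs, abs_of_pos hm, mul_rpow hm.le (norm_nonneg _), smul_smul, smul_smul]
  congr 1
  rw [rpow_sub_one hm.ne']; field_simp

theorem Vf_mono {k : ℝ} (hk : 1 < k) (a b : ℂ) :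
    (1/2) * (‖a‖^(k-1) + ‖b‖^(k-1)) * ‖a - b‖^2 ≤ ⟪Vf k a - Vf k b, a - b⟫ := by
  unfold Vf
  set A := ‖a‖^(k-1) with hA
  set B := ‖b‖^(k-1) with hB
  have e1 : ⟪A • a - B • b, a - b⟫ = A * ‖a‖^2 + B * ‖b‖^2 - (A + B) * ⟪a, b⟫ := by
    simp only [inner_sub_left, inner_sub_right, real_inner_smul_left, real_inner_self_eq_norm_sq]
    rw [real_inner_comm a b]; ring
  have e2 : ‖a - b‖^2 = ‖a‖^2 - 2 * ⟪a, b⟫ + ‖b‖^2 := norm_sub_sq_real a b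
  have e3 : 0 ≤ (A - B) * (‖a‖^2 - ‖b‖^2) := by
    rcases le_total ‖a‖ ‖b‖ with h | h
    · have h1 : A ≤ B := rpow_le_rpow (norm_nonneg _) h (by linarith)
      have h2 : ‖a‖^2 ≤ ‖b‖^2 := by gcongr
      nlinarith
    · have h1 : B ≤ A := rpow_le_rpow (norm_nonneg _) h (by linarith)
      have h2 : ‖b‖^2 ≤ ‖a‖^2 := by gcongr
      nlinarith
  rw [e1, e2]; nlinarith

theorem Vf_lower {k : ℝ} (hk : 1 < k) (a b : ℂ) :
    (1/2) * (‖a‖^(k-1) + ‖b‖^(k-1)) * ‖a - b‖ ≤ ‖Vf k a - Vf k b‖ := by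
  rcases eq_or_ne a b with rfl | hab
  · simp
  · have h0 : 0 < ‖a - b‖ := norm_pos_iff.2 (sub_ne_zero.2 hab)
    have h1 := (Vf_mono hk a b).trans (real_inner_le_norm _ _)
    have : ((1/2) * (‖a‖^(k-1) + ‖b‖^(k-1)) * ‖a - b‖) * ‖a - b‖ ≤ ‖Vf k a - Vf k b‖ * ‖a - b‖ := by
      linarith
    exact le_of_mul_le_mul_right this h0

theorem Vf_inj {k : ℝ} (hk : 1 < k) : Function.Injective (Vf k) := by
  intro a b h
  by_contra hab
  have h0 : 0 < ‖a - b‖ := norm_pos_iff.2 (sub_ne_zero.2 hab)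
  have := Vf_lower hk a b
  rw [h, sub_self, norm_zero] at this
  have h1 : 0 < ‖a‖^(k-1) + ‖b‖^(k-1) := by
    rcases eq_or_ne a 0 with rfl | ha
    · have : 0 < ‖b‖ := by simpa using h0
      positivity
    · have : 0 < ‖a‖ := norm_pos_iff.2 ha
      positivity
  have : 0 < (1/2) * (‖a‖^(k-1) + ‖b‖^(k-1)) * ‖a - b‖ := by positivity
  linarith

theorem pow_diff {k s t : ℝ} (hk : 1 < k) (hs : 0 ≤ s) (ht : 0 ≤ t) : s^k - t^k ≤ k * s^(k-1) * (s - t) := by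
  rcases hs.eq_or_lt with rfl | hs0
  · rw [zero_rpow (by linarith), zero_rpow (by linarith)]
    have := rpow_nonneg ht k
    linarith
  · have b := one_add_mul_self_le_rpow_one_add (s := t/s - 1) (by have : 0 ≤ t/s := by positivity
                                                                  linarith) hk.le
    rw [add_sub_cancel, div_rpow ht hs] at b
    have hsk : 0 < s^k := rpow_pos_of_pos hs0 _
    rw [le_div_iff₀ hsk] at b
    have : s^k = s^(k-1) * s := by rw [rpow_sub_one hs0.ne']; field_simp
    have e : (1 + k * (t/s - 1)) * s^k = s^k + k * s^(k-1) * (t - s) := by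
      rw [this]; field_simp
    linarith

theorem Vf_lip {k : ℝ} (hk : 1 < k) {a b : ℂ} (ha : ‖a‖ ≤ 1) (hb : ‖b‖ ≤ 1) : ‖Vf k a - Vf k b‖ ≤ (k+1) * ‖a - b‖ := by
  wlog hab : ‖b‖ ≤ ‖a‖ generalizing a b
  · rw [norm_sub_rev, norm_sub_rev a]
    exact this hb ha (le_of_not_ge hab)
  set A := ‖a‖^(k-1) with hA
  set B := ‖b‖^(k-1) with hB
  have hBA : B ≤ A := rpow_le_rpow (norm_nonneg _) hab (by linarith)
  have hA1 : A ≤ 1 := rpow_le_one (norm_nonneg _) ha (by linarith)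
  have hA0 : 0 ≤ A := by positivity
  have e : Vf k a - Vf k b = A • (a - b) + (A - B) • b := by
    unfold Vf; rw [← hA, ← hB]; simp only [smul_sub, sub_smul]; abel
  have hn : ‖a‖ - ‖b‖ ≤ ‖a - b‖ := norm_sub_norm_le _ _
  have pd := pow_diff hk (norm_nonneg a) (norm_nonneg b)
  have ea : ‖a‖^k = A * ‖a‖ := by rw [← Vf_norm hk, Vf, norm_smul, Real.norm_eq_abs, abs_of_nonneg hA0]
  have eb : ‖b‖^k = B * ‖b‖ := by rw [← Vf_norm hk, Vf, norm_smul, Real.norm_eq_abs, abs_of_nonneg (by positivity)]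
  rw [ea, eb, ← hA] at pd
  rw [e]
  calc _ ≤ A * ‖a - b‖ + (A - B) * ‖b‖ := by
        refine (norm_add_le _ _).trans ?_
        rw [norm_smul, norm_smul, Real.norm_eq_abs, Real.norm_eq_abs, abs_of_nonneg hA0, abs_of_nonneg (by linarith)]
    _ ≤ A * ‖a - b‖ + k * A * (‖a‖ - ‖b‖) := by nlinarith
    _ ≤ A * ‖a - b‖ + k * A * ‖a - b‖ := by gcongr
    _ = A * ((k+1) * ‖a - b‖) := by ring
    _ ≤ 1 * ((k+1) * ‖a - b‖) := by gcongr
    _ = _ := one_mul _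

/-- solutions, in the form used below -/
structure Sol (k δ : ℝ) (c : ℂ) (R : ℝ) (u : ℂ → ℝ) (g : ℂ → ℂ) : Prop where
  cont : ContinuousOn g (ball c R)
  grad : ∀ x ∈ ball c R, HasFDerivAt u (innerSL ℝ (g x)) x
  weak : ∀ φ : ℂ → ℝ, ContDiff ℝ (⊤ : ℕ∞) φ → HasCompactSupport φ → tsupport φ ⊆ ball c R →
    |∫ x, fderiv ℝ φ x (Vf k (g x))| ≤ δ * ∫ x, |φ x|

/-- mollifier of radius `r` -/
def bmp {r : ℝ} (hr : 0 < r) : ContDiffBump (0:ℂ) := ⟨r/2, r, by linarith, by linarith⟩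

theorem approx_C1 {φ : ℂ → ℝ} (hφ : ContDiff ℝ 1 φ) (hc : HasCompactSupport φ) {U : Set ℂ} (hU : IsOpen U) (hs : tsupport φ ⊆ U) :
    ∃ K ⊆ U, IsCompact K ∧ tsupport φ ⊆ K ∧ ∀ ε > 0, ∃ ψ : ℂ → ℝ, ContDiff ℝ (⊤ : ℕ∞) ψ ∧ tsupport ψ ⊆ K ∧
      (∀ x, |ψ x - φ x| ≤ ε) ∧ ∀ x, ‖fderiv ℝ ψ x - fderiv ℝ φ x‖ ≤ ε := by
  obtain ⟨r, hr, hrU⟩ := hc.isCompact.exists_cthickening_subset_open hU hs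
  refine ⟨cthickening r (tsupport φ), hrU, hc.isCompact.cthickening, self_subset_cthickening _, ?_⟩
  intro ε hε
  have hD : Continuous (fderiv ℝ φ) := hφ.continuous_fderiv (by norm_num)
  have u1 := hc.uniformContinuous_of_continuous hφ.continuous
  have u2 := (hc.fderiv ℝ).uniformContinuous_of_continuous hD
  obtain ⟨d1, hd1, h1⟩ := Metric.uniformContinuous_iff.1 u1 ε hε
  obtain ⟨d2, hd2, h2⟩ := Metric.uniformContinuous_iff.1 u2 ε hε
  set d := min r (min d1 d2) with hd
  have hd0 : 0 < d := by positivity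
  set b := bmp hd0 with hb
  set N : ℂ → ℝ := b.normed volume with hN
  have hNs : ContDiff ℝ (⊤ : ℕ∞) N := b.contDiff_normed
  have hNc : HasCompactSupport N := b.hasCompactSupport_normed
  refine ⟨convolution N φ (ContinuousLinearMap.lsmul ℝ ℝ) volume, ?_, ?_, ?_, ?_⟩
  · exact hNc.contDiff_convolution_left _ hNs hφ.continuous.locallyIntegrable
  · apply closure_minimal _ isClosed_cthickening
    refine (support_convolution_subset _).trans ?_
    rintro _ ⟨a, ha, z, hz, rfl⟩
    rw [hN, b.support_normed_eq] at ha
    refine mem_cthickening_of_dist_le _ z _ _ (subset_tsupport _ hz) ?_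
    have : dist a 0 < d := ha
    rw [dist_eq_norm, sub_zero] at this
    rw [dist_eq_norm]; simp only [add_sub_cancel_right]
    exact this.le.trans (min_le_left _ _)
  · intro x
    have := b.dist_normed_convolution_le (μ := volume) (g := φ) (x₀ := x) (ε := ε) hφ.continuous.aestronglyMeasurable (fun y hy => ?_)
    · rwa [Real.dist_eq] at this
    · exact (h1 (lt_of_lt_of_le hy ((min_le_right _ _).trans (min_le_left _ _)))).le
  · intro x
    have hf := (hc.hasFDerivAt_convolution_right (ContinuousLinearMap.lsmul ℝ ℝ) (hNs.continuous.locallyIntegrable (μ := (volume : Measure ℂ))) hφ x).fderiv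
    rw [hf]
    have := b.dist_normed_convolution_le (μ := volume) (g := fderiv ℝ φ) (x₀ := x) (ε := ε) hD.aestronglyMeasurable (fun y hy => ?_)
    · rw [dist_eq_norm] at this
      exact this
    · exact (h2 (lt_of_lt_of_le hy ((min_le_right _ _).trans (min_le_right _ _)))).le

theorem Sol.weak1 {k δ : ℝ} (hk : 1 < k) (hδ : 0 ≤ δ) {c : ℂ} {R : ℝ} {u : ℂ → ℝ} {g : ℂ → ℂ} (h : Sol k δ c R u g) {φ : ℂ → ℝ}
    (hφ : ContDiff ℝ 1 φ) (hc : HasCompactSupport φ) (hs : tsupport φ ⊆ ball c R) :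
    |∫ x, fderiv ℝ φ x (Vf k (g x))| ≤ δ * ∫ x, |φ x| := by
  obtain ⟨K, hKU, hK, hφK, hap⟩ := approx_C1 hφ hc isOpen_ball hs
  have hVc : ContinuousOn (fun x => Vf k (g x)) K := (Vf_cont hk).comp_continuousOn (h.cont.mono hKU)
  obtain ⟨M, hM⟩ := hK.exists_bound_of_continuousOn hVc
  have hM0 : 0 ≤ max M 0 := le_max_right _ _
  set VK := volume.real K with hVK
  have hVK0 : 0 ≤ VK := measureReal_nonneg
  refine le_of_forall_pos_le_add fun ε hε => ?_
  set κ := (max M 0 + δ) * VK + 1 with hκ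
  have hκ0 : 0 < κ := by positivity
  obtain ⟨ψ, hψ, hψK, h1, h2⟩ := hap (ε/κ) (by positivity)
  have hψc : HasCompactSupport ψ := HasCompactSupport.of_support_subset_isCompact hK (subset_closure.trans hψK)
  have w := h.weak ψ hψ hψc (hψK.trans hKU)
  have zf : ∀ (χ : ℂ → ℝ), tsupport χ ⊆ K → ∀ x ∉ K, fderiv ℝ χ x = 0 := fun χ hχ x hx =>
    image_eq_zero_of_notMem_tsupport (fun hh => hx (hχ (tsupport_fderiv_subset ℝ hh)))
  have z0 : ∀ (χ : ℂ → ℝ), tsupport χ ⊆ K → ∀ x ∉ K, χ x = 0 := fun χ hχ x hx =>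
    image_eq_zero_of_notMem_tsupport (fun hh => hx (hχ hh))
  have r1 : ∀ (χ : ℂ → ℝ), tsupport χ ⊆ K → ∫ x, fderiv ℝ χ x (Vf k (g x)) = ∫ x in K, fderiv ℝ χ x (Vf k (g x)) := fun χ hχ =>
    (setIntegral_eq_integral_of_forall_compl_eq_zero fun x hx => by rw [zf χ hχ x hx]; simp).symm
  have r2 : ∀ (χ : ℂ → ℝ), tsupport χ ⊆ K → ∫ x, |χ x| = ∫ x in K, |χ x| := fun χ hχ =>
    (setIntegral_eq_integral_of_forall_compl_eq_zero fun x hx => by rw [z0 χ hχ x hx]; simp).symm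
  rw [r1 ψ hψK, r2 ψ hψK] at w
  rw [r1 φ hφK, r2 φ hφK]
  have iK : ∀ (χ : ℂ → ℝ), ContDiff ℝ 1 χ → IntegrableOn (fun x => fderiv ℝ χ x (Vf k (g x))) K := fun χ hχ =>
    ((hχ.continuous_fderiv (by norm_num)).continuousOn.clm_apply hVc).integrableOn_compact hK
  have iA : ∀ (χ : ℂ → ℝ), Continuous χ → IntegrableOn (fun x => |χ x|) K := fun χ hχ =>
    hχ.abs.continuousOn.integrableOn_compact hK
  have d1 : ‖(∫ x in K, fderiv ℝ ψ x (Vf k (g x))) - ∫ x in K, fderiv ℝ φ x (Vf k (g x))‖ ≤ ε/κ * max M 0 * VK := by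
    rw [← integral_sub (iK ψ (hψ.of_le (by exact_mod_cast le_top))) (iK φ hφ)]
    refine norm_setIntegral_le_of_norm_le_const hK.measure_lt_top fun x hx => ?_
    rw [← ContinuousLinearMap.sub_apply]
    refine (ContinuousLinearMap.le_opNorm _ _).trans ?_
    exact mul_le_mul (h2 x) ((hM x hx).trans (le_max_left _ _)) (norm_nonneg _) (by positivity)
  have d2 : ‖(∫ x in K, |ψ x|) - ∫ x in K, |φ x|‖ ≤ ε/κ * VK := by
    rw [← integral_sub (iA ψ hψ.continuous) (iA φ hφ.continuous)]
    refine norm_setIntegral_le_of_norm_le_const hK.measure_lt_top fun x hx => ?_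
    exact (abs_abs_sub_abs_le _ _).trans (h1 x)
  rw [Real.norm_eq_abs, abs_le] at d1 d2
  rw [abs_le] at w ⊢
  have e1 : ε/κ * max M 0 * VK + δ * (ε/κ * VK) ≤ ε := by
    have : ε/κ * κ = ε := by field_simp
    calc _ = ε/κ * (κ - 1) := by rw [hκ]; ring
      _ ≤ ε/κ * κ := by gcongr; linarith
      _ = ε := this
  have e2 := mul_le_mul_of_nonneg_left d2.2 hδ
  constructor <;> nlinarith


theorem cd_mul {η w : ℂ → ℝ} {U : Set ℂ} (hη : ContDiff ℝ (⊤ : ℕ∞) η) (hU : IsOpen U) (hs : tsupport η ⊆ U) (hw : ContDiffOn ℝ 1 w U) :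
    ContDiff ℝ 1 (fun x => η x * w x) := by
  rw [contDiff_iff_contDiffAt]
  intro x
  by_cases hx : x ∈ U
  · exact (hη.contDiffAt.of_le (by exact_mod_cast le_top)).mul (hw.contDiffAt (hU.mem_nhds hx))
  · have hx2 : x ∉ tsupport η := fun h => hx (hs h)
    have : (fun x => η x * w x) =ᶠ[nhds x] fun _ => 0 := by
      filter_upwards [(isClosed_tsupport η).isOpen_compl.mem_nhds hx2] with y hy
      rw [image_eq_zero_of_notMem_tsupport hy, zero_mul]
    exact contDiffAt_const.congr_of_eventuallyEq this

theorem Sol.cd {k δ : ℝ} {c : ℂ} {R : ℝ} {u : ℂ → ℝ} {g : ℂ → ℂ} (h : Sol k δ c R u g) : ContDiffOn ℝ 1 u (ball c R) := by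
  rw [show (1 : WithTop ℕ∞) = 0 + 1 from rfl, contDiffOn_succ_iff_fderiv_of_isOpen isOpen_ball]
  refine ⟨fun x hx => (h.grad x hx).differentiableAt.differentiableWithinAt, by simp, ?_⟩
  rw [contDiffOn_zero]
  have : ContinuousOn (fun x => innerSL ℝ (g x)) (ball c R) := (innerSL ℝ).continuous.comp_continuousOn h.cont
  exact this.congr fun x hx => (h.grad x hx).fderiv

theorem l1_diff {ψ : ℂ → ℝ} (hψ : ContDiff ℝ 1 ψ) (hc : HasCompactSupport ψ) (y : ℂ) :
    ∫ x, |ψ (x - y) - ψ x| ≤ ‖y‖ * ∫ x, ‖fderiv ℝ ψ x‖ := by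
  have hD : Continuous (fderiv ℝ ψ) := hψ.continuous_fderiv (by norm_num)
  obtain ⟨ρ, hρ⟩ := hc.isCompact.isBounded.subset_closedBall (0:ℂ)
  set K := closedBall (0:ℂ) (ρ + ‖y‖) with hK
  have hKc : IsCompact K := isCompact_closedBall _ _
  haveI := finK hKc
  have hz : ∀ x ∉ K, ψ (x - y) = 0 ∧ ψ x = 0 := by
    intro x hx
    rw [hK, mem_closedBall, dist_zero_right] at hx
    push Not at hx
    constructor
    · apply image_eq_zero_of_notMem_tsupport
      intro hh
      have := hρ hh
      rw [mem_closedBall, dist_zero_right] at this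
      have := norm_sub_norm_le x y
      linarith
    · apply image_eq_zero_of_notMem_tsupport
      intro hh
      have := hρ hh
      rw [mem_closedBall, dist_zero_right] at this
      have := norm_nonneg y
      linarith
  have e1 : ∫ x, |ψ (x - y) - ψ x| = ∫ x in K, |ψ (x - y) - ψ x| :=
    (setIntegral_eq_integral_of_forall_compl_eq_zero fun x hx => by rw [(hz x hx).1, (hz x hx).2]; simp).symm
  have hiD : Integrable (fun x => ‖fderiv ℝ ψ x‖) := (hD.integrable_of_hasCompactSupport (hc.fderiv ℝ)).norm
  have hFc : Continuous (fun q : ℂ × ℝ => ‖fderiv ℝ ψ (q.1 - q.2 • y)‖) := by fun_prop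
  have hFi : Integrable (fun q : ℂ × ℝ => ‖fderiv ℝ ψ (q.1 - q.2 • y)‖) ((volume.restrict K).prod (volume.restrict (Set.Icc (0:ℝ) 1))) := by
    rw [Measure.prod_restrict]
    exact hFc.continuousOn.integrableOn_compact (hKc.prod isCompact_Icc)
  rw [e1]
  have pt : ∀ x, |ψ (x - y) - ψ x| ≤ ‖y‖ * ∫ t in Set.Icc (0:ℝ) 1, ‖fderiv ℝ ψ (x - t • y)‖ := by
    intro x
    have hder : ∀ t ∈ Set.uIcc (0:ℝ) 1, HasDerivAt (fun t : ℝ => ψ (x - t • y)) (fderiv ℝ ψ (x - t • y) (-y)) t := by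
      intro t _
      have : HasDerivAt (fun t : ℝ => x - t • y) (-y) t := by
        simpa using ((hasDerivAt_id t).smul_const y).const_sub x
      exact ((hψ.differentiable (by norm_num)) _).hasFDerivAt.comp_hasDerivAt t this
    have hcc : Continuous (fun t : ℝ => fderiv ℝ ψ (x - t • y) (-y)) := by fun_prop
    have ftc := intervalIntegral.integral_eq_sub_of_hasDerivAt hder (hcc.intervalIntegrable _ _)
    simp only [one_smul, zero_smul, sub_zero] at ftc
    rw [← ftc, intervalIntegral.integral_of_le zero_le_one, ← integral_Icc_eq_integral_Ioc, ← integral_const_mul, ← Real.norm_eq_abs]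
    refine norm_integral_le_of_norm_le ?_ (Filter.Eventually.of_forall fun t => ?_)
    · have : Continuous (fun t : ℝ => ‖y‖ * ‖fderiv ℝ ψ (x - t • y)‖) := by fun_prop
      exact this.continuousOn.integrableOn_compact isCompact_Icc
    · refine (ContinuousLinearMap.le_opNorm _ _).trans ?_
      rw [norm_neg, mul_comm]
  calc ∫ x in K, |ψ (x - y) - ψ x| ≤ ∫ x in K, ‖y‖ * ∫ t in Set.Icc (0:ℝ) 1, ‖fderiv ℝ ψ (x - t • y)‖ := by
        refine integral_mono ?_ (hFi.integral_prod_left.const_mul _) pt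
        have : Continuous (fun x => |ψ (x - y) - ψ x|) := by have := hψ.continuous; fun_prop
        exact this.continuousOn.integrableOn_compact hKc
    _ = ‖y‖ * ∫ t in Set.Icc (0:ℝ) 1, ∫ x in K, ‖fderiv ℝ ψ (x - t • y)‖ := by
        rw [integral_const_mul, integral_integral_swap hFi]
    _ ≤ ‖y‖ * ∫ t in Set.Icc (0:ℝ) 1, ∫ x, ‖fderiv ℝ ψ x‖ := by
        apply mul_le_mul_of_nonneg_left _ (norm_nonneg _)
        refine integral_mono hFi.integral_prod_right (integrable_const _) fun t => ?_
        beta_reduce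
        have tr : ∫ x, ‖fderiv ℝ ψ (x - t • y)‖ = ∫ x, ‖fderiv ℝ ψ x‖ :=
          integral_sub_right_eq_self (μ := (volume : Measure ℂ)) (fun x => ‖fderiv ℝ ψ x‖) (t • y)
        rw [← tr]
        exact setIntegral_le_integral (hiD.comp_sub_right (t • y)) (Filter.Eventually.of_forall fun x => norm_nonneg _)
    _ = _ := by simp

theorem dq_alg {θ η Δ Y M κ δ q n : ℝ} (hθ : 0 < θ) (hη0 : 0 ≤ η) (hη1 : η ≤ 1) (hM : 0 ≤ M) (hY : 0 ≤ Y) (hδ : 0 ≤ δ)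
    (hq : θ/2 * η^2 * Δ^2 - 2 * η * Y * M * κ * Δ ≤ q) (hn : n ≤ η^2 * Δ + 2 * η * Y * M) :
    θ/4 * (η^2 * Δ^2) ≤ q - δ * Y * n + (8/θ * κ^2 * M^2 + 2/θ * δ^2 + 2 * δ * M) * Y^2 := by
  have h1 : 2 * η * Y * M * κ * Δ ≤ θ/8 * (η^2 * Δ^2) + 8/θ * κ^2 * M^2 * Y^2 := by
    have : θ/8 * (η^2 * Δ^2) + 8/θ * κ^2 * M^2 * Y^2 - 2 * η * Y * M * κ * Δ = (8/θ) * (θ/8 * (η * Δ) - κ * M * Y)^2 := by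
      field_simp; ring
    have : 0 ≤ (8/θ) * (θ/8 * (η * Δ) - κ * M * Y)^2 := by positivity
    linarith
  have h2 : δ * Y * (η^2 * Δ) ≤ θ/8 * (η^2 * Δ^2) + 2/θ * δ^2 * Y^2 := by
    have e : θ/8 * (η^2 * Δ^2) + 2/θ * δ^2 * Y^2 * η^2 - δ * Y * (η^2 * Δ) = (2/θ) * η^2 * (θ/4 * Δ - δ * Y)^2 := by
      field_simp; ring
    have e1 : 0 ≤ (2/θ) * η^2 * (θ/4 * Δ - δ * Y)^2 := by positivity
    have e2 : 2/θ * δ^2 * Y^2 * η^2 ≤ 2/θ * δ^2 * Y^2 * 1 := by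
      apply mul_le_mul_of_nonneg_left _ (by positivity)
      nlinarith
    linarith
  have h3 : δ * Y * (2 * η * Y * M) ≤ 2 * δ * M * Y^2 := by
    have : δ * Y * (2 * η * Y * M) = (2 * δ * M * Y^2) * η := by ring
    rw [this]
    exact mul_le_of_le_one_right (by positivity) hη1
  have h4 := mul_le_mul_of_nonneg_left hn (mul_nonneg hδ hY)
  linarith

theorem dq {k δ : ℝ} (hk : 1 < k) (hδ : 0 ≤ δ) {c : ℂ} {R : ℝ} {u : ℂ → ℝ} {g : ℂ → ℂ} (h : Sol k δ c R u g)
    (hg : ∀ x ∈ ball c R, ‖g x‖ ≤ 1) {K : Set ℂ} (hK : IsCompact K) (hKΩ : K ⊆ {x | x ∈ ball c R ∧ g x ≠ 0}) :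
    ∃ C, 0 ≤ C ∧ ∃ y0 > 0, cthickening y0 K ⊆ ball c R ∧ ∀ y, ‖y‖ ≤ y0 → ∫ x in K, ‖g (x + y) - g x‖^2 ≤ C * ‖y‖^2 := by
  set Ω := {x | x ∈ ball c R ∧ g x ≠ 0} with hΩ
  have hΩo : IsOpen Ω := h.cont.isOpen_inter_preimage isOpen_ball isOpen_compl_singleton
  obtain ⟨η, hη, hηc, hηs, hη01, hηK⟩ := cutoff hK hΩo hKΩ
  set S := tsupport η with hS
  have hSc : IsCompact S := hηc.isCompact
  have hSb : S ⊆ ball c R := fun x hx => (hηs hx).1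
  haveI := finK hSc
  have hKS : K ⊆ S := fun x hx => by
    apply subset_tsupport
    rw [Function.mem_support, (hηK x hx).self_of_nhds]
    norm_num
  obtain ⟨τ, hτ0, hτ⟩ : ∃ τ > 0, ∀ x ∈ S, τ ≤ ‖g x‖ := by
    rcases S.eq_empty_or_nonempty with he | hne
    · exact ⟨1, one_pos, fun x hx => by rw [he] at hx; exact hx.elim⟩
    · obtain ⟨x0, hx0, hmin⟩ := hSc.exists_isMinOn hne (h.cont.mono hSb).norm
      exact ⟨‖g x0‖, norm_pos_iff.2 (hηs hx0).2, fun x hx => hmin hx⟩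
  obtain ⟨y0, hy0, hyb⟩ := hSc.exists_cthickening_subset_open isOpen_ball hSb
  set K2 := cthickening y0 S with hK2
  have hK2c : IsCompact K2 := hSc.cthickening
  have hDη : Continuous (fderiv ℝ η) := hη.continuous_fderiv (by simp)
  obtain ⟨M, hM⟩ := hSc.exists_bound_of_continuousOn hDη.continuousOn
  have hM0 : 0 ≤ max M 0 := le_max_right _ _
  set M' := max M 0 with hM'
  set θ := τ^(k-1) with hθ
  have hθ0 : 0 < θ := rpow_pos_of_pos hτ0 _
  set C1 := 8/θ * (k+1)^2 * M'^2 + 2/θ * δ^2 + 2 * δ * M' with hC1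
  have hC10 : 0 ≤ C1 := by positivity
  set VS := volume.real S with hVS
  have hVS0 : 0 ≤ VS := measureReal_nonneg
  refine ⟨4/θ * (C1 * VS), by positivity, y0, hy0, (cthickening_subset_of_subset _ hKS).trans hyb, ?_⟩
  intro y hy
  have hxy : ∀ x ∈ S, x + y ∈ K2 := fun x hx =>
    mem_cthickening_of_dist_le _ x _ _ hx (by rw [dist_eq_norm]; simpa using hy)
  have hSK2 : S ⊆ K2 := self_subset_cthickening _
  -- the test function
  set w : ℂ → ℝ := fun x => u (x + y) - u x with hw
  set U : Set ℂ := ball c R ∩ (fun x => x + y) ⁻¹' (ball c R) with hU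
  have hUo : IsOpen U := isOpen_ball.inter (isOpen_ball.preimage (by fun_prop))
  have hSU : S ⊆ U := fun x hx => ⟨hSb hx, hyb (hxy x hx)⟩
  have hwU : ContDiffOn ℝ 1 w U :=
    (h.cd.comp (contDiff_id.add contDiff_const).contDiffOn (fun x hx => hx.2)).sub (h.cd.mono Set.inter_subset_left)
  set ψ : ℂ → ℝ := fun x => (η x)^2 * w x with hψd
  have hη2 : ContDiff ℝ (⊤ : ℕ∞) (fun x => (η x)^2) := hη.pow 2
  have hts2 : tsupport (fun x => (η x)^2) ⊆ S := by
    apply closure_mono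
    intro x hx hx0
    exact hx (by simp [hx0])
  have hψ : ContDiff ℝ 1 ψ := cd_mul hη2 hUo (hts2.trans hSU) hwU
  have hψz : ∀ x ∉ S, ψ x = 0 := fun x hx => by simp [hψd, image_eq_zero_of_notMem_tsupport hx]
  have hψS : tsupport ψ ⊆ S := closure_minimal (fun x hx => by by_contra hh; exact hx (hψz x hh)) (isClosed_tsupport η)
  have hψc : HasCompactSupport ψ := HasCompactSupport.of_support_subset_isCompact hSc (subset_closure.trans hψS)
  have hDψ : Continuous (fderiv ℝ ψ) := hψ.continuous_fderiv (by norm_num)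
  have hDψz : ∀ x ∉ S, fderiv ℝ ψ x = 0 := fun x hx =>
    image_eq_zero_of_notMem_tsupport (fun hh => hx (hψS (tsupport_fderiv_subset ℝ hh)))
  have hfψ : ∀ x ∈ S, fderiv ℝ ψ x = (η x)^2 • innerSL ℝ (g (x + y) - g x) + w x • ((2 * η x) • fderiv ℝ η x) := by
    intro x hx
    have h1 : HasFDerivAt w (innerSL ℝ (g (x + y)) - innerSL ℝ (g x)) x := by
      have a1 : HasFDerivAt (fun x => u (x + y)) (innerSL ℝ (g (x + y))) x := by
        have := (h.grad (x+y) (hyb (hxy x hx))).comp x ((hasFDerivAt_id x).add_const y)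
        rw [ContinuousLinearMap.comp_id] at this
        exact this
      exact a1.sub (h.grad x (hSb hx))
    have h2 : HasFDerivAt (fun x => (η x)^2) ((2 * η x) • fderiv ℝ η x) x := by
      have := ((hη.differentiable (by simp)) x).hasFDerivAt.pow 2
      simpa using this
    have := (h2.mul h1).fderiv
    rw [map_sub]
    exact this
  -- weak formulation
  set φ : ℂ → ℝ := fun x => ψ (x - y) - ψ x with hφd
  have hφ1 : ContDiff ℝ 1 φ := (hψ.comp (contDiff_id.sub contDiff_const)).sub hψ
  have hφz : ∀ x ∉ K2, φ x = 0 := by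
    intro x hx
    have n1 : x ∉ S := fun hh => hx (hSK2 hh)
    have n2 : x - y ∉ S := fun hh => hx (by simpa using hxy _ hh)
    simp only [hφd, hψz _ n1, hψz _ n2, sub_zero]
  have hφS : tsupport φ ⊆ K2 := closure_minimal (fun x hx => by by_contra hh; exact hx (hφz x hh)) isClosed_cthickening
  have hφc : HasCompactSupport φ := HasCompactSupport.of_support_subset_isCompact hK2c (subset_closure.trans hφS)
  have wk := h.weak1 hk hδ hφ1 hφc (hφS.trans hyb)
  have hfφ : ∀ x, fderiv ℝ φ x = fderiv ℝ ψ (x - y) - fderiv ℝ ψ x := by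
    intro x
    have hd := hψ.differentiable (by norm_num)
    have a1 : HasFDerivAt (fun x => ψ (x - y)) (fderiv ℝ ψ (x - y)) x := by
      have := (hd (x-y)).hasFDerivAt.comp x ((hasFDerivAt_id x).sub_const y)
      rw [ContinuousLinearMap.comp_id] at this
      exact this
    exact (a1.sub (hd x).hasFDerivAt).fderiv
  have hVc : ContinuousOn (fun x => Vf k (g x)) K2 := (Vf_cont hk).comp_continuousOn (h.cont.mono hyb)
  have hi1 : Integrable (fun x => fderiv ℝ ψ (x - y) (Vf k (g x))) := by
    rw [← integrableOn_iff_integrable_of_support_subset (s := K2)]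
    · refine ContinuousOn.integrableOn_compact hK2c (ContinuousOn.clm_apply ?_ hVc)
      exact (hDψ.comp (continuous_id.sub continuous_const)).continuousOn
    · intro x hx
      by_contra hh
      have n2 : x - y ∉ S := fun h2 => hh (by simpa using hxy _ h2)
      exact hx (by simp [hDψz _ n2])
  have hi2 : Integrable (fun x => fderiv ℝ ψ x (Vf k (g x))) := by
    rw [← integrableOn_iff_integrable_of_support_subset (s := K2)]
    · exact ContinuousOn.integrableOn_compact hK2c (hDψ.continuousOn.clm_apply hVc)
    · intro x hx
      by_contra hh
      exact hx (by simp [hDψz _ (fun h2 => hh (hSK2 h2))])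
  have hi3 : Integrable (fun x => fderiv ℝ ψ x (Vf k (g (x + y)))) := by
    have := hi1.comp_add_right y
    simpa using this
  have e1 : ∫ x, fderiv ℝ φ x (Vf k (g x)) = ∫ x, fderiv ℝ ψ x (Vf k (g (x + y)) - Vf k (g x)) := by
    simp only [hfφ, ContinuousLinearMap.sub_apply, map_sub]
    rw [integral_sub hi1 hi2, integral_sub hi3 hi2]
    congr 1
    have := integral_add_right_eq_self (μ := (volume : Measure ℂ)) (fun x => fderiv ℝ ψ (x - y) (Vf k (g x))) y
    rw [← this]; simp
  have i4 : Integrable (fun x => fderiv ℝ ψ x (Vf k (g (x + y)) - Vf k (g x))) := by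
    simp only [map_sub]; exact hi3.sub hi2
  have i5 : Integrable (fun x => ‖fderiv ℝ ψ x‖) := (hDψ.integrable_of_hasCompactSupport (hψc.fderiv ℝ)).norm
  have main : ∫ x, fderiv ℝ ψ x (Vf k (g (x + y)) - Vf k (g x)) ≤ δ * ‖y‖ * ∫ x, ‖fderiv ℝ ψ x‖ := by
    rw [← e1]
    refine (le_abs_self _).trans (wk.trans ?_)
    rw [mul_assoc]
    exact mul_le_mul_of_nonneg_left (l1_diff hψ hψc y) hδ
  -- pointwise
  have gc1 : ContinuousOn (fun x => g (x + y)) S := h.cont.comp (by fun_prop) (fun x hx => hyb (hxy x hx))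
  have gc2 : ContinuousOn g S := h.cont.mono hSb
  have pt : ∀ x ∈ S, θ/4 * ((η x)^2 * ‖g (x+y) - g x‖^2) ≤
      fderiv ℝ ψ x (Vf k (g (x + y)) - Vf k (g x)) - δ * ‖y‖ * ‖fderiv ℝ ψ x‖ + C1 * ‖y‖^2 := by
    intro x hx
    obtain ⟨n0, n1⟩ := hη01 x
    set a := g (x + y) with ha
    set b := g x with hb
    have ga : ‖a‖ ≤ 1 := hg _ (hyb (hxy x hx))
    have gb : ‖b‖ ≤ 1 := hg _ (hSb hx)
    have hwx : |w x| ≤ ‖y‖ := by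
      have := (convex_ball c R).norm_image_sub_le_of_norm_hasFDerivWithin_le (f := u) (f' := fun x => innerSL ℝ (g x)) (C := 1)
        (fun x hx => (h.grad x hx).hasFDerivWithinAt) (fun x hx => by rw [innerSL_apply_norm]; exact hg x hx) (hSb hx) (hyb (hxy x hx))
      simpa [hw] using this
    have hMx : ‖fderiv ℝ η x‖ ≤ M' := (hM x hx).trans (le_max_left _ _)
    have hΔ0 := norm_nonneg (a - b)
    refine dq_alg hθ0 n0 n1 hM0 (norm_nonneg y) hδ (κ := k+1) ?_ ?_
    · rw [hfψ x hx]
      simp only [ContinuousLinearMap.add_apply, ContinuousLinearMap.smul_apply, innerSL_apply_apply, smul_eq_mul]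
      have m1 := Vf_mono hk a b
      rw [real_inner_comm] at m1
      have m2 : θ ≤ ‖a‖^(k-1) + ‖b‖^(k-1) := by
        have : θ ≤ ‖b‖^(k-1) := rpow_le_rpow hτ0.le (hτ x hx) (by linarith)
        have : 0 ≤ ‖a‖^(k-1) := by positivity
        linarith
      have m3 : θ/2 * (η x)^2 * ‖a-b‖^2 ≤ (η x)^2 * ⟪a - b, Vf k a - Vf k b⟫ := by
        have : θ/2 * ‖a-b‖^2 ≤ ⟪a - b, Vf k a - Vf k b⟫ := by nlinarith [sq_nonneg ‖a-b‖]
        nlinarith [sq_nonneg (η x)]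
      have m4 : |w x * (2 * η x * fderiv ℝ η x (Vf k a - Vf k b))| ≤ 2 * η x * ‖y‖ * M' * (k+1) * ‖a-b‖ := by
        have o := (ContinuousLinearMap.le_opNorm (fderiv ℝ η x) (Vf k a - Vf k b)).trans
          (mul_le_mul hMx (Vf_lip hk ga gb) (norm_nonneg _) hM0)
        rw [Real.norm_eq_abs] at o
        rw [abs_mul, abs_mul, abs_of_nonneg (by positivity : 0 ≤ 2 * η x)]
        calc _ ≤ ‖y‖ * (2 * η x * (M' * ((k+1) * ‖a-b‖))) :=
              mul_le_mul hwx (mul_le_mul_of_nonneg_left o (by positivity)) (by positivity) (norm_nonneg _)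
          _ = _ := by ring
      have := (abs_le.1 m4).1
      linarith
    · rw [hfψ x hx]
      refine (norm_add_le _ _).trans ?_
      rw [norm_smul, norm_smul, norm_smul, innerSL_apply_norm, Real.norm_eq_abs, Real.norm_eq_abs, Real.norm_eq_abs,
        abs_of_nonneg (sq_nonneg (η x)), abs_of_nonneg (by positivity : 0 ≤ 2 * η x)]
      have : |w x| * (2 * η x * ‖fderiv ℝ η x‖) ≤ ‖y‖ * (2 * η x * M') :=
        mul_le_mul hwx (mul_le_mul_of_nonneg_left hMx (by positivity)) (by positivity) (norm_nonneg _)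
      linarith
  have iL : IntegrableOn (fun x => (η x)^2 * ‖g (x+y) - g x‖^2) S := by
    refine ContinuousOn.integrableOn_compact hSc ?_
    exact (hη.continuous.pow 2).continuousOn.mul ((gc1.sub gc2).norm.pow 2)
  have tot : θ/4 * ∫ x in S, (η x)^2 * ‖g (x+y) - g x‖^2 ≤ C1 * VS * ‖y‖^2 := by
    rw [← integral_const_mul]
    have i6 : IntegrableOn (fun x => fderiv ℝ ψ x (Vf k (g (x + y)) - Vf k (g x)) - δ * ‖y‖ * ‖fderiv ℝ ψ x‖) S :=
      (i4.sub (i5.const_mul (δ * ‖y‖))).integrableOn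
    calc _ ≤ ∫ x in S, (fderiv ℝ ψ x (Vf k (g (x + y)) - Vf k (g x)) - δ * ‖y‖ * ‖fderiv ℝ ψ x‖ + C1 * ‖y‖^2) := by
          refine setIntegral_mono_on (iL.const_mul _) (i6.add (integrable_const _)) hSc.measurableSet pt
      _ = (∫ x, fderiv ℝ ψ x (Vf k (g (x + y)) - Vf k (g x))) - δ * ‖y‖ * (∫ x, ‖fderiv ℝ ψ x‖) + C1 * VS * ‖y‖^2 := by
          rw [integral_add i6 (integrable_const _), setIntegral_eq_integral_of_forall_compl_eq_zero, integral_sub i4 (i5.const_mul _), integral_const_mul,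
            integral_const, measureReal_restrict_apply_univ, smul_eq_mul]
          · ring
          · intro x hx; rw [hDψz x hx]; simp
      _ ≤ _ := by linarith
  have last : ∫ x in K, ‖g (x+y) - g x‖^2 ≤ ∫ x in S, (η x)^2 * ‖g (x+y) - g x‖^2 := by
    calc ∫ x in K, ‖g (x+y) - g x‖^2 = ∫ x in K, (η x)^2 * ‖g (x+y) - g x‖^2 := by
          refine setIntegral_congr_fun hK.measurableSet fun x hx => ?_
          simp only [(hηK x hx).self_of_nhds]; ring
      _ ≤ _ := setIntegral_mono_set iL (Filter.Eventually.of_forall fun x => by positivity) hKS.eventuallyLE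
  calc _ ≤ _ := last
    _ = 4/θ * (θ/4 * ∫ x in S, (η x)^2 * ‖g (x+y) - g x‖^2) := by field_simp
    _ ≤ 4/θ * (C1 * VS * ‖y‖^2) := mul_le_mul_of_nonneg_left tot (by positivity)
    _ = _ := by ring


theorem exhaust {Ω : Set ℂ} (hΩ : IsOpen Ω) : ∃ K : ℕ → Set ℂ, (∀ n, IsCompact (K n) ∧ K n ⊆ Ω) ∧
    ∀ L ⊆ Ω, IsCompact L → ∃ n, L ⊆ K n := by
  haveI : LocallyCompactSpace Ω := hΩ.locallyCompactSpace
  let A : CompactExhaustion Ω := CompactExhaustion.choice Ω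
  refine ⟨fun n => Subtype.val '' (A n), fun n => ⟨(A.isCompact n).image continuous_subtype_val, ?_⟩, ?_⟩
  · rintro _ ⟨y, _, rfl⟩; exact y.2
  · intro L hL hLc
    have : IsCompact (Subtype.val ⁻¹' L : Set Ω) := by
      rw [Topology.IsEmbedding.subtypeVal.isCompact_iff, Subtype.image_preimage_coe, Set.inter_eq_right.2 hL]
      exact hLc
    obtain ⟨n, hn⟩ := A.exists_superset_of_isCompact this
    exact ⟨n, fun x hx => ⟨⟨x, hL hx⟩, hn hx, rfl⟩⟩

theorem lp_sq {E : Type*} [NormedAddCommGroup E] {f : ℂ → E} {μ : Measure ℂ} (h : MemLp f 2 μ) :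
    ‖h.toLp f‖^2 = ∫ x, ‖f x‖^2 ∂μ := by
  rw [Lp.norm_toLp, h.eLpNorm_eq_integral_rpow_norm (by simp) (by simp)]
  have h0 : 0 ≤ ∫ x, ‖f x‖^2 ∂μ := integral_nonneg (fun x => by positivity)
  have e : ∀ x, ‖f x‖ ^ (2 : ℝ≥0∞).toReal = ‖f x‖^2 := fun x => by simp
  simp only [e]
  rw [ENNReal.toReal_ofReal (by positivity), ← Real.rpow_natCast, ← Real.rpow_mul h0]
  simp

theorem hs_int' {μ : Measure ℂ} {N : ℂ → ℂ →L[ℝ] ℂ} (hN : MemLp N 2 μ) :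
    Integrable (fun x => hs (N x)) μ := by
  have h := (MemLp2.int hN).const_mul 2
  refine h.mono' (continuous_hs.comp_aestronglyMeasurable hN.1) (Filter.Eventually.of_forall fun x => ?_)
  rw [Real.norm_eq_abs, abs_of_nonneg (by unfold hs; positivity)]
  exact hs_le_norm _

theorem hs_par (L M : ℂ →L[ℝ] ℂ) :
    hs (L - M) = 2 * hs L + 2 * hs M - 4 * hs ((1/2:ℝ) • L + (1/2:ℝ) • M) := by
  unfold hs
  have h : ∀ a b : ℂ, ‖a - b‖^2 = 2 * ‖a‖^2 + 2 * ‖b‖^2 - 4 * ‖(1/2:ℝ) • a + (1/2:ℝ) • b‖^2 := by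
    intro a b
    have h1 := parallelogram_law_with_norm ℝ a b
    rw [← smul_add, norm_smul]
    norm_num
    nlinarith
  have h1 := h (L 1) (M 1)
  have h2 := h (L I) (M I)
  simp only [ContinuousLinearMap.sub_apply, ContinuousLinearMap.add_apply, ContinuousLinearMap.smul_apply]
  linarith

theorem mazur {μ : Measure ℂ} {G : ℕ → ℂ → ℂ} {M : ℝ} (hG : ∀ n, ContDiff ℝ (⊤ : ℕ∞) (G n))
    (hD : ∀ n, MemLp (fderiv ℝ (G n)) 2 μ) (hM : ∀ n, ∫ x, hs (fderiv ℝ (G n) x) ∂μ ≤ M) :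
    ∃ D, MemLp D 2 μ ∧ ∀ ε > 0, ∀ n, ∃ H ∈ convexHull ℝ (G '' Set.Ici n), ContDiff ℝ (⊤ : ℕ∞) H ∧
      Integrable (fun x => ‖fderiv ℝ H x - D x‖^2) μ ∧ ∫ x, ‖fderiv ℝ H x - D x‖^2 ∂μ ≤ ε := by
  set S : ℕ → Set (ℂ → ℂ) := fun n => convexHull ℝ (G '' Set.Ici n) with hS
  set J : (ℂ → ℂ) → ℝ := fun H => ∫ x, hs (fderiv ℝ H x) ∂μ with hJ
  have hJ0 : ∀ H, 0 ≤ J H := fun H => integral_nonneg fun x => hs_nonneg _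
  have hP : ∀ n, ∀ H ∈ S n, ContDiff ℝ (⊤ : ℕ∞) H ∧ MemLp (fderiv ℝ H) 2 μ := by
    intro n
    have : S n ⊆ {H | ContDiff ℝ (⊤ : ℕ∞) H ∧ MemLp (fderiv ℝ H) 2 μ} := by
      apply convexHull_min
      · rintro _ ⟨j, _, rfl⟩; exact ⟨hG j, hD j⟩
      · rintro H ⟨h1, h2⟩ H' ⟨h1', h2'⟩ a b _ _ _
        have e : fderiv ℝ (a • H + b • H') = a • fderiv ℝ H + b • fderiv ℝ H' := by
          ext1 x
          have d1 : DifferentiableAt ℝ H x := (h1.differentiable (by simp)) x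
          have d2 : DifferentiableAt ℝ H' x := (h1'.differentiable (by simp)) x
          rw [fderiv_add (d1.const_smul a) (d2.const_smul b), fderiv_const_smul d1, fderiv_const_smul d2]
          rfl
        refine ⟨(h1.const_smul a).add (h1'.const_smul b), ?_⟩
        rw [e]
        exact (h2.const_smul a).add (h2'.const_smul b)
    exact this
  have hSm : ∀ m n, m ≤ n → S n ⊆ S m := fun m n h =>
    convexHull_mono (Set.image_mono (Set.Ici_subset_Ici.2 h))
  have hSG : ∀ n, G n ∈ S n := fun n => subset_convexHull _ _ ⟨n, Set.mem_Ici.2 le_rfl, rfl⟩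
  set d : ℕ → ℝ := fun n => sInf (J '' S n) with hd
  have hbd : ∀ n, BddBelow (J '' S n) := fun n => ⟨0, by rintro _ ⟨H, _, rfl⟩; exact hJ0 H⟩
  have hdle : ∀ n, ∀ H ∈ S n, d n ≤ J H := fun n H hH => csInf_le (hbd n) ⟨H, hH, rfl⟩
  have hne : ∀ n, (J '' S n).Nonempty := fun n => ⟨J (G n), G n, hSG n, rfl⟩
  have hdmono : Monotone d := by
    intro m n h
    apply le_csInf (hne n)
    rintro _ ⟨H, hH, rfl⟩
    exact hdle m H (hSm m n h hH)
  have hdM : ∀ n, d n ≤ M := fun n => (hdle n _ (hSG n)).trans (hM n)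
  have hch : ∀ n, ∃ H ∈ S n, J H < d n + 1 / ((n:ℝ)+1) := by
    intro n
    have : sInf (J '' S n) < d n + 1 / ((n:ℝ)+1) := by
      have : (0:ℝ) < 1 / ((n:ℝ)+1) := by positivity
      show d n < _
      linarith
    obtain ⟨_, ⟨H, hH, rfl⟩, h⟩ := exists_lt_of_csInf_lt (hne n) this
    exact ⟨H, hH, h⟩
  choose H hHS hHJ using hch
  have hHD : ∀ n, MemLp (fderiv ℝ (H n)) 2 μ := fun n => (hP n _ (hHS n)).2
  have hHC : ∀ n, ContDiff ℝ (⊤ : ℕ∞) (H n) := fun n => (hP n _ (hHS n)).1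
  set dd := ⨆ n, d n
  have hbdd : BddAbove (Set.range d) := ⟨M, by rintro _ ⟨n, rfl⟩; exact hdM n⟩
  have hdd : ∀ n, d n ≤ dd := fun n => le_ciSup hbdd n
  have hlim : Filter.Tendsto d Filter.atTop (nhds dd) := tendsto_atTop_ciSup hdmono hbdd
  have key : ∀ m n, m ≤ n → ∫ x, ‖fderiv ℝ (H m) x - fderiv ℝ (H n) x‖^2 ∂μ ≤ 2 * (2 * (dd - d m) + 4 * (1 / ((m:ℝ)+1))) := by
    intro m n hmn
    have hmid : (1/2:ℝ) • H m + (1/2:ℝ) • H n ∈ S m :=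
      (convex_convexHull ℝ _) (hHS m) (hSm m n hmn (hHS n)) (by norm_num) (by norm_num) (by norm_num)
    have e : fderiv ℝ ((1/2:ℝ) • H m + (1/2:ℝ) • H n) = fun x => (1/2:ℝ) • fderiv ℝ (H m) x + (1/2:ℝ) • fderiv ℝ (H n) x := by
      ext1 x
      have d1 : DifferentiableAt ℝ (H m) x := ((hHC m).differentiable (by simp)) x
      have d2 : DifferentiableAt ℝ (H n) x := ((hHC n).differentiable (by simp)) x
      rw [fderiv_add (d1.const_smul _) (d2.const_smul _), fderiv_const_smul d1, fderiv_const_smul d2]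
    have hmm : MemLp (fun x => (1/2:ℝ) • fderiv ℝ (H m) x + (1/2:ℝ) • fderiv ℝ (H n) x) 2 μ := by
      have := (hP m _ hmid).2
      rwa [e] at this
    have hmJ := hdle m _ hmid
    have hJe : J ((1/2:ℝ) • H m + (1/2:ℝ) • H n) = ∫ x, hs ((1/2:ℝ) • fderiv ℝ (H m) x + (1/2:ℝ) • fderiv ℝ (H n) x) ∂μ := by
      simp only [hJ]
      rw [e]
    have hsub : MemLp (fun x => fderiv ℝ (H m) x - fderiv ℝ (H n) x) 2 μ := (hHD m).sub (hHD n)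
    have hintg : ∫ x, hs (fderiv ℝ (H m) x - fderiv ℝ (H n) x) ∂μ = 2 * J (H m) + 2 * J (H n) - 4 * J ((1/2:ℝ) • H m + (1/2:ℝ) • H n) := by
      rw [hJe]
      simp only [hJ, hs_par]
      have i1 := (hs_int' (hHD m)).const_mul 2
      have i2 := (hs_int' (hHD n)).const_mul 2
      have i3 := (hs_int' hmm).const_mul 4
      have i12 : Integrable (fun x => 2 * hs (fderiv ℝ (H m) x) + 2 * hs (fderiv ℝ (H n) x)) μ := i1.add i2
      rw [integral_sub i12 i3, integral_add i1 i2, integral_const_mul, integral_const_mul, integral_const_mul]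
    have h1 : ∫ x, ‖fderiv ℝ (H m) x - fderiv ℝ (H n) x‖^2 ∂μ ≤ 2 * ∫ x, hs (fderiv ℝ (H m) x - fderiv ℝ (H n) x) ∂μ := by
      rw [← integral_const_mul]
      exact integral_mono (MemLp2.int hsub) ((hs_int' hsub).const_mul 2) (fun x => norm_le_hs _)
    have h2 := hHJ m
    have h3 := hHJ n
    have h4 : 1 / ((n:ℝ)+1) ≤ 1 / ((m:ℝ)+1) := by
      apply one_div_le_one_div_of_le (by positivity)
      have : (m:ℝ) ≤ n := by exact_mod_cast hmn
      linarith
    have h5 := hdd n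
    linarith
  set b : ℕ → ℝ := fun m => Real.sqrt (2 * (2 * (dd - d m) + 4 * (1 / ((m:ℝ)+1))))
  have hb : Filter.Tendsto b Filter.atTop (nhds 0) := by
    have h1 : Filter.Tendsto (fun m : ℕ => 2 * (2 * (dd - d m) + 4 * (1 / ((m:ℝ)+1)))) Filter.atTop (nhds (2 * (2 * (dd - dd) + 4 * 0))) :=
      ((hlim.const_sub dd).const_mul 2 |>.add (tendsto_one_div_add_atTop_nhds_zero_nat.const_mul 4)).const_mul 2
    have h2 := h1.sqrt
    have h3 : √(2 * (2 * (dd - dd) + 4 * 0)) = 0 := by simp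
    rw [h3] at h2
    exact h2
  have hcau : CauchySeq (fun n => (hHD n).toLp (fderiv ℝ (H n))) := by
    refine cauchySeq_of_le_tendsto_0' b (fun m n hmn => ?_) hb
    rw [dist_eq_norm, ← MemLp.toLp_sub]
    apply Real.le_sqrt_of_sq_le
    rw [lp_sq]
    exact key m n hmn
  obtain ⟨f, hf⟩ := cauchySeq_tendsto_of_complete hcau
  refine ⟨f, Lp.memLp f, fun ε hε n => ?_⟩
  have hf2 : Filter.Tendsto (fun n => ‖(hHD n).toLp (fderiv ℝ (H n)) - f‖^2) Filter.atTop (nhds 0) := by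
    have := ((tendsto_iff_norm_sub_tendsto_zero).1 hf).pow 2
    simpa using this
  obtain ⟨m, hm1, hm2⟩ := ((hf2.eventually (gt_mem_nhds hε)).and (Filter.eventually_ge_atTop n)).exists
  refine ⟨H m, hSm n m hm2 (hHS m), hHC m, MemLp2.int ((hHD m).sub (Lp.memLp f)), ?_⟩
  have e : (hHD m).toLp (fderiv ℝ (H m)) - f = ((hHD m).sub (Lp.memLp f)).toLp _ := by
    rw [MemLp.toLp_sub (hHD m) (Lp.memLp f), Lp.toLp_coeFn f (Lp.memLp f)]
  rw [e, lp_sq] at hm1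
  exact hm1.le


theorem jensen {N : ℂ → ℝ} (hN : Integrable N) (hN0 : ∀ t, 0 ≤ N t) (hN1 : ∫ t, N t = 1) {w : ℂ → ℂ} {M : ℝ}
    (hw : Measurable w) (hM : ∀ t, ‖w t‖ ≤ M) : ‖∫ t, N t • w t‖^2 ≤ ∫ t, N t * ‖w t‖^2 := by
  set q := ∫ t, N t • w t with hq
  have hM0 : 0 ≤ M := (norm_nonneg _).trans (hM 0)
  have i1 : Integrable (fun t => N t • w t) := hN.smul_bdd M hw.aestronglyMeasurable (Filter.Eventually.of_forall hM)
  have i2 : Integrable (fun t => N t * ‖w t‖^2) := by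
    refine hN.mul_bdd (c := M^2) (hw.norm.pow_const 2).aestronglyMeasurable (Filter.Eventually.of_forall fun t => ?_)
    rw [norm_pow, norm_norm]
    exact pow_le_pow_left₀ (norm_nonneg _) (hM t) 2
  have i3 : Integrable (fun t => ⟪q, N t • w t⟫) := i1.const_inner q
  have h3 : ∫ t, ⟪q, N t • w t⟫ = ‖q‖^2 := by
    rw [integral_inner i1, ← hq, real_inner_self_eq_norm_sq]
  have i4 : Integrable (fun t => N t * ‖q‖^2) := hN.mul_const _
  have h0 : 0 ≤ ∫ t, (N t * ‖w t‖^2 - 2 * ⟪q, N t • w t⟫ + N t * ‖q‖^2) := by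
    apply integral_nonneg
    intro t
    show 0 ≤ N t * ‖w t‖^2 - 2 * ⟪q, N t • w t⟫ + N t * ‖q‖^2
    have := norm_sub_sq_real q (w t)
    rw [real_inner_smul_right]
    have h5 := mul_nonneg (hN0 t) (sq_nonneg ‖q - w t‖)
    rw [this] at h5
    linarith
  have i5 : Integrable (fun t => N t * ‖w t‖^2 - 2 * ⟪q, N t • w t⟫) := i2.sub (i3.const_mul 2)
  rw [integral_add i5 i4, integral_sub i2 (i3.const_mul 2), integral_const_mul, h3, integral_mul_const, hN1] at h0
  linarith

theorem trans_set {ψ : ℂ → ℝ} {M r : ℝ} (hψ : Measurable ψ) (h0 : ∀ z, 0 ≤ ψ z) (hM : ∀ z, ψ z ≤ M) {K : Set ℂ} (hK : IsCompact K)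
    {t : ℂ} (ht : ‖t‖ ≤ r) : ∫ x in K, ψ (x - t) ≤ ∫ x in cthickening r K, ψ x := by
  rw [← integral_indicator hK.measurableSet, ← integral_indicator (isClosed_cthickening).measurableSet]
  rw [← integral_add_right_eq_self (μ := (volume : Measure ℂ)) _ t]
  have ic : IntegrableOn ψ (cthickening r K) := by
    haveI := finK (hK.cthickening (r := r))
    refine Integrable.of_bound hψ.aestronglyMeasurable M (Filter.Eventually.of_forall fun x => ?_)
    rw [Real.norm_eq_abs, abs_of_nonneg (h0 x)]; exact hM x
  refine integral_mono_of_nonneg (Filter.Eventually.of_forall fun x => ?_) ((integrable_indicator_iff (isClosed_cthickening).measurableSet).2 ic) (Filter.Eventually.of_forall fun x => ?_)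
  · exact Set.indicator_nonneg (fun z _ => h0 _) _
  · beta_reduce
    by_cases hx : x + t ∈ K
    · have hx2 : x ∈ cthickening r K := mem_cthickening_of_dist_le x (x+t) r K hx (by simpa [dist_eq_norm] using ht)
      rw [Set.indicator_of_mem hx, Set.indicator_of_mem hx2, add_sub_cancel_right]
    · rw [Set.indicator_of_notMem hx]
      exact Set.indicator_nonneg (fun z _ => h0 _) _

theorem moll1 {N : ℂ → ℝ} {r : ℝ} (hN : Integrable N) (hN0 : ∀ t, 0 ≤ N t) (hN1 : ∫ t, N t = 1) (hNr : ∀ t, r < ‖t‖ → N t = 0)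
    {g : ℂ → ℂ} (hg : Measurable g) (hb : ∀ x, ‖g x‖ ≤ 1) {K : Set ℂ} (hK : IsCompact K) (y : ℂ) :
    ∫ x in K, ‖(∫ t, N t • g (x + y - t)) - ∫ t, N t • g (x - t)‖^2 ≤ ∫ x in cthickening r K, ‖g (x + y) - g x‖^2 := by
  haveI := finK hK
  set ψ : ℂ → ℝ := fun z => ‖g (z + y) - g z‖^2 with hψ
  have hψm : Measurable ψ := by
    have : Measurable (fun z => g (z + y)) := hg.comp (measurable_id.add_const y)
    exact (this.sub hg).norm.pow_const 2
  have hd : ∀ z z', ‖g z - g z'‖ ≤ 2 := fun z z' => (norm_sub_le _ _).trans (by linarith [hb z, hb z'])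
  have hψ4 : ∀ z, ψ z ≤ 4 := fun z => by
    have := hd (z+y) z
    simp only [hψ]; nlinarith [norm_nonneg (g (z+y) - g z)]
  have hψ0 : ∀ z, 0 ≤ ψ z := fun z => by simp only [hψ]; positivity
  have hI : ∀ a : ℂ, Integrable (fun t => N t • g (a - t)) := fun a =>
    hN.smul_bdd 1 (hg.comp (measurable_id.const_sub a)).aestronglyMeasurable (Filter.Eventually.of_forall fun t => hb _)
  have h1 : ∀ x, ‖(∫ t, N t • g (x + y - t)) - ∫ t, N t • g (x - t)‖^2 ≤ ∫ t, N t * ψ (x - t) := by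
    intro x
    rw [← integral_sub (hI _) (hI _)]
    have := jensen hN hN0 hN1 (w := fun t => g (x + y - t) - g (x - t)) (M := 2)
      ((hg.comp (measurable_id.const_sub _)).sub (hg.comp (measurable_id.const_sub _))) (fun t => hd _ _)
    simp only [smul_sub] at this
    refine this.trans (le_of_eq ?_)
    congr 1; ext t
    simp only [hψ]
    rw [show x + y - t = x - t + y by ring]
  have hprod : Integrable (fun z : ℂ × ℂ => N z.2 * ψ (z.1 - z.2)) ((volume.restrict K).prod volume) := by
    have a1 : Integrable (fun z : ℂ × ℂ => (1:ℝ) * N z.2) ((volume.restrict K).prod volume) :=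
      (integrable_const (1:ℝ)).mul_prod hN
    simp only [one_mul] at a1
    refine a1.mul_bdd (c := 4) (hψm.comp (measurable_fst.sub measurable_snd)).aestronglyMeasurable (Filter.Eventually.of_forall fun z => ?_)
    rw [Real.norm_eq_abs, abs_of_nonneg (hψ0 _)]
    exact hψ4 _
  calc ∫ x in K, ‖(∫ t, N t • g (x + y - t)) - ∫ t, N t • g (x - t)‖^2 ≤ ∫ x in K, ∫ t, N t * ψ (x - t) :=
        integral_mono_of_nonneg (Filter.Eventually.of_forall fun x => by positivity) hprod.integral_prod_left (Filter.Eventually.of_forall h1)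
    _ = ∫ t, ∫ x in K, N t * ψ (x - t) := integral_integral_swap hprod
    _ ≤ ∫ t, N t * ∫ x in cthickening r K, ψ x := by
        refine integral_mono hprod.integral_prod_right (hN.mul_const _) fun t => ?_
        beta_reduce
        rw [integral_const_mul]
        by_cases ht : r < ‖t‖
        · rw [hNr t ht]; simp
        · exact mul_le_mul_of_nonneg_left (trans_set hψm hψ0 hψ4 hK (not_lt.1 ht)) (hN0 t)
    _ = _ := by rw [integral_mul_const, hN1, one_mul]

theorem moll2 {G : ℂ → ℂ} (hG : ContDiff ℝ (⊤ : ℕ∞) G) {K : Set ℂ} (hK : IsCompact K) {C y0 : ℝ} (hy0 : 0 < y0)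
    (h : ∀ y, ‖y‖ ≤ y0 → ∫ x in K, ‖G (x + y) - G x‖^2 ≤ C * ‖y‖^2) (v : ℂ) (hv : ‖v‖ = 1) :
    ∫ x in K, ‖fderiv ℝ G x v‖^2 ≤ C := by
  haveI := finK hK
  obtain ⟨R, hR⟩ := hK.isBounded.subset_closedBall (0:ℂ)
  obtain ⟨M, hM⟩ := (isCompact_closedBall (0:ℂ) (R+1)).exists_bound_of_continuousOn (hG.continuous_fderiv (by simp)).continuousOn
  have hdiff := hG.differentiable (by simp)
  set s : ℕ → ℝ := fun n => min y0 1 * (1 / ((n:ℝ)+1)) with hs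
  have hm0 : 0 < min y0 1 := lt_min hy0 one_pos
  have hs0 : ∀ n, 0 < s n := fun n => by simp only [hs]; positivity
  have hs1 : ∀ n, s n ≤ min y0 1 := fun n => by
    have : 1 / ((n:ℝ)+1) ≤ 1 := by rw [div_le_one (by positivity)]; linarith [n.cast_nonneg (α := ℝ)]
    simp only [hs]; nlinarith
  have hst : Filter.Tendsto s Filter.atTop (nhds 0) := by
    have := (tendsto_one_div_add_atTop_nhds_zero_nat (𝕜 := ℝ)).const_mul (min y0 1)
    rwa [mul_zero] at this
  have hlim : Filter.Tendsto (fun n => ∫ x in K, ‖(s n)⁻¹ • (G (x + s n • v) - G x)‖^2) Filter.atTop (nhds (∫ x in K, ‖fderiv ℝ G x v‖^2)) := by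
    refine tendsto_integral_of_dominated_convergence (fun _ => M^2) (fun n => ?_) (integrable_const _) (fun n => ?_) ?_
    · have : Continuous fun x => ‖(s n)⁻¹ • (G (x + s n • v) - G x)‖^2 := by
        have := hG.continuous; fun_prop
      exact this.aestronglyMeasurable
    · filter_upwards [ae_restrict_mem hK.measurableSet] with x hx
      have hx1 := mem_closedBall_zero_iff.1 (hR hx)
      have hsv : ‖s n • v‖ = s n := by rw [norm_smul, hv, mul_one, Real.norm_eq_abs, abs_of_pos (hs0 n)]
      have hs1' : s n ≤ 1 := (hs1 n).trans (min_le_right _ _)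
      have : ‖G (x + s n • v) - G x‖ ≤ M * ‖x + s n • v - x‖ := by
        refine (convex_closedBall (0:ℂ) (R+1)).norm_image_sub_le_of_norm_fderiv_le (𝕜 := ℝ) (fun z _ => hdiff z) hM ?_ ?_
        · rw [mem_closedBall_zero_iff]; linarith
        · rw [mem_closedBall_zero_iff]; refine (norm_add_le _ _).trans ?_; linarith
      rw [add_sub_cancel_left, hsv] at this
      rw [norm_pow, norm_norm, norm_smul, norm_inv, Real.norm_eq_abs, abs_of_pos (hs0 n)]
      refine pow_le_pow_left₀ (by have := hs0 n; positivity) ?_ 2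
      rw [inv_mul_le_iff₀ (hs0 n)]; linarith
    · refine Filter.Eventually.of_forall fun x => ?_
      have := (hasFDerivWithinAt_univ.2 (hdiff x).hasFDerivAt).lim (c := fun n => (s n)⁻¹) (d := fun n => s n • v) (l := Filter.atTop) (v := v)
        (by have := hst.smul_const v; rwa [zero_smul] at this) (Filter.Eventually.of_forall fun _ => Set.mem_univ _)
        (tendsto_const_nhds.congr fun n => by rw [smul_smul, inv_mul_cancel₀ (hs0 n).ne', one_smul])
      exact (this.norm).pow 2
  refine le_of_tendsto' hlim fun n => ?_
  have e : ∀ x, ‖(s n)⁻¹ • (G (x + s n • v) - G x)‖^2 = ((s n)^2)⁻¹ * ‖G (x + s n • v) - G x‖^2 := fun x => by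
    rw [norm_smul, mul_pow, norm_inv, Real.norm_eq_abs, inv_pow, sq_abs]
  simp only [e]
  rw [integral_const_mul, inv_mul_le_iff₀ (by have := hs0 n; positivity)]
  have hsv : ‖s n • v‖ = s n := by rw [norm_smul, hv, mul_one, Real.norm_eq_abs, abs_of_pos (hs0 n)]
  have := h (s n • v) (by rw [hsv]; exact (hs1 n).trans (min_le_left _ _))
  rw [hsv] at this
  linarith


theorem moll_seq {Ω : Set ℂ} (hΩ : IsOpen Ω) {g : ℂ → ℂ} (hg : ContinuousOn g Ω) (hb : ∀ x ∈ Ω, ‖g x‖ ≤ 1)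
    (hdq : ∀ K ⊆ Ω, IsCompact K → ∃ C, 0 ≤ C ∧ ∃ y0 > 0, ∀ y, ‖y‖ ≤ y0 → ∫ x in K, ‖g (x + y) - g x‖^2 ≤ C * ‖y‖^2) :
    ∃ G : ℕ → ℂ → ℂ, (∀ n, ContDiff ℝ (⊤ : ℕ∞) (G n)) ∧
      (∀ K ⊆ Ω, IsCompact K → ∃ C, 0 ≤ C ∧ ∀ n, ∫ x in K, hs (fderiv ℝ (G n) x) ≤ C) ∧
      (∀ K ⊆ Ω, IsCompact K → ∀ ε > 0, ∃ n0, ∀ n, n0 ≤ n → ∀ x ∈ K, ‖G n x - g x‖ ≤ ε) := by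
  classical
  set g0 : ℂ → ℂ := Ω.piecewise g (fun _ => 0) with hg0
  have e0 : ∀ x ∈ Ω, g0 x = g x := fun x hx => Set.piecewise_eq_of_mem _ _ _ hx
  have hm : Measurable g0 := hg.measurable_piecewise continuousOn_const hΩ.measurableSet
  have hb0 : ∀ x, ‖g0 x‖ ≤ 1 := by
    intro x
    by_cases hx : x ∈ Ω
    · rw [e0 x hx]; exact hb x hx
    · rw [hg0, Set.piecewise_eq_of_notMem _ _ _ hx]; simp
  have hli : LocallyIntegrable g0 (volume : Measure ℂ) :=
    (locallyIntegrable_const (1:ℝ)).mono hm.aestronglyMeasurable (Filter.Eventually.of_forall fun x => by simpa using hb0 x)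
  set r : ℕ → ℝ := fun n => 1 / ((n:ℝ)+1) with hr
  have hr0 : ∀ n, 0 < r n := fun n => by simp only [hr]; positivity
  have hrt : Filter.Tendsto r Filter.atTop (nhds 0) := tendsto_one_div_add_atTop_nhds_zero_nat
  set N : ℕ → ℂ → ℝ := fun n => (bmp (hr0 n)).normed volume with hN
  have hNs : ∀ n, ContDiff ℝ (⊤ : ℕ∞) (N n) := fun n => (bmp (hr0 n)).contDiff_normed
  have hNc : ∀ n, HasCompactSupport (N n) := fun n => (bmp (hr0 n)).hasCompactSupport_normed
  have hNi : ∀ n, Integrable (N n) := fun n => (hNs n).continuous.integrable_of_hasCompactSupport (hNc n)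
  have hN0 : ∀ n t, 0 ≤ N n t := fun n t => (bmp (hr0 n)).nonneg_normed t
  have hN1 : ∀ n, ∫ t, N n t = 1 := fun n => (bmp (hr0 n)).integral_normed
  have hNr : ∀ n t, r n < ‖t‖ → N n t = 0 := by
    intro n t ht
    by_contra h
    have : t ∈ Function.support (N n) := h
    rw [hN] at this
    simp only [(bmp (hr0 n)).support_normed_eq] at this
    have h2 : dist t 0 < r n := this
    rw [dist_zero_right] at h2; linarith
  set G : ℕ → ℂ → ℂ := fun n => convolution (N n) g0 (ContinuousLinearMap.lsmul ℝ ℝ) volume with hG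
  have hGe : ∀ n x, G n x = ∫ t, N n t • g0 (x - t) := fun n x => rfl
  have hGs : ∀ n, ContDiff ℝ (⊤ : ℕ∞) (G n) := fun n => (hNc n).contDiff_convolution_left _ (hNs n) hli
  refine ⟨G, hGs, ?_, ?_⟩
  · intro K hKΩ hK
    obtain ⟨r1, hr1, hrK⟩ := hK.exists_cthickening_subset_open hΩ hKΩ
    have hK' : IsCompact (cthickening r1 K) := hK.cthickening
    obtain ⟨C, hC0, y0, hy0, hC⟩ := hdq _ hrK hK'
    obtain ⟨y1, hy1, hyK⟩ := hK'.exists_cthickening_subset_open hΩ hrK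
    have hev : ∀ᶠ n in Filter.atTop, ∫ x in K, hs (fderiv ℝ (G n) x) ≤ 2 * C := by
      filter_upwards [hrt.eventually (gt_mem_nhds hr1)] with n hn
      have key : ∀ y, ‖y‖ ≤ min y0 y1 → ∫ x in K, ‖G n (x + y) - G n x‖^2 ≤ C * ‖y‖^2 := by
        intro y hy
        simp only [hGe]
        refine (moll1 (hNi n) (hN0 n) (hN1 n) (hNr n) hm hb0 hK y).trans ?_
        have s1 : ∫ x in cthickening (r n) K, ‖g0 (x + y) - g0 x‖^2 ≤ ∫ x in cthickening r1 K, ‖g0 (x + y) - g0 x‖^2 := by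
          refine setIntegral_mono_set ?_ (Filter.Eventually.of_forall fun x => by positivity) (Filter.Eventually.of_forall (cthickening_mono hn.le K))
          haveI := finK hK'
          have m1 : Measurable (fun z => g0 (z + y)) := hm.comp (measurable_id.add_const y)
          refine Integrable.of_bound ((m1.sub hm).norm.pow_const 2).aestronglyMeasurable 4 (Filter.Eventually.of_forall fun x => ?_)
          rw [norm_pow, norm_norm]
          have : ‖g0 (x+y) - g0 x‖ ≤ 2 := (norm_sub_le _ _).trans (by linarith [hb0 (x+y), hb0 x])
          nlinarith [norm_nonneg (g0 (x+y) - g0 x)]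
        refine s1.trans ?_
        have s2 : ∫ x in cthickening r1 K, ‖g0 (x + y) - g0 x‖^2 = ∫ x in cthickening r1 K, ‖g (x + y) - g x‖^2 := by
          refine setIntegral_congr_fun hK'.measurableSet fun x hx => ?_
          have hxy : x + y ∈ Ω := hyK (mem_cthickening_of_dist_le (x+y) x y1 _ hx (by simpa [dist_eq_norm] using hy.trans (min_le_right _ _)))
          simp only [e0 _ hxy, e0 _ (hrK hx)]
        rw [s2]
        exact hC y (hy.trans (min_le_left _ _))
      have a1 := moll2 (hGs n) hK (lt_min hy0 hy1) key 1 (by simp)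
      have a2 := moll2 (hGs n) hK (lt_min hy0 hy1) key I (by simp)
      have hc : Continuous (fderiv ℝ (G n)) := (hGs n).continuous_fderiv (by simp)
      have i1 : IntegrableOn (fun x => ‖fderiv ℝ (G n) x 1‖^2) K := ContinuousOn.integrableOn_compact hK (by fun_prop)
      have i2 : IntegrableOn (fun x => ‖fderiv ℝ (G n) x I‖^2) K := ContinuousOn.integrableOn_compact hK (by fun_prop)
      unfold hs
      rw [integral_add i1 i2]
      linarith
    have hbdd : Filter.IsBoundedUnder (· ≤ ·) Filter.atTop (fun n => ∫ x in K, hs (fderiv ℝ (G n) x)) := ⟨2 * C, by simpa using hev⟩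
    obtain ⟨C', hC'⟩ := hbdd.bddAbove_range
    exact ⟨max C' 0, le_max_right _ _, fun n => (hC' ⟨n, rfl⟩).trans (le_max_left _ _)⟩
  · intro K hKΩ hK ε hε
    obtain ⟨r1, hr1, hrK⟩ := hK.exists_cthickening_subset_open hΩ hKΩ
    have hK' : IsCompact (cthickening r1 K) := hK.cthickening
    have hu := Metric.uniformContinuousOn_iff.1 (hK'.uniformContinuousOn_of_continuous (hg.mono hrK)) ε hε
    obtain ⟨d, hd, hu⟩ := hu
    obtain ⟨n0, hn0⟩ := Filter.eventually_atTop.1 (hrt.eventually (gt_mem_nhds (lt_min hd hr1)))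
    refine ⟨n0, fun n hn x hx => ?_⟩
    have hrn := hn0 n hn
    have := (bmp (hr0 n)).dist_normed_convolution_le (μ := volume) (g := g0) (x₀ := x) (ε := ε) hm.aestronglyMeasurable (fun y hy => ?_)
    · rw [dist_eq_norm, e0 x (hKΩ hx)] at this
      exact this
    · have hy' : dist y x < r n := hy
      have hy2 : y ∈ cthickening r1 K := mem_cthickening_of_dist_le y x r1 _ hx (hy'.le.trans (hrn.le.trans (min_le_right _ _)))
      rw [e0 x (hKΩ hx), e0 y (hrK hy2)]
      exact (hu y hy2 x (self_subset_cthickening _ hx) (hy'.trans (hrn.trans_le (min_le_left _ _)))).le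

theorem h1_of_seq {Ω : Set ℂ} (hΩ : IsOpen Ω) {g : ℂ → ℂ} {G : ℕ → ℂ → ℂ} (hG : ∀ n, ContDiff ℝ (⊤ : ℕ∞) (G n))
    (hB : ∀ K ⊆ Ω, IsCompact K → ∃ C, 0 ≤ C ∧ ∀ n, ∫ x in K, hs (fderiv ℝ (G n) x) ≤ C)
    (hU : ∀ K ⊆ Ω, IsCompact K → ∀ ε > 0, ∃ n0, ∀ n, n0 ≤ n → ∀ x ∈ K, ‖G n x - g x‖ ≤ ε) : ∃ D, H1loc Ω g D := by
  obtain ⟨K, hK, hKe⟩ := exhaust hΩ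
  choose C hC0 hC using fun m => hB (K m) (hK m).2 (hK m).1
  set w : ℕ → ℝ := fun m => (1/2)^m / (C m + 1) with hw
  have hw0 : ∀ m, 0 < w m := fun m => by have := hC0 m; simp only [hw]; positivity
  set μ : Measure ℂ := Measure.sum fun m => ENNReal.ofReal (w m) • volume.restrict (K m) with hμ
  have hDc : ∀ n, Continuous (fderiv ℝ (G n)) := fun n => (hG n).continuous_fderiv (by simp)
  have hsc : ∀ n, Continuous (fun x => hs (fderiv ℝ (G n) x)) := fun n => continuous_hs.comp (hDc n)
  have hl : ∀ n, ∫⁻ x, ENNReal.ofReal (hs (fderiv ℝ (G n) x)) ∂μ ≤ ENNReal.ofReal 2 := by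
    intro n
    rw [hμ, lintegral_sum_measure, ← tsum_geometric_two, ENNReal.ofReal_tsum_of_nonneg (fun m => by positivity) summable_geometric_two]
    refine ENNReal.tsum_le_tsum fun m => ?_
    rw [lintegral_smul_measure, ← ofReal_integral_eq_lintegral_ofReal (hs_int' (fd_memLp (hG n) (hK m).1)) (Filter.Eventually.of_forall fun x => hs_nonneg _),
      smul_eq_mul, ← ENNReal.ofReal_mul (hw0 m).le]
    apply ENNReal.ofReal_le_ofReal
    have h1 := hC m n
    have h2 := hC0 m
    calc w m * ∫ x in K m, hs (fderiv ℝ (G n) x) ≤ w m * (C m + 1) := mul_le_mul_of_nonneg_left (by linarith) (hw0 m).le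
      _ = (1/2)^m := by simp only [hw]; field_simp
  have hintg : ∀ n, Integrable (fun x => hs (fderiv ℝ (G n) x)) μ := by
    intro n
    refine ⟨(hsc n).aestronglyMeasurable, ?_⟩
    rw [hasFiniteIntegral_iff_ofReal (Filter.Eventually.of_forall fun x => hs_nonneg _)]
    exact (hl n).trans_lt ENNReal.ofReal_lt_top
  have hDm : ∀ n, MemLp (fderiv ℝ (G n)) 2 μ := by
    intro n
    rw [memLp_two_iff_integrable_sq_norm (hDc n).aestronglyMeasurable]
    refine ((hintg n).const_mul 2).mono' ((hDc n).norm.pow 2).aestronglyMeasurable (Filter.Eventually.of_forall fun x => ?_)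
    rw [norm_pow, norm_norm]
    exact norm_le_hs _
  have hM : ∀ n, ∫ x, hs (fderiv ℝ (G n) x) ∂μ ≤ 2 := by
    intro n
    rw [integral_eq_lintegral_of_nonneg_ae (Filter.Eventually.of_forall fun x => hs_nonneg _) (hsc n).aestronglyMeasurable]
    exact ENNReal.toReal_le_of_le_ofReal (by norm_num) (hl n)
  obtain ⟨D, hD, hap⟩ := mazur hG hDm hM
  refine ⟨D, fun L hL hLc => ?_⟩
  obtain ⟨m, hm⟩ := hKe L hL hLc
  have hne : ENNReal.ofReal (w m) ≠ 0 := by rw [Ne, ENNReal.ofReal_eq_zero, not_le]; exact hw0 m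
  have hle : volume.restrict L ≤ (ENNReal.ofReal (w m))⁻¹ • μ := by
    have h1 : ENNReal.ofReal (w m) • volume.restrict (K m) ≤ μ := Measure.le_sum _ m
    have h2 : (ENNReal.ofReal (w m))⁻¹ • (ENNReal.ofReal (w m) • volume.restrict (K m)) ≤ (ENNReal.ofReal (w m))⁻¹ • μ := by
      gcongr
    rw [smul_smul, ENNReal.inv_mul_cancel hne ENNReal.ofReal_ne_top, one_smul] at h2
    exact (Measure.restrict_mono hm le_rfl).trans h2
  have hct : (ENNReal.ofReal (w m))⁻¹ ≠ ∞ := ENNReal.inv_ne_top.2 hne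
  refine ⟨hD.of_measure_le_smul hct hle, fun ε hε => ?_⟩
  obtain ⟨n0, hn0⟩ := hU L hL hLc ε hε
  obtain ⟨H, hH, hHs, hI, hHi⟩ := hap (ε * w m) (mul_pos hε (hw0 m)) n0
  refine ⟨H, hHs, ?_, ?_⟩
  · have : convexHull ℝ (G '' Set.Ici n0) ⊆ {H | ∀ x ∈ L, ‖H x - g x‖ ≤ ε} := by
      apply convexHull_min
      · rintro _ ⟨j, hj, rfl⟩ x hx; exact hn0 j hj x hx
      · intro H1 h1 H2 h2 a b ha hb hab x hx
        have e : (a • H1 + b • H2) x - g x = a • (H1 x - g x) + b • (H2 x - g x) := by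
          simp only [Pi.add_apply, Pi.smul_apply, smul_sub]
          have : g x = a • g x + b • g x := by rw [← add_smul, hab, one_smul]
          nth_rw 1 [this]; abel
        rw [e]
        refine (norm_add_le _ _).trans ?_
        rw [norm_smul, norm_smul, Real.norm_eq_abs, Real.norm_eq_abs, abs_of_nonneg ha, abs_of_nonneg hb]
        have := h1 x hx
        have := h2 x hx
        calc a * ‖H1 x - g x‖ + b * ‖H2 x - g x‖ ≤ a * ε + b * ε := by gcongr
          _ = ε := by rw [← add_mul, hab, one_mul]
    exact this hH
  · have h1 : ∫ x in L, ‖fderiv ℝ H x - D x‖^2 ≤ ∫ x, ‖fderiv ℝ H x - D x‖^2 ∂((ENNReal.ofReal (w m))⁻¹ • μ) :=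
      integral_mono_measure hle (Filter.Eventually.of_forall fun x => by positivity) (hI.smul_measure hct)
    rw [integral_smul_measure, ENNReal.toReal_inv, ENNReal.toReal_ofReal (hw0 m).le, smul_eq_mul] at h1
    refine h1.trans ?_
    rw [inv_mul_le_iff₀ (hw0 m)]; linarith

theorem h1_of_dq {Ω : Set ℂ} (hΩ : IsOpen Ω) {g : ℂ → ℂ} (hg : ContinuousOn g Ω) (hb : ∀ x ∈ Ω, ‖g x‖ ≤ 1)
    (hdq : ∀ K ⊆ Ω, IsCompact K → ∃ C, 0 ≤ C ∧ ∃ y0 > 0, ∀ y, ‖y‖ ≤ y0 → ∫ x in K, ‖g (x + y) - g x‖^2 ≤ C * ‖y‖^2) :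
    ∃ D, H1loc Ω g D := by
  obtain ⟨G, h1, h2, h3⟩ := moll_seq hΩ hg hb hdq
  exact h1_of_seq hΩ h1 h2 h3


def rot (e : ℂ) (L : ℂ →L[ℝ] ℂ) : ℂ →L[ℝ] ℂ :=
  (ContinuousLinearMap.mul ℝ ℂ (conj e)).comp (L.comp (ContinuousLinearMap.mul ℝ ℂ e))

def tr (L : ℂ →L[ℝ] ℂ) : ℝ := (L 1).re + (L I).im
def asy (L : ℂ →L[ℝ] ℂ) : ℝ := (L 1).im - (L I).re

theorem rot_apply (e : ℂ) (L : ℂ →L[ℝ] ℂ) (v : ℂ) : rot e L v = conj e * L (e * v) := rfl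

theorem rot_inv {e : ℂ} (he : ‖e‖ = 1) (L : ℂ →L[ℝ] ℂ) :
    jac (rot e L) = jac L ∧ hs (rot e L) = hs L ∧ tr (rot e L) = tr L ∧ asy (rot e L) = asy L := by
  have h : e.re^2 + e.im^2 = 1 := by
    have := Complex.normSq_eq_norm_sq e
    rw [he, Complex.normSq_apply] at this; linarith
  have h1 : (rot e L) 1 = conj e * (e.re • L 1 + e.im • L I) := by
    rw [rot_apply, mul_one, clm_apply L e]
  have h2 : (rot e L) I = conj e * ((-e.im) • L 1 + e.re • L I) := by
    rw [rot_apply, clm_apply L (e * I)]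
    congr 3 <;> simp
  have a1 : ((rot e L) 1).re = e.re * (e.re * (L 1).re + e.im * (L I).re) + e.im * (e.re * (L 1).im + e.im * (L I).im) := by
    rw [h1]; simp
  have a2 : ((rot e L) 1).im = e.re * (e.re * (L 1).im + e.im * (L I).im) - e.im * (e.re * (L 1).re + e.im * (L I).re) := by
    rw [h1]; simp; ring
  have a3 : ((rot e L) I).re = e.re * (-e.im * (L 1).re + e.re * (L I).re) + e.im * (-e.im * (L 1).im + e.re * (L I).im) := by
    rw [h2]; simp
  have a4 : ((rot e L) I).im = e.re * (-e.im * (L 1).im + e.re * (L I).im) - e.im * (-e.im * (L 1).re + e.re * (L I).re) := by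
    rw [h2]; simp; ring
  rw [jac_eq, jac_eq, hs_eq, hs_eq, tr, tr, asy, asy, a1, a2, a3, a4]
  generalize e.re = c at *
  generalize e.im = s at *
  generalize (L 1).re = p at *
  generalize (L 1).im = q at *
  generalize (L I).re = r at *
  generalize (L I).im = t at *
  refine ⟨?_, ?_, ?_, ?_⟩
  · linear_combination ((p * t - q * r) * (c^2 + s^2 + 1)) * h
  · linear_combination ((p^2 + q^2 + r^2 + t^2) * (c^2 + s^2 + 1)) * h
  · linear_combination (p + t) * h
  · linear_combination (q - r) * h

def DV (k : ℝ) (g : ℂ) : ℂ →L[ℝ] ℂ :=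
  (‖g‖^(k-1)) • ContinuousLinearMap.id ℝ ℂ + ((k-1) * ‖g‖^(k-3)) • (innerSL ℝ g).smulRight g

theorem hVf (k : ℝ) {g : ℂ} (hg : g ≠ 0) : HasFDerivAt (Vf k) (DV k g) g := by
  have hn : 0 < ‖g‖ := norm_pos_iff.2 hg
  have h1 : HasFDerivAt (fun z : ℂ => ‖z‖^2) (2 • innerSL ℝ g) g := (hasStrictFDerivAt_norm_sq g).hasFDerivAt
  have h2 := h1.rpow_const (p := (k-1)/2) (Or.inl (by positivity))
  have e : (fun z : ℂ => (‖z‖^2)^((k-1)/2)) = fun z => ‖z‖^(k-1) := by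
    ext z
    rw [← Real.rpow_natCast, ← Real.rpow_mul (norm_nonneg _)]
    congr 1; push_cast; ring
  rw [e] at h2
  have h3 := h2.smul (hasFDerivAt_id g)
  unfold Vf
  refine h3.congr_fderiv ?_
  ext1 v
  have e2 : (‖g‖^2)^((k-1)/2-1) = ‖g‖^(k-3) := by
    rw [← Real.rpow_natCast, ← Real.rpow_mul (norm_nonneg _)]
    congr 1; push_cast; ring
  simp only [DV, e2, ContinuousLinearMap.add_apply, ContinuousLinearMap.smul_apply, ContinuousLinearMap.smulRight_apply, id]
  congr 1
  rw [smul_smul]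
  congr 1
  simp only [nsmul_eq_mul, smul_eq_mul]
  push_cast
  ring

theorem Vf_cd (k : ℝ) {g : ℂ} (hg : g ≠ 0) : ContDiffAt ℝ (⊤ : ℕ∞) (Vf k) g := by
  unfold Vf
  have h1 : ContDiffAt ℝ (⊤ : ℕ∞) (fun z : ℂ => ‖z‖) g := contDiffAt_norm ℝ hg
  exact (h1.rpow_const_of_ne (norm_ne_zero_iff.2 hg)).smul contDiffAt_id

theorem rot_N (k : ℝ) {g : ℂ} (hg : g ≠ 0) (D : ℂ →L[ℝ] ℂ) (v : ℂ) :
    (rot (g / ‖g‖) ((DV k g).comp D) v).re = ‖g‖^(k-1) * (k * (rot (g / ‖g‖) D v).re) ∧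
    (rot (g / ‖g‖) ((DV k g).comp D) v).im = ‖g‖^(k-1) * (rot (g / ‖g‖) D v).im := by
  have hn : 0 < ‖g‖ := norm_pos_iff.2 hg
  rw [rot_apply, rot_apply, ContinuousLinearMap.comp_apply]
  set w := D (g / ‖g‖ * v) with hw
  set e := g / (‖g‖ : ℂ) with he
  have hge : g = (‖g‖ : ℂ) * e := by
    rw [he, mul_div_cancel₀]; exact_mod_cast hn.ne'
  have hee : conj e * e = 1 := by
    rw [mul_comm, Complex.mul_conj, Complex.normSq_eq_norm_sq, he, norm_div, Complex.norm_real, norm_norm, div_self hn.ne']; simp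
  have hin : ⟪g, w⟫ = ‖g‖ * (conj e * w).re := by
    rw [Complex.inner]
    have : w * conj g = (‖g‖ : ℂ) * (conj e * w) := by
      nth_rw 1 [hge]; rw [map_mul, Complex.conj_ofReal]; ring
    rw [this, Complex.re_ofReal_mul]
  have hDV : DV k g w = (‖g‖^(k-1)) • w + ((k-1) * ‖g‖^(k-3) * ⟪g, w⟫) • g := by
    simp [DV, smul_smul, mul_assoc]
  have hpow : ‖g‖^(k-3) * ‖g‖ * ‖g‖ = ‖g‖^(k-1) := by
    have : ‖g‖^(k-1) = ‖g‖^(k-3) * ‖g‖^(2:ℝ) := by rw [← Real.rpow_add hn]; congr 1; ring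
    rw [this, Real.rpow_two]; ring
  have key : conj e * DV k g w = ((‖g‖^(k-1) : ℝ) : ℂ) * (conj e * w) + ((‖g‖^(k-1) * ((k-1) * (conj e * w).re) : ℝ) : ℂ) := by
    rw [hDV, hin]
    have e3 : conj e * (((k-1) * ‖g‖^(k-3) * (‖g‖ * (conj e * w).re)) • g) = ((‖g‖^(k-1) * ((k-1) * (conj e * w).re) : ℝ) : ℂ) := by
      have : conj e * g = (‖g‖ : ℂ) := by
        calc conj e * g = conj e * ((‖g‖ : ℂ) * e) := by rw [← hge]
          _ = _ := by rw [mul_left_comm, hee, mul_one]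
      rw [mul_smul_comm, this, Complex.real_smul, ← hpow]
      push_cast; ring
    rw [mul_add, e3, mul_smul_comm, Complex.real_smul]
  rw [key]
  constructor
  · rw [Complex.add_re, Complex.re_ofReal_mul, Complex.ofReal_re]; ring
  · rw [Complex.add_im, Complex.im_ofReal_mul, Complex.ofReal_im]; ring

theorem unit_e {g : ℂ} (hg : g ≠ 0) : ‖g / (‖g‖ : ℂ)‖ = 1 := by
  have hn : 0 < ‖g‖ := norm_pos_iff.2 hg
  rw [norm_div, Complex.norm_real, norm_norm, div_self hn.ne']

theorem qg_h {k δ : ℝ} (hk : 1 < k) {g : ℂ} (hg : g ≠ 0) {D : ℂ →L[ℝ] ℂ} (hD : asy D = 0)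
    (ht : |tr ((DV k g).comp D)| ≤ δ) :
    qg k ((k + 1/k + 2) * δ) ((ContinuousLinearMap.mul ℝ ℂ I).comp ((DV k g).comp D)) := by
  set N := (DV k g).comp D with hN
  obtain ⟨i1, i2, i3, i4⟩ := rot_inv (unit_e hg) N
  obtain ⟨_, _, _, j4⟩ := rot_inv (unit_e hg) D
  obtain ⟨r1, r2⟩ := rot_N k hg D 1
  obtain ⟨r3, r4⟩ := rot_N k hg D I
  rw [← hN] at r1 r2 r3 r4
  rw [hD, asy] at j4
  have hδ0 : 0 ≤ δ := (abs_nonneg _).trans ht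
  have hk1 : 0 < 1/k := by positivity
  have hk2 : 0 ≤ k + 1/k - 2 := by
    have : k + 1/k - 2 = (k-1)^2/k := by field_simp; ring
    rw [this]; positivity
  have hc : 1 ≤ k + 1/k + 2 := by linarith
  have hJ : jac ((ContinuousLinearMap.mul ℝ ℂ I).comp N) = jac N := by
    rw [jac_eq, jac_eq]; simp; ring
  have hH : hs ((ContinuousLinearMap.mul ℝ ℂ I).comp N) = hs N := by
    rw [hs_eq, hs_eq]; simp; ring
  constructor
  · have : (((ContinuousLinearMap.mul ℝ ℂ I).comp N) 1).im - (((ContinuousLinearMap.mul ℝ ℂ I).comp N) I).re = tr N := by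
      simp [tr]
    rw [this]
    refine ht.trans ?_
    nlinarith
  · rw [hJ, hH, ← i1, ← i2, jac_eq, hs_eq, r1, r2, r3, r4]
    rw [tr, r1, r4] at i3
    rw [← i3] at ht
    set a := ‖g‖^(k-1)
    set x := (rot (g / ‖g‖) D 1).re
    set b := (rot (g / ‖g‖) D 1).im
    have hb : (rot (g / ‖g‖) D I).re = b := by linarith
    rw [hb]
    set y := (rot (g / ‖g‖) D I).im
    set φ := a * (k * x) + a * y with hφ
    have hφ2 : φ^2 ≤ δ^2 := by rw [← sq_abs φ]; exact pow_le_pow_left₀ (abs_nonneg _) ht 2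
    set X := a * (k * x) with hX
    have hy : a * y = φ - X := by rw [hφ]; ring
    have hkk : (k + 1/k) * (a * (k * b) * (a * b)) = (a * b)^2 * (k^2+1) := by field_simp
    have e1 : (k + 1/k) * (-(X * (a * y) - (a * b) * (a * (k * b)))) = (k+1/k) * (X^2 - X * φ) + (a * b)^2 * (k^2+1) := by
      rw [hy, ← hkk]; ring
    have e2 : ((k + 1/k + 2) * δ)^2 ≥ (k+1/k+2) * δ^2 := by
      have : 0 ≤ δ^2 := sq_nonneg _
      rw [mul_pow]
      apply mul_le_mul_of_nonneg_right _ this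
      nlinarith
    rw [e1, hy]
    have e3 : 0 ≤ (k + 1/k - 2) * ((X - φ/2)^2) := by positivity
    have e4 : (k+1/k+2) * φ^2 ≤ (k+1/k+2) * δ^2 := mul_le_mul_of_nonneg_left hφ2 (by linarith)
    have e5 : 0 ≤ (k+1/k+2) * φ^2 := by positivity
    have e6 : (a * (k * b))^2 = (a * b)^2 * k^2 := by ring
    rw [e6]
    generalize k + 1/k = κ at *
    generalize (a * b)^2 = ab at *
    have e7 : (κ - 2) * (X - φ/2)^2 = κ * (X^2 - X * φ) - 2 * (X^2 - X * φ) + (κ-2) * φ^2/4 := by ring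
    rw [e7] at e3
    linarith

theorem qg_g {k : ℝ} (hk : 1 < k) {g : ℂ} (hg : g ≠ 0) {D : ℂ →L[ℝ] ℂ} (hD : asy D = 0)
    (ht : tr ((DV k g).comp D) = 0) : qg k 0 D := by
  set N := (DV k g).comp D with hN
  obtain ⟨_, _, i3, i4⟩ := rot_inv (unit_e hg) N
  obtain ⟨j1, j2, _, j4⟩ := rot_inv (unit_e hg) D
  obtain ⟨r1, r2⟩ := rot_N k hg D 1
  obtain ⟨r3, r4⟩ := rot_N k hg D I
  rw [← hN] at r1 r2 r3 r4
  refine ⟨by rw [asy] at hD; rw [hD, abs_zero], ?_⟩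
  rw [hD, asy] at j4
  rw [← j1, ← j2, jac_eq, hs_eq]
  rw [ht, tr, r1, r4] at i3
  have ha : 0 < ‖g‖^(k-1) := Real.rpow_pos_of_pos (norm_pos_iff.2 hg) _
  set x := (rot (g / ‖g‖) D 1).re
  set b := (rot (g / ‖g‖) D 1).im
  have hb : (rot (g / ‖g‖) D I).re = b := by linarith
  rw [hb]
  set y := (rot (g / ‖g‖) D I).im
  have hy : y = - (k * x) := by
    have : ‖g‖^(k-1) * (k * x + y) = 0 := by linarith
    rcases mul_eq_zero.1 this with h | h
    · exact absurd h ha.ne'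
    · linarith
  have hk2 : 0 ≤ k + 1/k - 2 := by
    have : k + 1/k - 2 = (k-1)^2/k := by field_simp; ring
    rw [this]; positivity
  have e1 : (k + 1/k) * (-(x * y - b * b)) = (k^2+1) * x^2 + (k + 1/k) * b^2 := by
    rw [hy]; field_simp; ring
  rw [e1, hy]
  nlinarith [sq_nonneg b, mul_nonneg hk2 (sq_nonneg b)]


theorem ae_le_of_test {Ω : Set ℂ} (hΩ : IsOpen Ω) {T : ℂ → ℝ} (hT : ∀ K ⊆ Ω, IsCompact K → IntegrableOn T K) {δ : ℝ}
    (h : ∀ φ : ℂ → ℝ, ContDiff ℝ (⊤ : ℕ∞) φ → HasCompactSupport φ → tsupport φ ⊆ Ω → |∫ x, φ x * T x| ≤ δ * ∫ x, |φ x|) :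
    ∀ᵐ x, x ∈ Ω → |T x| ≤ δ := by
  obtain ⟨K, hK, hKex⟩ := exhaust hΩ
  have key : ∀ n, ∀ᵐ x, x ∈ interior (K n) → |T x| ≤ δ := by
    intro n
    set T' := (K n).indicator T with hT'
    have hi : Integrable T' := (integrable_indicator_iff (hK n).1.measurableSet).2 (hT _ (hK n).2 (hK n).1)
    set r : ℕ → ℝ := fun n => 1 / ((n:ℝ)+1) with hr
    have hr0 : ∀ n, 0 < r n := fun n => by simp only [hr]; positivity
    have hrt : Filter.Tendsto r Filter.atTop (nhds 0) := tendsto_one_div_add_atTop_nhds_zero_nat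
    have hae := ContDiffBump.ae_convolution_tendsto_right_of_locallyIntegrable (μ := (volume : Measure ℂ)) (φ := fun n => bmp (hr0 n)) (l := Filter.atTop) (K := 2) (g := T')
      hrt (Filter.Eventually.of_forall fun n => by show r n ≤ 2 * (r n / 2); linarith) hi.locallyIntegrable
    filter_upwards [hae] with x hx hxK
    have hxx : T' x = T x := Set.indicator_of_mem (interior_subset hxK) _
    rw [hxx] at hx
    obtain ⟨ρ, hρ, hρK⟩ := Metric.isOpen_iff.1 isOpen_interior x hxK
    refine le_of_tendsto hx.abs ?_
    filter_upwards [hrt.eventually (gt_mem_nhds hρ)] with m hm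
    set N : ℂ → ℝ := (bmp (hr0 m)).normed volume with hN
    have hNs : ContDiff ℝ (⊤ : ℕ∞) N := (bmp (hr0 m)).contDiff_normed
    set φ : ℂ → ℝ := fun t => N (x - t) with hφ
    have hφs : ContDiff ℝ (⊤ : ℕ∞) φ := hNs.comp (contDiff_const.sub contDiff_id)
    have hsup : tsupport φ ⊆ closedBall x (r m) := by
      apply closure_minimal _ isClosed_closedBall
      intro t ht
      have : x - t ∈ Function.support N := ht
      rw [hN, (bmp (hr0 m)).support_normed_eq, mem_ball_zero_iff] at this
      rw [mem_closedBall, dist_comm, dist_eq_norm]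
      exact this.le
    have hcb : closedBall x (r m) ⊆ K n := (closedBall_subset_ball hm).trans (hρK.trans interior_subset)
    have hφc : HasCompactSupport φ := (isCompact_closedBall x (r m)).of_isClosed_subset (isClosed_tsupport _) hsup
    have h1 := h φ hφs hφc (hsup.trans (hcb.trans (hK n).2))
    have h2 : ∫ t, |φ t| = 1 := by
      have : ∀ t, |φ t| = N (x - t) := fun t => abs_of_nonneg ((bmp (hr0 m)).nonneg_normed _)
      simp_rw [this]
      rw [integral_sub_left_eq_self (fun t => N t) (volume : Measure ℂ) x]
      exact (bmp (hr0 m)).integral_normed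
    rw [h2, mul_one] at h1
    rw [convolution_eq_swap]
    refine le_of_eq_of_le (congrArg abs (integral_congr_ae (Filter.Eventually.of_forall fun t => ?_))) h1
    show N (x - t) • T' t = N (x - t) * T t
    by_cases ht : t ∈ K n
    · rw [hT', Set.indicator_of_mem ht, smul_eq_mul]
    · have : φ t = 0 := image_eq_zero_of_notMem_tsupport (fun hh => ht (hcb (hsup hh)))
      have : N (x - t) = 0 := this
      rw [this]; simp
  filter_upwards [ae_all_iff.2 key] with x hx hxΩ
  obtain ⟨L, hL, hxL, hLΩ⟩ := exists_compact_subset hΩ hxΩ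
  obtain ⟨n, hn⟩ := hKex L hLΩ hL
  exact hx n (interior_mono hn hxL)

theorem int_supp {a b : ℂ → ℝ} (ha : Continuous a) {K : Set ℂ} (hK : IsCompact K) (haK : tsupport a ⊆ K) (hb : ContinuousOn b K) :
    Integrable (fun x => a x * b x) := by
  rw [← integrableOn_iff_integrable_of_support_subset (s := K)]
  · exact ContinuousOn.integrableOn_compact hK (ha.continuousOn.mul hb)
  · intro x hx
    by_contra hxK
    exact hx (by simp [image_eq_zero_of_notMem_tsupport (fun hh => hxK (haK hh))])

theorem ibp_lin {U : Set ℂ} {F : ℂ → ℂ} {N : ℂ → ℂ →L[ℝ] ℂ} (h : H1loc U F N) (hF : ContinuousOn F U)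
    {ζ : ℂ → ℝ} (hζ : ContDiff ℝ (⊤ : ℕ∞) ζ) (hc : HasCompactSupport ζ) (hζU : tsupport ζ ⊆ U) (v : ℂ) (l : ℂ →L[ℝ] ℝ) :
    Integrable (fun x => ζ x * l (N x v)) ∧ Integrable (fun x => fderiv ℝ ζ x v * l (F x)) ∧
    ∫ x, ζ x * l (N x v) = -∫ x, fderiv ℝ ζ x v * l (F x) := by
  set K := tsupport ζ with hKd
  have hK : IsCompact K := hc.isCompact
  have hζ' : Continuous (fun x => fderiv ℝ ζ x v) := (hζ.continuous_fderiv (by simp)).clm_apply continuous_const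
  obtain ⟨hN, hap⟩ := h _ hζU hK
  haveI := finK hK
  have hFK := hF.mono hζU
  obtain ⟨M, hM⟩ := hK.exists_bound_of_continuousOn hζ.continuous.continuousOn
  obtain ⟨M', hM'⟩ := hK.exists_bound_of_continuousOn hζ'.continuousOn
  have hz : ∀ x ∉ K, ζ x = 0 := fun x hx => image_eq_zero_of_notMem_tsupport hx
  have hz' : ∀ x ∉ K, fderiv ℝ ζ x v = 0 := fun x hx => by
    rw [image_eq_zero_of_notMem_tsupport (fun hh => hx (tsupport_fderiv_subset ℝ hh))]; simp
  have hsz' : tsupport (fun x => fderiv ℝ ζ x v) ⊆ K := by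
    apply closure_minimal _ (isClosed_tsupport _)
    intro x hx
    by_contra hxK
    exact hx (hz' x hxK)
  have int1 : ∀ N : ℂ → ℂ →L[ℝ] ℂ, MemLp N 2 (volume.restrict K) → IntegrableOn (fun x => ζ x * l (N x v)) K := by
    intro N hN
    have c : Continuous (fun L : ℂ →L[ℝ] ℂ => l (L v)) := by fun_prop
    have i0 : Integrable N (volume.restrict K) := hN.integrable (by norm_num)
    refine (i0.norm.const_mul (|M| * (‖l‖ * ‖v‖))).mono' (hζ.continuous.aestronglyMeasurable.mul (c.comp_aestronglyMeasurable hN.1)) ?_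
    filter_upwards [ae_restrict_mem hK.measurableSet] with x hx
    rw [norm_mul, mul_assoc]
    refine mul_le_mul ((hM x hx).trans (le_abs_self _)) ?_ (norm_nonneg _) (abs_nonneg _)
    refine (l.le_opNorm _).trans ?_
    rw [mul_assoc]
    refine mul_le_mul_of_nonneg_left ?_ (norm_nonneg _)
    rw [mul_comm]; exact (N x).le_opNorm v
  have int2 : ∀ G : ℂ → ℂ, ContinuousOn G K → Integrable (fun x => fderiv ℝ ζ x v * l (G x)) := by
    intro G hG
    exact int_supp hζ' hK hsz' (l.continuous.comp_continuousOn hG)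
  have int1' : ∀ N : ℂ → ℂ →L[ℝ] ℂ, MemLp N 2 (volume.restrict K) → Integrable (fun x => ζ x * l (N x v)) := by
    intro N hN
    rw [← integrableOn_iff_integrable_of_support_subset (s := K)]
    · exact int1 N hN
    · intro x hx
      by_contra hxK
      exact hx (by simp [hz x hxK])
  have key : ∀ ε > 0, |(∫ x in K, (ζ x * l (N x v) + fderiv ℝ ζ x v * l (F x)))| ≤ ε := by
    intro ε hε
    have hC0 : 0 ≤ |M| * (‖l‖ * ‖v‖) + |M'| * ‖l‖ := by positivity
    obtain ⟨η, hη, hlim⟩ := lim_form hK (F := F) hN (fun x w L => ζ x * l (L v) + fderiv ℝ ζ x v * l w) hC0 (by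
      intro x hx w' L L' hw
      have e : ζ x * l (L' v) + fderiv ℝ ζ x v * l w' - (ζ x * l (L v) + fderiv ℝ ζ x v * l (F x)) = ζ x * l ((L' - L) v) + fderiv ℝ ζ x v * l (w' - F x) := by
        simp; ring
      rw [e]
      refine (abs_add_le _ _).trans ?_
      rw [abs_mul, abs_mul]
      have z1 : |ζ x| ≤ |M| := (hM x hx).trans (le_abs_self _)
      have z2 : |fderiv ℝ ζ x v| ≤ |M'| := (hM' x hx).trans (le_abs_self _)
      have b1 : |l ((L' - L) v)| ≤ ‖l‖ * ‖v‖ * ‖L' - L‖ := by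
        refine (l.le_opNorm _).trans ?_
        rw [mul_assoc]
        refine mul_le_mul_of_nonneg_left ?_ (norm_nonneg _)
        rw [mul_comm]; exact (L' - L).le_opNorm v
      have b2 : |l (w' - F x)| ≤ ‖l‖ * ‖w' - F x‖ := l.le_opNorm _
      set E := ‖L' - L‖
      set W := ‖w' - F x‖
      have hE : 0 ≤ E := norm_nonneg _
      have hW : 0 ≤ W := norm_nonneg _
      have hL := norm_nonneg L
      have t2 : E ≤ (E^2 + E * (1 + ‖L‖) + W * (1 + ‖L‖)^2) := by
        have : 0 ≤ W * (1 + ‖L‖)^2 := by positivity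
        linarith [mul_nonneg hE hL, sq_nonneg E, mul_one_add E ‖L‖]
      have t3 : W ≤ (E^2 + E * (1 + ‖L‖) + W * (1 + ‖L‖)^2) := by
        have : 0 ≤ E * (1 + ‖L‖) := by positivity
        have : W * 1 ≤ W * (1 + ‖L‖)^2 := mul_le_mul_of_nonneg_left (by nlinarith) hW
        linarith [sq_nonneg E]
      rw [add_mul]
      refine add_le_add ?_ ?_
      · rw [mul_assoc]
        exact mul_le_mul z1 (b1.trans (mul_le_mul_of_nonneg_left t2 (by positivity))) (abs_nonneg _) (abs_nonneg _)
      · rw [mul_assoc]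
        exact mul_le_mul z2 (b2.trans (mul_le_mul_of_nonneg_left t3 (by positivity))) (abs_nonneg _) (abs_nonneg _))
      ((int1 N hN).add (int2 F hFK).integrableOn)
      (fun G hG => (int1 _ (fd_memLp hG hK)).add (int2 G hG.continuous.continuousOn).integrableOn) hε
    obtain ⟨G, g1, g2, g3⟩ := hap η hη
    have h1 := hlim G g1 g2 g3
    have h3 : ∫ x in K, (ζ x * l (fderiv ℝ G x v) + fderiv ℝ ζ x v * l (G x)) = 0 := by
      rw [setIntegral_eq_integral_of_forall_compl_eq_zero (fun x hx => by simp [hz x hx, hz' x hx])]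
      rw [integral_add (int1' _ (fd_memLp g1 hK)) (int2 G g1.continuous.continuousOn)]
      have hd : ∀ x, fderiv ℝ (fun y => l (G y)) x v = l (fderiv ℝ G x v) := by
        intro x
        have := (l.hasFDerivAt (x := G x)).comp x (g1.differentiable (by simp) x).hasFDerivAt
        have e : fderiv ℝ (fun y => l (G y)) x = l.comp (fderiv ℝ G x) := this.fderiv
        rw [e]; rfl
      have := integral_mul_fderiv_eq_neg_fderiv_mul_of_integrable (μ := (volume : Measure ℂ)) (f := ζ) (g := fun x => l (G x)) (v := v)
        (int2 G g1.continuous.continuousOn) (by simp_rw [hd]; exact int1' _ (fd_memLp g1 hK))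
        (int_supp hζ.continuous hK subset_rfl (l.continuous.comp g1.continuous).continuousOn)
        (fun x _ => hζ.differentiable (by simp) x) (fun x _ => (l.differentiableAt).comp x (g1.differentiable (by simp) x))
      simp_rw [hd] at this
      rw [this]; ring
    beta_reduce at h1
    rw [h3, zero_sub, abs_neg] at h1
    exact h1
  have key2 : (∫ x in K, (ζ x * l (N x v) + fderiv ℝ ζ x v * l (F x))) = 0 := by
    apply abs_eq_zero.1
    apply le_antisymm _ (abs_nonneg _)
    apply le_of_forall_pos_le_add
    intro ε hε
    linarith [key ε hε]
  rw [setIntegral_eq_integral_of_forall_compl_eq_zero (fun x hx => by simp [hz x hx, hz' x hx]),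
    integral_add (int1' N hN) (int2 F hFK)] at key2
  exact ⟨int1' N hN, int2 F hFK, by linarith⟩


theorem fderiv_app_smooth {φ : ℂ → ℝ} (hφ : ContDiff ℝ (⊤ : ℕ∞) φ) (v : ℂ) : ContDiff ℝ (⊤ : ℕ∞) (fun x => fderiv ℝ φ x v) :=
  (hφ.fderiv_right (m := (⊤ : ℕ∞)) (by simp)).clm_apply contDiff_const

theorem tsupp_app (φ : ℂ → ℝ) (v : ℂ) : tsupport (fun x => fderiv ℝ φ x v) ⊆ tsupport φ := by
  apply closure_minimal _ (isClosed_tsupport _)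
  intro x hx
  by_contra hxK
  refine hx ?_
  show fderiv ℝ φ x v = 0
  rw [image_eq_zero_of_notMem_tsupport (fun hh => hxK (tsupport_fderiv_subset ℝ hh))]; simp

/-- curl of a gradient vanishes, tested -/
theorem curl_test {k δ : ℝ} {c : ℂ} {R : ℝ} {u : ℂ → ℝ} {g : ℂ → ℂ} (h : Sol k δ c R u g) {φ : ℂ → ℝ}
    (hφ : ContDiff ℝ (⊤ : ℕ∞) φ) (hc : HasCompactSupport φ) (hs : tsupport φ ⊆ ball c R) :
    ∫ x, fderiv ℝ φ x 1 * (g x).im = ∫ x, fderiv ℝ φ x I * (g x).re := by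
  set K := tsupport φ with hKd
  have hK : IsCompact K := hc.isCompact
  have hu : ContinuousOn u K := (h.cd.continuousOn).mono hs
  have hgK : ContinuousOn g K := h.cont.mono hs
  have cre : ContinuousOn (fun x => (g x).re) K := Complex.continuous_re.comp_continuousOn hgK
  have cim : ContinuousOn (fun x => (g x).im) K := Complex.continuous_im.comp_continuousOn hgK
  have d1 : ∀ x ∈ K, fderiv ℝ u x 1 = (g x).re := by
    intro x hx
    rw [(h.grad x (hs hx)).fderiv, innerSL_apply_apply, Complex.inner]; simp
  have dI : ∀ x ∈ K, fderiv ℝ u x I = (g x).im := by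
    intro x hx
    rw [(h.grad x (hs hx)).fderiv, innerSL_apply_apply, Complex.inner]; simp
  have gen : ∀ v w : ℂ, ∀ b : ℂ → ℝ, ContinuousOn b K → (∀ x ∈ K, fderiv ℝ u x w = b x) →
      ∫ x, fderiv ℝ φ x v * b x = - ∫ x, fderiv ℝ (fun y => fderiv ℝ φ y v) x w * u x := by
    intro v w b hb hbe
    have hsub : tsupport (fun x => fderiv ℝ φ x v) ⊆ K := tsupp_app φ v
    have hz : ∀ x ∉ K, fderiv ℝ φ x v = 0 := fun x hx => image_eq_zero_of_notMem_tsupport (f := fun x => fderiv ℝ φ x v) (fun hh => hx (hsub hh))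
    have e : (fun x => fderiv ℝ φ x v * b x) = fun x => fderiv ℝ φ x v * fderiv ℝ u x w := by
      ext x
      by_cases hx : x ∈ K
      · rw [hbe x hx]
      · rw [hz x hx]; simp
    have i1 := int_supp (fderiv_app_smooth hφ v).continuous hK hsub hb
    rw [e] at i1 ⊢
    exact integral_mul_fderiv_eq_neg_fderiv_mul_of_integrable (μ := (volume : Measure ℂ)) (f := fun x => fderiv ℝ φ x v) (g := u) (v := w)
      (int_supp (fderiv_app_smooth (fderiv_app_smooth hφ v) w).continuous hK ((tsupp_app _ w).trans hsub) hu) i1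
      (int_supp (fderiv_app_smooth hφ v).continuous hK hsub hu)
      (fun x _ => (fderiv_app_smooth hφ v).differentiable (by simp) x) (fun x hx => (h.grad x (hs (hsub hx))).differentiableAt)
  rw [gen 1 I _ cim dI, gen I 1 _ cre d1]
  have hsym : ∀ x, fderiv ℝ (fun y => fderiv ℝ φ y 1) x I = fderiv ℝ (fun y => fderiv ℝ φ y I) x 1 := by
    intro x
    have hd : DifferentiableAt ℝ (fderiv ℝ φ) x := (hφ.fderiv_right (m := (⊤ : ℕ∞)) (by simp)).differentiable (by simp) x
    have ee : ∀ v w : ℂ, fderiv ℝ (fun y => fderiv ℝ φ y v) x w = fderiv ℝ (fderiv ℝ φ) x w v := by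
      intro v w
      rw [fderiv_clm_apply hd (differentiableAt_const v)]
      simp
    rw [ee, ee]
    exact (hφ.contDiffAt.isSymmSndFDerivAt (by rw [minSmoothness_of_isRCLikeNormedField]; exact WithTop.coe_le_coe.2 (le_top : (2:ℕ∞) ≤ ⊤))).eq I 1
  simp_rw [hsym]

theorem H1V {k : ℝ} {U : Set ℂ} {g : ℂ → ℂ} {D : ℂ → ℂ →L[ℝ] ℂ} (h : H1loc U g D) (hg : ContinuousOn g U) (hg0 : ∀ x ∈ U, g x ≠ 0) :
    H1loc U (fun x => Vf k (g x)) (fun x => (DV k (g x)).comp (D x)) := by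
  apply h.comp hg
  intro K hKU hK
  have hK' : IsCompact (g '' K) := hK.image_of_continuousOn (hg.mono hKU)
  have hK0 : g '' K ⊆ {0}ᶜ := by
    rintro _ ⟨x, hx, rfl⟩; exact hg0 x (hKU hx)
  obtain ⟨ξ, x1, x2, x3, x4, x5⟩ := cutoff hK' isOpen_compl_singleton hK0
  refine ⟨fun z => ξ z • Vf k z, ?_, ?_, ?_⟩
  · rw [contDiff_iff_contDiffAt]
    intro z
    by_cases hz : z = 0
    · have : (fun z => ξ z • Vf k z) =ᶠ[nhds z] fun _ => 0 := by
        have hzn : z ∉ tsupport ξ := fun hh => x3 hh hz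
        filter_upwards [(isClosed_tsupport ξ).isOpen_compl.mem_nhds hzn] with y hy
        rw [image_eq_zero_of_notMem_tsupport hy, zero_smul]
      exact contDiffAt_const.congr_of_eventuallyEq this
    · exact x1.contDiffAt.smul (Vf_cd k hz)
  · intro x hx
    beta_reduce
    rw [(x5 _ ⟨x, hx, rfl⟩).self_of_nhds, one_smul]
  · intro x hx
    have : (fun z => ξ z • Vf k z) =ᶠ[nhds (g x)] Vf k := by
      filter_upwards [x5 _ ⟨x, hx, rfl⟩] with y hy
      rw [hy, one_smul]
    rw [this.fderiv_eq, (hVf k (hg0 x (hKU hx))).fderiv]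

theorem H1mulI {U : Set ℂ} {g : ℂ → ℂ} {D : ℂ → ℂ →L[ℝ] ℂ} (h : H1loc U g D) (hg : ContinuousOn g U) :
    H1loc U (fun x => I * g x) (fun x => (ContinuousLinearMap.mul ℝ ℂ I).comp (D x)) := by
  apply h.comp hg
  intro K hKU hK
  refine ⟨fun z => ContinuousLinearMap.mul ℝ ℂ I z, (ContinuousLinearMap.mul ℝ ℂ I).contDiff, fun x _ => rfl, fun x _ => ?_⟩
  rw [(ContinuousLinearMap.mul ℝ ℂ I).fderiv]

theorem sol_D {k δ : ℝ} (hk : 1 < k) (hδ : 0 ≤ δ) {R : ℝ} {c : ℂ} {u : ℂ → ℝ} {g : ℂ → ℂ} (h : Sol k δ c R u g)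
    (hg : ∀ x ∈ ball c R, ‖g x‖ ≤ 1) :
    ∃ D, H1loc {x | x ∈ ball c R ∧ g x ≠ 0} g D ∧ (∀ᵐ x, x ∈ ball c R → g x ≠ 0 → asy (D x) = 0 ∧ |tr ((DV k (g x)).comp (D x))| ≤ δ) := by
  set Ω := {x | x ∈ ball c R ∧ g x ≠ 0} with hΩ
  have hΩo : IsOpen Ω := h.cont.isOpen_inter_preimage isOpen_ball isOpen_compl_singleton
  have hΩb : Ω ⊆ ball c R := fun x hx => hx.1
  have hgc : ContinuousOn g Ω := h.cont.mono hΩb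
  obtain ⟨D, hD⟩ := h1_of_dq hΩo hgc (fun x hx => hg x hx.1) (fun K hK hKc => by
    obtain ⟨C, hC, y0, hy0, -, hh⟩ := dq hk hδ h hg hKc hK
    exact ⟨C, hC, y0, hy0, hh⟩)
  refine ⟨D, hD, ?_⟩
  have hV := H1V (k := k) hD hgc (fun x hx => hx.2)
  have hVc : ContinuousOn (fun x => Vf k (g x)) Ω := (Vf_cont hk).comp_continuousOn hgc
  have lint : ∀ (N : ℂ → ℂ →L[ℝ] ℂ) (F : ℂ → ℂ), H1loc Ω F N → ∀ A : (ℂ →L[ℝ] ℂ) → ℝ, Continuous A → (∃ M, ∀ L, |A L| ≤ M * ‖L‖) →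
      ∀ K ⊆ Ω, IsCompact K → IntegrableOn (fun x => A (N x)) K := by
    rintro N F hN A hA ⟨M, hM⟩ K hK hKc
    haveI := finK hKc
    have i0 : Integrable N (volume.restrict K) := ((hN K hK hKc).1).integrable (by norm_num)
    exact (i0.norm.const_mul M).mono' (hA.comp_aestronglyMeasurable i0.1) (Filter.Eventually.of_forall fun x => hM _)
  have b1 : ∀ L : ℂ →L[ℝ] ℂ, |asy L| ≤ 2 * ‖L‖ := by
    intro L
    rw [asy]
    have a1 := (Complex.abs_im_le_norm (L 1)).trans (n1 L)
    have a2 := (Complex.abs_re_le_norm (L I)).trans (nI L)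
    refine (abs_sub _ _).trans ?_
    linarith
  have b2 : ∀ L : ℂ →L[ℝ] ℂ, |tr L| ≤ 2 * ‖L‖ := by
    intro L
    rw [tr]
    have a1 := (Complex.abs_re_le_norm (L 1)).trans (n1 L)
    have a2 := (Complex.abs_im_le_norm (L I)).trans (nI L)
    refine (abs_add_le _ _).trans ?_
    linarith
  have c1 : Continuous asy := by unfold asy; fun_prop
  have c2 : Continuous tr := by unfold tr; fun_prop
  have A1 := ae_le_of_test hΩo (δ := 0) (lint D g hD asy c1 ⟨2, b1⟩) (by
    intro φ p1 p2 p3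
    obtain ⟨i1, i2, i3⟩ := ibp_lin hD hgc p1 p2 p3 1 Complex.imCLM
    obtain ⟨j1, j2, j3⟩ := ibp_lin hD hgc p1 p2 p3 I Complex.reCLM
    simp only [Complex.imCLM_apply, Complex.reCLM_apply] at i1 i2 i3 j1 j2 j3
    have : ∫ x, φ x * asy (D x) = 0 := by
      simp only [asy, mul_sub]
      rw [integral_sub i1 j1, i3, j3, curl_test h p1 p2 (p3.trans hΩb)]; ring
    rw [this]; simp)
  have A2 := ae_le_of_test hΩo (δ := δ) (lint _ _ hV tr c2 ⟨2, b2⟩) (by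
    intro φ p1 p2 p3
    obtain ⟨i1, i2, i3⟩ := ibp_lin hV hVc p1 p2 p3 1 Complex.reCLM
    obtain ⟨j1, j2, j3⟩ := ibp_lin hV hVc p1 p2 p3 I Complex.imCLM
    simp only [Complex.imCLM_apply, Complex.reCLM_apply] at i1 i2 i3 j1 j2 j3
    have : ∫ x, φ x * tr ((DV k (g x)).comp (D x)) = -∫ x, fderiv ℝ φ x (Vf k (g x)) := by
      simp only [tr, mul_add]
      rw [integral_add i1 j1, i3, j3, ← neg_add, ← integral_add i2 j2]
      congr 2
      ext x
      rw [clm_real (fderiv ℝ φ x) (Vf k (g x))]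
      ring
    rw [this, abs_neg]
    exact h.weak φ p1 p2 (p3.trans hΩb))
  filter_upwards [A1, A2] with x h1 h2 hx hx0
  refine ⟨?_, h2 ⟨hx, hx0⟩⟩
  exact abs_eq_zero.1 (le_antisymm (h1 ⟨hx, hx0⟩) (abs_nonneg _))

theorem sol_QGh {k δ : ℝ} (hk : 1 < k) (hδ : 0 ≤ δ) {R : ℝ} {c : ℂ} {u : ℂ → ℝ} {g : ℂ → ℂ} (h : Sol k δ c R u g)
    (hg : ∀ x ∈ ball c R, ‖g x‖ ≤ 1) : ∃ D, QG k ((k + 1/k + 2) * δ) (ball c R) (fun x => I * Vf k (g x)) D := by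
  obtain ⟨D, hD, hae⟩ := sol_D hk hδ h hg
  set Ω := {x | x ∈ ball c R ∧ g x ≠ 0} with hΩ
  have hΩb : Ω ⊆ ball c R := fun x hx => hx.1
  have hgc : ContinuousOn g Ω := h.cont.mono hΩb
  have hV := H1V (k := k) hD hgc (fun x hx => hx.2)
  have hVc : ContinuousOn (fun x => Vf k (g x)) (ball c R) := (Vf_cont hk).comp_continuousOn h.cont
  have h0 : ∀ z, I * Vf k z ≠ 0 ↔ z ≠ 0 := by
    intro z
    have : Vf k z = 0 ↔ z = 0 := ⟨fun hh => Vf_inj hk (hh.trans (Vf_zero k).symm), fun hh => by rw [hh, Vf_zero]⟩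
    simp [this]
  have hset : {x | x ∈ ball c R ∧ I * Vf k (g x) ≠ 0} = Ω := by
    ext x; simp only [hΩ, Set.mem_setOf_eq, h0]
  refine ⟨_, ⟨isOpen_ball, continuousOn_const.mul hVc, ?_, by rw [hset]; exact H1mulI hV (hVc.mono hΩb), ?_⟩⟩
  · intro x hx
    rw [norm_mul, Complex.norm_I, one_mul, Vf_norm hk]
    exact Real.rpow_le_one (norm_nonneg _) (hg x hx) (by linarith)
  · filter_upwards [hae] with x hx hxb hx0
    rw [h0] at hx0
    obtain ⟨a1, a2⟩ := hx hxb hx0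
    exact qg_h hk hx0 a1 a2

theorem sol_QGg {k : ℝ} (hk : 1 < k) {R : ℝ} {c : ℂ} {u : ℂ → ℝ} {g : ℂ → ℂ} (h : Sol k 0 c R u g)
    (hg : ∀ x ∈ ball c R, ‖g x‖ ≤ 1) : ∃ D, QG k 0 (ball c R) g D := by
  obtain ⟨D, hD, hae⟩ := sol_D hk le_rfl h hg
  refine ⟨D, ⟨isOpen_ball, h.cont, hg, hD, ?_⟩⟩
  filter_upwards [hae] with x hx hxb hx0
  obtain ⟨a1, a2⟩ := hx hxb hx0
  exact qg_g hk hx0 a1 (abs_eq_zero.1 (le_antisymm a2 (abs_nonneg _)))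

theorem propA {k : ℝ} (hk : 1 < k) : ∃ α C : ℝ, 1/k < α ∧ α < 1 ∧ 0 < C ∧ ∀ δ u g, 0 ≤ δ → δ ≤ 1 → Sol k δ 0 1 u g → (∀ x ∈ ball (0:ℂ) 1, ‖g x‖ ≤ 1) →
    ∀ x ∈ closedBall (0:ℂ) (1/32), ∀ y ∈ closedBall (0:ℂ) (1/32), ‖Vf k (g x) - Vf k (g y)‖ ≤ C * ‖x - y‖^α := by
  obtain ⟨l, C, h1, h2, h3, h4⟩ := propC hk
  have hk1 : 0 < 1/k := by positivity
  refine ⟨l, C * (1 + (k+1/k+2)) + 1, h1, h2, by positivity, ?_⟩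
  intro δ u g hδ hδ1 hs hg x hx y hy
  obtain ⟨D, hD⟩ := sol_QGh hk hδ hs hg
  have := h4 _ _ D (by positivity) hD x hx y hy
  rw [← mul_sub, norm_mul, Complex.norm_I, one_mul] at this
  refine this.trans ?_
  apply mul_le_mul_of_nonneg_right _ (by positivity)
  have : C * (1 + (k + 1/k + 2) * δ) ≤ C * (1 + (k+1/k+2)) := by
    apply mul_le_mul_of_nonneg_left _ h3
    have : (k + 1/k + 2) * δ ≤ (k + 1/k + 2) * 1 := mul_le_mul_of_nonneg_left hδ1 (by positivity)
    linarith
  linarith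

theorem propB {k : ℝ} (hk : 1 < k) : ∃ α C : ℝ, 1/k < α ∧ α < 1 ∧ 0 < C ∧ ∀ u g, Sol k 0 0 1 u g → (∀ x ∈ ball (0:ℂ) 1, ‖g x‖ ≤ 1) → g 0 = 0 →
    ∀ x ∈ closedBall (0:ℂ) (1/32), ‖g x‖ ≤ C * ‖x‖^α := by
  obtain ⟨l, C, h1, h2, h3, h4⟩ := propC hk
  refine ⟨l, C + 1, h1, h2, by positivity, ?_⟩
  intro u g hs hg hg0 x hx
  obtain ⟨D, hD⟩ := sol_QGg hk hs hg
  have := h4 _ _ D le_rfl hD x hx 0 (by simp)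
  rw [hg0, sub_zero, sub_zero, add_zero, mul_one] at this
  refine this.trans ?_
  apply mul_le_mul_of_nonneg_right _ (by positivity)
  linarith


theorem Sol.mono {k δ δ' : ℝ} {c : ℂ} {R : ℝ} {u : ℂ → ℝ} {g : ℂ → ℂ} (h : Sol k δ c R u g) (hd : δ ≤ δ') : Sol k δ' c R u g :=
  ⟨h.cont, h.grad, fun φ a b d => (h.weak φ a b d).trans (mul_le_mul_of_nonneg_right hd (integral_nonneg fun _ => abs_nonneg _))⟩

theorem aff_ball {c c' : ℂ} {R ρ : ℝ} (hρ : 0 < ρ) (hb : ball c' ρ ⊆ ball c R) {y : ℂ} (hy : y ∈ ball (0:ℂ) 1) : c' + ρ • y ∈ ball c R := by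
  apply hb
  rw [mem_ball_zero_iff] at hy
  rw [mem_ball_iff_norm, add_sub_cancel_left, norm_smul, Real.norm_eq_abs, abs_of_pos hρ]
  nlinarith

theorem Sol.scale {k δ : ℝ} (hk : 1 < k) {c : ℂ} {R : ℝ} {u : ℂ → ℝ} {g : ℂ → ℂ} (h : Sol k δ c R u g) {ρ m : ℝ} (hρ : 0 < ρ) (hm : 0 < m)
    {c' : ℂ} (hb : ball c' ρ ⊆ ball c R) :
    Sol k (ρ * δ / m^k) 0 1 (fun y => (ρ * m)⁻¹ * (u (c' + ρ • y) - u c')) (fun y => m⁻¹ • g (c' + ρ • y)) := by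
  have haff : ∀ y : ℂ, HasFDerivAt (fun y : ℂ => c' + ρ • y) (ρ • ContinuousLinearMap.id ℝ ℂ) y := by
    intro y
    exact ((hasFDerivAt_id y).const_smul ρ).const_add c'
  refine ⟨?_, ?_, ?_⟩
  · have : ContinuousOn (fun y : ℂ => g (c' + ρ • y)) (ball 0 1) :=
      h.cont.comp (by fun_prop) (fun y hy => aff_ball hρ hb hy)
    exact this.const_smul m⁻¹
  · intro y hy
    have h1 := (h.grad _ (aff_ball hρ hb hy)).comp y (haff y)
    have h2 := (h1.sub_const (u c')).const_mul (ρ * m)⁻¹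
    refine h2.congr_fderiv ?_
    ext1 v
    simp only [ContinuousLinearMap.smul_apply, ContinuousLinearMap.comp_apply, innerSL_apply_apply, ContinuousLinearMap.id_apply, inner_smul_left, inner_smul_right, smul_eq_mul]
    simp only [conj_trivial]
    field_simp
  · intro φ p1 p2 p3
    set ψ : ℂ → ℝ := fun x => φ (ρ⁻¹ • (x - c')) with hψ
    have hinv : ∀ y : ℂ, ρ⁻¹ • (c' + ρ • y - c') = y := by
      intro y; rw [add_sub_cancel_left, smul_smul, inv_mul_cancel₀ hρ.ne', one_smul]
    have hinv2 : ∀ x : ℂ, c' + ρ • (ρ⁻¹ • (x - c')) = x := by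
      intro x; rw [smul_smul, mul_inv_cancel₀ hρ.ne', one_smul]; ring
    have hψs : ContDiff ℝ (⊤ : ℕ∞) ψ := p1.comp ((contDiff_id.sub contDiff_const).const_smul ρ⁻¹)
    have hsup : tsupport ψ ⊆ (fun y : ℂ => c' + ρ • y) '' tsupport φ := by
      apply closure_minimal
      · intro x hx
        refine ⟨ρ⁻¹ • (x - c'), subset_tsupport _ hx, hinv2 x⟩
      · exact (p2.isCompact.image (by fun_prop)).isClosed
    have hψc : HasCompactSupport ψ := (p2.isCompact.image (f := fun y : ℂ => c' + ρ • y) (by fun_prop)).of_isClosed_subset (isClosed_tsupport _) hsup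
    have hψb : tsupport ψ ⊆ ball c R := by
      intro x hx
      obtain ⟨y, hy, rfl⟩ := hsup hx
      exact aff_ball hρ hb (p3 hy)
    have hw := h.weak ψ hψs hψc hψb
    have hfd : ∀ y, fderiv ℝ ψ (c' + ρ • y) = ρ⁻¹ • fderiv ℝ φ y := by
      intro y
      have e1 : HasFDerivAt (fun x : ℂ => ρ⁻¹ • (x - c')) (ρ⁻¹ • ContinuousLinearMap.id ℝ ℂ) (c' + ρ • y) :=
        ((hasFDerivAt_id _).sub_const c').const_smul ρ⁻¹
      have e2 : HasFDerivAt φ (fderiv ℝ φ y) (ρ⁻¹ • (c' + ρ • y - c')) := by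
        rw [hinv]; exact (p1.differentiable (by simp) y).hasFDerivAt
      have e3 := (HasFDerivAt.comp (f := fun x : ℂ => ρ⁻¹ • (x - c')) (c' + ρ • y) e2 e1).fderiv
      have e4 : fderiv ℝ ψ (c' + ρ • y) = (fderiv ℝ φ y).comp (ρ⁻¹ • ContinuousLinearMap.id ℝ ℂ) := e3
      rw [e4]; ext v; simp
    have i1 := int_affine (fun x => fderiv ℝ ψ x (Vf k (g x))) c' hρ
    have i2 := int_affine (fun x => |ψ x|) c' hρ
    simp only [hψ, hinv] at i2
    simp only [hfd] at i1
    have e5 : ∫ y, fderiv ℝ φ y (Vf k (m⁻¹ • g (c' + ρ • y))) = (m^k)⁻¹ * ρ * ∫ y, (ρ⁻¹ • fderiv ℝ φ y) (Vf k (g (c' + ρ • y))) := by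
      rw [← integral_const_mul]
      congr 1
      ext y
      rw [Vf_smul (inv_pos.2 hm) hk, map_smul, Real.inv_rpow hm.le, ContinuousLinearMap.smul_apply, smul_eq_mul, smul_eq_mul]
      field_simp
    beta_reduce
    have hmk : 0 < m^k := Real.rpow_pos_of_pos hm k
    rw [e5, i1, i2, smul_eq_mul, smul_eq_mul, abs_mul ((m^k)⁻¹ * ρ), abs_mul (ρ^2)⁻¹,
      abs_of_pos (by positivity : 0 < (m^k)⁻¹ * ρ), abs_of_pos (by positivity : 0 < (ρ^2)⁻¹)]
    calc (m^k)⁻¹ * ρ * ((ρ^2)⁻¹ * |∫ x, fderiv ℝ ψ x (Vf k (g x))|) ≤ (m^k)⁻¹ * ρ * ((ρ^2)⁻¹ * (δ * ∫ x, |ψ x|)) := by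
          apply mul_le_mul_of_nonneg_left _ (by positivity)
          apply mul_le_mul_of_nonneg_left hw (by positivity)
      _ = _ := by rw [hψ]; field_simp

theorem propL {k : ℝ} (hk : 1 < k) : ∃ L : ℝ, 1 ≤ L ∧ ∀ δ u g, 0 ≤ δ → δ ≤ 1 → Sol k δ 0 1 u g → (∀ x ∈ ball (0:ℂ) 1, |u x| ≤ 1) →
    ∀ x ∈ ball (0:ℂ) (1/2), ‖g x‖ ≤ L := by
  obtain ⟨α, C, hα', hα1, hC, hA⟩ := propA hk
  have hα : 0 < α := lt_trans (by positivity) hα'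
  set h0 : ℝ := (1/2)^k/2 with hh0
  have hh0p : 0 < h0 := by positivity
  obtain ⟨s, hs0, hs1, hs2⟩ : ∃ s : ℝ, 0 < s ∧ s ≤ 1/32 ∧ C * s^α ≤ h0 := by
    refine ⟨min (1/32) ((h0/C)^(1/α)), by positivity, min_le_left _ _, ?_⟩
    have : (min (1/32) ((h0/C)^(1/α)))^α ≤ ((h0/C)^(1/α))^α := Real.rpow_le_rpow (by positivity) (min_le_right _ _) hα.le
    rw [← Real.rpow_mul (by positivity), one_div_mul_cancel hα.ne', Real.rpow_one] at this
    calc C * _ ≤ C * (h0/C) := mul_le_mul_of_nonneg_left this hC.le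
      _ = h0 := by field_simp
  set M : ℝ := max 1 (2/(h0*s)) with hM
  have hM1 : 1 ≤ M := le_max_left _ _
  refine ⟨4*M, by linarith, ?_⟩
  intro δ u g hδ hδ1 hS hu
  have hsub : closedBall (0:ℂ) (3/4) ⊆ ball 0 1 := closedBall_subset_ball (by norm_num)
  have hcont : ContinuousOn (fun x => (3/4 - ‖x‖) * ‖g x‖) (closedBall (0:ℂ) (3/4)) :=
    (continuousOn_const.sub continuous_norm.continuousOn).mul (hS.cont.mono hsub).norm
  obtain ⟨x0, hx0, hmax⟩ := (isCompact_closedBall (0:ℂ) (3/4)).exists_isMaxOn ⟨0, mem_closedBall_self (by norm_num)⟩ hcont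
  have hmax' : ∀ x ∈ closedBall (0:ℂ) (3/4), (3/4 - ‖x‖) * ‖g x‖ ≤ (3/4 - ‖x0‖) * ‖g x0‖ := hmax
  rw [mem_closedBall_zero_iff] at hx0
  suffices hfin : (3/4 - ‖x0‖) * ‖g x0‖ ≤ M by
    intro x hx
    rw [mem_ball_zero_iff] at hx
    have := hmax' x (by rw [mem_closedBall_zero_iff]; linarith)
    have h3 : 1/4 * ‖g x‖ ≤ (3/4 - ‖x‖) * ‖g x‖ := mul_le_mul_of_nonneg_right (by linarith) (norm_nonneg _)
    linarith
  set d := 3/4 - ‖x0‖ with hd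
  set m := ‖g x0‖ with hm
  have hm0 : 0 ≤ m := norm_nonneg _
  have hd1 : d ≤ 3/4 := by linarith [norm_nonneg x0]
  have hd0 : 0 ≤ d := by linarith
  by_cases hm1 : m < 1
  · have : d * m ≤ 1 := by nlinarith
    linarith
  push Not at hm1
  by_cases hdz : d = 0
  · rw [hdz, zero_mul]; linarith
  have hdp : 0 < d := lt_of_le_of_ne hd0 (Ne.symm hdz)
  have hbs : ball x0 (d/2) ⊆ ball 0 1 := by
    intro x hx
    rw [mem_ball_iff_norm] at hx
    rw [mem_ball_zero_iff]
    have := norm_le_norm_add_norm_sub' x x0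
    linarith
  have hv := hS.scale hk (ρ := d/2) (m := 2*m) (by linarith) (by linarith) hbs
  set v := (fun y : ℂ => (d/2 * (2*m))⁻¹ * (u (x0 + (d/2) • y) - u x0)) with hvd
  set gv := (fun y : ℂ => (2*m)⁻¹ • g (x0 + (d/2) • y)) with hgv
  have hδ' : d/2 * δ / (2*m)^k ≤ 1 := by
    have h1 : 1 ≤ (2*m)^k := Real.one_le_rpow (by linarith) (by linarith)
    rw [div_le_one (by linarith)]
    nlinarith
  have hδ'0 : 0 ≤ d/2 * δ / (2*m)^k := by positivity
  have hgb : ∀ y ∈ ball (0:ℂ) 1, ‖gv y‖ ≤ 1 := by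
    intro y hy
    rw [mem_ball_zero_iff] at hy
    have n0 : ‖x0 + (d/2) • y‖ ≤ ‖x0‖ + d/2 := by
      refine (norm_add_le _ _).trans ?_
      rw [norm_smul, Real.norm_eq_abs, abs_of_pos (by linarith)]
      nlinarith
    have := hmax' (x0 + (d/2) • y) (by rw [mem_closedBall_zero_iff]; linarith)
    have n2 : d/2 * ‖g (x0 + (d/2) • y)‖ ≤ (3/4 - ‖x0 + (d/2) • y‖) * ‖g (x0 + (d/2) • y)‖ :=
      mul_le_mul_of_nonneg_right (by linarith) (norm_nonneg _)
    have n3 : d/2 * ‖g (x0 + (d/2) • y)‖ ≤ d/2 * (2 * m) := by linarith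
    have n4 := le_of_mul_le_mul_left n3 (by linarith)
    simp only [hgv]
    rw [norm_smul, norm_inv, Real.norm_eq_abs, abs_of_pos (by linarith), inv_mul_le_one₀ (by linarith)]
    exact n4
  have hhol := hA _ v gv hδ'0 hδ' hv hgb
  have hg0 : ‖gv 0‖ = 1/2 := by
    simp only [hgv, smul_zero, add_zero]
    rw [norm_smul, norm_inv, Real.norm_eq_abs, abs_of_pos (by linarith), ← hm]
    field_simp
  set e : ℂ := (2:ℝ) • gv 0 with he
  have hen : ‖e‖ = 1 := by rw [he, norm_smul, hg0]; norm_num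
  have hVe : ⟪e, Vf k (gv 0)⟫ = 2 * h0 := by
    rw [he, Vf, inner_smul_left, inner_smul_right, real_inner_self_eq_norm_sq, hg0, hh0]
    have : ((1/2:ℝ))^k = (1/2)^(k-1) * (1/2) := by
      rw [Real.rpow_sub_one (by norm_num)]; ring
    rw [this]; simp only [conj_trivial]; ring
  have hder : ∀ t ∈ Set.Icc (0:ℝ) s, h0 ≤ ⟪gv (t • e), e⟫ := by
    intro t ht
    have htn : ‖t • e‖ = t := by rw [norm_smul, hen, mul_one, Real.norm_eq_abs, abs_of_nonneg ht.1]
    have h1 := hhol (t • e) (by rw [mem_closedBall_zero_iff, htn]; linarith [ht.2]) 0 (by simp)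
    rw [sub_zero, htn] at h1
    have h2 : C * t^α ≤ h0 := (mul_le_mul_of_nonneg_left (Real.rpow_le_rpow ht.1 ht.2 hα.le) hC.le).trans hs2
    have h3 : ⟪e, Vf k (gv (t • e))⟫ ≥ h0 := by
      have : ⟪e, Vf k (gv (t • e)) - Vf k (gv 0)⟫ ≥ -h0 := by
        have := abs_real_inner_le_norm e (Vf k (gv (t • e)) - Vf k (gv 0))
        rw [hen, one_mul] at this
        linarith [(abs_le.1 this).1]
      rw [inner_sub_right, hVe] at this
      linarith
    rw [Vf, inner_smul_right] at h3
    have h4 : ‖gv (t • e)‖^(k-1) ≤ 1 := Real.rpow_le_one (norm_nonneg _) (hgb _ (by rw [mem_ball_zero_iff, htn]; linarith [ht.2])) (by linarith)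
    have h5 : 0 ≤ ‖gv (t • e)‖^(k-1) := by positivity
    rw [real_inner_comm]
    have h6 : 0 ≤ ⟪e, gv (t • e)⟫ := by
      by_contra hneg
      push Not at hneg
      nlinarith
    nlinarith
  have hdt : ∀ t ∈ Set.Icc (0:ℝ) s, HasDerivAt (fun t : ℝ => v (t • e)) (⟪gv (t • e), e⟫) t := by
    intro t ht
    have htn : ‖t • e‖ = t := by rw [norm_smul, hen, mul_one, Real.norm_eq_abs, abs_of_nonneg ht.1]
    have h1 := hv.grad (t • e) (by rw [mem_ball_zero_iff, htn]; linarith [ht.2])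
    have h2 : HasDerivAt (fun t : ℝ => t • e) e t := by simpa using (hasDerivAt_id t).smul_const e
    exact h1.comp_hasDerivAt t h2
  obtain ⟨t, ht, hts⟩ := exists_hasDerivAt_eq_slope (fun t : ℝ => v (t • e)) (fun t => ⟪gv (t • e), e⟫) hs0
    (fun t ht => (hdt t ht).continuousAt.continuousWithinAt) (fun t ht => hdt t (Set.Ioo_subset_Icc_self ht))
  have hsl := hder t (Set.Ioo_subset_Icc_self ht)
  rw [hts, le_div_iff₀ (by linarith)] at hsl
  have hvs : v (s • e) ≤ 2 / (d * m) := by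
    have hin : x0 + (d/2) • (s • e) ∈ ball (0:ℂ) 1 := aff_ball (by linarith) hbs (by
      rw [mem_ball_zero_iff, norm_smul, hen, Real.norm_eq_abs, abs_of_pos hs0]; linarith)
    have u1 := abs_le.1 (hu _ hin)
    have u2 := abs_le.1 (hu x0 (hbs (mem_ball_self (by linarith))))
    simp only [hvd]
    have : d / 2 * (2 * m) = d * m := by ring
    rw [this, inv_mul_eq_div]
    apply div_le_div_of_nonneg_right _ (by positivity)
    linarith [u1.2, u2.1]
  have hv0 : v ((0:ℝ) • e) = 0 := by simp [hvd]
  rw [hv0, sub_zero, sub_zero] at hsl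
  have h7 : h0 * s ≤ 2 / (d * m) := hsl.trans hvs
  rw [le_div_iff₀ (by positivity)] at h7
  have : d * m ≤ 2 / (h0 * s) := by rw [le_div_iff₀ (by positivity)]; linarith
  exact this.trans (le_max_right _ _)


theorem Vf_inv_hol {k : ℝ} (hk : 1 < k) (a b : ℂ) : ‖a - b‖^k ≤ 2^k * ‖Vf k a - Vf k b‖ := by
  have h1 := Vf_lower hk a b
  have h2 : (‖a - b‖/2)^(k-1) ≤ ‖a‖^(k-1) + ‖b‖^(k-1) := by
    have h3 : ‖a - b‖ ≤ ‖a‖ + ‖b‖ := norm_sub_le a b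
    have pa : 0 ≤ ‖a‖^(k-1) := by positivity
    have pb : 0 ≤ ‖b‖^(k-1) := by positivity
    rcases le_total ‖a‖ ‖b‖ with h | h
    · have : (‖a - b‖/2)^(k-1) ≤ ‖b‖^(k-1) := Real.rpow_le_rpow (by positivity) (by linarith) (by linarith)
      linarith
    · have : (‖a - b‖/2)^(k-1) ≤ ‖a‖^(k-1) := Real.rpow_le_rpow (by positivity) (by linarith) (by linarith)
      linarith
  have e : ‖a - b‖^k = 2^k * ((1/2) * (‖a - b‖/2)^(k-1) * ‖a - b‖) := by
    rcases eq_or_ne (‖a - b‖) 0 with h0 | h0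
    · rw [h0, Real.zero_rpow (by linarith)]; simp
    · rw [Real.div_rpow (norm_nonneg _) (by norm_num), Real.rpow_sub_one h0, Real.rpow_sub_one (by norm_num)]
      field_simp
  rw [e]
  apply mul_le_mul_of_nonneg_left _ (by positivity)
  refine le_trans ?_ h1
  apply mul_le_mul_of_nonneg_right _ (norm_nonneg _)
  apply mul_le_mul_of_nonneg_left h2 (by norm_num)

theorem propA2 {k : ℝ} (hk : 1 < k) : ∃ β C : ℝ, 0 < β ∧ 0 < C ∧ ∀ δ u g, 0 ≤ δ → δ ≤ 1 → Sol k δ 0 1 u g → (∀ x ∈ ball (0:ℂ) 1, ‖g x‖ ≤ 1) →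
    ∀ x ∈ closedBall (0:ℂ) (1/32), ∀ y ∈ closedBall (0:ℂ) (1/32), ‖g x - g y‖ ≤ C * ‖x - y‖^β := by
  obtain ⟨α, C, hα', hα1, hC, hA⟩ := propA hk
  have hα : 0 < α := lt_trans (by positivity) hα'
  have hk0 : 0 < k := by linarith
  refine ⟨α/k, 2 * C^(1/k), by positivity, by positivity, ?_⟩
  intro δ u g h1 h2 h3 h4 x hx y hy
  have h5 := hA δ u g h1 h2 h3 h4 x hx y hy
  have h6 := Vf_inv_hol hk (g x) (g y)
  have h7 : ‖g x - g y‖^k ≤ 2^k * (C * ‖x - y‖^α) := h6.trans (mul_le_mul_of_nonneg_left h5 (by positivity))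
  have e : (2:ℝ)^k * (C * ‖x - y‖^α) = (2 * C^(1/k) * ‖x - y‖^(α/k))^k := by
    rw [Real.mul_rpow (by positivity) (by positivity), Real.mul_rpow (by positivity) (by positivity),
      ← Real.rpow_mul hC.le, ← Real.rpow_mul (norm_nonneg _), one_div_mul_cancel hk0.ne', div_mul_cancel₀ _ hk0.ne', Real.rpow_one]
    ring
  rw [e] at h7
  exact (Real.rpow_le_rpow_iff (norm_nonneg _) (by positivity) hk0).1 h7

theorem taylor {u : ℂ → ℝ} {g : ℂ → ℂ} {x y : ℂ} {A : ℝ} (hd : ∀ z ∈ segment ℝ x y, HasFDerivAt u (innerSL ℝ (g z)) z)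
    (hA : ∀ z ∈ segment ℝ x y, ‖g z - g x‖ ≤ A) : |u y - u x - ⟪g x, y - x⟫| ≤ A * ‖y - x‖ := by
  have := Convex.norm_image_sub_le_of_norm_hasFDerivWithin_le' (f := u) (f' := fun z => innerSL ℝ (g z)) (φ := innerSL ℝ (g x)) (s := segment ℝ x y) (C := A)
    (fun z hz => (hd z hz).hasFDerivWithinAt) (fun z hz => by
      rw [← map_sub, innerSL_apply_norm]; exact hA z hz) (convex_segment x y) (left_mem_segment ℝ x y) (right_mem_segment ℝ x y)
  rw [innerSL_apply_apply, Real.norm_eq_abs] at this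
  exact this

theorem seg_norm {x y z : ℂ} (hz : z ∈ segment ℝ x y) : ‖z - x‖ ≤ ‖y - x‖ := by
  rw [segment_eq_image_lineMap] at hz
  obtain ⟨t, ht, rfl⟩ := hz
  rw [AffineMap.lineMap_apply, vsub_eq_sub, vadd_eq_add, add_sub_cancel_right, norm_smul, Real.norm_eq_abs, abs_of_nonneg ht.1]
  exact mul_le_of_le_one_left (norm_nonneg _) ht.2

theorem ulim {E : Type*} [NormedAddCommGroup E] [ProperSpace E] (a : ℕ → E) {M : ℝ} (h : ∀ n, ‖a n‖ ≤ M) :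
    ∃ l, Filter.Tendsto a (Filter.hyperfilter ℕ : Filter ℕ) (nhds l) := by
  obtain ⟨l, -, hl⟩ := (isCompact_closedBall (0:E) M).ultrafilter_le_nhds' ((Filter.hyperfilter ℕ).map a)
    (by
      rw [Ultrafilter.mem_map]
      exact Filter.univ_mem' (fun n => by simpa using h n))
  exact ⟨l, hl⟩

theorem compact_sol {k : ℝ} (hk : 1 < k) {r β C : ℝ} (hr : 0 < r) (hr1 : r < 1) (hβ : 0 < β) (hC : 0 < C) {δ : ℕ → ℝ} {u : ℕ → ℂ → ℝ} {g : ℕ → ℂ → ℂ}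
    (hS : ∀ n, Sol k (δ n) 0 1 (u n) (g n)) (hδ : Filter.Tendsto δ Filter.atTop (nhds 0)) (hb : ∀ n, ∀ x ∈ ball (0:ℂ) 1, ‖g n x‖ ≤ 1)
    (hH : ∀ n, ∀ x ∈ closedBall (0:ℂ) r, ∀ y ∈ closedBall (0:ℂ) r, ‖g n x - g n y‖ ≤ C * ‖x - y‖^β) :
    ∃ u' g', Sol k 0 0 r u' g' ∧ (∀ x ∈ closedBall (0:ℂ) r, ‖g' x‖ ≤ 1) ∧
      ∀ ε > 0, ∀ N, ∃ n ≥ N, ∀ x ∈ closedBall (0:ℂ) r, ‖g n x - g' x‖ ≤ ε := by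
  set U : Filter ℕ := (Filter.hyperfilter ℕ : Filter ℕ) with hU
  have hUa : U ≤ Filter.atTop := Nat.hyperfilter_le_atTop
  have hsub : closedBall (0:ℂ) r ⊆ ball 0 1 := closedBall_subset_ball hr1
  have hconv : Convex ℝ (closedBall (0:ℂ) r) := convex_closedBall _ _
  -- limits
  have hg1 : ∀ x, ∃ l, x ∈ closedBall (0:ℂ) r → Filter.Tendsto (fun n => g n x) U (nhds l) := by
    intro x
    by_cases hx : x ∈ closedBall (0:ℂ) r
    · obtain ⟨l, hl⟩ := ulim (fun n => g n x) (fun n => hb n x (hsub hx))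
      exact ⟨l, fun _ => hl⟩
    · exact ⟨0, fun h => absurd h hx⟩
  choose g' hg' using hg1
  have hu1 : ∀ x, ∃ l, x ∈ closedBall (0:ℂ) r → Filter.Tendsto (fun n => u n x - u n 0) U (nhds l) := by
    intro x
    by_cases hx : x ∈ closedBall (0:ℂ) r
    · obtain ⟨l, hl⟩ := ulim (fun n => u n x - u n 0) (M := 1) (fun n => by
        have := (convex_ball (0:ℂ) 1).norm_image_sub_le_of_norm_hasFDerivWithin_le (f := u n) (f' := fun z => innerSL ℝ (g n z)) (C := 1)
          (fun z hz => ((hS n).grad z hz).hasFDerivWithinAt) (fun z hz => by rw [innerSL_apply_norm]; exact hb n z hz)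
          (mem_ball_self one_pos) (hsub hx)
        have h2 := hsub hx
        rw [mem_ball_zero_iff] at h2
        rw [sub_zero] at this
        linarith)
      exact ⟨l, fun _ => hl⟩
    · exact ⟨0, fun h => absurd h hx⟩
  choose u' hu' using hu1
  have hH' : ∀ x ∈ closedBall (0:ℂ) r, ∀ y ∈ closedBall (0:ℂ) r, ‖g' x - g' y‖ ≤ C * ‖x - y‖^β := by
    intro x hx y hy
    exact le_of_tendsto ((hg' x hx).sub (hg' y hy)).norm (Filter.Eventually.of_forall fun n => hH n x hx y hy)
  have hb' : ∀ x ∈ closedBall (0:ℂ) r, ‖g' x‖ ≤ 1 := by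
    intro x hx
    exact le_of_tendsto (hg' x hx).norm (Filter.Eventually.of_forall fun n => hb n x (hsub hx))
  have hcont : ContinuousOn g' (closedBall (0:ℂ) r) := by
    intro x hx
    rw [ContinuousWithinAt, tendsto_iff_norm_sub_tendsto_zero]
    have h0 : Filter.Tendsto (fun y : ℂ => C * ‖y - x‖^β) (nhdsWithin x (closedBall 0 r)) (nhds 0) := by
      have : Continuous (fun y : ℂ => C * ‖y - x‖^β) :=
        continuous_const.mul ((continuous_norm.comp (continuous_id.sub continuous_const)).rpow_const (fun _ => Or.inr hβ.le))
      have h2 := this.tendsto x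
      simp only [sub_self, norm_zero, Real.zero_rpow hβ.ne', mul_zero] at h2
      exact h2.mono_left nhdsWithin_le_nhds
    refine squeeze_zero' (Filter.Eventually.of_forall fun _ => norm_nonneg _) ?_ h0
    filter_upwards [self_mem_nhdsWithin] with y hy
    exact hH' y hy x hx
  have hunif : ∀ ε > 0, ∀ᶠ n in U, ∀ x ∈ closedBall (0:ℂ) r, ‖g n x - g' x‖ ≤ ε := by
    intro ε hε
    obtain ⟨η, hη, hηe⟩ : ∃ η : ℝ, 0 < η ∧ C * η^β ≤ ε/3 := by
      refine ⟨(ε/3/C)^(1/β), by positivity, ?_⟩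
      rw [← Real.rpow_mul (by positivity), one_div_mul_cancel hβ.ne', Real.rpow_one]
      apply le_of_eq; field_simp
    obtain ⟨t, hts, htf, htc⟩ := (isCompact_closedBall (0:ℂ) r).finite_cover_balls hη
    have : ∀ᶠ n in U, ∀ z ∈ t, ‖g n z - g' z‖ ≤ ε/3 := by
      rw [Filter.eventually_all_finite htf]
      intro z hz
      have := (tendsto_iff_norm_sub_tendsto_zero.1 (hg' z (hts hz)))
      filter_upwards [this.eventually (gt_mem_nhds (by positivity : 0 < ε/3))] with n hn using hn.le
    filter_upwards [this] with n hn x hx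
    obtain ⟨z, hz, hxz⟩ := Set.mem_iUnion₂.1 (htc hx)
    rw [mem_ball, dist_eq_norm] at hxz
    have hp : C * ‖x - z‖^β ≤ ε/3 := (mul_le_mul_of_nonneg_left (Real.rpow_le_rpow (norm_nonneg _) hxz.le hβ.le) hC.le).trans hηe
    have a1 := (hH n x hx z (hts hz)).trans hp
    have a2 := (hH' x hx z (hts hz)).trans hp
    have a3 := hn z hz
    have e : g n x - g' x = (g n x - g n z) + (g n z - g' z) - (g' x - g' z) := by ring
    rw [e]
    refine (norm_sub_le _ _).trans ?_
    have := norm_add_le (g n x - g n z) (g n z - g' z)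
    linarith
  refine ⟨u', g', ⟨hcont.mono ball_subset_closedBall, ?_, ?_⟩, hb', ?_⟩
  · intro x hx
    have hxc := ball_subset_closedBall hx
    have hT : ∀ y ∈ closedBall (0:ℂ) r, |u' y - u' x - ⟪g' x, y - x⟫| ≤ C * ‖y - x‖^β * ‖y - x‖ := by
      intro y hy
      have hlim : Filter.Tendsto (fun n => (u n y - u n 0) - (u n x - u n 0) - ⟪g n x, y - x⟫) U (nhds (u' y - u' x - ⟪g' x, y - x⟫)) :=
        ((hu' y hy).sub (hu' x hxc)).sub ((hg' x hxc).inner tendsto_const_nhds)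
      refine le_of_tendsto hlim.abs (Filter.Eventually.of_forall fun n => ?_)
      have hseg : segment ℝ x y ⊆ closedBall (0:ℂ) r := hconv.segment_subset hxc hy
      have := taylor (u := u n) (g := g n) (x := x) (y := y) (A := C * ‖y - x‖^β) (fun z hz => (hS n).grad z (hsub (hseg hz)))
        (fun z hz => (hH n z (hseg hz) x hxc).trans (mul_le_mul_of_nonneg_left (Real.rpow_le_rpow (norm_nonneg _) (seg_norm hz) hβ.le) hC.le))
      have e : (u n y - u n 0) - (u n x - u n 0) - ⟪g n x, y - x⟫ = u n y - u n x - ⟪g n x, y - x⟫ := by linarith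
      rw [e]; exact this
    rw [hasFDerivAt_iff_isLittleO, Asymptotics.isLittleO_iff]
    intro ε hε
    have h0 : Filter.Tendsto (fun y : ℂ => C * ‖y - x‖^β) (nhds x) (nhds 0) := by
      have : Continuous (fun y : ℂ => C * ‖y - x‖^β) :=
        continuous_const.mul ((continuous_norm.comp (continuous_id.sub continuous_const)).rpow_const (fun _ => Or.inr hβ.le))
      have h2 := this.tendsto x
      simpa only [sub_self, norm_zero, Real.zero_rpow hβ.ne', mul_zero] using h2
    filter_upwards [h0.eventually (gt_mem_nhds hε), isOpen_ball.mem_nhds hx] with y hy hyb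
    rw [innerSL_apply_apply, Real.norm_eq_abs]
    exact (hT y (ball_subset_closedBall hyb)).trans (mul_le_mul_of_nonneg_right hy.le (norm_nonneg _))
  · intro φ p1 p2 p3
    rw [zero_mul]
    set K := tsupport φ with hKd
    have hK : IsCompact K := p2.isCompact
    have hKr : K ⊆ closedBall 0 r := p3.trans ball_subset_closedBall
    have hfc : Continuous (fderiv ℝ φ) := p1.continuous_fderiv (by simp)
    have hz : ∀ x ∉ K, fderiv ℝ φ x = 0 := fun x hx => image_eq_zero_of_notMem_tsupport (fun hh => hx (tsupport_fderiv_subset ℝ hh))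
    have hintg : ∀ G : ℂ → ℂ, ContinuousOn G K → Integrable (fun x => fderiv ℝ φ x (Vf k (G x))) := by
      intro G hG
      rw [← integrableOn_iff_integrable_of_support_subset (s := K)]
      · exact ContinuousOn.integrableOn_compact hK (hfc.continuousOn.clm_apply ((Vf_cont hk).comp_continuousOn hG))
      · intro x hx
        by_contra hxK
        exact hx (by simp [hz x hxK])
    have hnI : Integrable (fun x => ‖fderiv ℝ φ x‖) :=
      (hfc.integrable_of_hasCompactSupport (p2.fderiv (𝕜 := ℝ))).norm
    set A := ∫ x, ‖fderiv ℝ φ x‖ with hA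
    have hA0 : 0 ≤ A := integral_nonneg fun _ => norm_nonneg _
    set P := ∫ x, |φ x| with hP
    have hP0 : 0 ≤ P := integral_nonneg fun _ => abs_nonneg _
    apply le_of_forall_pos_le_add
    intro ε hε
    have hε' : 0 < ε / (2 * ((k+1) * A + 1)) := by positivity
    have hδ' : ∀ᶠ n in U, δ n < ε / (2 * (P + 1)) := (hδ.mono_left hUa).eventually (gt_mem_nhds (by positivity))
    obtain ⟨n, h1, h2⟩ := ((hunif _ hε').and hδ').exists
    have hw := (hS n).weak φ p1 p2 (p3.trans (ball_subset_ball hr1.le))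
    have i1 := hintg g' (hcont.mono hKr)
    have i2 := hintg (g n) ((hS n).cont.mono (hKr.trans hsub))
    have hdiff : |(∫ x, fderiv ℝ φ x (Vf k (g' x))) - ∫ x, fderiv ℝ φ x (Vf k (g n x))| ≤ A * ((k+1) * (ε / (2 * ((k+1) * A + 1)))) := by
      rw [← integral_sub i1 i2]
      generalize ε / (2 * ((k+1) * A + 1)) = ε' at *
      rw [hA, ← integral_mul_const, ← Real.norm_eq_abs]
      refine norm_integral_le_of_norm_le (hnI.mul_const _) (Filter.Eventually.of_forall fun x => ?_)
      by_cases hx : x ∈ K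
      · rw [← map_sub]
        refine ((fderiv ℝ φ x).le_opNorm _).trans (mul_le_mul_of_nonneg_left ?_ (norm_nonneg _))
        refine (Vf_lip hk (hb' x (hKr hx)) (hb n x (hsub (hKr hx)))).trans (mul_le_mul_of_nonneg_left ?_ (by linarith))
        rw [norm_sub_rev]; exact h1 x (hKr hx)
      · simp [hz x hx]
    have b1 : A * ((k+1) * (ε / (2 * ((k+1) * A + 1)))) ≤ ε/2 := by
      have : A * ((k+1) * (ε / (2 * ((k+1) * A + 1)))) = ((k+1) * A) / ((k+1) * A + 1) * (ε/2) := by field_simp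
      rw [this]
      apply mul_le_of_le_one_left (by positivity)
      rw [div_le_one (by positivity)]; linarith
    have b2 : δ n * P ≤ ε/2 := by
      have : δ n * P ≤ ε / (2 * (P+1)) * P := mul_le_mul_of_nonneg_right h2.le hP0
      refine this.trans ?_
      have : ε / (2 * (P+1)) * P = P / (P+1) * (ε/2) := by field_simp
      rw [this]
      apply mul_le_of_le_one_left (by positivity)
      rw [div_le_one (by positivity)]; linarith
    have e : ∫ x, fderiv ℝ φ x (Vf k (g' x)) = ((∫ x, fderiv ℝ φ x (Vf k (g' x))) - ∫ x, fderiv ℝ φ x (Vf k (g n x))) + ∫ x, fderiv ℝ φ x (Vf k (g n x)) := by ring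
    rw [e]
    refine (abs_add_le _ _).trans ?_
    linarith
  · intro ε hε N
    obtain ⟨n, h1, h2⟩ := ((hunif ε hε).and (hUa (Filter.eventually_ge_atTop N))).exists
    exact ⟨n, h2, h1⟩


theorem propD {k : ℝ} (hk : 1 < k) : ∃ l ε : ℝ, 0 < l ∧ l < 1 ∧ 0 < ε ∧ ε ≤ 1 ∧ ∀ δ u g, 0 ≤ δ → δ ≤ ε → Sol k δ 0 1 u g →
    (∀ x ∈ ball (0:ℂ) 1, ‖g x‖ ≤ 1) → ‖g 0‖ ≤ ε → ∀ x ∈ ball (0:ℂ) l, ‖g x‖ ≤ l^(1/k) := by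
  obtain ⟨α, C, hα, hα1, hC, hB⟩ := propB hk
  obtain ⟨β, C', hβ, hC', hA⟩ := propA2 hk
  have hk0 : 0 < 1/k := by positivity
  have hα0 : 0 < α := hk0.trans hα
  obtain ⟨l, hl0, hl1, hl2⟩ : ∃ l : ℝ, 0 < l ∧ l ≤ 1/1024 ∧ C * (32 * l)^α ≤ (1/2) * l^(1/k) := by
    set q := 1 / (2 * C * 32^α) with hq
    have hq0 : 0 < q := by positivity
    have hγ : 0 < α - 1/k := by linarith
    refine ⟨min (1/1024) (q^(1/(α - 1/k))), by positivity, min_le_left _ _, ?_⟩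
    set l := min (1/1024) (q^(1/(α - 1/k))) with hl
    have hl0 : 0 < l := by positivity
    have h1 : l^(α - 1/k) ≤ q := by
      have := Real.rpow_le_rpow hl0.le (min_le_right (1/1024) (q^(1/(α - 1/k)))) hγ.le
      rwa [← Real.rpow_mul hq0.le, one_div_mul_cancel hγ.ne', Real.rpow_one] at this
    have h2 : l^α = l^(α - 1/k) * l^(1/k) := by rw [← Real.rpow_add hl0]; congr 1; ring
    rw [Real.mul_rpow (by norm_num) hl0.le, h2]
    have h3 : C * (32^α * (l^(α - 1/k) * l^(1/k))) ≤ C * (32^α * (q * l^(1/k))) := by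
      apply mul_le_mul_of_nonneg_left _ hC.le
      apply mul_le_mul_of_nonneg_left _ (by positivity)
      apply mul_le_mul_of_nonneg_right h1 (by positivity)
    refine h3.trans (le_of_eq ?_)
    rw [hq]; field_simp
  by_contra hcon
  push Not at hcon
  have hcon' : ∀ n : ℕ, ∃ δ u g, 0 ≤ δ ∧ δ ≤ 1/((n:ℝ)+1) ∧ Sol k δ 0 1 u g ∧ (∀ x ∈ ball (0:ℂ) 1, ‖g x‖ ≤ 1) ∧ ‖g 0‖ ≤ 1/((n:ℝ)+1) ∧
      ∃ x ∈ ball (0:ℂ) l, l^(1/k) < ‖g x‖ := by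
    intro n
    have hn : (0:ℝ) ≤ n := Nat.cast_nonneg n
    exact hcon l (1/((n:ℝ)+1)) hl0 (by linarith) (by positivity) (by rw [div_le_one (by positivity)]; linarith)
  choose δ u g c1 c2 c3 c4 c5 x c6 c7 using hcon'
  have hlim : Filter.Tendsto (fun n : ℕ => 1/((n:ℝ)+1)) Filter.atTop (nhds 0) := tendsto_one_div_add_atTop_nhds_zero_nat
  have hδ : Filter.Tendsto δ Filter.atTop (nhds 0) := squeeze_zero c1 c2 hlim
  have hn1 : ∀ n : ℕ, 1/((n:ℝ)+1) ≤ 1 := by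
    intro n
    have hn : (0:ℝ) ≤ n := Nat.cast_nonneg n
    rw [div_le_one (by positivity)]; linarith
  obtain ⟨u', g', hS, hb', hun⟩ := compact_sol hk (r := 1/32) (by norm_num) (by norm_num) hβ hC' c3 hδ c4
    (fun n => hA _ _ _ (c1 n) ((c2 n).trans (hn1 n)) (c3 n) (c4 n))
  have hz : (0:ℂ) ∈ closedBall (0:ℂ) (1/32) := mem_closedBall_self (by norm_num)
  have hg0 : g' 0 = 0 := by
    rw [← norm_eq_zero]
    apply le_antisymm _ (norm_nonneg _)
    apply le_of_forall_pos_le_add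
    intro ε hε
    obtain ⟨N, hN⟩ := Filter.eventually_atTop.1 (hlim.eventually (gt_mem_nhds (by positivity : 0 < ε/2)))
    obtain ⟨n, hn, hnx⟩ := hun (ε/2) (by positivity) N
    have h1 := hnx 0 hz
    have h2 := hN n hn
    have h3 := c5 n
    have h4 := norm_le_norm_add_norm_sub (g n 0) (g' 0)
    linarith
  have hsc := hS.scale hk (ρ := 1/32) (m := 1) (c' := 0) (by norm_num) one_pos subset_rfl
  rw [mul_zero, zero_div] at hsc
  have hB' := hB _ _ hsc (fun y hy => by
    have := aff_ball (c := 0) (c' := 0) (ρ := 1/32) (R := 1/32) (by norm_num) subset_rfl hy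
    rw [inv_one, one_smul]
    exact hb' _ (ball_subset_closedBall this)) (by simp [hg0])
  have hsmall : ∀ z ∈ ball (0:ℂ) l, ‖g' z‖ ≤ (1/2) * l^(1/k) := by
    intro z hz
    rw [mem_ball_zero_iff] at hz
    have h1 := hB' ((32:ℝ) • z) (by
      rw [mem_closedBall_zero_iff, norm_smul, Real.norm_eq_abs, abs_of_pos (by norm_num)]; linarith)
    rw [inv_one, one_smul, zero_add, smul_smul, norm_smul, Real.norm_eq_abs, abs_of_pos (by norm_num)] at h1
    norm_num at h1
    refine h1.trans (le_trans ?_ hl2)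
    apply mul_le_mul_of_nonneg_left _ hC.le
    apply Real.rpow_le_rpow (by positivity) (by linarith) hα0.le
  obtain ⟨n, -, hn⟩ := hun ((1/2) * l^(1/k)) (by positivity) 0
  have hx := c6 n
  have h1 := hsmall _ hx
  have h2 := hn (x n) (by
    rw [mem_ball_zero_iff] at hx
    rw [mem_closedBall_zero_iff]; linarith)
  have h3 := c7 n
  have h4 := norm_le_norm_add_norm_sub' (g n (x n)) (g' (x n))
  linarith

theorem propE {k : ℝ} (hk : 1 < k) : ∃ ε C : ℝ, 0 < ε ∧ ε ≤ 1 ∧ 1 ≤ C ∧ ∀ δ u g, 0 ≤ δ → δ ≤ ε → Sol k δ 0 1 u g →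
    (∀ x ∈ ball (0:ℂ) 1, ‖g x‖ ≤ 1) → ∀ x ∈ ball (0:ℂ) 1, ‖g x‖ ≤ C * (‖x‖^(1/k) + ‖g 0‖) := by
  obtain ⟨l, ε, hl0, hl1, hε, hε1, hD⟩ := propD hk
  have hk0 : 0 < k := by linarith
  have hk1 : 0 < 1/k := by positivity
  have hε2 : 1 ≤ 1/ε := by rw [le_div_iff₀ hε]; linarith
  set P := (1/l)^(1/k) with hP
  have hP0 : 0 < P := by positivity
  refine ⟨ε, P + 1/ε, hε, hε1, by linarith, ?_⟩
  intro δ u g hδ hδε hS hg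
  have hQ : ∀ j : ℕ, (∀ x ∈ ball (0:ℂ) (l^j), ‖g x‖ ≤ (l^j)^(1/k)) ∨ (∀ x ∈ ball (0:ℂ) (l^j), ‖g x‖ ≤ 1/ε * ‖g 0‖) := by
    intro j
    induction j with
    | zero => left; simpa using hg
    | succ j ih =>
      have hlj : 0 < l^j := by positivity
      have hlj1 : l^j ≤ 1 := pow_le_one₀ hl0.le hl1.le
      have hmon : ball (0:ℂ) (l^(j+1)) ⊆ ball 0 (l^j) := ball_subset_ball (pow_le_pow_of_le_one hl0.le hl1.le (Nat.le_succ j))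
      rcases ih with ih | ih
      · set m := (l^j)^(1/k) with hm
        have hm0 : 0 < m := by positivity
        have hmk : m^k = l^j := by
          rw [hm, ← Real.rpow_mul hlj.le, one_div_mul_cancel hk0.ne', Real.rpow_one]
        by_cases hc : ‖g 0‖ ≤ ε * m
        · left
          have hsc := hS.scale hk (ρ := l^j) (m := m) (c' := 0) hlj hm0 (ball_subset_ball hlj1)
          rw [hmk, mul_div_cancel_left₀ _ hlj.ne'] at hsc
          have := hD δ _ _ hδ hδε hsc (fun y hy => by
              have h1 := ih _ (aff_ball hlj subset_rfl hy)
              rw [norm_smul, norm_inv, Real.norm_eq_abs, abs_of_pos hm0, inv_mul_le_one₀ hm0]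
              exact h1) (by
              rw [smul_zero, add_zero, norm_smul, norm_inv, Real.norm_eq_abs, abs_of_pos hm0, inv_mul_le_iff₀ hm0]
              linarith)
          intro x hx
          rw [mem_ball_zero_iff] at hx
          have h2 := this ((l^j)⁻¹ • x) (by
            rw [mem_ball_zero_iff, norm_smul, norm_inv, Real.norm_eq_abs, abs_of_pos hlj, inv_mul_lt_iff₀ hlj, ← pow_succ]
            exact hx)
          rw [smul_smul, mul_inv_cancel₀ hlj.ne', one_smul, zero_add, norm_smul, norm_inv, Real.norm_eq_abs, abs_of_pos hm0, inv_mul_le_iff₀ hm0] at h2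
          rw [pow_succ, Real.mul_rpow hlj.le hl0.le]
          exact h2
        · right
          push Not at hc
          intro x hx
          refine (ih x (hmon hx)).trans ?_
          rw [one_div, ← div_eq_inv_mul, le_div_iff₀ hε]; linarith
      · right
        intro x hx
        exact ih x (hmon hx)
  intro x hx
  rw [mem_ball_zero_iff] at hx
  have hgn := norm_nonneg (g 0)
  by_cases hx0 : x = 0
  · rw [hx0]
    have : 0 ≤ ‖(0:ℂ)‖^(1/k) := by positivity
    nlinarith [mul_nonneg hP0.le hgn, mul_nonneg hP0.le this, mul_nonneg (by linarith : 0 ≤ 1/ε) this]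
  have hxp : 0 < ‖x‖ := norm_pos_iff.2 hx0
  obtain ⟨j, hj1, hj2⟩ : ∃ j : ℕ, ‖x‖ < l^j ∧ l^(j+1) ≤ ‖x‖ := by
    classical
    have hex : ∃ n : ℕ, l^n ≤ ‖x‖ := by
      obtain ⟨n, hn⟩ := exists_pow_lt_of_lt_one hxp hl1
      exact ⟨n, hn.le⟩
    have h1 := Nat.find_spec hex
    have h0 : Nat.find hex ≠ 0 := by
      intro h0
      rw [h0, pow_zero] at h1; linarith
    obtain ⟨j, hj⟩ := Nat.exists_eq_succ_of_ne_zero h0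
    refine ⟨j, ?_, by rw [← Nat.succ_eq_add_one, ← hj]; exact h1⟩
    by_contra hc
    push Not at hc
    exact Nat.find_min hex (by omega) hc
  have hxm : x ∈ ball (0:ℂ) (l^j) := by rw [mem_ball_zero_iff]; exact hj1
  have h3 : (l^j)^(1/k) ≤ P * ‖x‖^(1/k) := by
    rw [hP, ← Real.mul_rpow (by positivity) hxp.le]
    apply Real.rpow_le_rpow (by positivity) _ hk1.le
    rw [pow_succ] at hj2
    rw [div_mul_eq_mul_div, one_mul, le_div_iff₀ hl0]; exact hj2
  have hxk : 0 ≤ ‖x‖^(1/k) := by positivity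
  have e : (P + 1/ε) * (‖x‖^(1/k) + ‖g 0‖) = P * ‖x‖^(1/k) + 1/ε * ‖g 0‖ + (1/ε * ‖x‖^(1/k) + P * ‖g 0‖) := by ring
  have t1 : 0 ≤ P * ‖x‖^(1/k) := by positivity
  have t2 : 0 ≤ 1/ε * ‖g 0‖ := by positivity
  have t3 : 0 ≤ 1/ε * ‖x‖^(1/k) + P * ‖g 0‖ := by positivity
  rw [e]
  rcases hQ j with h | h
  · linarith [h x hxm]
  · linarith [h x hxm]

theorem propF {k : ℝ} (hk : 1 < k) : ∃ ε C : ℝ, 0 < ε ∧ ε ≤ 1 ∧ 0 < C ∧ ∀ δ u g, 0 ≤ δ → δ ≤ ε → Sol k δ 0 1 u g →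
    (∀ x ∈ ball (0:ℂ) 1, ‖g x‖ ≤ 1) → ∀ x ∈ ball (0:ℂ) 1, ‖g x - g 0‖ ≤ C * ‖x‖^(1/k) := by
  obtain ⟨ε, C1, hε, hε1, hC1, hE⟩ := propE hk
  obtain ⟨α, CA, hα, hα1, hCA, hA⟩ := propA hk
  have hk0 : 0 < k := by linarith
  have hk1 : 0 < 1/k := by positivity
  set b := (1/2) * (1/(2*C1))^(k-1) with hb
  have hb0 : 0 < b := by positivity
  set C2 := C1 + (C1+1) * 32^(1/k) with hC2
  set C3 := 2 * C1 * (CA / b) with hC3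
  have hC20 : 0 < C2 := by positivity
  have hC30 : 0 < C3 := by positivity
  refine ⟨ε, C2 + C3, hε, hε1, by positivity, ?_⟩
  intro δ u g hδ hδε hS hg x hx
  have hE' := hE δ u g hδ hδε hS hg
  have hxk : 0 ≤ ‖x‖^(1/k) := by positivity
  rw [add_mul]
  set a := ‖g 0‖ with ha
  have ha0 : 0 ≤ a := norm_nonneg _
  have ha1 : a ≤ 1 := hg 0 (mem_ball_self one_pos)
  have hRa : (a^k)^(1/k) = a := by rw [← Real.rpow_mul ha0, mul_one_div_cancel hk0.ne', Real.rpow_one]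
  by_cases hc : a^k/32 ≤ ‖x‖
  · have h1 := hE' x hx
    have h2 : a ≤ 32^(1/k) * ‖x‖^(1/k) := by
      rw [← Real.mul_rpow (by norm_num) (norm_nonneg _), ← hRa]
      apply Real.rpow_le_rpow (by positivity) (by linarith) hk1.le
    have h3 : ‖g x - g 0‖ ≤ ‖g x‖ + a := norm_sub_le _ _
    have h4 : (C1 + 1) * a ≤ (C1 + 1) * (32^(1/k) * ‖x‖^(1/k)) := mul_le_mul_of_nonneg_left h2 (by linarith)
    have h5 : 0 ≤ C3 * ‖x‖^(1/k) := by positivity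
    have h6 : C2 * ‖x‖^(1/k) = C1 * ‖x‖^(1/k) + (C1 + 1) * (32^(1/k) * ‖x‖^(1/k)) := by rw [hC2]; ring
    linarith
  push Not at hc
  have hap : 0 < a := by
    rcases ha0.eq_or_lt with h | h
    · rw [← h, Real.zero_rpow hk0.ne', zero_div] at hc
      exact absurd hc (not_lt.2 (norm_nonneg _))
    · exact h
  set R := a^k with hR
  have hR0 : 0 < R := by positivity
  have hR1 : R ≤ 1 := Real.rpow_le_one ha0 ha1 hk0.le
  set m := 2 * C1 * a with hm
  have hm0 : 0 < m := by positivity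
  have hsc := hS.scale hk (ρ := R) (m := m) (c' := 0) hR0 hm0 (ball_subset_ball hR1)
  have hδ' : R * δ / m^k ≤ 1 := by
    rw [div_le_one (by positivity)]
    have : R ≤ m^k := Real.rpow_le_rpow ha0 (by rw [hm]; nlinarith) hk0.le
    nlinarith
  have hgv := hA _ _ _ (by positivity) hδ' hsc (fun y hy => by
    have hin := aff_ball hR0 (subset_rfl : ball (0:ℂ) R ⊆ ball 0 R) hy
    have h1 := hE' _ (ball_subset_ball hR1 hin)
    rw [mem_ball_zero_iff] at hin
    have h2 : ‖(0:ℂ) + R • y‖^(1/k) ≤ a := by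
      rw [← hRa]
      exact Real.rpow_le_rpow (norm_nonneg _) hin.le hk1.le
    rw [norm_smul, norm_inv, Real.norm_eq_abs, abs_of_pos hm0, inv_mul_le_one₀ hm0, hm]
    refine h1.trans ?_
    nlinarith)
  set y := R⁻¹ • x with hy
  have hyn : ‖y‖ = ‖x‖ / R := by
    rw [hy, norm_smul, norm_inv, Real.norm_eq_abs, abs_of_pos hR0, inv_mul_eq_div]
  have hy32 : ‖y‖ ≤ 1/32 := by
    rw [hyn, div_le_iff₀ hR0]; linarith
  have h1 := hgv y (by rw [mem_closedBall_zero_iff]; exact hy32) 0 (by simp)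
  beta_reduce at h1
  have e1 : (0:ℂ) + R • y = x := by rw [hy, smul_smul, mul_inv_cancel₀ hR0.ne', one_smul, zero_add]
  rw [e1, smul_zero, add_zero, sub_zero] at h1
  have h2 := (Vf_lower hk (m⁻¹ • g x) (m⁻¹ • g 0)).trans h1
  have n0 : ‖m⁻¹ • g 0‖ = 1/(2*C1) := by
    rw [norm_smul, norm_inv, Real.norm_eq_abs, abs_of_pos hm0, ← ha, hm]; field_simp
  have n1 : ‖m⁻¹ • g x - m⁻¹ • g 0‖ = m⁻¹ * ‖g x - g 0‖ := by
    rw [← smul_sub, norm_smul, norm_inv, Real.norm_eq_abs, abs_of_pos hm0]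
  rw [n0, n1] at h2
  have h3 : b * (m⁻¹ * ‖g x - g 0‖) ≤ CA * ‖y‖^α := by
    refine le_trans ?_ h2
    apply mul_le_mul_of_nonneg_right _ (by positivity)
    rw [hb]
    have : 0 ≤ ‖m⁻¹ • g x‖^(k-1) := by positivity
    linarith
  have h4 : ‖y‖^α ≤ ‖y‖^(1/k) := by
    rcases (norm_nonneg y).eq_or_lt with h | h
    · rw [← h, Real.zero_rpow (by linarith), Real.zero_rpow hk1.ne']
    · exact Real.rpow_le_rpow_of_exponent_ge h (by linarith) hα.le
  have h5 : ‖y‖^(1/k) = ‖x‖^(1/k) / a := by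
    rw [hyn, Real.div_rpow (norm_nonneg _) hR0.le, hRa]
  have h6 : b * (m⁻¹ * ‖g x - g 0‖) ≤ CA * (‖x‖^(1/k) / a) := by
    rw [← h5]; exact h3.trans (mul_le_mul_of_nonneg_left h4 hCA.le)
  have h7 : ‖g x - g 0‖ ≤ C3 * ‖x‖^(1/k) := by
    have e : ‖g x - g 0‖ = (m / b) * (b * (m⁻¹ * ‖g x - g 0‖)) := by field_simp
    rw [e]
    refine (mul_le_mul_of_nonneg_left h6 (by positivity)).trans (le_of_eq ?_)
    rw [hC3, hm]; field_simp
  have h8 : 0 ≤ C2 * ‖x‖^(1/k) := by positivity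
  linarith

theorem finalC {k : ℝ} (hk : 1 < k) : ∃ δ0 C : ℝ, 0 < δ0 ∧ 0 < C ∧ ∀ u g, Sol k δ0 0 1 u g → (∀ x ∈ ball (0:ℂ) 1, |u x| ≤ 1) →
    ∀ r, 0 < r → r ≤ 1/2 → ∀ x ∈ ball (0:ℂ) r, |u x - u 0 - ⟪g 0, x⟫| ≤ C * r^(1 + 1/k) := by
  obtain ⟨ε, C, hε, hε1, hC, hF⟩ := propF hk
  obtain ⟨L, hL, hLip⟩ := propL hk
  have hL0 : 0 < L := by linarith
  have hk1 : 0 < 1/k := by positivity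
  refine ⟨ε, L * (C * 2^(1/k)), hε, by positivity, ?_⟩
  intro u g hS hu r hr hr2
  have hg := hLip ε u g hε.le hε1 hS hu
  have hsc := hS.scale hk (ρ := 1/2) (m := L) (c' := 0) (by norm_num) hL0 (ball_subset_ball (by norm_num))
  have h1 : 1/2 * ε / L^k ≤ ε := by
    have : 1 ≤ L^k := Real.one_le_rpow hL (by linarith)
    rw [div_le_iff₀ (by linarith)]
    nlinarith
  have hH := hF _ _ _ (by positivity) h1 hsc (fun y hy => by
    have := hg _ (aff_ball (by norm_num) (subset_rfl : ball (0:ℂ) (1/2) ⊆ ball 0 (1/2)) hy)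
    rw [norm_smul, norm_inv, Real.norm_eq_abs, abs_of_pos hL0, inv_mul_le_one₀ hL0]
    exact this)
  have hH2 : ∀ z : ℂ, ‖z‖ < r → ‖g z - g 0‖ ≤ L * (C * 2^(1/k)) * r^(1/k) := by
    intro z hz
    have h2 := hH ((2:ℝ) • z) (by
      rw [mem_ball_zero_iff, norm_smul, Real.norm_eq_abs, abs_of_pos (by norm_num)]; linarith)
    beta_reduce at h2
    rw [smul_zero, add_zero, smul_smul, zero_add, ← smul_sub, norm_smul, norm_smul, norm_inv, Real.norm_eq_abs, Real.norm_eq_abs, abs_of_pos hL0, abs_of_pos (by norm_num),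
      inv_mul_le_iff₀ hL0, Real.mul_rpow (by norm_num) (norm_nonneg _)] at h2
    norm_num at h2
    refine h2.trans ?_
    rw [mul_assoc, mul_assoc]
    apply mul_le_mul_of_nonneg_left _ hL0.le
    apply mul_le_mul_of_nonneg_left _ hC.le
    rw [one_div]
    apply mul_le_mul_of_nonneg_left _ (by positivity)
    exact Real.rpow_le_rpow (norm_nonneg _) hz.le (by positivity)
  intro x hx
  rw [mem_ball_zero_iff] at hx
  have hz : ∀ z ∈ segment ℝ 0 x, ‖z‖ < r := by
    intro z hz
    have := seg_norm hz
    rw [sub_zero, sub_zero] at this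
    linarith
  have := taylor (u := u) (g := g) (x := 0) (y := x) (A := L * (C * 2^(1/k)) * r^(1/k))
    (fun z hzs => hS.grad z (by rw [mem_ball_zero_iff]; linarith [hz z hzs])) (fun z hzs => hH2 z (hz z hzs))
  rw [sub_zero] at this
  refine this.trans ?_
  have e : L * (C * 2^(1/k)) * r^(1 + 1/k) = L * (C * 2^(1/k)) * r^(1/k) * r := by
    rw [add_comm 1, Real.rpow_add hr, Real.rpow_one]; ring
  rw [e]
  exact mul_le_mul_of_nonneg_left hx.le (by positivity)


theorem ae_abs_le {f : EuclideanSpace ℝ (Fin 2) → ℝ} {δ : ℝ} (hδ : 0 ≤ δ) {s : Set (EuclideanSpace ℝ (Fin 2))}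
    (h : eLpNorm f ⊤ (volume.restrict s) ≤ ENNReal.ofReal δ) : ∀ᵐ x ∂(volume.restrict s), |f x| ≤ δ := by
  rw [eLpNorm_exponent_top] at h
  filter_upwards [ae_le_eLpNormEssSup (f := f) (μ := volume.restrict s)] with x hx
  have h1 := hx.trans h
  rw [← ofReal_norm, ENNReal.ofReal_le_ofReal_iff hδ] at h1
  exact h1

theorem abs_le_of_ess {u : EuclideanSpace ℝ (Fin 2) → ℝ} {s : Set (EuclideanSpace ℝ (Fin 2))} (hs : IsOpen s)
    (hu : ContinuousOn u s) (h : ∀ᵐ x ∂(volume.restrict s), |u x| ≤ 1) : ∀ x ∈ s, |u x| ≤ 1 := by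
  intro x hx
  by_contra hc
  push Not at hc
  have ho : IsOpen (s ∩ (fun y => |u y|) ⁻¹' Set.Ioi 1) := hu.abs.isOpen_inter_preimage hs isOpen_Ioi
  have hpos := ho.measure_pos volume ⟨x, hx, hc⟩
  rw [ae_restrict_iff' hs.measurableSet, ae_iff] at h
  refine hpos.ne' (measure_mono_null ?_ h)
  rintro y ⟨hy, hy2⟩ hyc
  exact absurd (hyc hy) (not_le.2 hy2)

def ee : ℂ ≃ₗᵢ[ℝ] EuclideanSpace ℝ (Fin 2) := Complex.orthonormalBasisOneI.repr

theorem ee_ball {z : ℂ} {r : ℝ} : ee z ∈ ball (0 : EuclideanSpace ℝ (Fin 2)) r ↔ z ∈ ball (0:ℂ) r := by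
  rw [mem_ball_zero_iff, mem_ball_zero_iff, LinearIsometryEquiv.norm_map]

theorem grad_inner {u : EuclideanSpace ℝ (Fin 2) → ℝ} (x v : EuclideanSpace ℝ (Fin 2)) :
    ⟪gradient u x, v⟫ = fderiv ℝ u x v := by
  rw [← toDual_gradient, InnerProductSpace.toDual_apply_apply]

theorem transfer_sol {p δ : ℝ} (hδ : 0 ≤ δ) {u f : EuclideanSpace ℝ (Fin 2) → ℝ}
    (hf : ∀ᵐ x ∂(volume.restrict (B 2 1)), |f x| ≤ δ)
    (hu : ContDiffOn ℝ 1 u (B 2 1)) (hw : IsPLaplaceWeakSolution p 1 u f) :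
    Sol (p-1) δ 0 1 (fun z => u (ee z)) (fun z => ee.symm (gradient u (ee z))) := by
  refine ⟨?_, ?_, ?_⟩
  · have h1 : ContinuousOn (fderiv ℝ u) (B 2 1) := hu.continuousOn_fderiv_of_isOpen isOpen_ball le_rfl
    have h2 : ContinuousOn (gradient u) (B 2 1) :=
      (InnerProductSpace.toDual ℝ (EuclideanSpace ℝ (Fin 2))).symm.continuous.comp_continuousOn h1
    exact ee.symm.continuous.comp_continuousOn (h2.comp ee.continuous.continuousOn (fun z hz => ee_ball.2 hz))
  · intro z hz
    have hd : HasFDerivAt u (fderiv ℝ u (ee z)) (ee z) :=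
      ((hu.differentiableOn (by simp)).differentiableAt (isOpen_ball.mem_nhds (ee_ball.2 hz))).hasFDerivAt
    have he : HasFDerivAt (fun z => ee z) (ee.toContinuousLinearEquiv : ℂ →L[ℝ] EuclideanSpace ℝ (Fin 2)) z :=
      (ee.toContinuousLinearEquiv : ℂ →L[ℝ] EuclideanSpace ℝ (Fin 2)).hasFDerivAt
    refine (hd.comp z he).congr_fderiv ?_
    ext1 v
    rw [innerSL_apply_apply, ← ee.inner_map_map, LinearIsometryEquiv.apply_symm_apply, grad_inner]
    rfl
  · intro φ hφ hc hs
    set ψ : EuclideanSpace ℝ (Fin 2) → ℝ := fun x => φ (ee.symm x) with hψ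
    have hψs : ContDiff ℝ (⊤ : ℕ∞) ψ := hφ.comp ee.symm.contDiff
    have hsupp : tsupport ψ ⊆ ee.symm ⁻¹' (tsupport φ) := tsupport_comp_subset_preimage φ ee.symm.continuous
    have hψc : HasCompactSupport ψ := hc.comp_homeomorph ee.symm.toHomeomorph
    have hψB : tsupport ψ ⊆ B 2 1 := by
      intro x hx
      have h1 := hs (hsupp hx)
      have := ee_ball.2 h1
      rwa [LinearIsometryEquiv.apply_symm_apply] at this
    have h := hw ψ hψs hψc hψB
    have hmp : MeasurePreserving ee (volume : Measure ℂ) (volume : Measure (EuclideanSpace ℝ (Fin 2))) := ee.measurePreserving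
    have hme : MeasurableEmbedding (ee : ℂ → EuclideanSpace ℝ (Fin 2)) := ee.toHomeomorph.measurableEmbedding
    have hz : ∀ x, x ∉ B 2 1 → ψ x = 0 := fun x hx => image_eq_zero_of_notMem_tsupport (fun hx2 => hx (hψB hx2))
    have hL : ∫ z, fderiv ℝ φ z (Vf (p-1) (ee.symm (gradient u (ee z)))) =
        ∫ x in B 2 1, ‖gradient u x‖ ^ (p - 2) * ⟪gradient u x, gradient ψ x⟫ := by
      rw [setIntegral_eq_integral_of_forall_compl_eq_zero, ← hmp.integral_comp hme]
      · congr 1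
        ext z
        have hd : HasFDerivAt φ (fderiv ℝ φ (ee.symm (ee z))) (ee.symm (ee z)) :=
          ((hφ.differentiable (by simp)) _).hasFDerivAt
        have he : HasFDerivAt (fun x => ee.symm x) (ee.symm.toContinuousLinearEquiv : EuclideanSpace ℝ (Fin 2) →L[ℝ] ℂ) (ee z) :=
          (ee.symm.toContinuousLinearEquiv : EuclideanSpace ℝ (Fin 2) →L[ℝ] ℂ).hasFDerivAt
        have hψd : fderiv ℝ ψ (ee z) = (fderiv ℝ φ (ee.symm (ee z))).comp
          (ee.symm.toContinuousLinearEquiv : EuclideanSpace ℝ (Fin 2) →L[ℝ] ℂ) := (hd.comp (ee z) he).fderiv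
        rw [real_inner_comm, grad_inner, hψd, LinearIsometryEquiv.symm_apply_apply, Vf, map_smul, smul_eq_mul,
          LinearIsometryEquiv.norm_map]
        congr 2
        ring
      · intro x hx
        have : fderiv ℝ ψ x = 0 :=
          image_eq_zero_of_notMem_tsupport (fun hx2 => hx (hψB (tsupport_fderiv_subset ℝ hx2)))
        rw [real_inner_comm, grad_inner, this]
        simp
    have hR : ∫ z, |φ z| = ∫ x in B 2 1, |ψ x| := by
      rw [setIntegral_eq_integral_of_forall_compl_eq_zero, ← hmp.integral_comp hme]
      · congr 1
        ext z
        rw [hψ]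
        simp
      · intro x hx
        rw [hz x hx, abs_zero]
    rw [hL, h, hR, ← integral_const_mul]
    refine norm_integral_le_of_norm_le (f := fun x => f x * ψ x) (g := fun x => δ * |ψ x|) ?_ ?_
    · exact ((hψs.continuous.integrable_of_hasCompactSupport hψc).abs.const_mul δ).restrict
    · filter_upwards [hf] with x hx
      rw [Real.norm_eq_abs, abs_mul]
      exact mul_le_mul_of_nonneg_right hx (abs_nonneg _)

end CP

/-- **Pointwise `C^{p'}` estimate at the origin** (Sections 4 and 5).
Let `p > 2` and `B_1 ⊂ ℝ²`.  There exist `δ₀ > 0`, `C > 0` and `r₀ > 0`,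
depending only on `p`, such that if `‖f‖_{L^∞(B_1)} ≤ δ₀` and `u ∈ C¹(B_1)` is
a weak solution of `-Δ_p u = f` in `B_1` with `‖u‖_{L^∞(B_1)} ≤ 1`, then
`sup_{x ∈ B_r} |u(x) - [u(0) + ∇u(0)·x]| ≤ C r^{p'}` for every `0 < r ≤ r₀`. -/
theorem pointwise_cp_prime_estimate (p : ℝ) (hp : 2 < p) :
    ∃ δ₀ C r₀ : ℝ, 0 < δ₀ ∧ 0 < C ∧ 0 < r₀ ∧
      ∀ u f : EuclideanSpace ℝ (Fin 2) → ℝ,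
        eLpNorm f ⊤ (volume.restrict (B 2 1)) ≤ ENNReal.ofReal δ₀ →
        ContDiffOn ℝ 1 u (B 2 1) →
        IsPLaplaceWeakSolution p 1 u f →
        eLpNorm u ⊤ (volume.restrict (B 2 1)) ≤ 1 →
        ∀ r : ℝ, 0 < r → r ≤ r₀ →
          ∀ x ∈ B 2 r,
            |u x - (u 0 + ⟪gradient u 0, x⟫)| ≤ C * r ^ (p / (p - 1)) := by
  obtain ⟨δ0, C, hδ0, hC, hmain⟩ := CP.finalC (k := p - 1) (by linarith)
  refine ⟨δ0, C, 1/2, hδ0, hC, by norm_num, ?_⟩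
  intro u f hf hu hw hu1 r hr hr2 x hx
  have hS := CP.transfer_sol hδ0.le (CP.ae_abs_le hδ0.le hf) hu hw
  have hb := CP.abs_le_of_ess isOpen_ball hu.continuousOn
    (CP.ae_abs_le zero_le_one (hu1.trans (le_of_eq ENNReal.ofReal_one.symm)))
  have h := hmain _ _ hS (fun z hz => hb _ (CP.ee_ball.2 hz)) r hr hr2 (CP.ee.symm x)
    (CP.ee_ball.1 (by rwa [LinearIsometryEquiv.apply_symm_apply]))
  rw [LinearIsometryEquiv.apply_symm_apply, LinearIsometryEquiv.inner_map_map, map_zero] at h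
  have e1 : p / (p - 1) = 1 + 1 / (p - 1) := by
    have : p - 1 ≠ 0 := by linarith
    field_simp
    ring
  rw [e1, ← sub_sub]
  exact h
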